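/- There is a bijection between the set of GL(n,ℂ)-conjugacy classes of irreducible elements (Σ_{j=1}^{k_i} A^(i)_j x^{−j})_{0≤i≤p} ∈ ∏_{i=0}^{p} O_{B^(i)} with Σ_{i=0}^{p} A^(i)_1 = 0, and the set of ∏_{a∈Q_0} GL(α_a,ℂ)-orbits of quasi-irreducible representations M = (M_a,ψ_ρ) ∈ Rep(Q̄,α)_λ such that the block matrix (ψ_{ρ^{[0,j]}_{[i,j′]}})_{1≤j≤m^(0),1≤j′≤m^(i)} is invertible for every i ∈ I_irr∖{0}. -/

import Mathlib

open Polynomial Matrix BigOperators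

namespace DS

noncomputable section

/-- The data of a collection of HTL normal forms `B⁽ⁱ⁾`, `i = 0,…,p`, on `ℂⁿ`:
block counts `m i`, pole orders `kk i`, block sizes `nn i j`, irregular parts
`q i j ∈ s²ℂ[s]` (pairwise distinct, degree ≤ kk i), residue blocks `R i j`,
chosen annihilating eigenvalue lists `ξ i j`, and an identification of
`Σ j, Fin (nn i j)` with `Fin n` (the block decomposition of `ℂⁿ`). -/
structure Setup where
  p : ℕ
  n : ℕ
  hn : 0 < n
  m : Fin (p+1) → ℕ
  hm : ∀ i, 0 < m i
  kk : Fin (p+1) → ℕ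
  hkk : ∀ i, 0 < kk i
  nn : ∀ i : Fin (p+1), Fin (m i) → ℕ
  q : ∀ i : Fin (p+1), Fin (m i) → Polynomial ℂ
  hq0 : ∀ i j, (q i j).coeff 0 = 0
  hq1 : ∀ i j, (q i j).coeff 1 = 0
  hqdeg : ∀ i j, (q i j).natDegree ≤ kk i
  hqdist : ∀ i : Fin (p+1), ∀ j j' : Fin (m i), j ≠ j' → q i j ≠ q i j'
  e : ∀ i : Fin (p+1), Fin (m i) → ℕ
  he : ∀ i j, 0 < e i j
  xi : ∀ (i : Fin (p+1)) (j : Fin (m i)), Fin (e i j) → ℂ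
  R : ∀ (i : Fin (p+1)) (j : Fin (m i)), Matrix (Fin (nn i j)) (Fin (nn i j)) ℂ
  hxi : ∀ i j, (((List.finRange (e i j)).map fun l => R i j - xi i j l • 1).prod) = 0
  emb : ∀ i : Fin (p+1), (Σ j : Fin (m i), Fin (nn i j)) ≃ Fin n
  hreg : ∀ i : Fin (p+1), ¬ (1 < m i ∨ i = 0) → kk i = 1

/-- `i ∈ I_irr` : the indices of irregular singular points together with `0`. -/
def Iirr (S : Setup) (i : Fin (S.p+1)) : Prop := 1 < S.m i ∨ i = 0

instance (S : Setup) : DecidablePred (Iirr S) := fun i =>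
  inferInstanceAs (Decidable (1 < S.m i ∨ i = 0))

/-- Vertices `[i,j]` for `i ∈ I_irr`. -/
abbrev Vb (S : Setup) := Σ i : {i : Fin (S.p+1) // Iirr S i}, Fin (S.m i.1)

/-- Vertices `[i,j,k]` for `0 ≤ i ≤ p`, `1 ≤ j ≤ m⁽ⁱ⁾`, `1 ≤ k ≤ e[i,j]-1`
(the third component `κ` encodes `k = κ+1`). -/
abbrev Vr (S : Setup) := Σ i : Fin (S.p+1), Σ j : Fin (S.m i), Fin (S.e i j - 1)

/-- The vertex set `Q₀` of the quiver `Q`. -/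
abbrev V (S : Setup) := Vb S ⊕ Vr S

/-- `d_i(j,j') = deg (q_j - q_j') - 2`. -/
def dcnt (S : Setup) (i : Fin (S.p+1)) (j j' : Fin (S.m i)) : ℕ :=
  (S.q i j - S.q i j').natDegree - 2

/-- The number of arrows of `Q` from a vertex `a` to a vertex `b`. -/
def arr (S : Setup) : V S → V S → ℕ
  | .inl ⟨i, j⟩, .inl ⟨i', j'⟩ =>
      (if i.1 = 0 ∧ i'.1 ≠ 0 then 1 else 0) +
      (if h : i = i' then
        (if (j : ℕ) < (j' : ℕ) then dcnt S i.1 j (Fin.cast (by rw [h]) j') else 0)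
       else 0)
  | .inl _, .inr _ => 0
  | .inr ⟨i, j, κ⟩, .inl ⟨i', j'⟩ =>
      (if i = i'.1 ∧ (j : ℕ) = (j' : ℕ) ∧ (κ : ℕ) = 0 then 1 else 0) +
      (if ¬ Iirr S i ∧ i'.1 = 0 ∧ (j : ℕ) = 0 ∧ (κ : ℕ) = 0 then 1 else 0)
  | .inr ⟨i, j, κ⟩, .inr ⟨i', j', κ'⟩ =>
      if i = i' ∧ (j : ℕ) = (j' : ℕ) ∧ (κ : ℕ) = (κ' : ℕ) + 1 then 1 else 0

/-- The Euler form `⟨β,γ⟩` of the quiver `Q`. -/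
def eform (S : Setup) (β γ : V S → ℤ) : ℤ :=
  (∑ a : V S, β a * γ a) - ∑ a : V S, ∑ b : V S, (arr S a b : ℤ) * β a * γ b

/-- The symmetrized bilinear form `(β,γ)`. -/
def bform (S : Setup) (β γ : V S → ℤ) : ℤ := eform S β γ + eform S γ β

/-- The quadratic form `q(β)`. -/
def qform (S : Setup) (β : V S → ℤ) : ℤ := eform S β β

/-- `p(β) = 1 - q(β)`. -/
def pform (S : Setup) (β : V S → ℤ) : ℤ := 1 - qform S β

/-- The coordinate vector `ε_a`. -/
def eps (S : Setup) (a : V S) : V S → ℤ := fun b => if b = a then 1 else 0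

/-- The fundamental reflection `s_a`. -/
def refl1 (S : Setup) (a : V S) (β : V S → ℤ) : V S → ℤ :=
  fun b => β b - bform S β (eps S a) * eps S a b

/-- Iterated fundamental reflections (a Weyl group element). -/
def reflList (S : Setup) (l : List (V S)) (β : V S → ℤ) : V S → ℤ :=
  l.foldr (refl1 S) β

/-- The support of a vector. -/
def supp (S : Setup) (β : V S → ℤ) : Set (V S) := {a | β a ≠ 0}

/-- The support of `β` is connected in the underlying graph of `Q`. -/
def connSupp (S : Setup) (β : V S → ℤ) : Prop :=
  ∀ a ∈ supp S β, ∀ b ∈ supp S β,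
    Relation.ReflTransGen
      (fun x y => (0 < arr S x y + arr S y x) ∧ x ∈ supp S β ∧ y ∈ supp S β) a b

/-- The fundamental set of the root system of `Q` (all vertices of `Q` are loop-free). -/
def fund (S : Setup) (β : V S → ℤ) : Prop :=
  β ≠ 0 ∧ (∀ a, 0 ≤ β a) ∧ connSupp S β ∧ ∀ a : V S, bform S β (eps S a) ≤ 0

/-- Real roots of `Q`. -/
def isRealRoot (S : Setup) (β : V S → ℤ) : Prop :=
  ∃ (l : List (V S)) (a : V S), β = reflList S l (eps S a)

/-- Imaginary roots of `Q`. -/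
def isImagRoot (S : Setup) (β : V S → ℤ) : Prop :=
  ∃ (l : List (V S)) (γ : V S → ℤ), (fund S γ ∨ fund S (-γ)) ∧ β = reflList S l γ

/-- Roots of `Q`. -/
def isRoot (S : Setup) (β : V S → ℤ) : Prop := isRealRoot S β ∨ isImagRoot S β

/-- Positive roots of `Q`. -/
def isPosRoot (S : Setup) (β : V S → ℤ) : Prop := isRoot S β ∧ ∀ a, 0 ≤ β a

/-- The index `0` as an element of `I_irr`. -/
def i0 (S : Setup) : {i : Fin (S.p+1) // Iirr S i} := ⟨0, Or.inr rfl⟩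

/-- The vertex `[0,j]`. -/
def v0 (S : Setup) (j : Fin (S.m 0)) : V S := Sum.inl ⟨i0 S, j⟩

/-- The vertex `[i,j]` for `i ∈ I_irr`. -/
def vI (S : Setup) (i : {i : Fin (S.p+1) // Iirr S i}) (j : Fin (S.m i.1)) : V S :=
  Sum.inl ⟨i, j⟩

/-- The lattice `L`: `Σ_j β_[0,j] = Σ_j β_[i,j]` for all `i ∈ I_irr ∖ {0}`. -/
def inL (S : Setup) (β : V S → ℤ) : Prop :=
  ∀ i : {i : Fin (S.p+1) // Iirr S i}, i.1 ≠ 0 →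
    (∑ j : Fin (S.m 0), β (v0 S j)) = ∑ j : Fin (S.m i.1), β (vI S i j)

/-- `L⁺ = L ∩ (ℤ≥0)^{Q₀}`. -/
def inLpos (S : Setup) (β : V S → ℤ) : Prop := inL S β ∧ ∀ a, 0 ≤ β a

/-- The dimension vector `α` (as natural numbers):
`α_[i,j] = n⁽ⁱ⁾_j`, `α_[i,j,k] = rank ∏_{l=1}^k (R⁽ⁱ⁾_j - ξ^{[i,j]}_l)`. -/
noncomputable def alN (S : Setup) : V S → ℕ
  | .inl ⟨i, j⟩ => S.nn i.1 j
  | .inr ⟨i, j, κ⟩ =>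
      ((((List.finRange (S.e i j)).take ((κ : ℕ) + 1)).map
          fun l => S.R i j - S.xi i j l • 1).prod).rank

/-- The dimension vector `α` as an integer vector. -/
noncomputable def alZ (S : Setup) : V S → ℤ := fun a => (alN S a : ℤ)

/-- The parameter `λ ∈ ℂ^{Q₀}`. -/
noncomputable def lam (S : Setup) : V S → ℂ
  | .inl ⟨i, j⟩ =>
      if h : i.1 = 0 then
        (- S.xi 0 (Fin.cast (by rw [h]) j) ⟨0, S.he 0 (Fin.cast (by rw [h]) j)⟩)
          - ∑ i' ∈ Finset.univ.filter (fun i' : Fin (S.p+1) => ¬ Iirr S i'),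
              S.xi i' ⟨0, S.hm i'⟩ ⟨0, S.he i' ⟨0, S.hm i'⟩⟩
      else - S.xi i.1 j ⟨0, S.he i.1 j⟩
  | .inr ⟨i, j, κ⟩ =>
      S.xi i j ⟨(κ : ℕ), by have := κ.2; omega⟩
        - S.xi i j ⟨(κ : ℕ) + 1, by have := κ.2; omega⟩

/-- Pairing `β · μ = Σ_a β_a μ_a` between `ℤ^{Q₀}` and `ℂ^{Q₀}`. -/
noncomputable def dotC (S : Setup) (β : V S → ℤ) (μ : V S → ℂ) : ℂ :=
  ∑ a : V S, (β a : ℂ) * μ a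

/-- `β ∈ R̃⁺_μ` : positive roots of `Q` lying in `L` with `β·μ = 0`. -/
def inRt (S : Setup) (μ : V S → ℂ) (β : V S → ℤ) : Prop :=
  isPosRoot S β ∧ inL S β ∧ dotC S β μ = 0

/-- `β ∈ ℕR̃⁺_μ` : finite sums (including `0`) of elements of `R̃⁺_μ`. -/
def inNRt (S : Setup) (μ : V S → ℂ) (β : V S → ℤ) : Prop :=
  ∃ (r : ℕ) (γ : Fin r → (V S → ℤ)), (∀ t, inRt S μ (γ t)) ∧ β = ∑ t, γ t

/-- `β ∈ Σ̃_μ`. -/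
def inSig (S : Setup) (μ : V S → ℂ) (β : V S → ℤ) : Prop :=
  inRt S μ β ∧ ∀ (r : ℕ), 2 ≤ r → ∀ γ : Fin r → (V S → ℤ),
    (∀ t, inRt S μ (γ t)) → β = ∑ t, γ t → (∑ t, pform S (γ t)) < pform S β

/-! ### The matrix side: truncated orbits.

An element `Σ_{j=1}^{k} A_j x^{-j}` of `𝔤_k*` is encoded as the polynomial matrix
`Σ_{j=1}^{k} A_j x^{k-j}` (of degree `< k`); the coadjoint `G_k`-action becomes
conjugation modulo `x^k` by polynomial matrices with invertible constant term. -/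

abbrev PMat (S : Setup) := Matrix (Fin S.n) (Fin S.n) (Polynomial ℂ)

/-- All entries have degree `< k`. -/
def degLT (S : Setup) (k : ℕ) (A : PMat S) : Prop :=
  ∀ a b, (A a b).degree < (k : ℕ)

/-- The HTL normal form `B⁽ⁱ⁾`, in the polynomial encoding. -/
noncomputable def Bmat (S : Setup) (i : Fin (S.p+1)) : PMat S :=
  Matrix.of fun a b =>
    if h : ((S.emb i).symm a).1 = ((S.emb i).symm b).1 then
      (if Fin.cast (by rw [h]) ((S.emb i).symm a).2 = ((S.emb i).symm b).2 then
          Polynomial.reflect (S.kk i) (S.q i ((S.emb i).symm b).1)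
        else 0)
        + Polynomial.C
            (S.R i ((S.emb i).symm b).1 (Fin.cast (by rw [h]) ((S.emb i).symm a).2)
              ((S.emb i).symm b).2)
          * Polynomial.X ^ (S.kk i - 1)
    else 0

/-- Membership in the truncated orbit `𝒪_{B⁽ⁱ⁾}`. -/
def inOrbit (S : Setup) (i : Fin (S.p+1)) (A : PMat S) : Prop :=
  degLT S (S.kk i) A ∧
  ∃ g : PMat S, IsUnit (g.map fun r => r.coeff 0) ∧
    ∀ a b, (Polynomial.X ^ (S.kk i) : Polynomial ℂ) ∣ (g * Bmat S i - A * g) a b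

/-- The residue matrix `A⁽ⁱ⁾₁`. -/
def resMat (S : Setup) (i : Fin (S.p+1)) (A : PMat S) : Matrix (Fin S.n) (Fin S.n) ℂ :=
  Matrix.of fun a b => (A a b).coeff (S.kk i - 1)

/-- `(A⁽ⁱ⁾)_{0≤i≤p} ∈ ∏ 𝒪_{B⁽ⁱ⁾}` with `Σ A⁽ⁱ⁾₁ = 0`. -/
def isDSElem (S : Setup) (A : ∀ _ : Fin (S.p+1), PMat S) : Prop :=
  (∀ i, inOrbit S i (A i)) ∧ (∑ i, resMat S i (A i)) = 0

/-- Irreducibility of the collection of all coefficient matrices `A⁽ⁱ⁾_j`. -/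
def irredTuple (S : Setup) (A : ∀ _ : Fin (S.p+1), PMat S) : Prop :=
  ∀ W : Submodule ℂ (Fin S.n → ℂ),
    (∀ (i : Fin (S.p+1)) (l : ℕ), ∀ v ∈ W,
        (Matrix.of fun a b => (A i a b).coeff l).mulVec v ∈ W) →
    W = ⊥ ∨ W = ⊤

/-! ### Representations of the double quiver -/

/-- A representation of the double quiver `Q̄` with dimension vector `β`:
`f a b ρ` is the matrix of `ψ_ρ : ℂ^{β a} → ℂ^{β b}` and `g a b ρ` the matrix of
`ψ_{ρ*} : ℂ^{β b} → ℂ^{β a}`, for the `ρ`-th arrow `a → b` of `Q`. -/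
structure Rep (S : Setup) (β : V S → ℕ) where
  f : ∀ a b : V S, Fin (arr S a b) → Matrix (Fin (β b)) (Fin (β a)) ℂ
  g : ∀ a b : V S, Fin (arr S a b) → Matrix (Fin (β a)) (Fin (β b)) ℂ

/-- The moment map at a vertex `c`. -/
noncomputable def moment (S : Setup) {β : V S → ℕ} (M : Rep S β) (c : V S) :
    Matrix (Fin (β c)) (Fin (β c)) ℂ :=
  (∑ a : V S, ∑ ρ : Fin (arr S a c), M.f a c ρ * M.g a c ρ)
    - ∑ b : V S, ∑ ρ : Fin (arr S c b), M.g c b ρ * M.f c b ρ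

/-- `M ∈ Rep(Q̄,β)_μ`. -/
def onMu (S : Setup) {β : V S → ℕ} (μ : V S → ℂ) (M : Rep S β) : Prop :=
  ∀ c : V S, moment S M c = μ c • (1 : Matrix (Fin (β c)) (Fin (β c)) ℂ)

/-- The block matrix `(ψ_{ρ^{[0,j]}_{[i,j']}})_{j,j'}` for `i ∈ I_irr ∖ {0}`. -/
noncomputable def crossMat (S : Setup) {β : V S → ℕ} (M : Rep S β)
    (i : {i : Fin (S.p+1) // Iirr S i}) :
    Matrix (Σ j' : Fin (S.m i.1), Fin (β (vI S i j'))) (Σ j : Fin (S.m 0), Fin (β (v0 S j))) ℂ :=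
  Matrix.of fun x y =>
    if h : 0 < arr S (v0 S y.1) (vI S i x.1) then
      M.f (v0 S y.1) (vI S i x.1) ⟨0, h⟩ x.2 y.2
    else 0

/-- All the block matrices `(ψ_{ρ^{[0,j]}_{[i,j']}})` for `i ∈ I_irr ∖ {0}` are invertible. -/
def crossBij (S : Setup) {β : V S → ℕ} (M : Rep S β) : Prop :=
  ∀ i : {i : Fin (S.p+1) // Iirr S i}, i.1 ≠ 0 →
    Function.Bijective ((crossMat S M i).mulVec)

/-- The combined map `(ψ_{ρ^{[i,1,1]}_{[0,j]}})_j : ℂ^{β [i,1,1]} → ⊕_j ℂ^{β [0,j]}`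
(for `i ∈ I_reg`). -/
noncomputable def regMatF (S : Setup) {β : V S → ℕ} (M : Rep S β)
    (i : Fin (S.p+1)) (j : Fin (S.m i)) (κ : Fin (S.e i j - 1)) :
    Matrix (Σ j' : Fin (S.m 0), Fin (β (v0 S j'))) (Fin (β (Sum.inr ⟨i, j, κ⟩))) ℂ :=
  Matrix.of fun x y =>
    if h : 0 < arr S (Sum.inr ⟨i, j, κ⟩) (v0 S x.1) then
      M.f (Sum.inr ⟨i, j, κ⟩) (v0 S x.1) ⟨0, h⟩ x.2 y
    else 0

/-- The combined map `(ψ_{(ρ^{[i,1,1]}_{[0,j]})*})_j : ⊕_j ℂ^{β [0,j]} → ℂ^{β [i,1,1]}`. -/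
noncomputable def regMatG (S : Setup) {β : V S → ℕ} (M : Rep S β)
    (i : Fin (S.p+1)) (j : Fin (S.m i)) (κ : Fin (S.e i j - 1)) :
    Matrix (Fin (β (Sum.inr ⟨i, j, κ⟩))) (Σ j' : Fin (S.m 0), Fin (β (v0 S j'))) ℂ :=
  Matrix.of fun y x =>
    if h : 0 < arr S (Sum.inr ⟨i, j, κ⟩) (v0 S x.1) then
      M.g (Sum.inr ⟨i, j, κ⟩) (v0 S x.1) ⟨0, h⟩ y x.2
    else 0

/-- `M ∈ Rep(Q̄,β)_μ^{dif}` (the open conditions). -/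
def difCond (S : Setup) {β : V S → ℕ} (M : Rep S β) : Prop :=
  crossBij S M ∧
  (∀ (i : Fin (S.p+1)), ¬ Iirr S i → ∀ (j : Fin (S.m i)) (κ : Fin (S.e i j - 1)),
      (κ : ℕ) = 0 →
      Function.Injective ((regMatF S M i j κ).mulVec) ∧
      Function.Surjective ((regMatG S M i j κ).mulVec)) ∧
  (∀ (i : Fin (S.p+1)) (j : Fin (S.m i)) (κ : Fin (S.e i j - 1)) (b : V S)
      (ρ : Fin (arr S (Sum.inr ⟨i, j, κ⟩) b)),
      (¬ Iirr S i ∧ (κ : ℕ) = 0) ∨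
      (Function.Injective ((M.f (Sum.inr ⟨i, j, κ⟩) b ρ).mulVec) ∧
       Function.Surjective ((M.g (Sum.inr ⟨i, j, κ⟩) b ρ).mulVec)))

/-- A family of subspaces forming a subrepresentation of `M`. -/
def isSubrep (S : Setup) {β : V S → ℕ} (M : Rep S β)
    (W : ∀ a : V S, Submodule ℂ (Fin (β a) → ℂ)) : Prop :=
  ∀ (a b : V S) (ρ : Fin (arr S a b)),
    (∀ v ∈ W a, (M.f a b ρ).mulVec v ∈ W b) ∧ (∀ v ∈ W b, (M.g a b ρ).mulVec v ∈ W a)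

/-- Irreducibility of a representation. -/
def irredRep (S : Setup) {β : V S → ℕ} (M : Rep S β) : Prop :=
  ∀ W, isSubrep S M W → (∀ a, W a = ⊥) ∨ (∀ a, W a = ⊤)

/-- A dimension vector is balanced if `Σ_j γ_[0,j] = Σ_j γ_[i,j]` for all `i ∈ I_irr∖{0}`. -/
def balanced (S : Setup) (γ : V S → ℕ) : Prop :=
  ∀ i : {i : Fin (S.p+1) // Iirr S i}, i.1 ≠ 0 →
    (∑ j : Fin (S.m 0), γ (v0 S j)) = ∑ j : Fin (S.m i.1), γ (vI S i j)

/-- Quasi-irreducibility: no nontrivial proper subrepresentation with balanced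
dimension vector. -/
def quasiIrred (S : Setup) {β : V S → ℕ} (M : Rep S β) : Prop :=
  ∀ W, isSubrep S M W → balanced S (fun a => Module.finrank ℂ (W a)) →
    (∀ a, W a = ⊥) ∨ (∀ a, W a = ⊤)

/-- Simultaneous conjugation of representations by `∏_a GL(β_a, ℂ)`. -/
def repConj (S : Setup) {β : V S → ℕ} (M N : Rep S β) : Prop :=
  ∃ g : ∀ a : V S, (Matrix (Fin (β a)) (Fin (β a)) ℂ)ˣ,
    (∀ a b ρ, N.f a b ρ = ((g b).val * M.f a b ρ) * ((g a)⁻¹).val) ∧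
    (∀ a b ρ, N.g a b ρ = ((g a).val * M.g a b ρ) * ((g b)⁻¹).val)

/-- Simultaneous conjugation of tuples by `GL(n, ℂ)`. -/
def tupConj (S : Setup) (A A' : ∀ _ : Fin (S.p+1), PMat S) : Prop :=
  ∃ g : (Matrix (Fin S.n) (Fin S.n) ℂ)ˣ,
    ∀ i, A' i = (g.val.map Polynomial.C) * A i * ((g⁻¹).val.map Polynomial.C)

/-- Carrier of the moduli space `ℳ*_{st}(𝐁)`. -/
abbrev MstC (S : Setup) := {A : ∀ _ : Fin (S.p+1), PMat S // isDSElem S A ∧ irredTuple S A}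

/-- The moduli space `ℳ*_{st}(𝐁)` of stable connections, identified with conjugacy
classes of irreducible elements of `∏ 𝒪_{B⁽ⁱ⁾}` with vanishing residue sum. -/
abbrev Mst (S : Setup) := Quot (fun A A' : MstC S => tupConj S A.1 A'.1)

abbrev DSC (S : Setup) := {A : ∀ _ : Fin (S.p+1), PMat S // isDSElem S A}

abbrev DSQ (S : Setup) := Quot (fun A A' : DSC S => tupConj S A.1 A'.1)

abbrev RepIrrC (S : Setup) (μ : V S → ℂ) :=
  {M : Rep S (alN S) // onMu S μ M ∧ irredRep S M}

/-- The quiver variety `𝔐^{reg}_μ(Q,α)`. -/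
abbrev Mreg (S : Setup) (μ : V S → ℂ) :=
  Quot (fun M N : RepIrrC S μ => repConj S M.1 N.1)

abbrev DifC (S : Setup) (μ : V S → ℂ) :=
  {M : Rep S (alN S) // onMu S μ M ∧ difCond S M}

abbrev DifQ (S : Setup) (μ : V S → ℂ) :=
  Quot (fun M N : DifC S μ => repConj S M.1 N.1)

abbrev QIC (S : Setup) (μ : V S → ℂ) :=
  {M : Rep S (alN S) // onMu S μ M ∧ quasiIrred S M ∧ crossBij S M}

abbrev QIQ (S : Setup) (μ : V S → ℂ) :=
  Quot (fun M N : QIC S μ => repConj S M.1 N.1)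

/-! ### `J`, `ε_𝐢`, and the equivalence relation `∼` -/

/-- `ε_𝐢 = Σ_{i ∈ I_irr} ε_{[i,j_i]}` for `𝐢 = ([i,j_i]) ∈ 𝒥`. -/
def epsJ (S : Setup) (I : ∀ i : Fin (S.p+1), Fin (S.m i)) : V S → ℤ
  | .inl ⟨i, j⟩ => if (j : ℕ) = (I i.1 : ℕ) then 1 else 0
  | .inr _ => 0

/-- The reflection `s_𝐢`. -/
def sJ (S : Setup) (I : ∀ i : Fin (S.p+1), Fin (S.m i)) (β : V S → ℤ) : V S → ℤ :=
  fun b => β b - bform S β (epsJ S I) * epsJ S I b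

/-- The quasi-fundamental set `F̃`. -/
def quasiFund (S : Setup) (β : V S → ℤ) : Prop :=
  inL S β ∧ (∀ a, 0 ≤ β a) ∧ β ≠ 0 ∧
  (∀ I : ∀ i : Fin (S.p+1), Fin (S.m i), bform S β (epsJ S I) ≤ 0) ∧
  (∀ (i : Fin (S.p+1)) (j : Fin (S.m i)) (κ : Fin (S.e i j - 1)),
      bform S β (eps S (Sum.inr ⟨i, j, κ⟩)) ≤ 0) ∧
  connSupp S β

/-- `μ_𝐢 = Σ_{i ∈ I_irr} μ_{[i,j_i]}`. -/
noncomputable def muJ (S : Setup) (I : ∀ i : Fin (S.p+1), Fin (S.m i)) (μ : V S → ℂ) : ℂ :=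
  ∑ i : {i : Fin (S.p+1) // Iirr S i}, μ (vI S i (I i.1))

/-- The transformed parameter `μ'` in the move `s_𝐢` on pairs. -/
noncomputable def muMove (S : Setup) (I : ∀ i : Fin (S.p+1), Fin (S.m i)) (μ : V S → ℂ) :
    V S → ℂ := fun a =>
  match a with
  | .inl ⟨i, j⟩ =>
      if i.1 = 0 ∧ (j : ℕ) = (I 0 : ℕ) then μ a - 2 * muJ S I μ else μ a
  | .inr ⟨i, j, κ⟩ =>
      if j = I i ∧ (κ : ℕ) = 0 then μ a + muJ S I μ else μ a

/-- The reflected parameter `r_a(μ)` for a vertex `a`. -/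
noncomputable def rvtx (S : Setup) (a : V S) (μ : V S → ℂ) : V S → ℂ :=
  fun b => μ b - ((bform S (eps S a) (eps S b) : ℤ) : ℂ) * μ a

/-- One move generating the relation `∼` on pairs `(β,μ)`. -/
def stepRel (S : Setup) :
    ((V S → ℤ) × (V S → ℂ)) → ((V S → ℤ) × (V S → ℂ)) → Prop := fun x y =>
  (∃ (i : Fin (S.p+1)) (j : Fin (S.m i)) (κ : Fin (S.e i j - 1)),
      x.2 (Sum.inr ⟨i, j, κ⟩) ≠ 0 ∧
      y = (refl1 S (Sum.inr ⟨i, j, κ⟩) x.1, rvtx S (Sum.inr ⟨i, j, κ⟩) x.2)) ∨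
  (∃ I : ∀ i : Fin (S.p+1), Fin (S.m i),
      muJ S I x.2 ≠ 0 ∧ y = (sJ S I x.1, muMove S I x.2))

/-- The smallest equivalence relation `∼` containing all the moves. -/
def pairEquiv (S : Setup) :
    ((V S → ℤ) × (V S → ℂ)) → ((V S → ℤ) × (V S → ℂ)) → Prop :=
  Relation.EqvGen (stepRel S)

/-- The vector `z^{(i₀)}` for `i₀ ∈ I_irr ∖ {0}`. -/
def zvec (S : Setup) (i' : Fin (S.p+1)) : V S → ℂ
  | .inl ⟨i, _⟩ => if i.1 = i' then 1 else if i.1 = 0 then -1 else 0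
  | .inr _ => 0

noncomputable section

section FilSec
variable {R : Type*} [Ring R]

/-- The `X`-adic filtration on power series. -/
def Fil (m : ℕ) : AddSubgroup (PowerSeries R) where
  carrier := {f | ∀ i < m, PowerSeries.coeff i f = 0}
  add_mem' := by
    intro f g hf hg i hi
    simp [hf i hi, hg i hi]
  zero_mem' := by intro i _; simp
  neg_mem' := by
    intro f hf i hi
    simp [hf i hi]

theorem mem_Fil {m : ℕ} {f : PowerSeries R} :
    f ∈ Fil m ↔ ∀ i < m, PowerSeries.coeff i f = 0 := Iff.rfl

theorem Fil_mono {a b : ℕ} (h : a ≤ b) {f : PowerSeries R} (hf : f ∈ Fil b) : f ∈ Fil a :=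
  fun i hi => hf i (lt_of_lt_of_le hi h)

theorem Fil_zero (f : PowerSeries R) : f ∈ Fil 0 := fun i hi => absurd hi (Nat.not_lt_zero i)

theorem Fil_mul {a b : ℕ} {f g : PowerSeries R} (hf : f ∈ Fil a) (hg : g ∈ Fil b) :
    f * g ∈ Fil (a + b) := by
  intro i hi
  rw [PowerSeries.coeff_mul]
  apply Finset.sum_eq_zero
  rintro ⟨x, y⟩ hxy
  have hxy : x + y = i := by simpa using hxy
  show PowerSeries.coeff x f * PowerSeries.coeff y g = 0
  by_cases hx : x < a
  · rw [hf x hx, zero_mul]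
  · rw [hg y (by omega), mul_zero]

theorem Fil_mul' {a b c : ℕ} {f g : PowerSeries R} (hf : f ∈ Fil a) (hg : g ∈ Fil b)
    (h : c ≤ a + b) : f * g ∈ Fil c := Fil_mono h (Fil_mul hf hg)

theorem Fil_mul_left {b : ℕ} (f : PowerSeries R) {g : PowerSeries R} (hg : g ∈ Fil b) :
    f * g ∈ Fil b := Fil_mul' (Fil_zero f) hg (by omega)

theorem Fil_mul_right {b : ℕ} {f : PowerSeries R} (g : PowerSeries R) (hf : f ∈ Fil b) :
    f * g ∈ Fil b := Fil_mul' hf (Fil_zero g) (by omega)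

theorem coeff_mul_Fil {a b : ℕ} {f g : PowerSeries R} (hf : f ∈ Fil a) (hg : g ∈ Fil b) :
    PowerSeries.coeff (a + b) (f * g) = PowerSeries.coeff a f * PowerSeries.coeff b g := by
  rw [PowerSeries.coeff_mul, Finset.sum_eq_single (a, b)]
  · rintro ⟨x, y⟩ hxy hne
    have hxy : x + y = a + b := by simpa using hxy
    show PowerSeries.coeff x f * PowerSeries.coeff y g = 0
    by_cases hx : x < a
    · rw [hf x hx, zero_mul]
    · by_cases hy : y < b
      · rw [hg y hy, mul_zero]
      · exfalso; apply hne; ext <;> simp <;> omega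
  · intro h; exact absurd (by simp) h

theorem coeff_C_mul' (x : R) (f : PowerSeries R) (m : ℕ) :
    PowerSeries.coeff m (PowerSeries.C x * f) = x * PowerSeries.coeff m f := by
  simp

theorem coeff_mul_C' (x : R) (f : PowerSeries R) (m : ℕ) :
    PowerSeries.coeff m (f * PowerSeries.C x) = PowerSeries.coeff m f * x := by
  simp

theorem Fil_succ {m : ℕ} {f : PowerSeries R} (hf : f ∈ Fil m)
    (h : PowerSeries.coeff m f = 0) : f ∈ Fil (m + 1) := by
  intro i hi
  rcases Nat.lt_succ_iff_lt_or_eq.mp hi with h1 | h1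
  · exact hf i h1
  · rw [h1]; exact h

/-- `f` lies in the corner `x R y`. -/
def Cor {A : Type*} [Mul A] (x y f : A) : Prop := x * f = f ∧ f * y = f

theorem Cor.mul_zero' {A : Type*} [Ring A] {x y z w f g : A} (hf : Cor x y f) (hg : Cor z w g)
    (h : y * z = 0) : f * g = 0 := by
  rw [← hf.2, ← hg.1, mul_assoc, ← mul_assoc y, h, zero_mul, mul_zero]

theorem Cor.mul {A : Type*} [Ring A] {x y z w f g : A} (hf : Cor x y f) (hg : Cor z w g) :
    Cor x w (f * g) := ⟨by rw [← mul_assoc, hf.1], by rw [mul_assoc, hg.2]⟩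

theorem Cor.add {A : Type*} [Ring A] {x y f g : A} (hf : Cor x y f) (hg : Cor x y g) :
    Cor x y (f + g) := ⟨by rw [mul_add, hf.1, hg.1], by rw [add_mul, hf.2, hg.2]⟩

theorem Cor.neg {A : Type*} [Ring A] {x y f : A} (hf : Cor x y f) :
    Cor x y (-f) := ⟨by rw [mul_neg, hf.1], by rw [neg_mul, hf.2]⟩

theorem Cor.sub {A : Type*} [Ring A] {x y f g : A} (hf : Cor x y f) (hg : Cor x y g) :
    Cor x y (f - g) := by rw [sub_eq_add_neg]; exact hf.add hg.neg

theorem Cor.of_mul {A : Type*} [Ring A] {x y : A} (hx : x * x = x) (hy : y * y = y) (f : A) :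
    Cor x y (x * f * y) :=
  ⟨by rw [← mul_assoc, ← mul_assoc, hx], by rw [mul_assoc, hy]⟩

theorem Cor.left_zero {A : Type*} [Ring A] {x y z f : A} (hf : Cor x y f) (h : z * x = 0) :
    z * f = 0 := by rw [← hf.1, ← mul_assoc, h, zero_mul]

theorem Cor.right_zero {A : Type*} [Ring A] {x y z f : A} (hf : Cor x y f) (h : y * z = 0) :
    f * z = 0 := by rw [← hf.2, mul_assoc, h, mul_zero]

/-- Inverse of `1 + z` for `z` topologically nilpotent in a corner. -/
theorem exists_inv_corner {x z : PowerSeries R} (_hx : x * x = x) (hz : Cor x x z)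
    (hz1 : z ∈ Fil 1) :
    ∃ w, Cor x x w ∧ w ∈ Fil 1 ∧ (1 + z) * (1 + w) = 1 ∧ (1 + w) * (1 + z) = 1 := by
  have hc : PowerSeries.constantCoeff (1 + z) = ((1 : Rˣ) : R) := by
    have := hz1 0 (by omega)
    rw [PowerSeries.coeff_zero_eq_constantCoeff_apply] at this
    simp [this]
  set i := PowerSeries.invOfUnit (1 + z) 1 with hi
  have h1 : (1 + z) * i = 1 := PowerSeries.mul_invOfUnit _ _ hc
  have h2 : i * (1 + z) = 1 := PowerSeries.invOfUnit_mul _ _ hc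
  have e1 : i - 1 = - (z * i) := by
    have : i + z * i = 1 := by rw [← h1]; noncomm_ring
    rw [← this]; noncomm_ring
  have e2 : i - 1 = - (i * z) := by
    have : i + i * z = 1 := by rw [← h2]; noncomm_ring
    rw [← this]; noncomm_ring
  refine ⟨i - 1, ⟨?_, ?_⟩, ?_, ?_, ?_⟩
  · rw [e1, mul_neg, ← mul_assoc, hz.1]
  · rw [e2, neg_mul, mul_assoc, hz.2]
  · rw [e1]; exact neg_mem (Fil_mul_right _ hz1)
  · rw [add_sub_cancel]; exact h1
  · rw [add_sub_cancel]; exact h2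

/-- Block Gauss decomposition. -/
theorem gauss {x x' y : PowerSeries R} (hx : x * x = x) (hx' : x' * x' = x') (hxx' : x * x' = 0)
    (hx'x : x' * x = 0) (hy : Cor (x + x') (x + x') y) (hy1 : y ∈ Fil 1) :
    ∃ a c z1 z2, Cor x' x a ∧ Cor x x' c ∧ Cor x x z1 ∧ Cor x' x' z2 ∧
      a ∈ Fil 1 ∧ c ∈ Fil 1 ∧ z1 ∈ Fil 1 ∧ z2 ∈ Fil 1 ∧
      1 + y = (1 + a) * ((1 + c) * (1 + z1 + z2)) := by
  have c11 := Cor.of_mul hx hx y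
  have c12 := Cor.of_mul hx hx' y
  have c21 := Cor.of_mul hx' hx y
  have c22 := Cor.of_mul hx' hx' y
  have hysum : y = x * y * x + x * y * x' + x' * y * x + x' * y * x' := by
    conv_lhs => rw [← hy.1, ← hy.2]
    noncomm_ring
  have f11 : x * y * x ∈ Fil 1 := Fil_mul_right _ (Fil_mul_left _ hy1)
  have f12 : x * y * x' ∈ Fil 1 := Fil_mul_right _ (Fil_mul_left _ hy1)
  have f21 : x' * y * x ∈ Fil 1 := Fil_mul_right _ (Fil_mul_left _ hy1)
  have f22 : x' * y * x' ∈ Fil 1 := Fil_mul_right _ (Fil_mul_left _ hy1)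
  generalize x * y * x = y11 at *
  generalize x * y * x' = y12 at *
  generalize x' * y * x = y21 at *
  generalize x' * y * x' = y22 at *
  obtain ⟨w1, cw1, fw1, e1, e1'⟩ := exists_inv_corner hx c11 f11
  have ca : Cor x' x (y21 * (1 + w1)) := by
    rw [mul_add, mul_one]; exact c21.add (c21.mul cw1)
  have fa : y21 * (1 + w1) ∈ Fil 1 := Fil_mul_right _ f21
  have cz2 : Cor x' x' (y22 - y21 * (1 + w1) * y12) := c22.sub (ca.mul c12)
  have fz2 : y22 - y21 * (1 + w1) * y12 ∈ Fil 1 := sub_mem f22 (Fil_mul_right _ fa)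
  obtain ⟨w2, cw2, fw2, e2, e2'⟩ := exists_inv_corner hx' cz2 fz2
  have cc : Cor x x' (y12 * (1 + w2)) := by
    rw [mul_add, mul_one]; exact c12.add (c12.mul cw2)
  refine ⟨y21 * (1 + w1), y12 * (1 + w2), y11, y22 - y21 * (1 + w1) * y12, ca, cc, c11, cz2, fa,
    Fil_mul_right _ f12, f11, fz2, ?_⟩
  set a := y21 * (1 + w1) with ha
  set z2 := y22 - a * y12 with hz2
  have k1 : y12 * (1 + w2) * y11 = 0 := cc.mul_zero' c11 hx'x
  have k2 : y12 * (1 + w2) * (1 + z2) = y12 := by rw [mul_assoc, e2', mul_one]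
  have k3 : a * (1 + y11) = y21 := by rw [ha, mul_assoc, e1', mul_one]
  have k4 : a * z2 = 0 := ca.mul_zero' cz2 hxx'
  have s1 : (1 + y12 * (1 + w2)) * (1 + y11 + z2) = 1 + y11 + z2 + y12 := by
    have : (1 + y12 * (1 + w2)) * (1 + y11 + z2)
      = 1 + y11 + z2 + y12 * (1 + w2) * y11 + y12 * (1 + w2) * (1 + z2) := by noncomm_ring
    rw [this, k1, k2, add_zero]
  rw [s1]
  have : (1 + a) * (1 + y11 + z2 + y12) = 1 + y11 + z2 + y12 + a * (1 + y11) + a * z2 + a * y12 := by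
    noncomm_ring
  rw [this, k3, k4, hz2, hysum]
  noncomm_ring

/-- Solving a Sylvester equation modulo a power of `X`. -/
theorem sylvester {e e' : R} {s P P' : PowerSeries R}
    (hP : Cor (PowerSeries.C e) (PowerSeries.C e) P)
    (hP' : Cor (PowerSeries.C e') (PowerSeries.C e') P')
    (hs : ∀ f, s * f = f * s) {v : ℕ}
    (fP : P - s * PowerSeries.C e ∈ Fil v) (fP' : P' - s * PowerSeries.C e' ∈ Fil v)
    (hsol : ∀ z : R, Cor e e' z → ∃ w, Cor e e' w ∧
      w * PowerSeries.coeff v (P' - s * PowerSeries.C e')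
        - PowerSeries.coeff v (P - s * PowerSeries.C e) * w = z)
    (r0 : ℕ) {y : PowerSeries R} (hy : Cor (PowerSeries.C e) (PowerSeries.C e') y)
    (fy : y ∈ Fil (v + r0)) (N : ℕ) :
    ∃ x, Cor (PowerSeries.C e) (PowerSeries.C e') x ∧ x ∈ Fil r0 ∧
      y - (x * P' - P * x) ∈ Fil (v + r0 + N) := by
  induction N with
  | zero => exact ⟨0, ⟨by simp, by simp⟩, zero_mem _, by simpa using fy⟩
  | succ N ih =>
    obtain ⟨x, cx, fx, hx⟩ := ih
    have cr : Cor (PowerSeries.C e) (PowerSeries.C e') (y - (x * P' - P * x)) :=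
      hy.sub ((cx.mul hP').sub (hP.mul cx))
    set ρ := y - (x * P' - P * x) with hρ
    obtain ⟨w, cw, hw⟩ := hsol (PowerSeries.coeff (v + r0 + N) ρ) (by
      constructor
      · rw [← coeff_C_mul', cr.1]
      · rw [← coeff_mul_C', cr.2])
    have cwX : Cor (PowerSeries.C e) (PowerSeries.C e')
        (PowerSeries.C w * PowerSeries.X ^ (r0 + N)) := by
      constructor
      · rw [← mul_assoc, ← map_mul, cw.1]
      · rw [mul_assoc, PowerSeries.X_pow_mul, ← mul_assoc, ← map_mul, cw.2]
    have fX : (PowerSeries.C w * PowerSeries.X ^ (r0 + N) : PowerSeries R) ∈ Fil (r0 + N) := by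
      intro i hi
      rw [coeff_C_mul', PowerSeries.coeff_X_pow, if_neg (by omega), mul_zero]
    have cX : PowerSeries.coeff (r0 + N)
        (PowerSeries.C w * PowerSeries.X ^ (r0 + N) : PowerSeries R) = w := by
      rw [coeff_C_mul', PowerSeries.coeff_X_pow, if_pos rfl, mul_one]
    set W : PowerSeries R := PowerSeries.C w * PowerSeries.X ^ (r0 + N) with hW
    have key : W * P' - P * W =
        W * (P' - s * PowerSeries.C e') - (P - s * PowerSeries.C e) * W := by
      have h1 : W * (s * PowerSeries.C e') = s * W := by
        rw [← mul_assoc, ← hs, mul_assoc, cwX.2]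
      have h2 : (s * PowerSeries.C e) * W = s * W := by rw [mul_assoc, cwX.1]
      rw [mul_sub, sub_mul, h1, h2]; abel
    refine ⟨x + W, cx.add cwX, add_mem fx (Fil_mono (by omega) fX), ?_⟩
    have e1 : y - ((x + W) * P' - P * (x + W)) = ρ - (W * P' - P * W) := by
      rw [hρ]; noncomm_ring
    rw [e1, key, ← add_assoc]
    have f1 : W * (P' - s * PowerSeries.C e') ∈ Fil (v + r0 + N) := Fil_mul' fX fP' (by omega)
    have f2 : (P - s * PowerSeries.C e) * W ∈ Fil (v + r0 + N) := Fil_mul' fP fX (by omega)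
    apply Fil_succ (sub_mem hx (sub_mem f1 f2))
    have g1 := coeff_mul_Fil fX fP'
    have g2 := coeff_mul_Fil fP fX
    rw [show r0 + N + v = v + r0 + N by omega, cX] at g1
    rw [show v + (r0 + N) = v + r0 + N by omega, cX] at g2
    clear_value ρ
    rw [map_sub, map_sub (PowerSeries.coeff _) (W * _), g1, g2, hw, sub_self]

end FilSec
end

noncomputable section

/-- Binary trees encoding the successive splittings of the exponential factors. -/
inductive BT (J : Type) where
  | leaf : J → BT J
  | node : ℕ → BT J → BT J → BT J

/-- The leaves of a tree. -/
def BT.leaves {J : Type} [DecidableEq J] : BT J → Finset J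
  | .leaf j => {j}
  | .node _ l r => l.leaves ∪ r.leaves

/-- Admissible trees for the coefficient functions `κ`. -/
def BT.Good {J : Type} [DecidableEq J] (κ : J → ℕ → ℂ) (k : ℕ) (D : J → J → ℕ) : BT J → Prop
  | .leaf _ => True
  | .node v l r => v + 2 ≤ k ∧ Disjoint l.leaves r.leaves ∧
      (∀ s ∈ l.leaves ∪ r.leaves, ∀ t ∈ l.leaves ∪ r.leaves, ∀ m < v, κ s m = κ t m) ∧
      (∀ s ∈ l.leaves, ∀ t ∈ l.leaves, κ s v = κ t v) ∧
      (∀ s ∈ l.leaves, ∀ t ∈ r.leaves, κ s v ≠ κ t v ∧ D s t = k - 2 - v ∧ D t s = k - 2 - v) ∧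
      l.Good κ k D ∧ r.Good κ k D

/-- `s` lies to the left of `t` in the tree. -/
def BT.left {J : Type} [DecidableEq J] : BT J → J → J → Prop
  | .leaf _, _, _ => False
  | .node _ l r, s, t => (s ∈ l.leaves ∧ t ∈ r.leaves) ∨ l.left s t ∨ r.left s t

theorem BT.leaves_nonempty {J : Type} [DecidableEq J] (t : BT J) : t.leaves.Nonempty := by
  induction t with
  | leaf j => exact ⟨j, by simp [BT.leaves]⟩
  | node v l r hl hr => obtain ⟨j, hj⟩ := hl; exact ⟨j, by simp [BT.leaves, hj]⟩

theorem BT.left_mem {J : Type} [DecidableEq J] (t : BT J) {s s' : J} (h : t.left s s') :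
    s ∈ t.leaves ∧ s' ∈ t.leaves := by
  induction t with
  | leaf j => exact h.elim
  | node v l r hl hr =>
    simp only [BT.leaves, Finset.mem_union]
    rcases h with ⟨h1, h2⟩ | h | h
    · exact ⟨Or.inl h1, Or.inr h2⟩
    · exact ⟨Or.inl (hl h).1, Or.inl (hl h).2⟩
    · exact ⟨Or.inr (hr h).1, Or.inr (hr h).2⟩

theorem BT.left_asymm {J : Type} [DecidableEq J] {κ : J → ℕ → ℂ} {k : ℕ} {D : J → J → ℕ}
    (t : BT J) (hG : t.Good κ k D) {s s' : J} (h : t.left s s') (h' : t.left s' s) : False := by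
  induction t with
  | leaf j => exact h.elim
  | node v l r hl hr =>
    obtain ⟨-, hd, -, -, -, Gl, Gr⟩ := hG
    have dj : ∀ x, x ∈ l.leaves → x ∈ r.leaves → False := fun x h1 h2 =>
      Finset.disjoint_left.mp hd h1 h2
    rcases h with ⟨h1, h2⟩ | h | h <;> rcases h' with ⟨h3, h4⟩ | h' | h'
    · exact dj _ h1 h4
    · exact dj _ (l.left_mem h').1 h2
    · exact dj _ h1 (r.left_mem h').2
    · exact dj _ (l.left_mem h).1 h4
    · exact hl Gl h h'
    · exact dj _ (l.left_mem h).1 (r.left_mem h').2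
    · exact dj _ h3 (r.left_mem h).2
    · exact dj _ (l.left_mem h').1 (r.left_mem h).2
    · exact hr Gr h h'

theorem BT.left_total {J : Type} [DecidableEq J]
    (t : BT J) {s s' : J} (h : s ∈ t.leaves) (h' : s' ∈ t.leaves) (hne : s ≠ s') :
    t.left s s' ∨ t.left s' s := by
  induction t with
  | leaf j => simp only [BT.leaves, Finset.mem_singleton] at h h'; exact absurd (h.trans h'.symm) hne
  | node v l r hl hr =>
    simp only [BT.leaves, Finset.mem_union] at h h'
    simp only [BT.left]
    rcases h with h | h <;> rcases h' with h' | h'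
    · rcases hl h h' with h1 | h1 <;> tauto
    · tauto
    · tauto
    · rcases hr h h' with h1 | h1 <;> tauto

theorem BT.left_irrefl {J : Type} [DecidableEq J] {κ : J → ℕ → ℂ} {k : ℕ} {D : J → J → ℕ}
    (t : BT J) (hG : t.Good κ k D) {s : J} (h : t.left s s) : False :=
  t.left_asymm hG h h

/-- Existence of admissible trees. -/
theorem exists_good {J : Type} [DecidableEq J] (κ : J → ℕ → ℂ) (k : ℕ) (D : J → J → ℕ)
    (hk : ∀ s t, s ≠ t → ∃ m, m + 2 ≤ k ∧ κ s m ≠ κ t m)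
    (hD : ∀ s t v, (∀ m < v, κ s m = κ t m) → κ s v ≠ κ t v → D s t = k - 2 - v)
    (s : Finset J) (hs : s.Nonempty) : ∃ t : BT J, t.leaves = s ∧ t.Good κ k D := by
  classical
  induction s using Finset.strongInduction with
  | H s ih =>
    obtain ⟨j0, hj0⟩ := hs
    by_cases h1 : s = {j0}
    · exact ⟨.leaf j0, by simp [BT.leaves, h1], trivial⟩
    have hne : ∃ t ∈ s, t ≠ j0 := by
      by_contra! hcon
      apply h1
      ext x; simp only [Finset.mem_singleton]
      exact ⟨fun hx => hcon x hx, fun hx => hx ▸ hj0⟩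
    obtain ⟨t0, ht0, htj⟩ := hne
    have hex : ∃ m, ∃ t ∈ s, κ t m ≠ κ j0 m := by
      obtain ⟨m, -, h⟩ := hk t0 j0 htj
      exact ⟨m, t0, ht0, h⟩
    set v := Nat.find hex with hv
    obtain ⟨t1, ht1, ht1v⟩ := Nat.find_spec hex
    have hmin : ∀ m < v, ∀ t ∈ s, κ t m = κ j0 m := by
      intro m hm t ht
      have := Nat.find_min hex hm
      push Not at this
      exact this t ht
    have hvk : v + 2 ≤ k := by
      obtain ⟨m, hm, h⟩ := hk t0 j0 htj
      have : v ≤ m := Nat.find_min' hex ⟨t0, ht0, h⟩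
      omega
    set a := s.filter (fun t => κ t v = κ j0 v) with ha
    set b := s.filter (fun t => ¬ κ t v = κ j0 v) with hb
    have hab : a ∪ b = s := Finset.filter_union_filter_not_eq _ _
    have hda : Disjoint a b := Finset.disjoint_filter_filter_not _ _ _
    have hja : j0 ∈ a := by simp [ha, hj0]
    have htb : t1 ∈ b := by simp only [hb, Finset.mem_filter]; exact ⟨ht1, ht1v⟩
    have has : a ⊂ s := by
      refine Finset.filter_ssubset.mpr ⟨t1, ht1, ht1v⟩
    have hbs : b ⊂ s := by
      refine Finset.filter_ssubset.mpr ⟨j0, hj0, by simp⟩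
    obtain ⟨l, hl, Gl⟩ := ih a has ⟨_, hja⟩
    obtain ⟨r, hr, Gr⟩ := ih b hbs ⟨_, htb⟩
    have memA : ∀ x ∈ a, κ x v = κ j0 v := fun x hx => (Finset.mem_filter.mp hx).2
    have memB : ∀ x ∈ b, ¬ κ x v = κ j0 v := fun x hx => (Finset.mem_filter.mp hx).2
    refine ⟨.node v l r, by simp only [BT.leaves, hl, hr, hab], hvk, by rw [hl, hr]; exact hda,
      ?_, ?_, ?_, Gl, Gr⟩
    · rw [hl, hr, hab]
      intro s' hs' t ht m hm
      rw [hmin m hm s' hs', hmin m hm t ht]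
    · rw [hl]; intro s' hs' t ht
      rw [memA _ hs', memA _ ht]
    · rw [hl, hr]; intro s' hs' t ht
      have h1 : s' ∈ s := has.1 hs'
      have h2 : t ∈ s := hbs.1 ht
      have hne : κ s' v ≠ κ t v := by
        rw [memA _ hs']; exact fun h => memB _ ht h.symm
      refine ⟨hne, hD _ _ _ ?_ hne, hD _ _ _ ?_ hne.symm⟩
      · intro m hm; rw [hmin m hm _ h1, hmin m hm _ h2]
      · intro m hm; rw [hmin m hm _ h1, hmin m hm _ h2]

section PhiSec
variable {R : Type*} [Ring R] [Algebra ℂ R] {J : Type} [DecidableEq J]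

/-- Sum of a family of idempotents over a finite set. -/
def es (E : J → R) (s : Finset J) : R := ∑ j ∈ s, E j

/-- Orthogonal idempotents. -/
def OI (E : J → R) : Prop := ∀ j j', E j * E j' = if j = j' then E j else 0

theorem OI.mul_es {E : J → R} (hE : OI E) {s : Finset J} {j : J} (hj : j ∈ s) :
    E j * es E s = E j := by
  rw [es, Finset.mul_sum, Finset.sum_eq_single j]
  · rw [hE, if_pos rfl]
  · intro b _ hb; rw [hE, if_neg hb.symm]
  · intro h; exact absurd hj h

theorem OI.es_mul {E : J → R} (hE : OI E) {s : Finset J} {j : J} (hj : j ∈ s) :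
    es E s * E j = E j := by
  rw [es, Finset.sum_mul, Finset.sum_eq_single j]
  · rw [hE, if_pos rfl]
  · intro b _ hb; rw [hE, if_neg hb]
  · intro h; exact absurd hj h

theorem OI.mul_es_zero {E : J → R} (hE : OI E) {s : Finset J} {j : J} (hj : j ∉ s) :
    E j * es E s = 0 := by
  rw [es, Finset.mul_sum]
  refine Finset.sum_eq_zero fun b hb => ?_
  rw [hE, if_neg]; rintro rfl; exact hj hb

theorem OI.es_mul_zero {E : J → R} (hE : OI E) {s : Finset J} {j : J} (hj : j ∉ s) :
    es E s * E j = 0 := by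
  rw [es, Finset.sum_mul]
  refine Finset.sum_eq_zero fun b hb => ?_
  rw [hE, if_neg]; rintro rfl; exact hj hb

theorem OI.es_es {E : J → R} (hE : OI E) (s : Finset J) : es E s * es E s = es E s := by
  conv_lhs => rw [es, Finset.sum_mul]
  rw [es]; exact Finset.sum_congr rfl fun j hj => hE.mul_es hj

theorem OI.es_es_zero {E : J → R} (hE : OI E) {s t : Finset J} (h : Disjoint s t) :
    es E s * es E t = 0 := by
  rw [es, Finset.sum_mul]
  exact Finset.sum_eq_zero fun j hj => hE.mul_es_zero (Finset.disjoint_left.mp h hj)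

theorem es_union (E : J → R) {s t : Finset J} (h : Disjoint s t) :
    es E (s ∪ t) = es E s + es E t := Finset.sum_union h

theorem C_idem {E : J → R} (hE : OI E) (s : Finset J) :
    (PowerSeries.C (es E s) * PowerSeries.C (es E s) : PowerSeries R) = PowerSeries.C (es E s) := by
  rw [← map_mul, hE.es_es]

theorem C_orth {E : J → R} (hE : OI E) {s t : Finset J} (h : Disjoint s t) :
    (PowerSeries.C (es E s) * PowerSeries.C (es E t) : PowerSeries R) = 0 := by
  rw [← map_mul, hE.es_es_zero h, map_zero]

/-- The lower unipotent part attached to a node. -/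
def aSer (E : J → R) (k v : ℕ) (l r : Finset J) (Z : ℕ → R) : PowerSeries R :=
  PowerSeries.mk fun m => if 1 ≤ m ∧ m + v + 2 ≤ k then es E r * Z (m - 1) * es E l else 0

/-- The upper part attached to a node. -/
def bSer (E : J → R) (k v : ℕ) (l r : Finset J) (Z : ℕ → R) : PowerSeries R :=
  PowerSeries.mk fun m => if v + 1 ≤ m ∧ m + 2 ≤ k then es E l * Z (k - 2 - m) * es E r else 0

/-- The parametrization of the orbit. -/
def Phi (E : J → R) (κ : J → ℕ → ℂ) (k : ℕ) (Z : ℕ → R) : BT J → PowerSeries R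
  | .leaf j => PowerSeries.mk fun m => κ j m • E j
  | .node v l r => (1 + aSer E k v l.leaves r.leaves Z) *
      (Phi E κ k Z l + Phi E κ k Z r + bSer E k v l.leaves r.leaves Z) *
      (1 - aSer E k v l.leaves r.leaves Z)

theorem aSer_cor {E : J → R} (hE : OI E) (k v : ℕ) (l r : Finset J) (Z : ℕ → R) :
    Cor (PowerSeries.C (es E r)) (PowerSeries.C (es E l)) (aSer E k v l r Z) := by
  constructor
  · ext m
    rw [coeff_C_mul', aSer, PowerSeries.coeff_mk]
    split_ifs
    · rw [← mul_assoc, ← mul_assoc, hE.es_es]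
    · rw [mul_zero]
  · ext m
    rw [coeff_mul_C', aSer, PowerSeries.coeff_mk]
    split_ifs
    · rw [mul_assoc, hE.es_es]
    · rw [zero_mul]

theorem bSer_cor {E : J → R} (hE : OI E) (k v : ℕ) (l r : Finset J) (Z : ℕ → R) :
    Cor (PowerSeries.C (es E l)) (PowerSeries.C (es E r)) (bSer E k v l r Z) := by
  constructor
  · ext m
    rw [coeff_C_mul', bSer, PowerSeries.coeff_mk]
    split_ifs
    · rw [← mul_assoc, ← mul_assoc, hE.es_es]
    · rw [mul_zero]
  · ext m
    rw [coeff_mul_C', bSer, PowerSeries.coeff_mk]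
    split_ifs
    · rw [mul_assoc, hE.es_es]
    · rw [zero_mul]

theorem aSer_Fil (E : J → R) (k v : ℕ) (l r : Finset J) (Z : ℕ → R) :
    aSer E k v l r Z ∈ Fil 1 := by
  intro i hi
  rw [aSer, PowerSeries.coeff_mk, if_neg (by omega)]

theorem bSer_Fil (E : J → R) (k v : ℕ) (l r : Finset J) (Z : ℕ → R) :
    bSer E k v l r Z ∈ Fil (v + 1) := by
  intro i hi
  rw [bSer, PowerSeries.coeff_mk, if_neg (by omega)]

theorem conj_expand {A : Type*} [Ring A] {x x' P Q a b : A} (hxx' : x * x' = 0)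
    (hx'x : x' * x = 0) (hP : Cor x x P) (hQ : Cor x' x' Q) (ha : Cor x' x a) (hb : Cor x x' b) :
    (1 + a) * (P + Q + b) * (1 - a)
      = (P - b * a) + (Q + a * b) + b + (a * P - Q * a - a * b * a) := by
  have h1 : a * Q = 0 := ha.mul_zero' hQ hxx'
  have h2 : P * a = 0 := hP.mul_zero' ha hxx'
  have h3 : (1 + a) * (P + Q + b) * (1 - a)
      = (P - b * a) + (Q + a * b) + b + (a * P - Q * a - a * b * a)
        - a * (P * a) - (a * Q) * a + a * Q - P * a := by noncomm_ring
  rw [h3, h1, h2]; simp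

theorem Cor.embed {A : Type*} [Ring A] {x y x' y' f : A} (hf : Cor x y f) (h1 : x' * x = x)
    (h2 : y * y' = y) : Cor x' y' f :=
  ⟨by rw [← hf.1, ← mul_assoc, h1], by rw [← hf.2, mul_assoc, h2]⟩

theorem Phi_cor {E : J → R} (hE : OI E) {κ : J → ℕ → ℂ} {k : ℕ} {D : J → J → ℕ} (Z : ℕ → R)
    (t : BT J) (hG : t.Good κ k D) :
    Cor (PowerSeries.C (es E t.leaves)) (PowerSeries.C (es E t.leaves)) (Phi E κ k Z t) := by
  induction t with
  | leaf j =>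
    have : es E (BT.leaf j).leaves = E j := by simp [es, BT.leaves]
    rw [this]
    have h2 : E j * E j = E j := by rw [hE, if_pos rfl]
    constructor
    · ext m; rw [coeff_C_mul', Phi, PowerSeries.coeff_mk, mul_smul_comm, h2]
    · ext m; rw [coeff_mul_C', Phi, PowerSeries.coeff_mk, smul_mul_assoc, h2]
  | node v l r hl hr =>
    obtain ⟨-, hd, -, -, -, Gl, Gr⟩ := hG
    have ha := aSer_cor hE k v l.leaves r.leaves Z
    have hb := bSer_cor hE k v l.leaves r.leaves Z
    have o1 := C_orth hE hd
    have o2 := C_orth hE hd.symm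
    have i1 := C_idem hE l.leaves
    have i2 := C_idem hE r.leaves
    have hP := hl Gl
    have hQ := hr Gr
    rw [Phi, conj_expand o1 o2 hP hQ ha hb]
    have hx : (PowerSeries.C (es E (BT.node v l r).leaves) : PowerSeries R)
        = PowerSeries.C (es E l.leaves) + PowerSeries.C (es E r.leaves) := by
      rw [BT.leaves, es_union E hd, map_add]
    rw [hx]
    have e1 : (PowerSeries.C (es E l.leaves) + PowerSeries.C (es E r.leaves)) *
      PowerSeries.C (es E l.leaves) = PowerSeries.C (es E l.leaves) := by rw [add_mul, i1, o2, add_zero]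
    have e2 : (PowerSeries.C (es E l.leaves) + PowerSeries.C (es E r.leaves)) *
      PowerSeries.C (es E r.leaves) = PowerSeries.C (es E r.leaves) := by rw [add_mul, i2, o1, zero_add]
    have e3 : PowerSeries.C (es E l.leaves) * (PowerSeries.C (es E l.leaves) + PowerSeries.C (es E r.leaves)) = PowerSeries.C (es E l.leaves) := by rw [mul_add, i1, o1, add_zero]
    have e4 : PowerSeries.C (es E r.leaves) * (PowerSeries.C (es E l.leaves) + PowerSeries.C (es E r.leaves)) = PowerSeries.C (es E r.leaves) := by rw [mul_add, i2, o2, zero_add]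
    refine ((((hP.sub (hb.mul ha)).embed e1 e3).add ((hQ.add (ha.mul hb)).embed e2 e4)).add
      (hb.embed e1 e4)).add (Cor.embed (((ha.mul hP).sub (hQ.mul ha)).sub ((ha.mul hb).mul ha)) e2 e3)

/-- Expanded form of the parametrization at a node. -/
theorem Phi_node {E : J → R} (hE : OI E) {κ : J → ℕ → ℂ} {k : ℕ} {D : J → J → ℕ} (Z : ℕ → R)
    (v : ℕ) (l r : BT J) (hG : (BT.node v l r).Good κ k D) :
    Phi E κ k Z (.node v l r) =
      (Phi E κ k Z l - bSer E k v l.leaves r.leaves Z * aSer E k v l.leaves r.leaves Z)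
      + (Phi E κ k Z r + aSer E k v l.leaves r.leaves Z * bSer E k v l.leaves r.leaves Z)
      + bSer E k v l.leaves r.leaves Z
      + (aSer E k v l.leaves r.leaves Z * Phi E κ k Z l
        - Phi E κ k Z r * aSer E k v l.leaves r.leaves Z
        - aSer E k v l.leaves r.leaves Z * bSer E k v l.leaves r.leaves Z
          * aSer E k v l.leaves r.leaves Z) := by
  obtain ⟨-, hd, -, -, -, Gl, Gr⟩ := hG
  rw [Phi, conj_expand (C_orth hE hd) (C_orth hE hd.symm) (Phi_cor hE Z l Gl) (Phi_cor hE Z r Gr)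
    (aSer_cor hE k v l.leaves r.leaves Z) (bSer_cor hE k v l.leaves r.leaves Z)]

theorem es_mul_mul_es (E : J → R) (s t : Finset J) (x : R) :
    es E s * x * es E t = ∑ i ∈ s, ∑ j ∈ t, E i * x * E j := by
  rw [es, es, Finset.sum_mul, Finset.sum_mul]
  exact Finset.sum_congr rfl fun i _ => by rw [Finset.mul_sum]

/-- The parametrization only depends on finitely many off-diagonal blocks. -/
theorem Phi_congr {E : J → R} {κ : J → ℕ → ℂ} {k : ℕ} {D : J → J → ℕ} (Z Z' : ℕ → R)
    (t : BT J) (hG : t.Good κ k D)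
    (h : ∀ s ∈ t.leaves, ∀ s' ∈ t.leaves, s ≠ s' → ∀ m < D s s', E s * Z m * E s' = E s * Z' m * E s') :
    Phi E κ k Z t = Phi E κ k Z' t := by
  induction t with
  | leaf j => rfl
  | node v l r hl hr =>
    obtain ⟨hk, hd, -, -, hv, Gl, Gr⟩ := hG
    simp only [BT.leaves, Finset.mem_union] at h
    have ea : aSer E k v l.leaves r.leaves Z = aSer E k v l.leaves r.leaves Z' := by
      ext m
      rw [aSer, aSer, PowerSeries.coeff_mk, PowerSeries.coeff_mk]
      split_ifs with hm
      · rw [es_mul_mul_es, es_mul_mul_es]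
        refine Finset.sum_congr rfl fun i hi => Finset.sum_congr rfl fun j hj => ?_
        refine h i (Or.inr hi) j (Or.inl hj) ?_ _ ?_
        · rintro rfl; exact Finset.disjoint_left.mp hd hj hi
        · rw [(hv j hj i hi).2.2]; omega
      · rfl
    have eb : bSer E k v l.leaves r.leaves Z = bSer E k v l.leaves r.leaves Z' := by
      ext m
      rw [bSer, bSer, PowerSeries.coeff_mk, PowerSeries.coeff_mk]
      split_ifs with hm
      · rw [es_mul_mul_es, es_mul_mul_es]
        refine Finset.sum_congr rfl fun i hi => Finset.sum_congr rfl fun j hj => ?_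
        refine h i (Or.inl hi) j (Or.inr hj) ?_ _ ?_
        · rintro rfl; exact Finset.disjoint_left.mp hd hi hj
        · rw [(hv i hi j hj).2.1]; omega
      · rfl
    rw [Phi, Phi, ea, eb, hl Gl fun s hs s' hs' => h s (Or.inl hs) s' (Or.inl hs'),
      hr Gr fun s hs s' hs' => h s (Or.inr hs) s' (Or.inr hs')]

theorem Phi_map {R' : Type*} [Ring R'] [Algebra ℂ R'] (φ : R →ₐ[ℂ] R')
    (E : J → R) (κ : J → ℕ → ℂ) (k : ℕ) (Z : ℕ → R) (t : BT J) :
    PowerSeries.map (φ : R →+* R') (Phi E κ k Z t)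
      = Phi (fun j => φ (E j)) κ k (fun m => φ (Z m)) t := by
  have hes : ∀ s, φ (es E s) = es (fun j => φ (E j)) s := fun s => by simp [es]
  induction t with
  | leaf j => ext m; simp [Phi]
  | node v l r hl hr =>
    have ea : PowerSeries.map (φ : R →+* R') (aSer E k v l.leaves r.leaves Z)
        = aSer (fun j => φ (E j)) k v l.leaves r.leaves (fun m => φ (Z m)) := by
      ext m
      simp only [aSer, PowerSeries.coeff_map, PowerSeries.coeff_mk]
      split_ifs <;> simp [hes]
    have eb : PowerSeries.map (φ : R →+* R') (bSer E k v l.leaves r.leaves Z)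
        = bSer (fun j => φ (E j)) k v l.leaves r.leaves (fun m => φ (Z m)) := by
      ext m
      simp only [bSer, PowerSeries.coeff_map, PowerSeries.coeff_mk]
      split_ifs <;> simp [hes]
    simp only [Phi, map_mul, map_add, map_sub, map_one, hl, hr, ea, eb]

/-- A central truncated scalar series. -/
def sSer (R : Type*) [Ring R] [Algebra ℂ R] (c : ℕ → ℂ) (v : ℕ) : PowerSeries R :=
  PowerSeries.mk fun m => if m < v then algebraMap ℂ R (c m) else 0

theorem sSer_comm (c : ℕ → ℂ) (v : ℕ) (f : PowerSeries R) : sSer R c v * f = f * sSer R c v := by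
  ext m
  rw [PowerSeries.coeff_mul, PowerSeries.coeff_mul, ← Finset.Nat.sum_antidiagonal_swap]
  refine Finset.sum_congr rfl fun x _ => ?_
  simp only [sSer, PowerSeries.coeff_mk, Prod.fst_swap, Prod.snd_swap]
  split_ifs
  · exact Algebra.commutes _ _
  · simp

/-- The leading coefficients of the parametrization. -/
theorem Phi_leading {E : J → R} (hE : OI E) {κ : J → ℕ → ℂ} {k : ℕ} {D : J → J → ℕ} (Z : ℕ → R)
    (t : BT J) (hG : t.Good κ k D) (c : ℕ → ℂ) (v : ℕ)
    (hc : ∀ s ∈ t.leaves, ∀ m < v, κ s m = c m) :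
    Phi E κ k Z t - sSer R c v * PowerSeries.C (es E t.leaves) ∈ Fil v ∧
    PowerSeries.coeff v (Phi E κ k Z t - sSer R c v * PowerSeries.C (es E t.leaves))
      = ∑ j ∈ t.leaves, κ j v • E j := by
  induction t with
  | leaf j =>
    have he : es E (BT.leaf j).leaves = E j := by simp [es, BT.leaves]
    rw [he]
    constructor
    · intro m hm
      rw [map_sub, coeff_mul_C', Phi, sSer, PowerSeries.coeff_mk, PowerSeries.coeff_mk, if_pos hm,
        hc j (by simp [BT.leaves]) m hm, Algebra.smul_def, sub_self]
    · rw [map_sub, coeff_mul_C', Phi, sSer, PowerSeries.coeff_mk, PowerSeries.coeff_mk,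
        if_neg (lt_irrefl _)]
      simp [BT.leaves]
  | node v' l r hl hr =>
    have hnode := Phi_node hE Z v' l r hG
    obtain ⟨hk, hd, hagree, -, hv, Gl, Gr⟩ := hG
    have hvv : v ≤ v' := by
      by_contra hcon
      push Not at hcon
      obtain ⟨s, hs⟩ := l.leaves_nonempty
      obtain ⟨t, ht⟩ := r.leaves_nonempty
      apply (hv s hs t ht).1
      rw [hc s (by simp [BT.leaves, hs]) _ hcon, hc t (by simp [BT.leaves, ht]) _ hcon]
    obtain ⟨l1, l2⟩ := hl Gl (fun s hs => hc s (by simp [BT.leaves, hs]))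
    obtain ⟨r1, r2⟩ := hr Gr (fun s hs => hc s (by simp [BT.leaves, hs]))
    have hx : (PowerSeries.C (es E (BT.node v' l r).leaves) : PowerSeries R)
        = PowerSeries.C (es E l.leaves) + PowerSeries.C (es E r.leaves) := by
      rw [BT.leaves, es_union E hd, map_add]
    have ha := aSer_cor hE k v' l.leaves r.leaves Z
    have fa := aSer_Fil E k v' l.leaves r.leaves Z
    have fb := Fil_mono (show v + 1 ≤ v' + 1 by omega) (bSer_Fil E k v' l.leaves r.leaves Z)
    have hs := sSer_comm c v (aSer E k v' l.leaves r.leaves Z)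
    rw [hnode, hx]
    generalize aSer E k v' l.leaves r.leaves Z = a at *
    generalize bSer E k v' l.leaves r.leaves Z = b at *
    generalize Phi E κ k Z l = P at *
    generalize Phi E κ k Z r = Q at *
    set s := sSer R c v with hsdef
    set x := PowerSeries.C (es E l.leaves) with hxd
    set x' := PowerSeries.C (es E r.leaves) with hx'd
    have key : P - b * a + (Q + a * b) + b + (a * P - Q * a - a * b * a) - s * (x + x')
        = (P - s * x) + (Q - s * x') +
          (b - b * a + a * b + (a * (P - s * x) - (Q - s * x') * a) - a * b * a) := by
      have h1 : a * (s * x) = s * a := by rw [← mul_assoc, ← hs, mul_assoc, ha.2]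
      have h2 : s * x' * a = s * a := by rw [mul_assoc, ha.1]
      have : a * (P - s * x) - (Q - s * x') * a = a * P - Q * a := by
        rw [mul_sub, sub_mul, h1, h2]; abel
      rw [this]; noncomm_ring
    have hF : (b - b * a + a * b + (a * (P - s * x) - (Q - s * x') * a) - a * b * a) ∈ Fil (v + 1) := by
      refine sub_mem (add_mem (add_mem (sub_mem fb (Fil_mul_right _ fb)) (Fil_mul_left _ fb))
        (sub_mem (Fil_mul' fa l1 (by omega)) (Fil_mul' r1 fa (by omega)))) 
        (Fil_mul_right _ (Fil_mul_left _ fb))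
    rw [key]
    refine ⟨add_mem (add_mem l1 r1) (Fil_mono (by omega) hF), ?_⟩
    rw [map_add, map_add, hF v (by omega), l2, r2, add_zero, BT.leaves, Finset.sum_union hd]

theorem coeff_bSer_mul_aSer {E : J → R} (hE : OI E) {k v : ℕ} (hk : v + 2 ≤ k) (l r : Finset J)
    (Z : ℕ → R) :
    PowerSeries.coeff (k - 1) (bSer E k v l r Z * aSer E k v l r Z)
      = ∑ m ∈ Finset.range (k - 2 - v), es E l * Z m * es E r * Z m * es E l := by
  rw [PowerSeries.coeff_mul]
  symm
  apply Finset.sum_of_injOn (fun m => (k - 2 - m, m + 1))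
  · intro a _ b _ h; simpa using (Prod.ext_iff.mp h).2
  · intro m hm
    have : m < k - 2 - v := by simpa using hm
    simp; omega
  · rintro ⟨x, y⟩ hxy hn
    have hxy' : x + y = k - 1 := by simpa using hxy
    simp only [aSer, bSer, PowerSeries.coeff_mk]
    by_cases h1 : v + 1 ≤ x ∧ x + 2 ≤ k
    · exfalso; apply hn
      refine ⟨y - 1, ?_, ?_⟩
      · simp; omega
      · ext <;> simp <;> omega
    · rw [if_neg h1, zero_mul]
  · intro m hm
    have : m < k - 2 - v := by simpa using hm
    simp only [aSer, bSer, PowerSeries.coeff_mk]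
    rw [if_pos (by omega), if_pos (by omega), show k - 2 - (k - 2 - m) = m by omega,
      Nat.add_sub_cancel]
    have := hE.es_es r
    simp only [mul_assoc]
    rw [← mul_assoc (es E r) (es E r), this]

theorem coeff_aSer_mul_bSer {E : J → R} (hE : OI E) {k v : ℕ} (hk : v + 2 ≤ k) (l r : Finset J)
    (Z : ℕ → R) :
    PowerSeries.coeff (k - 1) (aSer E k v l r Z * bSer E k v l r Z)
      = ∑ m ∈ Finset.range (k - 2 - v), es E r * Z m * es E l * Z m * es E r := by
  rw [PowerSeries.coeff_mul]
  symm
  apply Finset.sum_of_injOn (fun m => (m + 1, k - 2 - m))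
  · intro a _ b _ h; simpa using (Prod.ext_iff.mp h).1
  · intro m hm
    have : m < k - 2 - v := by simpa using hm
    simp; omega
  · rintro ⟨y, x⟩ hxy hn
    have hxy' : y + x = k - 1 := by simpa using hxy
    simp only [aSer, bSer, PowerSeries.coeff_mk]
    by_cases h1 : v + 1 ≤ x ∧ x + 2 ≤ k
    · exfalso; apply hn
      refine ⟨y - 1, ?_, ?_⟩
      · simp; omega
      · ext <;> simp <;> omega
    · rw [if_neg h1, mul_zero]
  · intro m hm
    have : m < k - 2 - v := by simpa using hm
    simp only [aSer, bSer, PowerSeries.coeff_mk]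
    rw [if_pos (by omega), if_pos (by omega), show k - 2 - (k - 2 - m) = m by omega,
      Nat.add_sub_cancel]
    have := hE.es_es l
    simp only [mul_assoc]
    rw [← mul_assoc (es E l) (es E l), this]

open Classical in
/-- The diagonal blocks of the residue of the parametrization. -/
theorem Phi_moment {E : J → R} (hE : OI E) {κ : J → ℕ → ℂ} {k : ℕ} {D : J → J → ℕ} (Z : ℕ → R)
    (t : BT J) (hG : t.Good κ k D) (j : J) (hj : j ∈ t.leaves) :
    E j * PowerSeries.coeff (k - 1) (Phi E κ k Z t) * E j = κ j (k - 1) • E j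
      + ∑ s ∈ t.leaves, ∑ m ∈ Finset.range (D s j),
        ((if t.left s j then (1 : ℂ) else 0) - (if t.left j s then 1 else 0)) •
          (E j * Z m * E s * Z m * E j) := by
  induction t with
  | leaf i =>
    simp only [BT.leaves, Finset.mem_singleton] at hj
    subst hj
    have h2 : E j * E j = E j := by rw [hE, if_pos rfl]
    simp [Phi, BT.left, h2]
  | node v l r hl hr =>
    have hnode := Phi_node hE Z v l r hG
    obtain ⟨hk, hd, -, -, hv, Gl, Gr⟩ := hG
    have ha := aSer_cor hE k v l.leaves r.leaves Z
    have hb := bSer_cor hE k v l.leaves r.leaves Z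
    have hP := Phi_cor hE Z l Gl
    have hQ := Phi_cor hE Z r Gr
    have dj : ∀ x, x ∈ l.leaves → x ∈ r.leaves → False := fun x h1 h2 =>
      Finset.disjoint_left.mp hd h1 h2
    have blk : ∀ f : PowerSeries R, E j * PowerSeries.coeff (k - 1) f * E j
        = PowerSeries.coeff (k - 1) (PowerSeries.C (E j) * f * PowerSeries.C (E j)) := by
      intro f; rw [coeff_mul_C', coeff_C_mul']
    have hsum : (BT.node v l r).leaves = l.leaves ∪ r.leaves := rfl
    rw [hsum, Finset.sum_union hd]
    rw [hsum, Finset.mem_union] at hj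
    rcases hj with hj | hj
    · have hjr : j ∉ r.leaves := fun h => dj j hj h
      have z1 : (PowerSeries.C (E j) * PowerSeries.C (es E r.leaves) : PowerSeries R) = 0 := by
        rw [← map_mul, hE.mul_es_zero hjr, map_zero]
      have z2 : (PowerSeries.C (es E r.leaves) * PowerSeries.C (E j) : PowerSeries R) = 0 := by
        rw [← map_mul, hE.es_mul_zero hjr, map_zero]
      have e1 : PowerSeries.C (E j) * Phi E κ k Z (.node v l r) * PowerSeries.C (E j)
          = PowerSeries.C (E j) * (Phi E κ k Z l - bSer E k v l.leaves r.leaves Z * aSer E k v l.leaves r.leaves Z) * PowerSeries.C (E j) := by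
        rw [hnode]
        rw [mul_add, mul_add, mul_add, (hQ.add (ha.mul hb)).left_zero z1, add_zero, add_mul, add_mul,
          mul_assoc _ (bSer E k v l.leaves r.leaves Z), hb.right_zero z2, mul_zero, add_zero,
          (((ha.mul hP).sub (hQ.mul ha)).sub ((ha.mul hb).mul ha)).left_zero z1, zero_mul, add_zero]
      rw [blk, e1, ← blk, map_sub, mul_sub, sub_mul, hl Gl hj, coeff_bSer_mul_aSer hE hk, add_sub_assoc]
      congr 1
      rw [sub_eq_add_neg]
      congr 1
      · refine Finset.sum_congr rfl fun s hs => Finset.sum_congr rfl fun m _ => ?_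
        have h1 : (BT.node v l r).left s j ↔ l.left s j := by
          simp only [BT.left]
          refine ⟨?_, fun h => Or.inr (Or.inl h)⟩
          rintro (h | h | h)
          · exact (dj _ hj h.2).elim
          · exact h
          · exact (dj _ hj (r.left_mem h).2).elim
        have h2 : (BT.node v l r).left j s ↔ l.left j s := by
          simp only [BT.left]
          refine ⟨?_, fun h => Or.inr (Or.inl h)⟩
          rintro (h | h | h)
          · exact (dj _ hs h.2).elim
          · exact h
          · exact (dj _ hj (r.left_mem h).1).elim
        simp only [h1, h2]
      · have h1 : ∀ s ∈ r.leaves, ¬ (BT.node v l r).left s j := by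
          intro s hs h
          rcases h with h | h | h
          · exact dj _ h.1 hs
          · exact dj _ (l.left_mem h).1 hs
          · exact dj _ hj (r.left_mem h).2
        have h2 : ∀ s ∈ r.leaves, (BT.node v l r).left j s := fun s hs => Or.inl ⟨hj, hs⟩
        have e2 : ∑ s ∈ r.leaves, ∑ m ∈ Finset.range (D s j),
            ((if (BT.node v l r).left s j then (1 : ℂ) else 0)
              - (if (BT.node v l r).left j s then 1 else 0)) • (E j * Z m * E s * Z m * E j)
            = ∑ s ∈ r.leaves, ∑ m ∈ Finset.range (k - 2 - v),
              ((0 : ℂ) - 1) • (E j * Z m * E s * Z m * E j) :=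
          Finset.sum_congr rfl (fun s hs => by
            rw [if_neg (h1 s hs), if_pos (h2 s hs), (hv j hj s hs).2.2])
        rw [e2, Finset.sum_comm, Finset.mul_sum, Finset.sum_mul, ← Finset.sum_neg_distrib]
        refine Finset.sum_congr rfl fun m _ => ?_
        rw [← Finset.smul_sum, zero_sub, neg_smul, one_smul]
        congr 1
        rw [show E j * (es E l.leaves * Z m * es E r.leaves * Z m * es E l.leaves) * E j
          = (E j * es E l.leaves) * Z m * es E r.leaves * Z m * (es E l.leaves * E j) by
            simp only [mul_assoc], hE.mul_es hj, hE.es_mul hj, es, Finset.mul_sum, Finset.sum_mul,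
            Finset.sum_mul]
    · have hjl : j ∉ l.leaves := fun h => dj j h hj
      have z1 : (PowerSeries.C (E j) * PowerSeries.C (es E l.leaves) : PowerSeries R) = 0 := by
        rw [← map_mul, hE.mul_es_zero hjl, map_zero]
      have z2 : (PowerSeries.C (es E l.leaves) * PowerSeries.C (E j) : PowerSeries R) = 0 := by
        rw [← map_mul, hE.es_mul_zero hjl, map_zero]
      have e1 : PowerSeries.C (E j) * Phi E κ k Z (.node v l r) * PowerSeries.C (E j)
          = PowerSeries.C (E j) * (Phi E κ k Z r + aSer E k v l.leaves r.leaves Z * bSer E k v l.leaves r.leaves Z) * PowerSeries.C (E j) := by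
        rw [hnode]
        rw [mul_add, mul_add, mul_add, (hP.sub (hb.mul ha)).left_zero z1, zero_add,
          hb.left_zero z1, add_zero, add_mul, mul_assoc _ (_ - _ - _),
          (((ha.mul hP).sub (hQ.mul ha)).sub ((ha.mul hb).mul ha)).right_zero z2, mul_zero, add_zero]
      rw [blk, e1, ← blk, map_add, mul_add, add_mul, hr Gr hj, coeff_aSer_mul_bSer hE hk, add_assoc]
      congr 1
      rw [add_comm]
      congr 1
      · have h1 : ∀ s ∈ l.leaves, ¬ (BT.node v l r).left j s := by
          intro s hs h
          rcases h with h | h | h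
          · exact dj _ h.1 hj
          · exact dj _ (l.left_mem h).1 hj
          · exact dj _ hs (r.left_mem h).2
        have h2 : ∀ s ∈ l.leaves, (BT.node v l r).left s j := fun s hs => Or.inl ⟨hs, hj⟩
        have e2 : ∑ s ∈ l.leaves, ∑ m ∈ Finset.range (D s j),
            ((if (BT.node v l r).left s j then (1 : ℂ) else 0)
              - (if (BT.node v l r).left j s then 1 else 0)) • (E j * Z m * E s * Z m * E j)
            = ∑ s ∈ l.leaves, ∑ m ∈ Finset.range (k - 2 - v),
              ((1 : ℂ) - 0) • (E j * Z m * E s * Z m * E j) :=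
          Finset.sum_congr rfl (fun s hs => by
            rw [if_neg (h1 s hs), if_pos (h2 s hs), (hv s hs j hj).2.1])
        rw [e2, Finset.sum_comm, Finset.mul_sum, Finset.sum_mul]
        refine Finset.sum_congr rfl fun m _ => ?_
        rw [← Finset.smul_sum, sub_zero, one_smul]
        rw [show E j * (es E r.leaves * Z m * es E l.leaves * Z m * es E r.leaves) * E j
          = (E j * es E r.leaves) * Z m * es E l.leaves * Z m * (es E r.leaves * E j) by
            simp only [mul_assoc], hE.mul_es hj, hE.es_mul hj, es, Finset.mul_sum, Finset.sum_mul,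
            Finset.sum_mul]
      · refine Finset.sum_congr rfl fun s hs => Finset.sum_congr rfl fun m _ => ?_
        have h1 : (BT.node v l r).left s j ↔ r.left s j := by
          simp only [BT.left]
          refine ⟨?_, fun h => Or.inr (Or.inr h)⟩
          rintro (h | h | h)
          · exact (dj _ h.1 hs).elim
          · exact (dj _ (l.left_mem h).2 hj).elim
          · exact h
        have h2 : (BT.node v l r).left j s ↔ r.left j s := by
          simp only [BT.left]
          refine ⟨?_, fun h => Or.inr (Or.inr h)⟩
          rintro (h | h | h)
          · exact (dj _ h.1 hj).elim
          · exact (dj _ (l.left_mem h).2 hs).elim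
          · exact h
        simp only [h1, h2]

end PhiSec
end

noncomputable section
section OrbSec
variable {R : Type*} [Ring R] [Algebra ℂ R] {J : Type} [DecidableEq J]

/-- Series supported in degree `≥ k-1` with vanishing diagonal blocks in degree `k-1`. -/
def Nz (E : J → R) (k : ℕ) : AddSubgroup (PowerSeries R) where
  carrier := {f | f ∈ Fil (k - 1) ∧ ∀ j, E j * PowerSeries.coeff (k - 1) f * E j = 0}
  add_mem' := by
    rintro f g ⟨hf, hf'⟩ ⟨hg, hg'⟩
    refine ⟨add_mem hf hg, fun j => ?_⟩
    rw [map_add, mul_add, add_mul, hf', hg', add_zero]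
  zero_mem' := ⟨zero_mem _, fun j => by simp⟩
  neg_mem' := by
    rintro f ⟨hf, hf'⟩
    refine ⟨neg_mem hf, fun j => ?_⟩
    rw [map_neg, mul_neg, neg_mul, hf', neg_zero]

theorem mem_Nz {E : J → R} {k : ℕ} {f : PowerSeries R} :
    f ∈ Nz E k ↔ f ∈ Fil (k - 1) ∧ ∀ j, E j * PowerSeries.coeff (k - 1) f * E j = 0 := Iff.rfl

theorem Nz_of_Fil {E : J → R} {k : ℕ} (hk : 0 < k) {f : PowerSeries R} (hf : f ∈ Fil k) :
    f ∈ Nz E k := by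
  refine ⟨Fil_mono (by omega) hf, fun j => ?_⟩
  rw [hf (k - 1) (by omega)]; simp

theorem Nz_of_cor {E : J → R} (hE : OI E) {k : ℕ} {s t : Finset J} (hd : Disjoint s t)
    {f : PowerSeries R} (hf : f ∈ Fil (k - 1))
    (hc : Cor (PowerSeries.C (es E s)) (PowerSeries.C (es E t)) f) :
    f ∈ Nz E k := by
  refine ⟨hf, fun j => ?_⟩
  by_cases hj : j ∈ s
  · rw [← hc.2, coeff_mul_C', mul_assoc, mul_assoc,
      hE.es_mul_zero (Finset.disjoint_left.mp hd hj), mul_zero, mul_zero]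
  · rw [← hc.1, coeff_C_mul', ← mul_assoc, hE.mul_es_zero hj, zero_mul, zero_mul]

theorem Nz_conj {E : J → R} {k : ℕ} (hk : 0 < k) {f a b : PowerSeries R} (hf : f ∈ Nz E k)
    (ha : a ∈ Fil 1) (hb : b ∈ Fil 1) :
    (1 + a) * f * (1 + b) ∈ Nz E k := by
  have : (1 + a) * f * (1 + b) = f + (a * f + (f * b + a * (f * b))) := by noncomm_ring
  rw [this]
  refine add_mem hf (Nz_of_Fil hk (add_mem (Fil_mul' ha hf.1 (by omega)) ?_))
  have h1 : f * b ∈ Fil k := Fil_mul' hf.1 hb (by omega)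
  exact add_mem h1 (Fil_mul_left _ h1)

theorem Nz_block {E : J → R} (hE : OI E) {k : ℕ} {f : PowerSeries R} (hf : f ∈ Nz E k)
    (s : Finset J) : PowerSeries.C (es E s) * f * PowerSeries.C (es E s) ∈ Nz E k := by
  refine ⟨Fil_mul_right _ (Fil_mul_left _ hf.1), fun j => ?_⟩
  rw [coeff_mul_C', coeff_C_mul']
  by_cases hj : j ∈ s
  · rw [show E j * (es E s * PowerSeries.coeff (k - 1) f * es E s) * E j
      = (E j * es E s) * PowerSeries.coeff (k - 1) f * (es E s * E j) by simp only [mul_assoc],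
      hE.mul_es hj, hE.es_mul hj, hf.2]
  · rw [← mul_assoc, ← mul_assoc, hE.mul_es_zero hj]; simp

/-- The normal form (without residue). -/
def Bser (E : J → R) (κ : J → ℕ → ℂ) (s : Finset J) : PowerSeries R :=
  PowerSeries.mk fun m => ∑ j ∈ s, κ j m • E j

theorem Bser_union (E : J → R) (κ : J → ℕ → ℂ) {s t : Finset J} (h : Disjoint s t) :
    Bser E κ (s ∪ t) = Bser E κ s + Bser E κ t := by
  ext m; simp [Bser, Finset.sum_union h]

theorem Bser_cor {E : J → R} (hE : OI E) (κ : J → ℕ → ℂ) (s : Finset J) :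
    Cor (PowerSeries.C (es E s)) (PowerSeries.C (es E s)) (Bser E κ s) := by
  constructor
  · ext m
    rw [coeff_C_mul', Bser, PowerSeries.coeff_mk, Finset.mul_sum]
    exact Finset.sum_congr rfl fun j hj => by rw [mul_smul_comm, hE.es_mul hj]
  · ext m
    rw [coeff_mul_C', Bser, PowerSeries.coeff_mk, Finset.sum_mul]
    exact Finset.sum_congr rfl fun j hj => by rw [smul_mul_assoc, hE.mul_es hj]

theorem cor_one_add_mul {A : Type*} [Ring A] {x u w : A} (hu : Cor x x u) (hw : Cor x x w) :
    Cor x x ((1 + u) * (1 + w) - 1) := by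
  have : (1 + u) * (1 + w) - 1 = u + w + u * w := by noncomm_ring
  rw [this]; exact (hu.add hw).add (hu.mul hw)

theorem fil_one_add_mul {u w : PowerSeries R} (hu : u ∈ Fil 1) (hw : w ∈ Fil 1) :
    (1 + u) * (1 + w) - 1 ∈ Fil 1 := by
  have : (1 + u) * (1 + w) - 1 = u + w + u * w := by noncomm_ring
  rw [this]; exact add_mem (add_mem hu hw) (Fil_mul_right _ hu)

theorem Fil_of_mul_unit {k : ℕ} {f g h : PowerSeries R} (hgh : g * h = 1) (hf : f * g ∈ Fil k) :
    f ∈ Fil k := by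
  have : f = f * g * h := by rw [mul_assoc, hgh, mul_one]
  rw [this]; exact Fil_mul_right _ hf

/-- commuting `b' = c'A₂ - A₁c'` past `1+c'`. -/
theorem conj_c {A : Type*} [Ring A] {x x' A1 A2 c : A} (hxx' : x * x' = 0)
    (hx'x : x' * x = 0) (h1 : Cor x x A1) (h2 : Cor x' x' A2) (hc : Cor x x' c) :
    (1 + c) * (A1 + A2) = (A1 + A2 + (c * A2 - A1 * c)) * (1 + c) := by
  have e1 : c * A1 = 0 := hc.mul_zero' h1 hx'x
  have e2 : A2 * c = 0 := h2.mul_zero' hc hx'x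
  have e3 : (c * A2 - A1 * c) * c = 0 := ((hc.mul h2).sub (h1.mul hc)).mul_zero' hc hx'x
  have : (A1 + A2 + (c * A2 - A1 * c)) * (1 + c)
    = A1 + A2 + c * A2 + A2 * c + (c * A2 - A1 * c) * c := by noncomm_ring
  rw [this, e2, e3]
  have : (1 + c) * (A1 + A2) = A1 + A2 + c * A2 + c * A1 := by noncomm_ring
  rw [this, e1]; simp

theorem lower_sq {A : Type*} [Ring A] {x x' a : A} (hxx' : x * x' = 0) (ha : Cor x' x a) :
    (1 - a) * (1 + a) = 1 ∧ (1 + a) * (1 - a) = 1 := by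
  have e : a * a = 0 := ha.mul_zero' ha hxx'
  constructor
  · have : (1 - a) * (1 + a) = 1 - a * a := by noncomm_ring
    rw [this, e, sub_zero]
  · have : (1 + a) * (1 - a) = 1 - a * a := by noncomm_ring
    rw [this, e, sub_zero]

/-- conjugating by the tail of the lower unipotent part. -/
theorem conj_tail {k v : ℕ} (hk : v + 2 ≤ k) {x x' A1 A2 b a : PowerSeries R} (hxx' : x * x' = 0)
    (hx'x : x' * x = 0) (h1 : Cor x x A1) (h2 : Cor x' x' A2) (hb : Cor x x' b) (ha : Cor x' x a)
    (fb : b ∈ Fil (v + 1)) (fa : a ∈ Fil (k - 1 - v)) :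
    (1 + a) * (A1 + A2 + b) * (1 - a) - (A1 + A2 + b + (a * A1 - A2 * a)) ∈ Fil k := by
  rw [conj_expand hxx' hx'x h1 h2 ha hb]
  have : A1 - b * a + (A2 + a * b) + b + (a * A1 - A2 * a - a * b * a)
    - (A1 + A2 + b + (a * A1 - A2 * a)) = a * b - b * a - a * b * a := by abel
  rw [this]
  have q1 : a * b ∈ Fil k := Fil_mul' fa fb (by omega)
  have q2 : b * a ∈ Fil k := Fil_mul' fb fa (by omega)
  exact sub_mem (sub_mem q1 q2) (Fil_mul_right _ q1)

theorem sol_left {E : J → R} (hE : OI E) (l r : Finset J) (κv : J → ℂ) (c : ℂ)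
    (hl : ∀ s ∈ l, κv s = c) (hr : ∀ s ∈ r, c ≠ κv s) (z : R) (hz : Cor (es E l) (es E r) z) :
    ∃ w, Cor (es E l) (es E r) w ∧
      w * (∑ j ∈ r, κv j • E j) - (∑ j ∈ l, κv j • E j) * w = z := by
  have hCl : (∑ j ∈ l, κv j • E j) = c • es E l := by
    rw [es, Finset.smul_sum]; exact Finset.sum_congr rfl fun j hj => by rw [hl j hj]
  set U := ∑ j ∈ r, (κv j - c)⁻¹ • E j with hU
  have hU1 : U * es E r = U := by
    rw [hU, Finset.sum_mul]
    exact Finset.sum_congr rfl fun j hj => by rw [smul_mul_assoc, hE.mul_es hj]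
  have hU2 : U * (∑ j ∈ r, κv j • E j) - c • U = es E r := by
    have : U * (∑ j ∈ r, κv j • E j) = ∑ j ∈ r, ((κv j - c)⁻¹ * κv j) • E j := by
      rw [hU, Finset.sum_mul]
      refine Finset.sum_congr rfl fun j hj => ?_
      rw [Finset.mul_sum, Finset.sum_eq_single j]
      · rw [smul_mul_smul_comm, hE, if_pos rfl]
      · intro i _ hi; rw [smul_mul_smul_comm, hE, if_neg hi.symm, smul_zero]
      · intro h; exact absurd hj h
    rw [this, hU, Finset.smul_sum, ← Finset.sum_sub_distrib, es]
    refine Finset.sum_congr rfl fun j hj => ?_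
    rw [smul_smul, ← sub_smul]
    have : κv j - c ≠ 0 := sub_ne_zero.mpr (hr j hj).symm
    rw [show (κv j - c)⁻¹ * κv j - c * (κv j - c)⁻¹ = 1 by field_simp, one_smul]
  refine ⟨z * U, ⟨by rw [← mul_assoc, hz.1], by rw [mul_assoc, hU1]⟩, ?_⟩
  rw [hCl, smul_mul_assoc, ← mul_assoc (es E l), hz.1, mul_assoc, ← mul_smul_comm, ← mul_sub, hU2, hz.2]

theorem sol_right {E : J → R} (hE : OI E) (l r : Finset J) (κv : J → ℂ) (c : ℂ)
    (hl : ∀ s ∈ l, κv s = c) (hr : ∀ s ∈ r, c ≠ κv s) (z : R) (hz : Cor (es E r) (es E l) z) :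
    ∃ w, Cor (es E r) (es E l) w ∧
      w * (∑ j ∈ l, κv j • E j) - (∑ j ∈ r, κv j • E j) * w = z := by
  have hCl : (∑ j ∈ l, κv j • E j) = c • es E l := by
    rw [es, Finset.smul_sum]; exact Finset.sum_congr rfl fun j hj => by rw [hl j hj]
  set U := ∑ j ∈ r, (c - κv j)⁻¹ • E j with hU
  have hU1 : es E r * U = U := by
    rw [hU, Finset.mul_sum]
    exact Finset.sum_congr rfl fun j hj => by rw [mul_smul_comm, hE.es_mul hj]
  have hU2 : c • U - (∑ j ∈ r, κv j • E j) * U = es E r := by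
    have : (∑ j ∈ r, κv j • E j) * U = ∑ j ∈ r, (κv j * (c - κv j)⁻¹) • E j := by
      rw [hU, Finset.sum_mul]
      refine Finset.sum_congr rfl fun j hj => ?_
      rw [Finset.mul_sum, Finset.sum_eq_single j]
      · rw [smul_mul_smul_comm, hE, if_pos rfl]
      · intro i _ hi; rw [smul_mul_smul_comm, hE, if_neg hi.symm, smul_zero]
      · intro h; exact absurd hj h
    rw [this, hU, Finset.smul_sum, ← Finset.sum_sub_distrib, es]
    refine Finset.sum_congr rfl fun j hj => ?_
    rw [smul_smul, ← sub_smul]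
    have : c - κv j ≠ 0 := sub_ne_zero.mpr (hr j hj)
    rw [show c * (c - κv j)⁻¹ - κv j * (c - κv j)⁻¹ = 1 by field_simp, one_smul]
  refine ⟨U * z, ⟨by rw [← mul_assoc, hU1], by rw [mul_assoc, hz.2]⟩, ?_⟩
  rw [hCl, mul_smul_comm, mul_assoc, hz.2, ← mul_assoc, ← smul_mul_assoc, ← sub_mul, hU2, hz.1]

/-- Orbit theorem, first direction. -/
theorem orbit_forward {E : J → R} (hE : OI E) {κ : J → ℕ → ℂ} {k : ℕ} (hk0 : 0 < k) {D : J → J → ℕ}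
    (t : BT J) (hG : t.Good κ k D) (A y : PowerSeries R)
    (hA : Cor (PowerSeries.C (es E t.leaves)) (PowerSeries.C (es E t.leaves)) A)
    (hy : Cor (PowerSeries.C (es E t.leaves)) (PowerSeries.C (es E t.leaves)) y)
    (fy : y ∈ Fil 1) (h : (1 + y) * Bser E κ t.leaves - A * (1 + y) ∈ Fil k) :
    ∃ Z : ℕ → R, A - Phi E κ k Z t ∈ Nz E k := by
  induction t generalizing A y with
  | leaf j =>
    refine ⟨0, Nz_of_Fil hk0 ?_⟩
    obtain ⟨w, -, -, h1, -⟩ := exists_inv_corner (C_idem hE _) hy fy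
    have hc : (1 + y) * Bser E κ (BT.leaf j).leaves = Phi E κ k 0 (.leaf j) * (1 + y) := by
      have e : Bser E κ (BT.leaf j).leaves = Phi E κ k 0 (.leaf j) := by
        ext m; simp [Bser, Phi, BT.leaves]
      rw [e]
      have he : es E (BT.leaf j).leaves = E j := by simp [es, BT.leaves]
      rw [he] at hy
      have e2 : Phi E κ k (0 : ℕ → R) (.leaf j)
          = sSer R (κ j) 0 + (PowerSeries.mk fun m => algebraMap ℂ R (κ j m)) * PowerSeries.C (E j) := by
        ext m; simp [Phi, sSer, Algebra.smul_def]
      have hcen : ∀ f : PowerSeries R, (PowerSeries.mk fun m => algebraMap ℂ R (κ j m)) * f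
          = f * (PowerSeries.mk fun m => algebraMap ℂ R (κ j m)) := by
        intro f
        ext m
        rw [PowerSeries.coeff_mul, PowerSeries.coeff_mul, ← Finset.Nat.sum_antidiagonal_swap]
        refine Finset.sum_congr rfl fun x _ => ?_
        simp only [PowerSeries.coeff_mk, Prod.fst_swap, Prod.snd_swap]
        exact Algebra.commutes _ _
      have e3 : sSer R (κ j) 0 = 0 := by ext m; simp [sSer]
      rw [e2, e3, zero_add]
      rw [mul_assoc, mul_add, hy.1, ← mul_assoc, ← hcen, mul_assoc, add_mul, hy.2, one_mul, mul_one]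
    rw [hc, ← sub_mul] at h
    have := Fil_of_mul_unit h1 h
    rw [← neg_sub]; exact neg_mem this
  | node v l r hl hr =>
    have hGn := hG
    obtain ⟨hk, hd, hagree, hlv, hv, Gl, Gr⟩ := hG
    have hx : (PowerSeries.C (es E (BT.node v l r).leaves) : PowerSeries R)
        = PowerSeries.C (es E l.leaves) + PowerSeries.C (es E r.leaves) := by
      rw [BT.leaves, es_union E hd, map_add]
    have o1 := C_orth hE hd
    have o2 := C_orth hE hd.symm
    have i1 := C_idem hE l.leaves
    have i2 := C_idem hE r.leaves
    obtain ⟨wy, -, -, hginv, -⟩ := exists_inv_corner (C_idem hE _) hy fy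
    rw [hx] at hy
    obtain ⟨a', c', z1, z2, ca, cc, cz1, cz2, fa, fc, fz1, fz2, hg⟩ := gauss i1 i2 o1 o2 hy fy
    obtain ⟨w1, cw1, fw1, hw1, hw1'⟩ := exists_inv_corner i1 cz1 fz1
    obtain ⟨w2, cw2, fw2, hw2, hw2'⟩ := exists_inv_corner i2 cz2 fz2
    have hB : Bser E κ (BT.node v l r).leaves = Bser E κ l.leaves + Bser E κ r.leaves :=
      Bser_union E κ hd
    have cB1 := Bser_cor hE κ l.leaves
    have cB2 := Bser_cor hE κ r.leaves
    rw [hB] at h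
    generalize Bser E κ l.leaves = B1 at *
    generalize Bser E κ r.leaves = B2 at *
    set x := PowerSeries.C (es E l.leaves) with hxdef
    set x' := PowerSeries.C (es E r.leaves) with hx'def
    have cA1 : Cor x x ((1 + z1) * B1 * (1 + w1)) := by
      have : (1 + z1) * B1 * (1 + w1) = B1 + B1 * w1 + (z1 * B1 + z1 * B1 * w1) := by noncomm_ring
      rw [this]; exact (cB1.add (cB1.mul cw1)).add ((cz1.mul cB1).add ((cz1.mul cB1).mul cw1))
    have cA2 : Cor x' x' ((1 + z2) * B2 * (1 + w2)) := by
      have : (1 + z2) * B2 * (1 + w2) = B2 + B2 * w2 + (z2 * B2 + z2 * B2 * w2) := by noncomm_ring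
      rw [this]; exact (cB2.add (cB2.mul cw2)).add ((cz2.mul cB2).add ((cz2.mul cB2).mul cw2))
    have hA1 : (1 + z1) * B1 = ((1 + z1) * B1 * (1 + w1)) * (1 + z1) := by
      rw [mul_assoc _ (1 + w1), hw1', mul_one]
    have hA2 : (1 + z2) * B2 = ((1 + z2) * B2 * (1 + w2)) * (1 + z2) := by
      rw [mul_assoc _ (1 + w2), hw2', mul_one]
    generalize (1 + z1) * B1 * (1 + w1) = A1 at *
    generalize (1 + z2) * B2 * (1 + w2) = A2 at *
    obtain ⟨Z1, hZ1⟩ := hl Gl A1 z1 cA1 cz1 fz1 (by rw [hA1, sub_self]; exact zero_mem _)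
    obtain ⟨Z2, hZ2⟩ := hr Gr A2 z2 cA2 cz2 fz2 (by rw [hA2, sub_self]; exact zero_mem _)
    obtain ⟨j0, hj0⟩ := l.leaves_nonempty
    have lead1 := (Phi_leading hE Z1 l Gl (κ j0) v (fun s hs m hm => hagree s (by simp [hs]) j0 (by simp [hj0]) m hm)).1
    have lead2 := (Phi_leading hE Z2 r Gr (κ j0) v (fun s hs m hm => hagree s (by simp [hs]) j0 (by simp [hj0]) m hm)).1
    rw [← hxdef] at lead1
    rw [← hx'def] at lead2
    have hs := fun f => sSer_comm (R := R) (κ j0) v f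
    generalize sSer R (κ j0) v = s at *
    have fA1 : A1 - s * x ∈ Fil v := by
      have := add_mem (Fil_mono (show v ≤ k - 1 by omega) hZ1.1) lead1
      rwa [sub_add_sub_cancel] at this
    have fA2 : A2 - s * x' ∈ Fil v := by
      have := add_mem (Fil_mono (show v ≤ k - 1 by omega) hZ2.1) lead2
      rwa [sub_add_sub_cancel] at this
    set b' := c' * A2 - A1 * c' with hb'
    have cb : Cor x x' b' := (cc.mul cA2).sub (cA1.mul cc)
    have fb : b' ∈ Fil (v + 1) := by
      have : b' = c' * (A2 - s * x') - (A1 - s * x) * c' := by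
        have h1 : c' * (s * x') = s * c' := by rw [← mul_assoc, ← hs, mul_assoc, cc.2]
        have h2 : s * x * c' = s * c' := by rw [mul_assoc, cc.1]
        rw [mul_sub, sub_mul, h1, h2, hb']; abel
      rw [this]; exact sub_mem (Fil_mul' fc fA2 (by omega)) (Fil_mul' fA1 fc (by omega))
    -- the total relation
    have hgB : (1 + y) * (B1 + B2) = ((1 + a') * (A1 + A2 + b') * (1 - a')) * (1 + y) := by
      have s1 : (1 + z1 + z2) * (B1 + B2) = (A1 + A2) * (1 + z1 + z2) := by
        have t1 : z2 * B1 = 0 := cz2.mul_zero' cB1 o2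
        have t2 : z1 * B2 = 0 := cz1.mul_zero' cB2 o1
        have t3 : A1 * z2 = 0 := cA1.mul_zero' cz2 o1
        have t4 : A2 * z1 = 0 := cA2.mul_zero' cz1 o2
        have : (1 + z1 + z2) * (B1 + B2) = (1 + z1) * B1 + (1 + z2) * B2 + z2 * B1 + z1 * B2 := by
          noncomm_ring
        rw [this, t1, t2, hA1, hA2]
        have : (A1 + A2) * (1 + z1 + z2) = A1 * (1 + z1) + A2 * (1 + z2) + A1 * z2 + A2 * z1 := by
          noncomm_ring
        rw [this, t3, t4]
      have s2 := conj_c o1 o2 cA1 cA2 cc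
      rw [← hb'] at s2
      rw [hg]
      calc (1 + a') * ((1 + c') * (1 + z1 + z2)) * (B1 + B2)
          = (1 + a') * (1 + c') * ((1 + z1 + z2) * (B1 + B2)) := by simp only [mul_assoc]
        _ = (1 + a') * ((1 + c') * (A1 + A2)) * (1 + z1 + z2) := by rw [s1]; simp only [mul_assoc]
        _ = (1 + a') * (A1 + A2 + b') * (1 + c') * (1 + z1 + z2) := by rw [s2]; simp only [mul_assoc]
        _ = (1 + a') * (A1 + A2 + b') * ((1 - a') * (1 + a')) * (1 + c') * (1 + z1 + z2) := by
            rw [(lower_sq o1 ca).1, mul_one]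
        _ = _ := by simp only [mul_assoc]
    rw [hgB, ← sub_mul] at h
    have hAA := Fil_of_mul_unit hginv h
    -- choose Z
    set Z : ℕ → R := fun m => es E l.leaves * Z1 m * es E l.leaves + es E r.leaves * Z2 m * es E r.leaves
      + es E l.leaves * PowerSeries.coeff (k - 2 - m) b' * es E r.leaves
      + es E r.leaves * PowerSeries.coeff (m + 1) a' * es E l.leaves with hZ
    have dj : ∀ x, x ∈ l.leaves → x ∉ r.leaves := fun x h1 h2 =>
      Finset.disjoint_left.mp hd h1 h2
    have dj' : ∀ x, x ∈ r.leaves → x ∉ l.leaves := fun x h1 h2 =>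
      Finset.disjoint_left.mp hd h2 h1
    have lr : es E l.leaves * es E r.leaves = 0 := hE.es_es_zero hd
    have rl : es E r.leaves * es E l.leaves = 0 := hE.es_es_zero hd.symm
    have ll := hE.es_es l.leaves
    have rr := hE.es_es r.leaves
    have eP1 : Phi E κ k Z l = Phi E κ k Z1 l := by
      refine Phi_congr _ _ l Gl ?_
      intro s hs t ht _ m _
      simp only [hZ, mul_add, add_mul, ← mul_assoc, hE.mul_es hs, hE.mul_es_zero (dj s hs), zero_mul,
        add_zero]
      simp only [mul_assoc, hE.es_mul ht, hE.es_mul_zero (dj t ht), mul_zero, add_zero]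
    have eP2 : Phi E κ k Z r = Phi E κ k Z2 r := by
      refine Phi_congr _ _ r Gr ?_
      intro s hs t ht _ m _
      simp only [hZ, mul_add, add_mul, ← mul_assoc, hE.mul_es hs, hE.mul_es_zero (dj' s hs), zero_mul,
        add_zero, zero_add]
      simp only [mul_assoc, hE.es_mul ht, hE.es_mul_zero (dj' t ht), mul_zero, add_zero]
    have coefa : ∀ m, es E r.leaves * PowerSeries.coeff m a' * es E l.leaves = PowerSeries.coeff m a' := by
      intro m; rw [← coeff_C_mul', ca.1, ← coeff_mul_C', ca.2]
    have coefb : ∀ m, es E l.leaves * PowerSeries.coeff m b' * es E r.leaves = PowerSeries.coeff m b' := by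
      intro m; rw [← coeff_C_mul', cb.1, ← coeff_mul_C', cb.2]
    have hZa : ∀ m, es E r.leaves * Z m * es E l.leaves = PowerSeries.coeff (m + 1) a' := by
      intro m
      simp only [hZ, mul_add, add_mul, ← mul_assoc, rr, rl, zero_mul, add_zero, zero_add]
      simp only [mul_assoc, ll, rl, mul_zero, zero_add]
      rw [← mul_assoc, coefa]
    have hZb : ∀ m, es E l.leaves * Z m * es E r.leaves = PowerSeries.coeff (k - 2 - m) b' := by
      intro m
      simp only [hZ, mul_add, add_mul, ← mul_assoc, ll, lr, zero_mul, add_zero, zero_add]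
      simp only [mul_assoc, rr, lr, mul_zero, zero_add, add_zero]
      rw [← mul_assoc, coefb]
    set a := aSer E k v l.leaves r.leaves Z with hadef
    set b := bSer E k v l.leaves r.leaves Z with hbdef
    have caS : Cor x' x a := aSer_cor hE k v l.leaves r.leaves Z
    have cbS : Cor x x' b := bSer_cor hE k v l.leaves r.leaves Z
    have faS : a ∈ Fil 1 := aSer_Fil E k v l.leaves r.leaves Z
    have fa'' : a' - a ∈ Fil (k - 1 - v) := by
      intro m hm
      rw [map_sub, hadef, aSer, PowerSeries.coeff_mk]
      by_cases h0 : m = 0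
      · subst h0; rw [fa 0 (by omega)]; simp
      · rw [if_pos (by omega), hZa, show m - 1 + 1 = m by omega, sub_self]
    have fb'' : b' - b ∈ Fil (k - 1) := by
      intro m hm
      rw [map_sub, hbdef, bSer, PowerSeries.coeff_mk]
      by_cases h0 : v + 1 ≤ m
      · rw [if_pos (by omega), hZb, show k - 2 - (k - 2 - m) = m by omega, sub_self]
      · rw [fb m (by omega), if_neg (by omega), sub_zero]
    refine ⟨Z, ?_⟩
    have hPhi : Phi E κ k Z (.node v l r) = (1 + a) * (Phi E κ k Z1 l + Phi E κ k Z2 r + b) * (1 - a) := by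
      rw [Phi, eP1, eP2]
    rw [hPhi]
    set a2 := a' - a with ha2
    have ca2 : Cor x' x a2 := ca.sub caS
    clear_value a2
    have tail := conj_tail hk o1 o2 cA1 cA2 cb ca2 fb fa''
    have t1 : a2 * A1 - A2 * a2 ∈ Nz E k := by
      refine Nz_of_cor hE hd.symm ?_ ((ca2.mul cA1).sub (cA2.mul ca2))
      have : a2 * A1 - A2 * a2 = a2 * (A1 - s * x) - (A2 - s * x') * a2 := by
        have h1 : a2 * (s * x) = s * a2 := by rw [← mul_assoc, ← hs, mul_assoc, ca2.2]
        have h2 : s * x' * a2 = s * a2 := by rw [mul_assoc, ca2.1]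
        rw [mul_sub, sub_mul, h1, h2]; abel
      rw [this]; exact sub_mem (Fil_mul' fa'' fA1 (by omega)) (Fil_mul' fA2 fa'' (by omega))
    have t2 : b' - b ∈ Nz E k := Nz_of_cor hE hd fb'' (cb.sub cbS)
    have t3 : (1 + a2) * (A1 + A2 + b') * (1 - a2) - (Phi E κ k Z1 l + Phi E κ k Z2 r + b) ∈ Nz E k := by
      have := add_mem (add_mem (add_mem (add_mem (Nz_of_Fil (E := E) hk0 tail) t1) t2) hZ1) hZ2
      convert this using 1; abel
    have hfac1 : (1 + a) * (1 + a2) = 1 + a' := by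
      have e : a * a2 = 0 := caS.mul_zero' ca2 o1
      have : (1 + a) * (1 + a2) = 1 + (a + a2) + a * a2 := by noncomm_ring
      rw [this, e, add_zero, ha2, add_sub_cancel]
    have hfac2 : (1 - a2) * (1 - a) = 1 - a' := by
      have e : a2 * a = 0 := ca2.mul_zero' caS o1
      have : (1 - a2) * (1 - a) = 1 - (a + a2) + a2 * a := by noncomm_ring
      rw [this, e, add_zero, ha2, add_sub_cancel]
    have t4 := Nz_conj hk0 t3 faS (neg_mem faS)
    have t5 : (1 + a) * ((1 + a2) * (A1 + A2 + b') * (1 - a2) - (Phi E κ k Z1 l + Phi E κ k Z2 r + b)) * (1 + -a)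
      = (1 + a') * (A1 + A2 + b') * (1 - a') - (1 + a) * (Phi E κ k Z1 l + Phi E κ k Z2 r + b) * (1 - a) := by
      rw [← sub_eq_add_neg, ← hfac1, ← hfac2]
      generalize (1 + a) = w1
      generalize (1 - a) = w2
      generalize (1 + a2) = w3
      generalize (1 - a2) = w4
      generalize (A1 + A2 + b') = w5
      rw [mul_sub, sub_mul]
      simp only [mul_assoc]
    rw [t5] at t4
    have t6 := sub_mem t4 (Nz_of_Fil (E := E) hk0 hAA)
    convert t6 using 1; abel

/-- Orbit theorem, second direction. -/
theorem orbit_backward {E : J → R} (hE : OI E) {κ : J → ℕ → ℂ} {k : ℕ} (hk0 : 0 < k) {D : J → J → ℕ}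
    (t : BT J) (hG : t.Good κ k D) (A : PowerSeries R) (Z : ℕ → R)
    (hA : Cor (PowerSeries.C (es E t.leaves)) (PowerSeries.C (es E t.leaves)) A)
    (h : A - Phi E κ k Z t ∈ Nz E k) :
    ∃ y, Cor (PowerSeries.C (es E t.leaves)) (PowerSeries.C (es E t.leaves)) y ∧
      y ∈ Fil 1 ∧ (1 + y) * Bser E κ t.leaves - A * (1 + y) ∈ Fil k := by
  induction t generalizing A with
  | leaf j =>
    refine ⟨0, ⟨by simp, by simp⟩, zero_mem _, ?_⟩
    have e : Bser E κ (BT.leaf j).leaves = Phi E κ k Z (.leaf j) := by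
      ext m; simp [Bser, Phi, BT.leaves]
    rw [add_zero, one_mul, mul_one, e, ← neg_sub]
    apply neg_mem
    have hc := hA.sub (Phi_cor hE Z (.leaf j) hG)
    have he : es E (BT.leaf j).leaves = E j := by simp [es, BT.leaves]
    rw [he] at hc
    have h2 := h.2 j
    rw [← coeff_C_mul', hc.1, ← coeff_mul_C', hc.2] at h2
    have := Fil_succ h.1 h2
    rwa [show k - 1 + 1 = k by omega] at this
  | node v l r hl hr =>
    have hGn := hG
    obtain ⟨hk, hd, hagree, hlv, hv, Gl, Gr⟩ := hG
    have hx : (PowerSeries.C (es E (BT.node v l r).leaves) : PowerSeries R)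
        = PowerSeries.C (es E l.leaves) + PowerSeries.C (es E r.leaves) := by
      rw [BT.leaves, es_union E hd, map_add]
    have o1 := C_orth hE hd
    have o2 := C_orth hE hd.symm
    have i1 := C_idem hE l.leaves
    have i2 := C_idem hE r.leaves
    have hB : Bser E κ (BT.node v l r).leaves = Bser E κ l.leaves + Bser E κ r.leaves :=
      Bser_union E κ hd
    have cB1 := Bser_cor hE κ l.leaves
    have cB2 := Bser_cor hE κ r.leaves
    rw [hB, hx]
    rw [hx] at hA
    rw [Phi] at h
    have cP1 := Phi_cor hE Z l Gl
    have cP2 := Phi_cor hE Z r Gr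
    have ca := aSer_cor hE k v l.leaves r.leaves Z
    have cb := bSer_cor hE k v l.leaves r.leaves Z
    have fa := aSer_Fil E k v l.leaves r.leaves Z
    have fb := bSer_Fil E k v l.leaves r.leaves Z
    obtain ⟨j0, hj0⟩ := l.leaves_nonempty
    obtain ⟨lead1, lc1⟩ := (Phi_leading hE Z l Gl (κ j0) v (fun s hs m hm => hagree s (by simp [hs]) j0 (by simp [hj0]) m hm))
    obtain ⟨lead2, lc2⟩ := (Phi_leading hE Z r Gr (κ j0) v (fun s hs m hm => hagree s (by simp [hs]) j0 (by simp [hj0]) m hm))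
    have hs := fun f => sSer_comm (R := R) (κ j0) v f
    have ihl := hl Gl
    have ihr := hr Gr
    have bl1 := fun (f : PowerSeries R) (hf : f ∈ Nz E k) => Nz_block hE hf l.leaves
    have bl2 := fun (f : PowerSeries R) (hf : f ∈ Nz E k) => Nz_block hE hf r.leaves
    have sl := sol_left hE l.leaves r.leaves (fun j => κ j v) (κ j0 v)
      (fun s hs => hlv s hs j0 hj0) (fun s hs => (hv j0 hj0 s hs).1)
    have sr := sol_right hE l.leaves r.leaves (fun j => κ j v) (κ j0 v)
      (fun s hs => hlv s hs j0 hj0) (fun s hs => (hv j0 hj0 s hs).1)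
    clear hl hr hGn hB hx hagree hlv hv
    generalize sSer R (κ j0) v = s at *
    generalize Bser E κ l.leaves = B1 at *
    generalize Bser E κ r.leaves = B2 at *
    generalize Phi E κ k Z l = P1 at *
    generalize Phi E κ k Z r = P2 at *
    generalize aSer E k v l.leaves r.leaves Z = a at *
    generalize bSer E k v l.leaves r.leaves Z = b at *
    generalize es E l.leaves = el at *
    generalize es E r.leaves = er at *
    set x := (PowerSeries.C el : PowerSeries R) with hxdef
    set x' := (PowerSeries.C er : PowerSeries R) with hx'def
    have e1 : (x + x') * x = x := by rw [add_mul, i1, o2, add_zero]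
    have e2 : (x + x') * x' = x' := by rw [add_mul, i2, o1, zero_add]
    have e3 : x * (x + x') = x := by rw [mul_add, i1, o1, add_zero]
    have e4 : x' * (x + x') = x' := by rw [mul_add, i2, o2, zero_add]
    obtain ⟨la, la'⟩ := lower_sq o1 ca
    set A' := (1 - a) * A * (1 + a) with hA'
    have hAA' : A * (1 + a) = (1 + a) * A' := by
      rw [hA', ← mul_assoc, ← mul_assoc, la', one_mul]
    have cA' : Cor (x + x') (x + x') A' := by
      have : A' = A + A * a - a * A - a * A * a := by rw [hA']; noncomm_ring
      have ca0 := ca.embed e2 e3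
      rw [this]
      exact ((hA.add (hA.mul ca0)).sub (ca0.mul hA)).sub ((ca0.mul hA).mul ca0)
    have hν : A' - (P1 + P2 + b) ∈ Nz E k := by
      have := Nz_conj hk0 h (neg_mem fa) fa
      convert this using 1
      rw [← sub_eq_add_neg, mul_sub, sub_mul, hA']
      have : (1 - a) * ((1 + a) * (P1 + P2 + b) * (1 - a)) * (1 + a) = P1 + P2 + b := by
        calc (1 - a) * ((1 + a) * (P1 + P2 + b) * (1 - a)) * (1 + a)
            = ((1 - a) * (1 + a)) * (P1 + P2 + b) * ((1 - a) * (1 + a)) := by simp only [mul_assoc]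
          _ = _ := by rw [la, one_mul, mul_one]
      rw [this]
    have cν : Cor (x + x') (x + x') (A' - (P1 + P2 + b)) :=
      cA'.sub (((cP1.embed e1 e3).add (cP2.embed e2 e4)).add (cb.embed e1 e4))
    set ν := A' - (P1 + P2 + b) with hνd
    have νsum : ν = x * ν * x + x * ν * x' + x' * ν * x + x' * ν * x' := by
      conv_lhs => rw [← cν.1, ← cν.2]
      noncomm_ring
    have n11 := bl1 ν hν
    have n22 := bl2 ν hν
    have c11 := Cor.of_mul i1 i1 ν
    have c22 := Cor.of_mul i2 i2 ν
    have c12 := Cor.of_mul i1 i2 ν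
    have c21 := Cor.of_mul i2 i1 ν
    have f12 : x * ν * x' ∈ Fil (k - 1) := Fil_mul_right _ (Fil_mul_left _ hν.1)
    have f21 : x' * ν * x ∈ Fil (k - 1) := Fil_mul_right _ (Fil_mul_left _ hν.1)
    generalize x * ν * x = ν11 at *
    generalize x * ν * x' = ν12 at *
    generalize x' * ν * x = ν21 at *
    generalize x' * ν * x' = ν22 at *
    obtain ⟨z1, cz1, fz1, hz1⟩ := ihl (P1 + ν11) (cP1.add c11) (by rwa [add_sub_cancel_left])
    obtain ⟨z2, cz2, fz2, hz2⟩ := ihr (P2 + ν22) (cP2.add c22) (by rwa [add_sub_cancel_left])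
    have cA1 := cP1.add c11
    have cA2 := cP2.add c22
    have fA1 : P1 + ν11 - s * x ∈ Fil v := by
      rw [add_sub_right_comm]
      exact add_mem lead1 (Fil_mono (by omega) n11.1)
    have fA2 : P2 + ν22 - s * x' ∈ Fil v := by
      rw [add_sub_right_comm]
      exact add_mem lead2 (Fil_mono (by omega) n22.1)
    have lcA1 : PowerSeries.coeff v (P1 + ν11 - s * x) = ∑ j ∈ l.leaves, κ j v • E j := by
      rw [add_sub_right_comm, map_add, lc1, n11.1 v (by omega), add_zero]
    have lcA2 : PowerSeries.coeff v (P2 + ν22 - s * x') = ∑ j ∈ r.leaves, κ j v • E j := by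
      rw [add_sub_right_comm, map_add, lc2, n22.1 v (by omega), add_zero]
    have hA'sum : A' = (P1 + ν11) + (P2 + ν22) + (b + ν12) + ν21 := by
      have : A' = ν + (P1 + P2 + b) := by rw [hνd, sub_add_cancel]
      rw [this, νsum]; abel
    generalize P1 + ν11 = A1 at *
    generalize P2 + ν22 = A2 at *
    obtain ⟨c, cc, fc, hc⟩ := sylvester (e := el) (e' := er) (s := s) cA1 cA2 hs fA1 fA2
      (by intro z hz; rw [lcA1, lcA2]; exact sl z hz) 1 (cb.add c12)
      (add_mem fb (Fil_mono (by omega) f12)) (k - v - 1)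
    obtain ⟨a2, ca2, fa2, ha2⟩ := sylvester (e := er) (e' := el) (s := s) cA2 cA1 hs fA2 fA1
      (by intro z hz; rw [lcA1, lcA2]; exact sr z hz) (k - 1 - v) c21
      (Fil_mono (by omega) f21) 1
    rw [show v + 1 + (k - v - 1) = k by omega] at hc
    rw [show v + (k - 1 - v) + 1 = k by omega] at ha2
    have cb' : Cor x x' (c * A2 - A1 * c) := (cc.mul cA2).sub (cA1.mul cc)
    have fb' : c * A2 - A1 * c ∈ Fil (v + 1) := by
      have : c * A2 - A1 * c = c * (A2 - s * x') - (A1 - s * x) * c := by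
        have h1 : c * (s * x') = s * c := by rw [← mul_assoc, ← hs, mul_assoc, cc.2]
        have h2 : s * x * c = s * c := by rw [mul_assoc, cc.1]
        rw [mul_sub, sub_mul, h1, h2]; abel
      rw [this]; exact sub_mem (Fil_mul' fc fA2 (by omega)) (Fil_mul' fA1 fc (by omega))
    have s2 := conj_c o1 o2 cA1 cA2 cc
    have tail := conj_tail hk o1 o2 cA1 cA2 cb' ca2 fb' fa2
    generalize c * A2 - A1 * c = b' at *
    have q1 : (1 + a2) * (A1 + A2 + b') * (1 - a2) - A' ∈ Fil k := by
      have := sub_mem (sub_mem tail hc) ha2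
      convert this using 1
      rw [hA'sum]; abel
    have q2 : (1 + a2) * (A1 + A2 + b') - A' * (1 + a2) ∈ Fil k := by
      have := Fil_mul_right (1 + a2) q1
      rwa [sub_mul, mul_assoc _ (1 - a2), (lower_sq o1 ca2).1, mul_one] at this
    have q3 : (1 + z1 + z2) * (B1 + B2) - (A1 + A2) * (1 + z1 + z2) ∈ Fil k := by
      have t1 : z2 * B1 = 0 := cz2.mul_zero' cB1 o2
      have t2 : z1 * B2 = 0 := cz1.mul_zero' cB2 o1
      have t3 : A1 * z2 = 0 := cA1.mul_zero' cz2 o1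
      have t4 : A2 * z1 = 0 := cA2.mul_zero' cz1 o2
      have : (1 + z1 + z2) * (B1 + B2) = (1 + z1) * B1 + (1 + z2) * B2 + z2 * B1 + z1 * B2 := by
        noncomm_ring
      rw [this, t1, t2]
      have : (A1 + A2) * (1 + z1 + z2) = A1 * (1 + z1) + A2 * (1 + z2) + A1 * z2 + A2 * z1 := by
        noncomm_ring
      rw [this, t3, t4]
      convert add_mem hz1 hz2 using 1; abel
    have fa2' : a2 ∈ Fil 1 := Fil_mono (by omega) fa2
    have u1 := cor_one_add_mul (ca.embed e2 e3) (ca2.embed e2 e3)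
    have v1 := fil_one_add_mul fa fa2'
    have u2 := cor_one_add_mul (cc.embed e1 e4) ((cz1.embed e1 e3).add (cz2.embed e2 e4))
    have v2 := fil_one_add_mul fc (add_mem fz1 fz2)
    have u3 := cor_one_add_mul u1 u2
    have v3 := fil_one_add_mul v1 v2
    refine ⟨_, u3, v3, ?_⟩
    have hprod : (1 + ((1 + (((1 + a) * (1 + a2)) - 1)) * (1 + ((1 + c) * (1 + (z1 + z2)) - 1)) - 1))
        = (1 + a) * (1 + a2) * (1 + c) * (1 + z1 + z2) := by
      simp only [add_sub_cancel, mul_assoc, ← add_assoc]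
    rw [hprod]
    have final : (1 + a) * (1 + a2) * (1 + c) * (1 + z1 + z2) * (B1 + B2)
        - A * ((1 + a) * (1 + a2) * (1 + c) * (1 + z1 + z2))
        = (1 + a) * (1 + a2) * (1 + c) * ((1 + z1 + z2) * (B1 + B2) - (A1 + A2) * (1 + z1 + z2))
          + (1 + a) * ((1 + a2) * (A1 + A2 + b') - A' * (1 + a2)) * (1 + c) * (1 + z1 + z2) := by
      have r1 : A * ((1 + a) * (1 + a2) * (1 + c) * (1 + z1 + z2))
        = (1 + a) * A' * (1 + a2) * (1 + c) * (1 + z1 + z2) := by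
        rw [← hAA']; simp only [mul_assoc]
      have r2 : (1 + a) * (1 + a2) * (1 + c) * ((A1 + A2) * (1 + z1 + z2))
        = (1 + a) * (1 + a2) * (A1 + A2 + b') * (1 + c) * (1 + z1 + z2) := by
        calc (1 + a) * (1 + a2) * (1 + c) * ((A1 + A2) * (1 + z1 + z2))
          = (1 + a) * (1 + a2) * ((1 + c) * (A1 + A2)) * (1 + z1 + z2) := by simp only [mul_assoc]
          _ = _ := by rw [s2]; simp only [mul_assoc]
      rw [r1, mul_sub, r2]
      generalize 1 + a2 = G2
      generalize 1 + a = G1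
      generalize 1 + c = G3
      generalize 1 + z1 + z2 = G4
      generalize A1 + A2 + b' = P
      simp only [mul_sub, sub_mul, mul_assoc]
      abel
    rw [final]
    exact add_mem (Fil_mul_left _ q3) (Fil_mul_right _ (Fil_mul_right _ (Fil_mul_left _ q2)))

end OrbSec
end

noncomputable section

variable {R : Type*} [Ring R] [Algebra ℂ R] {J : Type} [DecidableEq J]

/-- Power series whose coefficients below `N` lie in a subalgebra. -/
def PS (SA : Subalgebra ℂ R) (N : ℕ) (f : PowerSeries R) : Prop :=
  ∀ m < N, PowerSeries.coeff m f ∈ SA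

theorem PS.add {SA : Subalgebra ℂ R} {N : ℕ} {f g : PowerSeries R} (hf : PS SA N f) (hg : PS SA N g) :
    PS SA N (f + g) := fun m hm => by rw [map_add]; exact add_mem (hf m hm) (hg m hm)

theorem PS.sub {SA : Subalgebra ℂ R} {N : ℕ} {f g : PowerSeries R} (hf : PS SA N f) (hg : PS SA N g) :
    PS SA N (f - g) := fun m hm => by rw [map_sub]; exact sub_mem (hf m hm) (hg m hm)

theorem PS.mul {SA : Subalgebra ℂ R} {N : ℕ} {f g : PowerSeries R} (hf : PS SA N f) (hg : PS SA N g) :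
    PS SA N (f * g) := fun m hm => by
  rw [PowerSeries.coeff_mul]
  refine sum_mem fun x hx => ?_
  have hx' : x.1 + x.2 = m := by simpa using hx
  exact mul_mem (hf _ (by omega)) (hg _ (by omega))

theorem PS.C0 {SA : Subalgebra ℂ R} (N : ℕ) {x : R} (hx : x ∈ SA) : PS SA N (PowerSeries.C x) :=
  fun m hm => by
    rw [PowerSeries.coeff_C]; split_ifs
    · exact hx
    · exact zero_mem _

theorem PS.one0 {SA : Subalgebra ℂ R} (N : ℕ) : PS SA N (1 : PowerSeries R) :=
  fun m hm => by
    rw [PowerSeries.coeff_one]; split_ifs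
    · exact one_mem _
    · exact zero_mem _

theorem PS_sSer {SA : Subalgebra ℂ R} (N : ℕ) (c : ℕ → ℂ) (v : ℕ) : PS SA N (sSer R c v) :=
  fun m hm => by
    rw [sSer, PowerSeries.coeff_mk]; split_ifs
    · exact SA.algebraMap_mem _
    · exact zero_mem _

theorem interp {E : J → R} (hE : OI E) {SA : Subalgebra ℂ R} (s : Finset J) (c : J → ℂ)
    (h0 : es E s ∈ SA) (h1 : ∑ j ∈ s, c j • E j ∈ SA) (φ : ℂ → ℂ) :
    ∑ j ∈ s, φ (c j) • E j ∈ SA := by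
  have hpoly : ∀ p : ℂ[X], ∑ j ∈ s, p.eval (c j) • E j ∈ SA := by
    intro p
    induction p using Polynomial.induction_on with
    | C a => simp only [Polynomial.eval_C, ← Finset.smul_sum]; exact SA.smul_mem h0 a
    | add p q hp hq =>
      simp only [Polynomial.eval_add, add_smul, Finset.sum_add_distrib]; exact add_mem hp hq
    | monomial n a hn =>
      have : ∑ j ∈ s, (Polynomial.C a * X ^ (n + 1)).eval (c j) • E j
        = (∑ j ∈ s, (Polynomial.C a * X ^ n).eval (c j) • E j) * ∑ j ∈ s, c j • E j := by
        rw [Finset.sum_mul]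
        refine Finset.sum_congr rfl fun j hj => ?_
        rw [Finset.mul_sum, Finset.sum_eq_single j]
        · rw [smul_mul_smul_comm, hE, if_pos rfl]
          congr 1; simp [pow_succ]; ring
        · intro b _ hb; rw [smul_mul_smul_comm, hE, if_neg hb.symm, smul_zero]
        · intro h; exact absurd hj h
      rw [this]; exact mul_mem hn h1
  have := hpoly (Lagrange.interpolate (s.image c) id φ)
  convert this using 1
  refine Finset.sum_congr rfl fun j hj => ?_
  have := Lagrange.eval_interpolate_at_node (s := s.image c) (v := id) (i := c j) φ
    (Function.injective_id.injOn) (Finset.mem_image_of_mem c hj)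
  rw [id] at this
  rw [this]

/-- Generation: the coefficients of the parametrization generate the idempotents and the blocks. -/
theorem gen {E : J → R} (hE : OI E) {κ : J → ℕ → ℂ} {k : ℕ} {D : J → J → ℕ} (Z : ℕ → R)
    (SA : Subalgebra ℂ R) (t : BT J) (hG : t.Good κ k D) (h0 : es E t.leaves ∈ SA)
    (h : PS SA (k - 1) (Phi E κ k Z t)) :
    (∀ j ∈ t.leaves, E j ∈ SA) ∧
    ∀ s ∈ t.leaves, ∀ s' ∈ t.leaves, s ≠ s' → ∀ m < D s s', E s * Z m * E s' ∈ SA := by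
  induction t with
  | leaf j =>
    simp only [BT.leaves, Finset.mem_singleton]
    have he : es E (BT.leaf j).leaves = E j := by simp [es, BT.leaves]
    rw [he] at h0
    exact ⟨fun i hi => hi ▸ h0, fun s hs s' hs' hne => absurd (hs.trans hs'.symm) hne⟩
  | node v l r hl hr =>
    have hGn := hG
    obtain ⟨hk, hd, hagree, hlv, hv, Gl, Gr⟩ := hG
    have o1 := C_orth hE hd
    have o2 := C_orth hE hd.symm
    have i1 := C_idem hE l.leaves
    have i2 := C_idem hE r.leaves
    obtain ⟨j0, hj0⟩ := l.leaves_nonempty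
    have lead := Phi_leading hE Z (.node v l r) hGn (κ j0) v
      (fun s hs m hm => hagree s hs j0 (by simp [hj0]) m hm)
    have leadl := Phi_leading hE Z l Gl (κ j0) v
      (fun s hs m hm => hagree s (by simp [hs]) j0 (by simp [hj0]) m hm)
    have leadr := Phi_leading hE Z r Gr (κ j0) v
      (fun s hs m hm => hagree s (by simp [hs]) j0 (by simp [hj0]) m hm)
    have hC : ∑ j ∈ (BT.node v l r).leaves, κ j v • E j ∈ SA := by
      rw [← lead.2]
      exact (h.sub ((PS_sSer _ _ _).mul (PS.C0 _ h0))) v (by omega)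
    have key := interp hE _ (fun j => κ j v) h0 hC
    have dj : ∀ x ∈ r.leaves, x ∉ l.leaves := fun x h1 h2 => Finset.disjoint_left.mp hd h2 h1
    have hel : es E l.leaves ∈ SA := by
      have := key (fun z => if z = κ j0 v then 1 else 0)
      rw [BT.leaves, Finset.sum_union hd] at this
      rw [Finset.sum_congr rfl (g := fun j => E j) (fun j hj => by
          rw [if_pos (hlv j hj j0 hj0), one_smul]),
        Finset.sum_congr (s₁ := r.leaves) rfl (g := fun j => (0 : R)) (fun j hj => by
          rw [if_neg (fun e => (hv j0 hj0 j hj).1 e.symm), zero_smul]), Finset.sum_const_zero, add_zero] at this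
      exact this
    have her : es E r.leaves ∈ SA := by
      have : es E r.leaves = es E (BT.node v l r).leaves - es E l.leaves := by
        rw [BT.leaves, es_union E hd]; abel
      rw [this]; exact sub_mem h0 hel
    have hU : ∑ j ∈ r.leaves, (κ j0 v - κ j v)⁻¹ • E j ∈ SA := by
      have := mul_mem her (key (fun z => (κ j0 v - z)⁻¹))
      convert this using 1
      rw [BT.leaves, Finset.mul_sum, Finset.sum_union hd]
      rw [Finset.sum_congr (s₁ := l.leaves) rfl (g := fun j => (0 : R)) (fun j hj => by
          rw [mul_smul_comm, hE.es_mul_zero (fun h => dj j h hj), smul_zero]), Finset.sum_const_zero, zero_add]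
      exact Finset.sum_congr rfl fun j hj => by rw [mul_smul_comm, hE.es_mul hj]
    have cP := Phi_cor hE Z l Gl
    have cQ := Phi_cor hE Z r Gr
    have ca := aSer_cor hE k v l.leaves r.leaves Z
    have cb := bSer_cor hE k v l.leaves r.leaves Z
    have fa := aSer_Fil E k v l.leaves r.leaves Z
    have fb := bSer_Fil E k v l.leaves r.leaves Z
    have hx := PS.C0 (k - 1) hel
    have hx' := PS.C0 (k - 1) her
    have hPhi := Phi_node hE Z v l r hGn
    have azero : ∀ m, ¬ (m + v + 2 ≤ k) → PowerSeries.coeff m (aSer E k v l.leaves r.leaves Z) = 0 := by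
      intro m hm; rw [aSer, PowerSeries.coeff_mk, if_neg (by omega)]
    have acoef : ∀ m, m + v + 3 ≤ k → es E r.leaves * Z m * es E l.leaves
        = PowerSeries.coeff (m + 1) (aSer E k v l.leaves r.leaves Z) := by
      intro m hm; rw [aSer, PowerSeries.coeff_mk, if_pos (by omega)]; rfl
    have bcoef : ∀ m, m + v + 3 ≤ k → es E l.leaves * Z m * es E r.leaves
        = PowerSeries.coeff (k - 2 - m) (bSer E k v l.leaves r.leaves Z) := by
      intro m hm; rw [bSer, PowerSeries.coeff_mk, if_pos (by omega), show k - 2 - (k - 2 - m) = m by omega]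
    have hlead1 : PowerSeries.coeff v (Phi E κ k Z l - sSer R (κ j0) v * PowerSeries.C (es E l.leaves))
        = κ j0 v • es E l.leaves := by
      rw [leadl.2, es, Finset.smul_sum]
      exact Finset.sum_congr rfl fun j hj => by rw [hlv j hj j0 hj0]
    have hlead2 := leadr.2
    have hUC : (∑ j ∈ r.leaves, (κ j0 v - κ j v)⁻¹ • E j) *
        (κ j0 v • es E r.leaves - ∑ j ∈ r.leaves, κ j v • E j) = es E r.leaves := by
      have : κ j0 v • es E r.leaves - ∑ j ∈ r.leaves, κ j v • E j
        = ∑ j ∈ r.leaves, (κ j0 v - κ j v) • E j := by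
        simp only [es, sub_smul, Finset.sum_sub_distrib, Finset.smul_sum]
      rw [this, Finset.sum_mul, es]
      refine Finset.sum_congr rfl fun j hj => ?_
      rw [Finset.mul_sum, Finset.sum_eq_single j]
      · rw [smul_mul_smul_comm, hE, if_pos rfl, inv_mul_cancel₀ (sub_ne_zero.mpr (hv j0 hj0 j hj).1), one_smul]
      · intro b _ hb; rw [smul_mul_smul_comm, hE, if_neg hb.symm, smul_zero]
      · intro h; exact absurd hj h
    have ihl := hl Gl hel
    have ihr := hr Gr her
    have fP := leadl.1
    have fQ := leadr.1
    rw [hPhi] at h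
    have hss := PS_sSer (SA := SA) (R := R) (k - 1) (κ j0) v
    have hscomm := fun f => sSer_comm (R := R) (κ j0) v f
    clear hl hr lead key hPhi leadl leadr
    generalize sSer R (κ j0) v = s at *
    generalize Phi E κ k Z l = P at *
    generalize Phi E κ k Z r = Q at *
    generalize hagen : aSer E k v l.leaves r.leaves Z = a at *
    generalize hbgen : bSer E k v l.leaves r.leaves Z = b at *
    have hb : PS SA (k - 1) b := by
      have := (hx.mul h).mul hx'
      convert this using 1
      simp only [mul_add, mul_sub, add_mul, sub_mul, ← mul_assoc, cP.1, cb.1, cQ.left_zero o1, ca.left_zero o1,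
        zero_mul]
      simp only [mul_assoc, cP.right_zero o1, ca.right_zero o1, cb.2, mul_zero]
      abel
    have h1 := (hx.mul h).mul hx
    have h2 := (hx'.mul h).mul hx'
    have h3 := (hx'.mul h).mul hx
    have e1 : PowerSeries.C (es E l.leaves) * ((P - b * a) + (Q + a * b) + b + (a * P - Q * a - a * b * a)) *
        PowerSeries.C (es E l.leaves) = P - b * a := by
      simp only [mul_add, mul_sub, add_mul, sub_mul, ← mul_assoc, cP.1, cb.1, cQ.left_zero o1, ca.left_zero o1,
        zero_mul]
      simp only [mul_assoc, cP.2, ca.2, cb.right_zero o2, mul_zero]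
      abel
    have e2 : PowerSeries.C (es E r.leaves) * ((P - b * a) + (Q + a * b) + b + (a * P - Q * a - a * b * a)) *
        PowerSeries.C (es E r.leaves) = Q + a * b := by
      simp only [mul_add, mul_sub, add_mul, sub_mul, ← mul_assoc, cP.left_zero o2, cb.left_zero o2, cQ.1, ca.1,
        zero_mul]
      simp only [mul_assoc, cP.right_zero o1, ca.right_zero o1, cb.2, cQ.2, mul_zero]
      abel
    have e3 : PowerSeries.C (es E r.leaves) * ((P - b * a) + (Q + a * b) + b + (a * P - Q * a - a * b * a)) *
        PowerSeries.C (es E l.leaves) = a * P - Q * a - a * b * a := by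
      simp only [mul_add, mul_sub, add_mul, sub_mul, ← mul_assoc, cP.left_zero o2, cb.left_zero o2, cQ.1, ca.1,
        zero_mul]
      simp only [mul_assoc, cP.2, ca.2, cb.right_zero o2, cQ.right_zero o2, mul_zero]
      abel
    rw [e1] at h1
    rw [e2] at h2
    rw [e3] at h3
    -- reduced blocks
    have hba : b * a ∈ Fil (v + 2) := Fil_mul' fb fa (by omega)
    have hab : a * b ∈ Fil (v + 2) := Fil_mul' fa fb (by omega)
    obtain ⟨F, hF⟩ : ∃ F, F = P - b * a - s * PowerSeries.C (es E l.leaves) := ⟨_, rfl⟩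
    obtain ⟨G, hGd⟩ : ∃ G, G = Q + a * b - s * PowerSeries.C (es E r.leaves) := ⟨_, rfl⟩
    have pF : PS SA (k - 1) F := by rw [hF]; exact h1.sub (hss.mul hx)
    have pG : PS SA (k - 1) G := by rw [hGd]; exact h2.sub (hss.mul hx')
    have F1 : F = (P - s * PowerSeries.C (es E l.leaves)) - b * a := by rw [hF]; abel
    have G1 : G = (Q - s * PowerSeries.C (es E r.leaves)) + a * b := by rw [hGd]; abel
    have fF : F ∈ Fil v := by rw [F1]; exact sub_mem fP (Fil_mono (by omega) hba)
    have fG : G ∈ Fil v := by rw [G1]; exact add_mem fQ (Fil_mono (by omega) hab)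
    have vF : PowerSeries.coeff v F = κ j0 v • es E l.leaves := by
      rw [F1, map_sub, hlead1, hba v (by omega), sub_zero]
    have vG : PowerSeries.coeff v G = ∑ j ∈ r.leaves, κ j v • E j := by
      rw [G1, map_add, hlead2, hab v (by omega), add_zero]
    have hL : a * P - Q * a - a * b * a = a * F - G * a + a * b * a := by
      have h4 : a * (s * PowerSeries.C (es E l.leaves)) = s * a := by
        rw [← mul_assoc, ← hscomm, mul_assoc, ca.2]
      have h5 : s * PowerSeries.C (es E r.leaves) * a = s * a := by rw [mul_assoc, ca.1]
      rw [hF, hGd]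
      simp only [mul_sub, sub_mul, add_mul, h4, h5, mul_assoc]; abel
    rw [hL] at h3
    have coefa : ∀ m, es E r.leaves * PowerSeries.coeff m a = PowerSeries.coeff m a := by
      intro m; rw [← coeff_C_mul', ca.1]
    have coefa' : ∀ m, PowerSeries.coeff m a * es E l.leaves = PowerSeries.coeff m a := by
      intro m; rw [← coeff_mul_C', ca.2]
    have ha : ∀ m, PowerSeries.coeff m a ∈ SA := by
      intro m
      induction m using Nat.strong_induction_on with
      | _ m ih =>
        by_cases hm : m + v + 2 ≤ k
        swap
        · rw [azero m hm]; exact zero_mem _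
        obtain ⟨p, hp⟩ : ∃ p : PowerSeries R, p = PowerSeries.mk fun i => if i < m then PowerSeries.coeff i a else 0 :=
          ⟨_, rfl⟩
        obtain ⟨q, hq⟩ : ∃ q, q = a - p := ⟨_, rfl⟩
        have hpP : PS SA (k - 1) p := by
          intro i hi; rw [hp, PowerSeries.coeff_mk]; split_ifs with hh
          · exact ih i hh
          · exact zero_mem _
        have hqF : q ∈ Fil m := by
          intro i hi; rw [hq, map_sub, hp, PowerSeries.coeff_mk, if_pos hi, sub_self]
        have hqm : PowerSeries.coeff m q = PowerSeries.coeff m a := by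
          rw [hq, map_sub, hp, PowerSeries.coeff_mk, if_neg (lt_irrefl m), sub_zero]
        have hpF : p ∈ Fil 1 := by
          intro i hi; rw [hp, PowerSeries.coeff_mk]; split_ifs
          · exact fa i hi
          · rfl
        have haq : a = p + q := by rw [hq]; abel
        have hdec : q * F - G * q = (a * F - G * a + a * b * a) - (p * F - G * p + p * b * p)
            - (p * b * q + q * b * a) := by
          have : a * b * a = p * b * p + (p * b * q + q * b * a) := by
            rw [haq]; noncomm_ring
          rw [this, haq]; noncomm_ring
        have hbad : p * b * q + q * b * a ∈ Fil (m + v + 1) := by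
          refine add_mem (Fil_mul' (Fil_mul' hpF fb (le_refl _)) hqF (by omega))
            (Fil_mul' (Fil_mul' hqF fb (le_refl _)) fa (by omega))
        have hmem : PowerSeries.coeff (m + v) (q * F - G * q) ∈ SA := by
          rw [hdec, map_sub, hbad (m + v) (by omega), sub_zero]
          exact (h3.sub (((hpP.mul pF).sub (pG.mul hpP)).add ((hpP.mul hb).mul hpP))) (m + v) (by omega)
        rw [map_sub, coeff_mul_Fil hqF fF, show m + v = v + m by omega, coeff_mul_Fil fG hqF, vF, vG, hqm,
          mul_smul_comm, coefa'] at hmem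
        have := mul_mem hU hmem
        have e : κ j0 v • PowerSeries.coeff m a - (∑ j ∈ r.leaves, κ j v • E j) * PowerSeries.coeff m a
          = (κ j0 v • es E r.leaves - ∑ j ∈ r.leaves, κ j v • E j) * PowerSeries.coeff m a := by
          rw [sub_mul, smul_mul_assoc, coefa]
        rw [e, ← mul_assoc, hUC, coefa] at this
        exact this
    have haP : PS SA (k - 1) a := fun m _ => ha m
    have ihl' := ihl (by have := h1.add (hb.mul haP); rwa [sub_add_cancel] at this)
    have ihr' := ihr (by have := h2.sub (haP.mul hb); rwa [add_sub_cancel_right] at this)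
    constructor
    · intro j hj
      rw [BT.leaves, Finset.mem_union] at hj
      exact hj.elim (ihl'.1 j) (ihr'.1 j)
    · intro s1 hs1 s2 hs2 hne m hm
      rw [BT.leaves, Finset.mem_union] at hs1 hs2
      rcases hs1 with hs1 | hs1 <;> rcases hs2 with hs2 | hs2
      · exact ihl'.2 s1 hs1 s2 hs2 hne m hm
      · have hD := (hv s1 hs1 s2 hs2).2.1
        have e : E s1 * Z m * E s2 = E s1 * (es E l.leaves * Z m * es E r.leaves) * E s2 := by
          simp only [← mul_assoc, hE.mul_es hs1]; simp only [mul_assoc, hE.es_mul hs2]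
        rw [e, bcoef m (by omega)]
        exact mul_mem (mul_mem (ihl'.1 _ hs1) (hb _ (by omega))) (ihr'.1 _ hs2)
      · have hD := (hv s2 hs2 s1 hs1).2.2
        have e : E s1 * Z m * E s2 = E s1 * (es E r.leaves * Z m * es E l.leaves) * E s2 := by
          simp only [← mul_assoc, hE.mul_es hs1]; simp only [mul_assoc, hE.es_mul hs2]
        rw [e, acoef m (by omega)]
        exact mul_mem (mul_mem (ihr'.1 _ hs1) (ha _)) (ihl'.1 _ hs2)
      · exact ihr'.2 s1 hs1 s2 hs2 hne m hm

/-- Converse of `gen`. -/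
theorem gen_conv {E : J → R} {κ : J → ℕ → ℂ} {k : ℕ} {D : J → J → ℕ} (Z : ℕ → R)
    (SA : Subalgebra ℂ R) (t : BT J) (hG : t.Good κ k D) (h0 : ∀ j ∈ t.leaves, E j ∈ SA)
    (h : ∀ s ∈ t.leaves, ∀ s' ∈ t.leaves, s ≠ s' → ∀ m < D s s', E s * Z m * E s' ∈ SA) (N : ℕ) :
    PS SA N (Phi E κ k Z t) := by
  induction t with
  | leaf j =>
    intro m _
    rw [Phi, PowerSeries.coeff_mk]
    exact SA.smul_mem (h0 j (by simp [BT.leaves])) _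
  | node v l r hl hr =>
    obtain ⟨hk, hd, hagree, hlv, hv, Gl, Gr⟩ := hG
    simp only [BT.leaves, Finset.mem_union] at h h0
    have h1 := hl Gl (fun j hj => h0 j (Or.inl hj)) (fun s hs s' hs' => h s (Or.inl hs) s' (Or.inl hs'))
    have h2 := hr Gr (fun j hj => h0 j (Or.inr hj)) (fun s hs s' hs' => h s (Or.inr hs) s' (Or.inr hs'))
    have hne : ∀ s ∈ l.leaves, ∀ s' ∈ r.leaves, s ≠ s' := fun s hs s' hs' e => (hv s hs s' hs').1 (by rw [e])
    have h3 : PS SA N (aSer E k v l.leaves r.leaves Z) := by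
      intro m _
      rw [aSer, PowerSeries.coeff_mk]
      split_ifs with hm
      · rw [es_mul_mul_es]
        exact sum_mem fun i hi => sum_mem fun j hj => h i (Or.inr hi) j (Or.inl hj) (hne j hj i hi).symm _ (by
          rw [(hv j hj i hi).2.2]; omega)
      · exact zero_mem _
    have h4 : PS SA N (bSer E k v l.leaves r.leaves Z) := by
      intro m _
      rw [bSer, PowerSeries.coeff_mk]
      split_ifs with hm
      · rw [es_mul_mul_es]
        exact sum_mem fun i hi => sum_mem fun j hj => h i (Or.inl hi) j (Or.inr hj) (hne i hi j hj) _ (by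
          rw [(hv i hi j hj).2.1]; omega)
      · exact zero_mem _
    rw [Phi]
    exact (((PS.one0 N).add h3).mul ((h1.add h2).add h4)).mul ((PS.one0 N).sub h3)

end

noncomputable section
section LocSec
variable {R : Type*} [Ring R] [Algebra ℂ R] {m : ℕ}

open Classical in
/-- Signs adjusting the tree order to the natural order. -/
def sg (t : BT (Fin m)) (s s' : Fin m) : ℂ := if t.left s s' ∧ s' < s then -1 else 1

theorem sg_sq (t : BT (Fin m)) (s s' : Fin m) : sg t s s' * sg t s s' = 1 := by
  unfold sg; split_ifs <;> norm_num

/-- Sign-twisted blocks. -/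
def tw (E : Fin m → R) (t : BT (Fin m)) (X : ℕ → R) (l : ℕ) : R :=
  ∑ s, ∑ s', sg t s s' • (E s * X l * E s')

theorem tw_block {E : Fin m → R} (hE : OI E) (t : BT (Fin m)) (X : ℕ → R) (l : ℕ) (s s' : Fin m) :
    E s * tw E t X l * E s' = sg t s s' • (E s * X l * E s') := by
  rw [tw, Finset.mul_sum, Finset.sum_mul, Finset.sum_eq_single s]
  · rw [Finset.mul_sum, Finset.sum_mul, Finset.sum_eq_single s']
    · rw [mul_smul_comm, smul_mul_assoc]
      congr 1
      rw [← mul_assoc, ← mul_assoc, hE, if_pos rfl, mul_assoc, hE, if_pos rfl]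
    · intro b _ hb
      rw [mul_smul_comm, smul_mul_assoc, mul_assoc, mul_assoc, hE, if_neg hb]; simp
    · intro h; exact absurd (Finset.mem_univ _) h
  · intro b _ hb
    rw [Finset.mul_sum, Finset.sum_mul]
    refine Finset.sum_eq_zero fun c _ => ?_
    rw [mul_smul_comm, ← mul_assoc, ← mul_assoc, hE, if_neg hb.symm]; simp
  · intro h; exact absurd (Finset.mem_univ _) h

/-- The twisted parametrization. -/
def Psi (E : Fin m → R) (κ : Fin m → ℕ → ℂ) (k : ℕ) (t : BT (Fin m)) (X : ℕ → R) : PowerSeries R :=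
  Phi E κ k (tw E t X) t

theorem Psi_moment {E : Fin m → R} (hE : OI E) {κ : Fin m → ℕ → ℂ} {k : ℕ} {D : Fin m → Fin m → ℕ}
    (t : BT (Fin m)) (hG : t.Good κ k D) (ht : t.leaves = Finset.univ) (X : ℕ → R) (j : Fin m)
    (hκ : κ j (k - 1) = 0) :
    E j * PowerSeries.coeff (k - 1) (Psi E κ k t X) * E j =
      ∑ s, ∑ l ∈ Finset.range (D s j), (if s < j then (1 : ℂ) else if j < s then -1 else 0) •
        (E j * X l * E s * X l * E j) := by
  rw [Psi, Phi_moment hE _ t hG j (by rw [ht]; exact Finset.mem_univ _), hκ, zero_smul, zero_add, ht]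
  refine Finset.sum_congr rfl fun s _ => Finset.sum_congr rfl fun l _ => ?_
  have hss : E s * E s = E s := by rw [hE, if_pos rfl]
  have e1 : ∀ Y : R, E j * Y * E s * Y * E j = (E j * Y * E s) * (E s * Y * E j) := by
    intro Y
    rw [show (E j * Y * E s) * (E s * Y * E j) = E j * Y * (E s * E s) * Y * E j by simp only [mul_assoc], hss]
  rw [e1, tw_block hE, tw_block hE, smul_mul_smul_comm, ← e1, smul_smul]
  congr 1
  rcases lt_trichotomy s j with h | h | h
  · have hne : s ≠ j := h.ne
    rcases t.left_total (s := s) (s' := j) (by rw [ht]; simp) (by rw [ht]; simp) hne with hl | hl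
    · have hn : ¬ t.left j s := fun h' => t.left_asymm hG hl h'
      simp [sg, hl, hn, h, h.not_gt]
    · have hn : ¬ t.left s j := fun h' => t.left_asymm hG hl h'
      simp [sg, hl, hn, h, h.not_gt]
  · subst h
    have hn : ¬ t.left s s := fun h' => t.left_asymm hG h' h'
    simp [sg, hn]
  · have hne : s ≠ j := h.ne'
    rcases t.left_total (s := s) (s' := j) (by rw [ht]; simp) (by rw [ht]; simp) hne with hl | hl
    · have hn : ¬ t.left j s := fun h' => t.left_asymm hG hl h'
      simp [sg, hl, hn, h, h.not_gt]
    · have hn : ¬ t.left s j := fun h' => t.left_asymm hG hl h'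
      simp [sg, hl, hn, h, h.not_gt]

/-- Monomial of degree `k-1`. -/
def mon (k : ℕ) (Y : R) : PowerSeries R := PowerSeries.mk fun l => if l = k - 1 then Y else 0

theorem mon_Fil (k : ℕ) (Y : R) : mon k Y ∈ Fil (k - 1) := by
  intro l hl; rw [mon, PowerSeries.coeff_mk, if_neg (by omega)]

theorem C_mul_mon (k : ℕ) (x Y : R) : PowerSeries.C x * mon k Y = mon k (x * Y) := by
  ext l; rw [coeff_C_mul', mon, mon, PowerSeries.coeff_mk, PowerSeries.coeff_mk]; split_ifs <;> simp

theorem mon_mul_C (k : ℕ) (x Y : R) : mon k Y * PowerSeries.C x = mon k (Y * x) := by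
  ext l; rw [coeff_mul_C', mon, mon, PowerSeries.coeff_mk, PowerSeries.coeff_mk]; split_ifs <;> simp

theorem mon_comm {k : ℕ} (hk : 0 < k) (Y : R) {y : PowerSeries R} (hy : y ∈ Fil 1) :
    (1 + y) * mon k Y - mon k Y * (1 + y) ∈ Fil k := by
  have : (1 + y) * mon k Y - mon k Y * (1 + y) = y * mon k Y - mon k Y * y := by noncomm_ring
  rw [this]
  exact sub_mem (Fil_mul' hy (mon_Fil k Y) (by omega)) (Fil_mul' (mon_Fil k Y) hy (by omega))

theorem orb_fwd {E : Fin m → R} (hE : OI E) (hE1 : ∑ j, E j = 1) {κ : Fin m → ℕ → ℂ} {k : ℕ} (hk0 : 0 < k)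
    {D : Fin m → Fin m → ℕ} (t : BT (Fin m)) (hG : t.Good κ k D) (ht : t.leaves = Finset.univ)
    (A g : PowerSeries R) (Y : R) (γ : Rˣ) (hγ : PowerSeries.coeff 0 g = γ.val)
    (h : g * (Bser E κ Finset.univ + mon k Y) - A * g ∈ Fil k) :
    ∃ X : ℕ → R, (∀ l < k - 1, PowerSeries.coeff l A * γ.val = γ.val * PowerSeries.coeff l (Psi E κ k t X)) ∧
      ∀ j, E j * (γ⁻¹.val * PowerSeries.coeff (k - 1) A * γ.val) * E j =
        E j * PowerSeries.coeff (k - 1) (Psi E κ k t X) * E j + E j * Y * E j := by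
  have hes : es E t.leaves = 1 := by rw [ht]; exact hE1
  obtain ⟨c, hc⟩ : ∃ c : PowerSeries R, c = PowerSeries.C γ.val := ⟨_, rfl⟩
  obtain ⟨c', hc'⟩ : ∃ c : PowerSeries R, c = PowerSeries.C γ⁻¹.val := ⟨_, rfl⟩
  have hcc : c * c' = 1 := by rw [hc, hc', ← map_mul, Units.mul_inv, map_one]
  have hcc' : c' * c = 1 := by rw [hc, hc', ← map_mul, Units.inv_mul, map_one]
  obtain ⟨y, hy⟩ : ∃ y, y = c' * g - 1 := ⟨_, rfl⟩
  have hy1 : 1 + y = c' * g := by rw [hy]; abel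
  have fy : y ∈ Fil 1 := by
    intro l hl
    obtain rfl : l = 0 := by omega
    rw [hy, map_sub, hc', coeff_C_mul', hγ, Units.inv_mul]; simp
  have hfw : (1 + y) * Bser E κ t.leaves - (c' * A * c - mon k Y) * (1 + y) ∈ Fil k := by
    have h1 := Fil_mul_left c' h
    have h2 := sub_mem h1 (mon_comm hk0 Y fy)
    convert h2 using 1
    rw [hy1, ht]
    have : c' * A * c * (c' * g) = c' * (A * g) := by
      rw [show c' * A * c * (c' * g) = c' * A * (c * c') * g by simp only [mul_assoc], hcc]
      simp only [mul_assoc, mul_one, one_mul]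
    rw [sub_mul, this, mul_sub, mul_add, mul_add]
    simp only [mul_assoc]; abel
  obtain ⟨Z, hZ⟩ := orbit_forward hE hk0 t hG (c' * A * c - mon k Y) y
    (by rw [hes, map_one]; exact ⟨one_mul _, mul_one _⟩) (by rw [hes, map_one]; exact ⟨one_mul _, mul_one _⟩) fy hfw
  refine ⟨tw E t Z, ?_⟩
  have hPhi : Psi E κ k t (tw E t Z) = Phi E κ k Z t := by
    refine Phi_congr _ _ t hG fun s _ s' _ _ l _ => ?_
    rw [tw_block hE, tw_block hE, smul_smul, sg_sq, one_smul]
  rw [hPhi]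
  constructor
  · intro l hl
    have := hZ.1 l hl
    rw [map_sub, map_sub, mon_Fil k Y l hl, sub_zero, sub_eq_zero, hc, hc', coeff_mul_C', coeff_C_mul'] at this
    rw [← this, ← mul_assoc, ← mul_assoc, Units.mul_inv, one_mul]
  · intro j
    have := hZ.2 j
    rw [map_sub, map_sub, hc, hc', coeff_mul_C', coeff_C_mul', mon, PowerSeries.coeff_mk, if_pos rfl,
      mul_sub, sub_mul, mul_sub, sub_mul] at this
    rw [sub_sub, sub_eq_zero] at this
    rw [this, add_comm]

theorem orb_bwd {E : Fin m → R} (hE : OI E) (hE1 : ∑ j, E j = 1) {κ : Fin m → ℕ → ℂ} {k : ℕ} (hk0 : 0 < k)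
    {D : Fin m → Fin m → ℕ} (t : BT (Fin m)) (hG : t.Good κ k D) (ht : t.leaves = Finset.univ)
    (A : PowerSeries R) (Y T : R) (γ η : Rˣ) (X : ℕ → R)
    (hη : ∀ j, η.val * E j = E j * η.val) (hT : T * η.val = η.val * Y)
    (h1 : ∀ l < k - 1, PowerSeries.coeff l A * γ.val = γ.val * PowerSeries.coeff l (Psi E κ k t X))
    (h2 : ∀ j, E j * (γ⁻¹.val * PowerSeries.coeff (k - 1) A * γ.val) * E j =
        E j * PowerSeries.coeff (k - 1) (Psi E κ k t X) * E j + E j * T * E j) :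
    ∃ g : PowerSeries R, IsUnit (PowerSeries.coeff 0 g) ∧
      g * (Bser E κ Finset.univ + mon k Y) - A * g ∈ Fil k := by
  have hes : es E t.leaves = 1 := by rw [ht]; exact hE1
  obtain ⟨c, hc⟩ : ∃ c : PowerSeries R, c = PowerSeries.C γ.val := ⟨_, rfl⟩
  obtain ⟨c', hc'⟩ : ∃ c : PowerSeries R, c = PowerSeries.C γ⁻¹.val := ⟨_, rfl⟩
  obtain ⟨d, hd⟩ : ∃ c : PowerSeries R, c = PowerSeries.C η.val := ⟨_, rfl⟩
  have hcc : c * c' = 1 := by rw [hc, hc', ← map_mul, Units.mul_inv, map_one]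
  have hcc' : c' * c = 1 := by rw [hc, hc', ← map_mul, Units.inv_mul, map_one]
  have hNz : c' * A * c - mon k T - Psi E κ k t X ∈ Nz E k := by
    constructor
    · intro l hl
      rw [map_sub, map_sub, mon_Fil k T l hl, sub_zero, hc, hc', coeff_mul_C', coeff_C_mul', mul_assoc, h1 l hl,
        ← mul_assoc, Units.inv_mul, one_mul, sub_self]
    · intro j
      rw [map_sub, map_sub, hc, hc', coeff_mul_C', coeff_C_mul', mon, PowerSeries.coeff_mk, if_pos rfl,
        mul_sub, sub_mul, mul_sub, sub_mul, h2]
      abel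
  obtain ⟨y, -, fy, hy⟩ := orbit_backward hE hk0 t hG _ _ (by rw [hes, map_one]; exact ⟨one_mul _, mul_one _⟩) hNz
  rw [ht] at hy
  refine ⟨c * (1 + y) * d, ?_, ?_⟩
  · have : PowerSeries.coeff 0 (c * (1 + y) * d) = γ.val * η.val := by
      rw [hd, coeff_mul_C', hc, coeff_C_mul', map_add, fy 0 (by omega)]; simp
    rw [this]; exact (γ * η).isUnit
  · have h3 := add_mem hy (mon_comm hk0 T fy)
    have h4 := Fil_mul_right d (Fil_mul_left c h3)
    have hdB : d * Bser E κ Finset.univ = Bser E κ Finset.univ * d := by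
      ext l
      rw [hd, coeff_C_mul', coeff_mul_C', Bser, PowerSeries.coeff_mk, Finset.mul_sum, Finset.sum_mul]
      exact Finset.sum_congr rfl fun j _ => by rw [mul_smul_comm, smul_mul_assoc, hη]
    have hdm : d * mon k Y = mon k T * d := by rw [hd, C_mul_mon, mon_mul_C, hT]
    convert h4 using 1
    have e1 : c * (1 + y) * d * (Bser E κ Finset.univ + mon k Y)
        = c * (1 + y) * Bser E κ Finset.univ * d + c * (1 + y) * mon k T * d := by
      rw [mul_add, mul_assoc _ d, mul_assoc _ d, hdB, hdm]; simp only [mul_assoc]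
    have e2 : A * (c * (1 + y) * d) = c * (c' * A * c * (1 + y)) * d := by
      rw [show c * (c' * A * c * (1 + y)) * d = (c * c') * A * c * (1 + y) * d by simp only [mul_assoc], hcc]
      simp only [mul_assoc, one_mul]
    rw [e1, e2]
    generalize 1 + y = u
    simp only [mul_sub, sub_mul, mul_add, add_mul, mul_assoc]; abel

theorem Psi_gen {E : Fin m → R} (hE : OI E) (hE1 : ∑ j, E j = 1) {κ : Fin m → ℕ → ℂ} {k : ℕ}
    {D : Fin m → Fin m → ℕ} (t : BT (Fin m)) (hG : t.Good κ k D) (ht : t.leaves = Finset.univ) (X : ℕ → R)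
    (SA : Subalgebra ℂ R) :
    (∀ l < k - 1, PowerSeries.coeff l (Psi E κ k t X) ∈ SA) ↔
      ((∀ j, E j ∈ SA) ∧ ∀ s s', s ≠ s' → ∀ l < D s s', E s * X l * E s' ∈ SA) := by
  have hes : es E t.leaves = 1 := by rw [ht]; exact hE1
  have hsm : ∀ s s' l, E s * tw E t X l * E s' ∈ SA ↔ E s * X l * E s' ∈ SA := by
    intro s s' l
    rw [tw_block hE]
    refine ⟨fun h => ?_, fun h => SA.smul_mem h _⟩
    have := SA.smul_mem h (sg t s s')
    rwa [smul_smul, sg_sq, one_smul] at this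
  constructor
  · intro h
    obtain ⟨h1, h2⟩ := gen hE (tw E t X) SA t hG (by rw [hes]; exact one_mem _) h
    rw [ht] at h1 h2
    exact ⟨fun j => h1 j (Finset.mem_univ _), fun s s' hne l hl =>
      (hsm s s' l).1 (h2 s (Finset.mem_univ _) s' (Finset.mem_univ _) hne l hl)⟩
  · rintro ⟨h1, h2⟩
    exact gen_conv (tw E t X) SA t hG (fun j _ => h1 j) (fun s _ s' _ hne l hl => (hsm s s' l).2 (h2 s s' hne l hl)) _

/-- Intertwiners. -/
def intSA (γ : R) : Subalgebra ℂ (R × R) where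
  carrier := {Y | γ * Y.1 = Y.2 * γ}
  mul_mem' := by
    rintro a b ha hb
    simp only [Set.mem_setOf_eq, Prod.fst_mul, Prod.snd_mul] at *
    rw [← mul_assoc, ha, mul_assoc, hb, mul_assoc]
  add_mem' := by
    rintro a b ha hb
    simp only [Set.mem_setOf_eq, Prod.fst_add, Prod.snd_add] at *
    rw [mul_add, add_mul, ha, hb]
  algebraMap_mem' := by
    intro r
    simp only [Set.mem_setOf_eq, Prod.algebraMap_apply]
    exact (Algebra.commutes r γ).symm

theorem mem_intSA (γ : R) (Y : R × R) : Y ∈ intSA γ ↔ γ * Y.1 = Y.2 * γ := Iff.rfl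

theorem Psi_map {R' : Type*} [Ring R'] [Algebra ℂ R'] (φ : R →ₐ[ℂ] R')
    (E : Fin m → R) (κ : Fin m → ℕ → ℂ) (k : ℕ) (X : ℕ → R) (t : BT (Fin m)) (l : ℕ) :
    φ (PowerSeries.coeff l (Psi E κ k t X))
      = PowerSeries.coeff l (Psi (fun j => φ (E j)) κ k t (fun m => φ (X m))) := by
  have h := congrArg (PowerSeries.coeff l) (Phi_map φ E κ k (tw E t X) t)
  rw [PowerSeries.coeff_map] at h
  have e : (fun m => φ (tw E t X m)) = tw (fun j => φ (E j)) t (fun m => φ (X m)) := by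
    funext a; simp [tw]
  rw [e] at h
  exact h

theorem Psi_intertwine {E : Fin m → R} (hE : OI E) (hE1 : ∑ j, E j = 1) {κ : Fin m → ℕ → ℂ} {k : ℕ}
    {D : Fin m → Fin m → ℕ} (t : BT (Fin m)) (hG : t.Good κ k D) (ht : t.leaves = Finset.univ) (X X' : ℕ → R)
    (γ : R) :
    (∀ l < k - 1, γ * PowerSeries.coeff l (Psi E κ k t X) = PowerSeries.coeff l (Psi E κ k t X') * γ) ↔
      ((∀ j, γ * E j = E j * γ) ∧
        ∀ s s', s ≠ s' → ∀ l < D s s', γ * (E s * X l * E s') = (E s * X' l * E s') * γ) := by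
  have := Psi_gen (R := R × R) (E := fun j => (E j, E j)) (κ := κ) (k := k) (D := D)
    (fun j j' => by
      ext
      · have := hE j j'; simp only [Prod.fst_mul, this]; split_ifs <;> rfl
      · have := hE j j'; simp only [Prod.snd_mul, this]; split_ifs <;> rfl)
    (by ext <;> simp [Prod.fst_sum, Prod.snd_sum, hE1]) t hG ht (fun l => (X l, X' l)) (intSA γ)
  simp only [mem_intSA, Prod.fst_mul, Prod.snd_mul] at this
  have e1 := fun l => Psi_map (AlgHom.fst ℂ R R) (fun j => (E j, E j)) κ k (fun l => (X l, X' l)) t l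
  have e2 := fun l => Psi_map (AlgHom.snd ℂ R R) (fun j => (E j, E j)) κ k (fun l => (X l, X' l)) t l
  simp only [AlgHom.fst_apply, AlgHom.snd_apply] at e1 e2
  simp only [e1, e2] at this
  exact this

/-- `Psi` only depends on the off-diagonal blocks of `X` below `D`. -/
theorem Psi_congr {E : Fin m → R} (hE : OI E) {κ : Fin m → ℕ → ℂ} {k : ℕ}
    {D : Fin m → Fin m → ℕ} (t : BT (Fin m)) (hG : t.Good κ k D) (X X' : ℕ → R)
    (h : ∀ s s', s ≠ s' → ∀ l < D s s', E s * X l * E s' = E s * X' l * E s') :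
    Psi E κ k t X = Psi E κ k t X' := by
  refine Phi_congr _ _ t hG fun s _ s' _ hne l hl => ?_
  rw [tw_block hE, tw_block hE, h s s' hne l hl]

end LocSec
end

noncomputable section
section SimSec

/-- Product of shifted endomorphisms. -/
def lp {V : Type} [AddCommGroup V] [Module ℂ V] (N : Module.End ℂ V) (l : List ℂ) : Module.End ℂ V :=
  (l.map fun z => N - z • 1).prod

theorem lp_comm {V : Type} [AddCommGroup V] [Module ℂ V] (N : Module.End ℂ V) (l : List ℂ) (z : ℂ) :
    Commute (N - z • 1) (lp N l) := by
  apply Commute.list_prod_right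
  intro x hx
  obtain ⟨y, -, rfl⟩ := List.mem_map.1 hx
  have h1 : Commute N (y • (1 : Module.End ℂ V)) := (Commute.one_right N).smul_right y
  have h2 : Commute (z • (1 : Module.End ℂ V)) N := (Commute.one_left N).smul_left z
  have h3 : Commute (z • (1 : Module.End ℂ V)) (y • 1) := ((Commute.one_right _).smul_right y)
  exact ((Commute.refl N).sub_right h1).sub_left (h2.sub_right h3)

theorem lp_cons {V : Type} [AddCommGroup V] [Module ℂ V] (N : Module.End ℂ V) (z : ℂ) (l : List ℂ) :
    lp N (z :: l) = (N - z • 1) * lp N l := by simp [lp]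

theorem extend_iso {V V' : Type} [AddCommGroup V] [Module ℂ V] [AddCommGroup V'] [Module ℂ V']
    [FiniteDimensional ℂ V] [FiniteDimensional ℂ V'] (M : Module.End ℂ V) (M' : Module.End ℂ V')
    (hdim : Module.finrank ℂ V = Module.finrank ℂ V')
    (φ0 : LinearMap.range M ≃ₗ[ℂ] LinearMap.range M')
    (h0 : ∀ x : LinearMap.range M, (φ0 ⟨M x, LinearMap.mem_range_self M _⟩ : V') = M' (φ0 x)) :
    ∃ φ : V ≃ₗ[ℂ] V', ∀ v, φ (M v) = M' (φ v) := by
  have hWf : Module.finrank ℂ (LinearMap.range M) = Module.finrank ℂ (LinearMap.range M') := LinearEquiv.finrank_eq φ0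
  have hKf : Module.finrank ℂ (LinearMap.ker M) = Module.finrank ℂ (LinearMap.ker M') := by
    have h1 := LinearMap.finrank_range_add_finrank_ker M
    have h2 := LinearMap.finrank_range_add_finrank_ker M'
    omega
  have hC : ∀ (U : Type) [AddCommGroup U] [Module ℂ U] [FiniteDimensional ℂ U] (A B : Submodule ℂ U),
      ∃ C : Submodule ℂ U, C ≤ B ∧ Disjoint A C ∧ (A ⊓ B) ⊔ C = B ∧
        Module.finrank ℂ C + Module.finrank ℂ (A ⊓ B : Submodule ℂ U) = Module.finrank ℂ B := by
    intro U _ _ _ A B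
    obtain ⟨c, hc⟩ := exists_isCompl (A ⊓ B)
    have e : (A ⊓ B) ⊔ (c ⊓ B) = B := by
      rw [← sup_inf_assoc_of_le c (inf_le_right : A ⊓ B ≤ B), hc.sup_eq_top, top_inf_eq]
    have d : Disjoint A (c ⊓ B) := by
      rw [disjoint_iff, ← le_bot_iff, ← hc.inf_eq_bot]
      exact le_inf (le_inf inf_le_left (inf_le_right.trans inf_le_right)) (inf_le_right.trans inf_le_left)
    refine ⟨c ⊓ B, inf_le_right, d, e, ?_⟩
    have := Submodule.finrank_sup_add_finrank_inf_eq (c ⊓ B) (A ⊓ B)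
    rw [sup_comm, e] at this
    have d2 : (c ⊓ B) ⊓ (A ⊓ B) = ⊥ := by
      rw [← le_bot_iff, ← hc.inf_eq_bot]
      exact le_inf inf_le_right (inf_le_left.trans inf_le_left)
    rw [d2, finrank_bot] at this
    omega
  obtain ⟨C, hCK, hCd, hCs, hCf⟩ := hC V (LinearMap.range M) (LinearMap.ker M)
  obtain ⟨C', hCK', hCd', hCs', hCf'⟩ := hC V' (LinearMap.range M') (LinearMap.ker M')
  have hWK : Module.finrank ℂ ((LinearMap.range M) ⊓ (LinearMap.ker M) : Submodule ℂ V) = Module.finrank ℂ ((LinearMap.range M') ⊓ (LinearMap.ker M') : Submodule ℂ V') := by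
    have e : ((LinearMap.ker M).comap (LinearMap.range M).subtype).map (φ0 : (LinearMap.range M) →ₗ[ℂ] (LinearMap.range M')) = (LinearMap.ker M').comap (LinearMap.range M').subtype := by
      ext y
      constructor
      · rintro ⟨x, hx, rfl⟩
        change M' (φ0 x) = 0
        have hx' : M x = 0 := hx
        rw [← h0 x]
        have : (⟨M x, LinearMap.mem_range_self M _⟩ : (LinearMap.range M)) = 0 := Subtype.ext hx'
        rw [this, map_zero]; rfl
      · intro hy
        refine ⟨φ0.symm y, ?_, by simp⟩
        change M (φ0.symm y) = 0
        have hy' : M' y = 0 := hy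
        have := h0 (φ0.symm y)
        rw [LinearEquiv.apply_symm_apply, hy'] at this
        have h3 : φ0 ⟨M (φ0.symm y), LinearMap.mem_range_self M _⟩ = 0 := Subtype.ext this
        have h4 := (LinearEquiv.map_eq_zero_iff φ0).1 h3
        exact congrArg Subtype.val h4
    have e1 := LinearEquiv.finrank_map_eq φ0 ((LinearMap.ker M).comap (LinearMap.range M).subtype)
    rw [e] at e1
    have f1 : Module.finrank ℂ ((LinearMap.ker M).comap (LinearMap.range M).subtype) = Module.finrank ℂ ((LinearMap.range M) ⊓ (LinearMap.ker M) : Submodule ℂ V) := by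
      rw [← Submodule.map_comap_subtype]
      exact (Submodule.finrank_map_subtype_eq _ _).symm
    have f2 : Module.finrank ℂ ((LinearMap.ker M').comap (LinearMap.range M').subtype) = Module.finrank ℂ ((LinearMap.range M') ⊓ (LinearMap.ker M') : Submodule ℂ V') := by
      rw [← Submodule.map_comap_subtype]
      exact (Submodule.finrank_map_subtype_eq _ _).symm
    omega
  have hCC : Module.finrank ℂ C = Module.finrank ℂ C' := by omega
  let pC : C ≃ₗ[ℂ] C' := LinearEquiv.ofFinrankEq _ _ hCC
  obtain ⟨p, hp⟩ := LinearMap.exists_extend ((Submodule.inclusion hCK').comp (pC : C →ₗ[ℂ] C'))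
  obtain ⟨D, hCD, hD⟩ := hCd.symm.exists_isCompl
  replace hD := hD.symm
  have hM' : Function.Surjective M'.rangeRestrict := fun y => by
    obtain ⟨y, x, rfl⟩ := y; exact ⟨x, rfl⟩
  obtain ⟨σ, hσ⟩ := M'.rangeRestrict.exists_rightInverse_of_surjective (LinearMap.range_eq_top.2 hM')
  have hσ' : ∀ y : (LinearMap.range M'), M' (σ y) = y := fun y => congrArg Subtype.val (LinearMap.congr_fun hσ y)
  let ε : V →ₗ[ℂ] V' := σ.comp ((φ0 : (LinearMap.range M) →ₗ[ℂ] (LinearMap.range M')).comp M.rangeRestrict) + (LinearMap.ker M').subtype.comp p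
  let φ : V →ₗ[ℂ] V' := LinearMap.ofIsCompl hD ((LinearMap.range M').subtype.comp (φ0 : (LinearMap.range M) →ₗ[ℂ] (LinearMap.range M'))) (ε.comp D.subtype)
  have φW : ∀ w : (LinearMap.range M), φ w = φ0 w := fun w => LinearMap.ofIsCompl_left_apply hD w
  have φD : ∀ d : D, φ d = ε d := fun d => LinearMap.ofIsCompl_right_apply hD d
  have hε : ∀ v, M' (ε v) = φ0 (M.rangeRestrict v) := by
    intro v
    change M' (σ (φ0 (M.rangeRestrict v)) + (p v : V')) = _
    rw [map_add, hσ']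
    have : M' (p v : V') = 0 := (p v).2
    rw [this, add_zero]
  have hφ : ∀ v, φ (M v) = M' (φ v) := by
    intro v
    obtain ⟨w, d, hw⟩ : ∃ (w : (LinearMap.range M)) (d : D), v = w + d := by
      have := hD.sup_eq_top
      have hv : v ∈ (LinearMap.range M) ⊔ D := this ▸ Submodule.mem_top
      obtain ⟨w, hw, d, hd, rfl⟩ := Submodule.mem_sup.1 hv
      exact ⟨⟨w, hw⟩, ⟨d, hd⟩, rfl⟩
    rw [hw, map_add, map_add, map_add, map_add, φW w, φD d, hε]
    congr 1
    · rw [← h0 w]; exact φW ⟨M w, _⟩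
    · exact φW (M.rangeRestrict d)
  have hinj : Function.Injective φ := by
    rw [← LinearMap.ker_eq_bot, LinearMap.ker_eq_bot']
    intro v hv
    have h1 : φ (M v) = 0 := by rw [hφ, hv, map_zero]
    have h2 := φW (M.rangeRestrict v)
    have h3 : φ0 (M.rangeRestrict v) = 0 := Subtype.ext (h2.symm.trans h1)
    have h4 : M v = 0 := congrArg Subtype.val ((LinearEquiv.map_eq_zero_iff φ0).1 h3)
    have hvK : v ∈ (LinearMap.ker M) := h4
    rw [← hCs] at hvK
    obtain ⟨u, hu, c, hc, rfl⟩ := Submodule.mem_sup.1 hvK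
    have hcM : M c = 0 := hCK hc
    have e1 : φ c = (pC ⟨c, hc⟩ : V') := by
      have := φD ⟨c, hCD hc⟩
      rw [this]
      change σ (φ0 (M.rangeRestrict c)) + (p c : V') = _
      have z : M.rangeRestrict c = 0 := Subtype.ext hcM
      rw [z, map_zero, map_zero, zero_add]
      have := LinearMap.congr_fun hp ⟨c, hc⟩
      exact congrArg Subtype.val this
    have e2 : φ u = φ0 ⟨u, hu.1⟩ := φW ⟨u, hu.1⟩
    rw [map_add, e1, e2] at hv
    have hmem : (pC ⟨c, hc⟩ : V') ∈ (LinearMap.range M') ⊓ C' := by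
      refine ⟨?_, (pC ⟨c, hc⟩).2⟩
      have : (pC ⟨c, hc⟩ : V') = -(φ0 ⟨u, hu.1⟩ : V') := by rw [eq_neg_iff_add_eq_zero, add_comm]; exact hv
      rw [this]; exact neg_mem (φ0 ⟨u, hu.1⟩).2
    rw [hCd'.eq_bot, Submodule.mem_bot] at hmem
    rw [hmem, add_zero] at hv
    have c0 : (⟨c, hc⟩ : C) = 0 := (LinearEquiv.map_eq_zero_iff pC).1 (Subtype.ext hmem)
    have u0 : (⟨u, hu.1⟩ : (LinearMap.range M)) = 0 := (LinearEquiv.map_eq_zero_iff φ0).1 (Subtype.ext hv)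
    have c1 : c = 0 := congrArg Subtype.val c0
    have u1 : u = 0 := congrArg Subtype.val u0
    rw [c1, u1, add_zero]
  exact ⟨LinearEquiv.ofInjectiveOfFinrankEq φ hinj hdim, hφ⟩

theorem restr_key {U : Type} [AddCommGroup U] [Module ℂ U] [FiniteDimensional ℂ U] (T A : Module.End ℂ U) (z : ℂ)
    (hA : A = T - z • (1 : Module.End ℂ U)) :
    ∃ T0 : Module.End ℂ (LinearMap.range A),
      (∀ x, (T0 x : U) = T x) ∧
      ∀ l' : List ℂ, (∀ x : LinearMap.range A, (lp T0 l' x).val = lp T l' x) ∧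
        Module.finrank ℂ (LinearMap.range (lp T0 l')) = Module.finrank ℂ (LinearMap.range (lp T (z :: l'))) := by
  have hmaps : ∀ x ∈ LinearMap.range A, T x ∈ LinearMap.range A := by
    rintro x ⟨y, rfl⟩
    exact ⟨T y, by simp [hA]⟩
  obtain ⟨T0, hT0⟩ : ∃ T0 : Module.End ℂ (LinearMap.range A), ∀ x, (T0 x : U) = T x :=
    ⟨T.restrict hmaps, fun x => rfl⟩
  refine ⟨T0, hT0, fun l' => ?_⟩
  have e : ∀ l' : List ℂ, ∀ x : LinearMap.range A, (lp T0 l' x).val = lp T l' x := by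
    intro l'
    induction l' with
    | nil => intro x; rfl
    | cons y l' ih' =>
      intro x
      rw [lp_cons, lp_cons, Module.End.mul_apply, Module.End.mul_apply, ← ih' x,
        LinearMap.sub_apply, LinearMap.sub_apply, ← hT0]
      rfl
  refine ⟨e l', ?_⟩
  rw [← Submodule.finrank_map_subtype_eq (LinearMap.range A)]
  have : (LinearMap.range (lp T0 l')).map (LinearMap.range A).subtype = LinearMap.range (lp T (z :: l')) := by
    rw [lp_cons, (lp_comm T l' z).eq, ← hA]
    ext y
    constructor
    · rintro ⟨_, ⟨⟨x, ⟨u, rfl⟩⟩, rfl⟩, rfl⟩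
      exact ⟨u, (e l' ⟨A u, ⟨u, rfl⟩⟩).symm⟩
    · rintro ⟨u, rfl⟩
      exact ⟨_, ⟨⟨A u, ⟨u, rfl⟩⟩, rfl⟩, e l' ⟨A u, ⟨u, rfl⟩⟩⟩
  rw [this]

theorem similar_of_ranks (l : List ℂ) : ∀ {V V' : Type} [AddCommGroup V] [Module ℂ V] [AddCommGroup V'] [Module ℂ V']
    [FiniteDimensional ℂ V] [FiniteDimensional ℂ V'] (N : Module.End ℂ V) (N' : Module.End ℂ V')
    (h : ∀ k, Module.finrank ℂ (LinearMap.range (lp N (l.take k))) = Module.finrank ℂ (LinearMap.range (lp N' (l.take k))))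
    (h0 : lp N l = 0),
    ∃ φ : V ≃ₗ[ℂ] V', ∀ v, φ (N v) = N' (φ v) := by
  induction l with
  | nil =>
    intro V V' _ _ _ _ _ _ N N' h h0
    have hd := h 0
    rw [show lp N (List.take 0 []) = 1 from rfl, show lp N' (List.take 0 []) = 1 from rfl] at hd; simp only [lp, List.map_nil, List.prod_nil] at h0
    have e1 : LinearMap.range (1 : Module.End ℂ V) = ⊤ := LinearMap.range_id
    have e2 : LinearMap.range (1 : Module.End ℂ V') = ⊤ := LinearMap.range_id
    rw [e1, e2, finrank_top, finrank_top] at hd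
    refine ⟨LinearEquiv.ofFinrankEq _ _ hd, fun v => ?_⟩
    have hz : ∀ v : V, v = 0 := fun v => LinearMap.congr_fun h0 v
    rw [hz (N v), hz v, map_zero, map_zero]
  | cons z l ih =>
    intro V V' _ _ _ _ _ _ N N' h h0
    have hdim : Module.finrank ℂ V = Module.finrank ℂ V' := by
      have hd := h 0
      rw [show lp N (List.take 0 (z::l)) = 1 from rfl, show lp N' (List.take 0 (z::l)) = 1 from rfl] at hd
      have e1 : LinearMap.range (1 : Module.End ℂ V) = ⊤ := LinearMap.range_id
      have e2 : LinearMap.range (1 : Module.End ℂ V') = ⊤ := LinearMap.range_id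
      rwa [e1, e2, finrank_top, finrank_top] at hd
    obtain ⟨T0, hT0, hT⟩ := restr_key N (N - z • 1) z rfl
    obtain ⟨T0', hT0', hT'⟩ := restr_key N' (N' - z • 1) z rfl
    obtain ⟨φ0, hφ0⟩ := ih T0 T0' (fun k => by
        rw [(hT _).2, (hT' _).2]; exact h (k + 1))
      (by
        ext ⟨x, ⟨u, rfl⟩⟩
        rw [(hT l).1]
        have := LinearMap.congr_fun h0 u
        rw [lp_cons, (lp_comm N l z).eq] at this
        exact this)
    obtain ⟨φ, hφ⟩ := extend_iso (N - z • 1) (N' - z • 1) hdim φ0 (by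
      intro x
      have h1 : (⟨(N - z • 1) (x : V), LinearMap.mem_range_self (N - z • 1) _⟩ : LinearMap.range (N - z • 1)) = T0 x - z • x := by
        apply Subtype.ext
        change (N - z • 1) (x : V) = (T0 x : V) - z • (x : V)
        rw [hT0]; simp
      rw [h1, map_sub, hφ0, map_smul]
      change (T0' (φ0 x) : V') - z • (φ0 x : V') = _
      rw [hT0']; simp)
    refine ⟨φ, fun v => ?_⟩
    have := hφ v
    simp only [LinearMap.sub_apply, LinearMap.smul_apply, Module.End.one_apply, map_sub, map_smul] at this
    exact sub_left_injective this
end SimSec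
end

noncomputable section
section LegSec

/-- Left invertible matrices. -/
def LI {a b : ℕ} (F : Matrix (Fin a) (Fin b) ℂ) : Prop := ∃ L : Matrix (Fin b) (Fin a) ℂ, L * F = 1

/-- Right invertible matrices. -/
def RI {a b : ℕ} (F : Matrix (Fin a) (Fin b) ℂ) : Prop := ∃ L : Matrix (Fin b) (Fin a) ℂ, F * L = 1

theorem left_inv_of_ker {a b : ℕ} (F : Matrix (Fin a) (Fin b) ℂ) (h : ∀ v, F.mulVec v = 0 → v = 0) :
    LI F := by
  obtain ⟨l, hl⟩ := LinearMap.exists_leftInverse_of_injective F.mulVecLin (LinearMap.ker_eq_bot'.2 h)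
  refine ⟨LinearMap.toMatrix' l, ?_⟩
  have := congrArg LinearMap.toMatrix' hl
  rw [LinearMap.toMatrix'_comp, LinearMap.toMatrix'_id] at this
  rwa [show LinearMap.toMatrix' F.mulVecLin = F from LinearMap.toMatrix'_toLin' F] at this

theorem right_inv_of_surj {a b : ℕ} (G : Matrix (Fin a) (Fin b) ℂ) (h : ∀ v, ∃ w, G.mulVec w = v) :
    RI G := by
  obtain ⟨l, hl⟩ := LinearMap.exists_rightInverse_of_surjective G.mulVecLin (LinearMap.range_eq_top.2 h)
  refine ⟨LinearMap.toMatrix' l, ?_⟩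
  have := congrArg LinearMap.toMatrix' hl
  rw [LinearMap.toMatrix'_comp, LinearMap.toMatrix'_id] at this
  rwa [show LinearMap.toMatrix' G.mulVecLin = G from LinearMap.toMatrix'_toLin' G] at this

theorem rank_of_inj_surj {a b d : ℕ} (A : Matrix (Fin a) (Fin d) ℂ) (B : Matrix (Fin d) (Fin b) ℂ)
    (L : Matrix (Fin d) (Fin a) ℂ) (K : Matrix (Fin b) (Fin d) ℂ) (hL : L * A = 1) (hK : B * K = 1) :
    (A * B).rank = d := by
  apply le_antisymm
  · exact (Matrix.rank_mul_le_left A B).trans (by simpa using Matrix.rank_le_width A)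
  · have e : L * (A * B) * K = 1 := by
      rw [← Matrix.mul_assoc, hL, Matrix.one_mul, hK]
    have h1 : (L * (A * B) * K).rank = d := by rw [e, Matrix.rank_one]; simp
    exact h1.symm.le.trans <| (Matrix.rank_mul_le_left _ _).trans (Matrix.rank_mul_le_right _ _)

theorem rank_factor {n d : ℕ} (N : Matrix (Fin n) (Fin n) ℂ) (h : N.rank = d) :
    ∃ (F : Matrix (Fin n) (Fin d) ℂ) (L : Matrix (Fin d) (Fin n) ℂ) (Z : Matrix (Fin n) (Fin d) ℂ),
      L * F = 1 ∧ F * (L * N) = N ∧ F = N * Z := by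
  let W := LinearMap.range N.mulVecLin
  have hW : Module.finrank ℂ W = Module.finrank ℂ (Fin d → ℂ) := by
    rw [Module.finrank_fin_fun]; exact h
  let φ : W ≃ₗ[ℂ] (Fin d → ℂ) := LinearEquiv.ofFinrankEq _ _ hW
  let Fl : (Fin d → ℂ) →ₗ[ℂ] (Fin n → ℂ) := W.subtype.comp (φ.symm : (Fin d → ℂ) →ₗ[ℂ] W)
  obtain ⟨l, hl⟩ := LinearMap.exists_leftInverse_of_injective Fl
    (LinearMap.ker_eq_bot.2 (fun x y hxy => φ.symm.injective (Subtype.ext hxy)))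
  obtain ⟨z, hz⟩ := LinearMap.exists_rightInverse_of_surjective N.mulVecLin.rangeRestrict
    (LinearMap.range_rangeRestrict _)
  have e1 : Fl.comp (l.comp N.mulVecLin) = N.mulVecLin := by
    ext1 v
    have : N.mulVecLin v = Fl (φ ⟨N.mulVecLin v, ⟨v, rfl⟩⟩) := by
      change _ = ((φ.symm (φ ⟨N.mulVecLin v, ⟨v, rfl⟩⟩) : W) : Fin n → ℂ)
      rw [LinearEquiv.symm_apply_apply]
    apply LinearMap.ext
    intro t
    have key : ∀ u, Fl (l (N.mulVecLin u)) = N.mulVecLin u := by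
      intro u
      have hu : N.mulVecLin u = Fl (φ ⟨N.mulVecLin u, ⟨u, rfl⟩⟩) := by
        change _ = ((φ.symm (φ ⟨N.mulVecLin u, ⟨u, rfl⟩⟩) : W) : Fin n → ℂ)
        rw [LinearEquiv.symm_apply_apply]
      have h2 := LinearMap.congr_fun hl (φ ⟨N.mulVecLin u, ⟨u, rfl⟩⟩)
      rw [LinearMap.comp_apply, ← hu] at h2
      rw [h2]
      exact hu.symm
    exact key _
  have e2 : Fl = N.mulVecLin.comp (z.comp (φ.symm : (Fin d → ℂ) →ₗ[ℂ] W)) := by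
    apply LinearMap.ext
    intro t
    have := LinearMap.congr_fun hz (φ.symm t)
    exact (congrArg Subtype.val this).symm
  have hN : LinearMap.toMatrix' N.mulVecLin = N := LinearMap.toMatrix'_toLin' N
  refine ⟨LinearMap.toMatrix' Fl, LinearMap.toMatrix' l,
    LinearMap.toMatrix' (z.comp (φ.symm : (Fin d → ℂ) →ₗ[ℂ] W)), ?_, ?_, ?_⟩
  · rw [← LinearMap.toMatrix'_comp, hl, LinearMap.toMatrix'_id]
  · have := congrArg LinearMap.toMatrix' e1
    rwa [LinearMap.toMatrix'_comp, LinearMap.toMatrix'_comp, hN] at this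
  · have := congrArg LinearMap.toMatrix' e2
    rwa [LinearMap.toMatrix'_comp, hN] at this

/-- Products of shifted matrices. -/
def pl {n : ℕ} (T : Matrix (Fin n) (Fin n) ℂ) (ξ : ℕ → ℂ) : ℕ → Matrix (Fin n) (Fin n) ℂ
  | 0 => T - ξ 0 • 1
  | k + 1 => pl T ξ k * (T - ξ (k + 1) • 1)

theorem pl_comm {n : ℕ} (T B : Matrix (Fin n) (Fin n) ℂ) (ξ : ℕ → ℂ) (h : T * B = B * T) (k : ℕ) :
    pl T ξ k * B = B * pl T ξ k := by
  have h1 : ∀ z : ℂ, (T - z • 1) * B = B * (T - z • 1) := by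
    intro z; rw [sub_mul, mul_sub, h]; simp
  induction k with
  | zero => exact h1 _
  | succ k ih => rw [pl, mul_assoc, h1, ← mul_assoc, ih, mul_assoc]

theorem pl_succ' {n : ℕ} (T : Matrix (Fin n) (Fin n) ℂ) (ξ : ℕ → ℂ) (k : ℕ) :
    pl T ξ (k + 1) = (T - ξ (k + 1) • 1) * pl T ξ k := by
  rw [pl, pl_comm]
  rw [mul_sub, sub_mul]; simp

theorem pl_conj {n m : ℕ} (T : Matrix (Fin n) (Fin n) ℂ) (T' : Matrix (Fin m) (Fin m) ℂ) (h : Matrix (Fin m) (Fin n) ℂ) (ξ : ℕ → ℂ)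
    (hh : h * T = T' * h) (k : ℕ) : h * pl T ξ k = pl T' ξ k * h := by
  have h1 : ∀ z : ℂ, h * (T - z • 1) = (T' - z • 1) * h := by
    intro z; rw [Matrix.sub_mul, Matrix.mul_sub, hh]; simp
  induction k with
  | zero => exact h1 _
  | succ k ih => rw [pl, pl, ← Matrix.mul_assoc, ih, Matrix.mul_assoc, h1, Matrix.mul_assoc]

variable {n : ℕ} {d : ℕ → ℕ}

/-- Composite of the leg maps towards the base. -/
def Fc (F0 : Matrix (Fin n) (Fin (d 0)) ℂ) (f : ∀ k, Matrix (Fin (d k)) (Fin (d (k+1))) ℂ) :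
    ∀ k, Matrix (Fin n) (Fin (d k)) ℂ
  | 0 => F0
  | k + 1 => Fc F0 f k * f k

/-- Composite of the leg maps away from the base. -/
def Gc (G0 : Matrix (Fin (d 0)) (Fin n) ℂ) (g : ∀ k, Matrix (Fin (d (k+1))) (Fin (d k)) ℂ) :
    ∀ k, Matrix (Fin (d k)) (Fin n) ℂ
  | 0 => G0
  | k + 1 => g k * Gc G0 g k

/-- The moment equations along a leg. -/
def legEq (ξ : ℕ → ℂ) (F0 : Matrix (Fin n) (Fin (d 0)) ℂ) (G0 : Matrix (Fin (d 0)) (Fin n) ℂ)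
    (f : ∀ k, Matrix (Fin (d k)) (Fin (d (k+1))) ℂ) (g : ∀ k, Matrix (Fin (d (k+1))) (Fin (d k)) ℂ) : Prop :=
  f 0 * g 0 - G0 * F0 = (ξ 0 - ξ 1) • 1 ∧
  ∀ k, f (k+1) * g (k+1) - g k * f k = (ξ (k+1) - ξ (k+2)) • 1

section
variable {ξ : ℕ → ℂ} {F0 : Matrix (Fin n) (Fin (d 0)) ℂ} {G0 : Matrix (Fin (d 0)) (Fin n) ℂ}
    {f : ∀ k, Matrix (Fin (d k)) (Fin (d (k+1))) ℂ} {g : ∀ k, Matrix (Fin (d (k+1))) (Fin (d k)) ℂ}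

theorem leg_F (h : legEq ξ F0 G0 f g) (k : ℕ) :
    Fc F0 f k * (f k * g k) = ((F0 * G0 + ξ 0 • 1) - ξ (k+1) • 1) * Fc F0 f k := by
  induction k with
  | zero =>
    rw [sub_eq_iff_eq_add.1 h.1, Fc]
    simp only [Matrix.mul_add, Matrix.add_mul, Matrix.mul_smul, Matrix.smul_mul]
    simp only [Matrix.mul_add, Matrix.add_mul, Matrix.sub_mul, Matrix.mul_smul, Matrix.mul_one, Matrix.smul_mul,
      Matrix.one_mul, Matrix.mul_assoc, sub_smul, zero_add]
    abel
  | succ k ih =>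
    rw [sub_eq_iff_eq_add.1 (h.2 k), Matrix.mul_add]
    have e : Fc F0 f (k+1) * (g k * f k) = (Fc F0 f k * (f k * g k)) * f k := by
      simp only [Fc, Matrix.mul_assoc]
    rw [e, ih, Matrix.mul_assoc, show Fc F0 f k * f k = Fc F0 f (k+1) from rfl]
    simp only [Matrix.mul_smul, Matrix.mul_one, Matrix.sub_mul, Matrix.smul_mul, Matrix.one_mul, sub_smul,
      show k + 1 + 1 = k + 2 from rfl, Matrix.mul_sub]
    abel

theorem leg_G (h : legEq ξ F0 G0 f g) (k : ℕ) :
    (f k * g k) * Gc G0 g k = Gc G0 g k * ((F0 * G0 + ξ 0 • 1) - ξ (k+1) • 1) := by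
  induction k with
  | zero =>
    rw [sub_eq_iff_eq_add.1 h.1, Gc]
    simp only [Matrix.mul_add, Matrix.add_mul, Matrix.mul_smul, Matrix.smul_mul]
    simp only [Matrix.mul_add, Matrix.add_mul, Matrix.mul_sub, Matrix.mul_smul, Matrix.mul_one, Matrix.smul_mul,
      Matrix.one_mul, Matrix.mul_assoc, sub_smul, zero_add]
    abel
  | succ k ih =>
    rw [sub_eq_iff_eq_add.1 (h.2 k), Matrix.add_mul]
    have e : (g k * f k) * Gc G0 g (k+1) = g k * ((f k * g k) * Gc G0 g k) := by
      simp only [Gc, Matrix.mul_assoc]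
    rw [e, ih, ← Matrix.mul_assoc, show g k * Gc G0 g k = Gc G0 g (k+1) from rfl]
    simp only [Matrix.mul_smul, Matrix.mul_one, Matrix.sub_mul, Matrix.smul_mul, Matrix.one_mul, sub_smul,
      show k + 1 + 1 = k + 2 from rfl, Matrix.mul_sub]
    abel

theorem leg_FG (h : legEq ξ F0 G0 f g) (k : ℕ) :
    Fc F0 f k * Gc G0 g k = pl (F0 * G0 + ξ 0 • 1) ξ k := by
  induction k with
  | zero => simp [Fc, Gc, pl]
  | succ k ih =>
    rw [pl_succ', ← ih, ← Matrix.mul_assoc, ← leg_F h]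
    simp only [Fc, Gc, Matrix.mul_assoc]

theorem leg_iso (h : legEq ξ F0 G0 f g)
    {F0' : Matrix (Fin n) (Fin (d 0)) ℂ} {G0' : Matrix (Fin (d 0)) (Fin n) ℂ}
    {f' : ∀ k, Matrix (Fin (d k)) (Fin (d (k+1))) ℂ} {g' : ∀ k, Matrix (Fin (d (k+1))) (Fin (d k)) ℂ}
    (h' : legEq ξ F0' G0' f' g') (γ : (Matrix (Fin n) (Fin n) ℂ)ˣ)
    (hγ : γ.val * (F0 * G0) = (F0' * G0') * γ.val)
    (hF : ∀ k, LI (Fc F0 f k)) (hG : ∀ k, RI (Gc G0 g k))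
    (hF' : ∀ k, LI (Fc F0' f' k)) (hG' : ∀ k, RI (Gc G0' g' k)) :
    ∃ t : ∀ k, (Matrix (Fin (d k)) (Fin (d k)) ℂ)ˣ,
      γ.val * F0 = F0' * (t 0).val ∧ (t 0).val * G0 = G0' * γ.val ∧
      (∀ k, (t k).val * f k = f' k * (t (k+1)).val) ∧ ∀ k, (t (k+1)).val * g k = g' k * (t k).val := by
  choose L hL using hF
  choose L' hL' using hF'
  choose K hK using hG
  choose K' hK' using hG'
  have hΘ : γ.val * (F0 * G0 + ξ 0 • 1) = (F0' * G0' + ξ 0 • 1) * γ.val := by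
    rw [mul_add, add_mul, hγ]; simp
  have hΘ' : γ⁻¹.val * (F0' * G0' + ξ 0 • 1) = (F0 * G0 + ξ 0 • 1) * γ⁻¹.val := by
    rw [Units.eq_mul_inv_iff_mul_eq, mul_assoc, ← hΘ, ← mul_assoc, Units.inv_mul, one_mul]
  have a1 : ∀ k, Fc F0' f' k * (Gc G0' g' k * γ.val * K k) = γ.val * Fc F0 f k := by
    intro k
    rw [← Matrix.mul_assoc, ← Matrix.mul_assoc, leg_FG h', ← pl_conj _ _ _ ξ hΘ, ← leg_FG h, Matrix.mul_assoc,
      Matrix.mul_assoc, hK, Matrix.mul_one]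
  have a2 : ∀ k, Fc F0 f k * (Gc G0 g k * γ⁻¹.val * K' k) = γ⁻¹.val * Fc F0' f' k := by
    intro k
    rw [← Matrix.mul_assoc, ← Matrix.mul_assoc, leg_FG h, ← pl_conj _ _ _ ξ hΘ', ← leg_FG h', Matrix.mul_assoc,
      Matrix.mul_assoc, hK', Matrix.mul_one]
  have b : ∀ k, (Gc G0 g k * γ⁻¹.val * K' k) * (Gc G0' g' k * γ.val * K k) = 1 := by
    intro k
    rw [← hL k]
    conv_lhs => rw [← Matrix.one_mul (Gc G0 g k * γ⁻¹.val * K' k), ← hL k, Matrix.mul_assoc (L k), a2]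
    rw [Matrix.mul_assoc, Matrix.mul_assoc, a1, ← Matrix.mul_assoc _ γ.val, Units.inv_mul, Matrix.one_mul]
  obtain ⟨t, t1⟩ : ∃ t : ∀ k, (Matrix (Fin (d k)) (Fin (d k)) ℂ)ˣ,
      ∀ k, Fc F0' f' k * (t k).val = γ.val * Fc F0 f k :=
    ⟨fun k => ⟨Gc G0' g' k * γ.val * K k, Gc G0 g k * γ⁻¹.val * K' k, mul_eq_one_comm.1 (b k), b k⟩, a1⟩
  have cancel : ∀ k {ι : Type} (x y : Matrix (Fin (d k)) ι ℂ), Fc F0' f' k * x = Fc F0' f' k * y → x = y := by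
    intro k ι x y hxy
    have := congrArg (fun z => L' k * z) hxy
    simp only [← Matrix.mul_assoc, hL', Matrix.one_mul] at this
    exact this
  have cancelG : ∀ k {ι : Type} (x y : Matrix ι (Fin (d k)) ℂ), x * Gc G0 g k = y * Gc G0 g k → x = y := by
    intro k ι x y hxy
    have := congrArg (fun z => z * K k) hxy
    simp only [Matrix.mul_assoc, hK, Matrix.mul_one] at this
    exact this
  have t2 : ∀ k, (t k).val * Gc G0 g k = Gc G0' g' k * γ.val := by
    intro k
    apply cancel k
    rw [← Matrix.mul_assoc, t1, Matrix.mul_assoc, leg_FG h, pl_conj _ _ _ ξ hΘ, ← leg_FG h', Matrix.mul_assoc]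
  refine ⟨t, (t1 0).symm, t2 0, fun k => ?_, fun k => ?_⟩
  · apply cancel k
    rw [← Matrix.mul_assoc, t1, ← Matrix.mul_assoc]
    exact (Matrix.mul_assoc _ _ _).trans (t1 (k+1)).symm
  · apply cancelG k
    rw [Matrix.mul_assoc, Matrix.mul_assoc, t2]
    exact (t2 (k+1)).trans (Matrix.mul_assoc _ _ _)

end

/-- Construct a leg from an endomorphism. -/
theorem exists_leg (ξ : ℕ → ℂ) (T E : Matrix (Fin n) (Fin n) ℂ) (hE : E * E = E) (hTE : T * E = E * T)
    (hr : ∀ k, (pl T ξ k * E).rank = d k) :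
    ∃ (F0 : Matrix (Fin n) (Fin (d 0)) ℂ) (G0 : Matrix (Fin (d 0)) (Fin n) ℂ)
      (f : ∀ k, Matrix (Fin (d k)) (Fin (d (k+1))) ℂ) (g : ∀ k, Matrix (Fin (d (k+1))) (Fin (d k)) ℂ),
      legEq ξ F0 G0 f g ∧ E * F0 = F0 ∧ G0 * E = G0 ∧ F0 * G0 = (T - ξ 0 • 1) * E ∧
      (∀ k, LI (Fc F0 f k)) ∧ (∀ k, RI (Gc G0 g k)) := by
  have hpE : ∀ k, pl T ξ k * E = E * pl T ξ k := fun k => pl_comm T E ξ hTE k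
  choose F L Z hLF hFL hZ using fun k => rank_factor (pl T ξ k * E) (hr k)
  have c1 : ∀ k, F k * (L k * F (k+1)) = F (k+1) := by
    intro k
    have e : F (k+1) = (pl T ξ k * E) * ((T - ξ (k+1) • 1) * Z (k+1)) := by
      rw [hZ (k+1)]
      rw [← Matrix.mul_assoc, pl]
      have : (T - ξ (k+1) • 1) * E = E * (T - ξ (k+1) • 1) := by rw [sub_mul, mul_sub, hTE]; simp
      rw [Matrix.mul_assoc (pl T ξ k), this, ← Matrix.mul_assoc (pl T ξ k)]
    conv_lhs => rw [e, ← Matrix.mul_assoc (L k), ← Matrix.mul_assoc (F k), hFL]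
    exact e.symm
  have c2 : ∀ k, F (k+1) * (L (k+1) * ((T - ξ (k+1) • 1) * F k)) = (T - ξ (k+1) • 1) * F k := by
    intro k
    have e : (T - ξ (k+1) • 1) * F k = (pl T ξ (k+1) * E) * Z k := by
      rw [hZ k, pl_succ']
      simp only [Matrix.mul_assoc]
    rw [e, ← Matrix.mul_assoc (L (k+1)), ← Matrix.mul_assoc (F (k+1)), hFL]
  have cancel : ∀ k {ι : Type} (x y : Matrix (Fin (d k)) ι ℂ), F k * x = F k * y → x = y := by
    intro k ι x y hxy
    have := congrArg (fun z => L k * z) hxy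
    simp only [← Matrix.mul_assoc, hLF, Matrix.one_mul] at this
    exact this
  have hEF : E * F 0 = F 0 := by
    rw [hZ 0, ← Matrix.mul_assoc, ← Matrix.mul_assoc, ← hpE, Matrix.mul_assoc _ E E, hE]
  have hFc : ∀ k, Fc (F 0) (fun k => L k * F (k+1)) k = F k := by
    intro k
    induction k with
    | zero => rfl
    | succ k ih => rw [Fc, ih, c1]
  have hFG : ∀ k, F k * Gc (L 0 * (pl T ξ 0 * E)) (fun k => L (k+1) * ((T - ξ (k+1) • 1) * F k)) k = pl T ξ k * E := by
    intro k
    induction k with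
    | zero => exact hFL 0
    | succ k ih =>
      rw [Gc, ← Matrix.mul_assoc, c2, Matrix.mul_assoc, ih, pl_succ', Matrix.mul_assoc]
  refine ⟨F 0, L 0 * (pl T ξ 0 * E), fun k => L k * F (k+1), fun k => L (k+1) * ((T - ξ (k+1) • 1) * F k),
    ⟨?_, fun k => ?_⟩, hEF, ?_, hFL 0, fun k => ⟨L k, by rw [hFc, hLF]⟩, fun k => ⟨Z k, ?_⟩⟩
  · apply cancel
    rw [Matrix.mul_sub, ← Matrix.mul_assoc, c1, c2, ← Matrix.mul_assoc, hFL, Matrix.mul_assoc, hEF, pl]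
    simp only [Matrix.sub_mul, Matrix.smul_mul, Matrix.one_mul, Matrix.mul_smul, Matrix.mul_one, sub_smul, zero_add]
    simp only [Matrix.mul_sub, Matrix.mul_smul, Matrix.mul_one]
    abel
  · apply cancel
    rw [Matrix.mul_sub, ← Matrix.mul_assoc, c1, c2, ← Matrix.mul_assoc (F (k+1)), c2, Matrix.mul_assoc, c1]
    simp only [Matrix.sub_mul, Matrix.smul_mul, Matrix.one_mul, Matrix.mul_smul, Matrix.mul_one, sub_smul, zero_add,
      show k + 1 + 1 = k + 2 from rfl, Matrix.mul_sub]
    abel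
  · rw [Matrix.mul_assoc, Matrix.mul_assoc, hE]
  · apply cancel
    rw [← Matrix.mul_assoc, hFG, ← hZ, Matrix.mul_one]

end LegSec
end

noncomputable section
section OrbSec

/-- Inclusion of the block `[i,j]` into `ℂⁿ`. -/
def inc (S : Setup) (i : Fin (S.p+1)) (j : Fin (S.m i)) : Matrix (Fin S.n) (Fin (S.nn i j)) ℂ :=
  Matrix.of fun a y => if a = S.emb i ⟨j, y⟩ then 1 else 0

/-- Projection onto the block `[i,j]`. -/
def pr (S : Setup) (i : Fin (S.p+1)) (j : Fin (S.m i)) : Matrix (Fin (S.nn i j)) (Fin S.n) ℂ :=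
  Matrix.of fun y a => if a = S.emb i ⟨j, y⟩ then 1 else 0

/-- The block idempotent. -/
def EE (S : Setup) (i : Fin (S.p+1)) (j : Fin (S.m i)) : Matrix (Fin S.n) (Fin S.n) ℂ :=
  inc S i j * pr S i j

variable {S : Setup}

theorem pr_mul_apply {ι : Type*} (i) (j) (A : Matrix (Fin S.n) ι ℂ) (y) (b) :
    (pr S i j * A) y b = A (S.emb i ⟨j, y⟩) b := by
  simp [Matrix.mul_apply, pr]

theorem mul_inc_apply {ι : Type*} (i) (j) (A : Matrix ι (Fin S.n) ℂ) (y) (b) :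
    (A * inc S i j) b y = A b (S.emb i ⟨j, y⟩) := by
  simp [Matrix.mul_apply, inc]

theorem pr_inc_same (i) (j) : pr S i j * inc S i j = 1 := by
  ext x y
  rw [pr_mul_apply, inc, Matrix.of_apply, Matrix.one_apply]
  simp

theorem pr_inc_ne (i) (j j') (h : j ≠ j') : pr S i j * inc S i j' = 0 := by
  ext x y
  rw [pr_mul_apply, inc, Matrix.of_apply, Matrix.zero_apply, if_neg]
  intro h'
  have := (S.emb i).injective h'
  exact h (congrArg Sigma.fst this)

theorem pr_mulVec (i) (j) (v : Fin S.n → ℂ) (y) : (pr S i j).mulVec v y = v (S.emb i ⟨j, y⟩) := by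
  simp [Matrix.mulVec, dotProduct, pr]

theorem EE_pr (i) (j) : pr S i j * EE S i j = pr S i j := by
  rw [EE, ← Matrix.mul_assoc, pr_inc_same, Matrix.one_mul]

theorem EE_inc (i) (j) : EE S i j * inc S i j = inc S i j := by
  rw [EE, Matrix.mul_assoc, pr_inc_same, Matrix.mul_one]

theorem EE_OI (i) : OI (EE S i) := by
  intro j j'
  by_cases h : j = j'
  · subst h
    rw [if_pos rfl, EE, Matrix.mul_assoc, ← Matrix.mul_assoc (pr S i j), pr_inc_same, Matrix.one_mul]
  · rw [if_neg h, EE, EE, Matrix.mul_assoc, ← Matrix.mul_assoc (pr S i j), pr_inc_ne i j j' h, Matrix.zero_mul,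
      Matrix.mul_zero]

theorem EE_sq (i) (j) : EE S i j * EE S i j = EE S i j := by
  rw [EE_OI i j j, if_pos rfl]

theorem EE_ne (i) (j j') (h : j ≠ j') : EE S i j * EE S i j' = 0 := by
  rw [EE_OI i j j', if_neg h]

theorem EE_apply (i) (j) (a b : Fin S.n) : EE S i j a b = if a = b ∧ ((S.emb i).symm a).1 = j then 1 else 0 := by
  obtain ⟨⟨j1, x⟩, rfl⟩ := (S.emb i).surjective a
  obtain ⟨⟨j2, y⟩, rfl⟩ := (S.emb i).surjective b
  simp only [EE, Matrix.mul_apply, inc, pr, Matrix.of_apply, EmbeddingLike.apply_eq_iff_eq, Equiv.symm_apply_apply]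
  by_cases h : j1 = j
  · subst h
    by_cases h2 : (⟨j1, x⟩ : Σ j, Fin (S.nn i j)) = ⟨j2, y⟩
    · rw [if_pos ⟨h2, rfl⟩]
      rw [← h2]
      simp
    · rw [if_neg (fun h => h2 h.1)]
      apply Finset.sum_eq_zero
      intro z _
      split_ifs with h3 h4
      · exact absurd (h3.trans h4.symm) h2
      · simp
      · simp
      · simp
  · rw [if_neg (fun h' => h h'.2)]
    apply Finset.sum_eq_zero
    intro z _
    rw [if_neg (fun h' => h (congrArg Sigma.fst h')), zero_mul]

theorem EE_sum (i) : ∑ j, EE S i j = 1 := by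
  ext a b
  rw [Matrix.sum_apply, Matrix.one_apply]
  simp only [EE_apply]
  by_cases h : a = b
  · simp [h]
  · simp [h]

theorem EE_reg (i) (hi : ¬ Iirr S i) (j) : EE S i j = 1 := by
  rw [← EE_sum i]
  have hm : S.m i = 1 := by
    have := S.hm i
    by_contra h
    exact hi (Or.inl (by omega))
  have : Subsingleton (Fin (S.m i)) := by rw [hm]; infer_instance
  rw [Finset.sum_eq_single j (fun b _ hb => absurd (Subsingleton.elim b j) hb) (by simp)]

/-- The exponents in the polynomial encoding. -/
def ka (S : Setup) (i : Fin (S.p+1)) (j : Fin (S.m i)) (l : ℕ) : ℂ :=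
  if l ≤ S.kk i then (S.q i j).coeff (S.kk i - l) else 0

theorem ka_top (i) (j) : ka S i j (S.kk i - 1) = 0 := by
  rw [ka]
  have := S.hkk i
  rw [if_pos (by omega), show S.kk i - (S.kk i - 1) = 1 by omega]
  exact S.hq1 i j

theorem dcnt_symm (i) (j j') : dcnt S i j j' = dcnt S i j' j := by
  rw [dcnt, dcnt, ← Polynomial.natDegree_neg, neg_sub]

theorem exists_tree (i) : ∃ t : BT (Fin (S.m i)), t.leaves = Finset.univ ∧ t.Good (ka S i) (S.kk i) (dcnt S i) := by
  apply exists_good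
  · intro s t hst
    have hne := S.hqdist i s t hst
    obtain ⟨c, hc⟩ : ∃ c, (S.q i s).coeff c ≠ (S.q i t).coeff c := by
      by_contra h
      push Not at h
      exact hne (Polynomial.ext h)
    have hc2 : 2 ≤ c := by
      by_contra h
      have : c = 0 ∨ c = 1 := by omega
      rcases this with rfl | rfl
      · rw [S.hq0, S.hq0] at hc; exact hc rfl
      · rw [S.hq1, S.hq1] at hc; exact hc rfl
    have hck : c ≤ S.kk i := by
      by_contra h
      rw [Polynomial.coeff_eq_zero_of_natDegree_lt (lt_of_le_of_lt (S.hqdeg i s) (by omega)),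
        Polynomial.coeff_eq_zero_of_natDegree_lt (lt_of_le_of_lt (S.hqdeg i t) (by omega))] at hc
      exact hc rfl
    refine ⟨S.kk i - c, by omega, ?_⟩
    rw [ka, ka, if_pos (by omega), if_pos (by omega), show S.kk i - (S.kk i - c) = c by omega]
    exact hc
  · intro s t v h1 h2
    have hv : v ≤ S.kk i := by
      by_contra h
      rw [ka, ka, if_neg h, if_neg h] at h2
      exact h2 rfl
    rw [ka, ka, if_pos hv, if_pos hv] at h2
    rw [dcnt]
    have : (S.q i s - S.q i t).natDegree = S.kk i - v := by
      apply Polynomial.natDegree_eq_of_le_of_coeff_ne_zero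
      · rw [Polynomial.natDegree_le_iff_coeff_eq_zero]
        intro N hN
        rw [Polynomial.coeff_sub, sub_eq_zero]
        by_cases hNk : N ≤ S.kk i
        · have := h1 (S.kk i - N) (by omega)
          rw [ka, ka, if_pos (by omega), if_pos (by omega), show S.kk i - (S.kk i - N) = N by omega] at this
          exact this
        · rw [Polynomial.coeff_eq_zero_of_natDegree_lt (lt_of_le_of_lt (S.hqdeg i s) (by omega)),
            Polynomial.coeff_eq_zero_of_natDegree_lt (lt_of_le_of_lt (S.hqdeg i t) (by omega))]
      · rw [Polynomial.coeff_sub]; exact sub_ne_zero.2 h2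
    rw [this]; omega
  · exact ⟨⟨0, S.hm i⟩, Finset.mem_univ _⟩

/-- A chosen separating tree for the `i`-th point. -/
def tr (S : Setup) (i : Fin (S.p+1)) : BT (Fin (S.m i)) := (exists_tree (S := S) i).choose

theorem tr_leaves (i) : (tr S i).leaves = Finset.univ := (exists_tree (S := S) i).choose_spec.1
theorem tr_good (i) : (tr S i).Good (ka S i) (S.kk i) (dcnt S i) := (exists_tree (S := S) i).choose_spec.2

/-- The coefficient matrix. -/
def cf (A : PMat S) (l : ℕ) : Matrix (Fin S.n) (Fin S.n) ℂ := Matrix.of fun a b => (A a b).coeff l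

/-- A polynomial matrix as a power series of matrices. -/
def toS (A : PMat S) : PowerSeries (Matrix (Fin S.n) (Fin S.n) ℂ) := PowerSeries.mk (cf A)

theorem coeff_toS (A : PMat S) (l) : PowerSeries.coeff l (toS A) = cf A l := by rw [toS, PowerSeries.coeff_mk]

theorem toS_mul (A B : PMat S) : toS (A * B) = toS A * toS B := by
  ext l a b
  rw [PowerSeries.coeff_mul, coeff_toS, Matrix.sum_apply]
  simp only [coeff_toS, cf, Matrix.of_apply, Matrix.mul_apply, Polynomial.finset_sum_coeff, Polynomial.coeff_mul]
  rw [Finset.sum_comm]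

theorem toS_sub (A B : PMat S) : toS (A - B) = toS A - toS B := by
  ext l a b
  simp [coeff_toS, cf]

theorem dvd_iff_Fil (k : ℕ) (A : PMat S) :
    (∀ a b, (Polynomial.X ^ k : Polynomial ℂ) ∣ A a b) ↔ toS A ∈ Fil k := by
  constructor
  · intro h l hl
    rw [coeff_toS]
    ext a b
    exact (Polynomial.X_pow_dvd_iff.1 (h a b)) l hl
  · intro h a b
    rw [Polynomial.X_pow_dvd_iff]
    intro l hl
    have := h l hl
    rw [coeff_toS] at this
    exact congrFun (congrFun this a) b

/-- The block diagonal residue. -/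
def Rh (S : Setup) (i : Fin (S.p+1)) : Matrix (Fin S.n) (Fin S.n) ℂ := ∑ j, inc S i j * S.R i j * pr S i j

theorem inc_mul_pr_apply (i) (j) (A : Matrix (Fin (S.nn i j)) (Fin (S.nn i j)) ℂ) (j1 j2 x y) :
    (inc S i j * A * pr S i j) (S.emb i ⟨j1, x⟩) (S.emb i ⟨j2, y⟩) =
      ∑ u, ∑ v, (if (⟨j1, x⟩ : Σ j, Fin (S.nn i j)) = ⟨j, u⟩ then (1:ℂ) else 0) * A u v *
        (if (⟨j2, y⟩ : Σ j, Fin (S.nn i j)) = ⟨j, v⟩ then 1 else 0) := by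
  simp only [Matrix.mul_apply, inc, pr, Matrix.of_apply, EmbeddingLike.apply_eq_iff_eq, Finset.sum_mul]
  rw [Finset.sum_comm]

theorem Rh_same (i) (j x y) : Rh S i (S.emb i ⟨j, x⟩) (S.emb i ⟨j, y⟩) = S.R i j x y := by
  rw [Rh, Matrix.sum_apply, Finset.sum_eq_single j]
  · rw [inc_mul_pr_apply]
    simp
  · intro j' _ hj'
    rw [inc_mul_pr_apply]
    refine Finset.sum_eq_zero fun u _ => Finset.sum_eq_zero fun v _ => ?_
    rw [if_neg (fun h => hj' (congrArg Sigma.fst h).symm), zero_mul, zero_mul]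
  · simp

theorem Rh_ne (i) (j j' x y) (h : j ≠ j') : Rh S i (S.emb i ⟨j, x⟩) (S.emb i ⟨j', y⟩) = 0 := by
  rw [Rh, Matrix.sum_apply]
  refine Finset.sum_eq_zero fun j1 _ => ?_
  rw [inc_mul_pr_apply]
  refine Finset.sum_eq_zero fun u _ => Finset.sum_eq_zero fun v _ => ?_
  by_cases h1 : j = j1
  · rw [if_neg (c := (⟨j', y⟩ : Σ j, Fin (S.nn i j)) = ⟨j1, v⟩) (fun h' => h (h1.trans (congrArg Sigma.fst h').symm)), mul_zero]
  · rw [if_neg (fun h' => h1 (congrArg Sigma.fst h')), zero_mul, zero_mul]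

/-- Entries of the normal form in block coordinates. -/
def Bent (S : Setup) (i : Fin (S.p+1)) (u v : Σ j : Fin (S.m i), Fin (S.nn i j)) : Polynomial ℂ :=
    if h : u.1 = v.1 then
      (if Fin.cast (by rw [h]) u.2 = v.2 then
          Polynomial.reflect (S.kk i) (S.q i v.1)
        else 0)
        + Polynomial.C
            (S.R i v.1 (Fin.cast (by rw [h]) u.2) v.2)
          * Polynomial.X ^ (S.kk i - 1)
    else 0

theorem Bmat_emb (i) (u v) : Bmat S i (S.emb i u) (S.emb i v) = Bent S i u v := by
  have : Bmat S i (S.emb i u) (S.emb i v) = Bent S i ((S.emb i).symm (S.emb i u)) ((S.emb i).symm (S.emb i v)) := rfl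
  rw [this, Equiv.symm_apply_apply, Equiv.symm_apply_apply]

theorem toS_B (i) : toS (Bmat S i) = Bser (EE S i) (ka S i) Finset.univ + mon (S.kk i) (Rh S i) := by
  have hk := S.hkk i
  ext l a b
  obtain ⟨⟨j1, x⟩, rfl⟩ := (S.emb i).surjective a
  obtain ⟨⟨j2, y⟩, rfl⟩ := (S.emb i).surjective b
  rw [coeff_toS, map_add, Matrix.add_apply, Bser, mon, PowerSeries.coeff_mk, PowerSeries.coeff_mk, Matrix.sum_apply,
    cf, Matrix.of_apply, Bmat_emb]
  simp only [Matrix.smul_apply, EE_apply, EmbeddingLike.apply_eq_iff_eq]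
  by_cases h : j1 = j2
  · subst h
    have e : ∀ z : ℂ, (if l = S.kk i - 1 then Rh S i else 0) (S.emb i ⟨j1, x⟩) (S.emb i ⟨j1, y⟩) =
        if l = S.kk i - 1 then S.R i j1 x y else 0 := by
      intro z; split_ifs
      · exact Rh_same i j1 x y
      · rfl
    rw [e 0]
    rw [Finset.sum_eq_single j1 (fun b _ hb => by
      rw [if_neg (fun h => hb (by simpa using h.2.symm)), smul_zero]) (by simp)]
    simp only [Bent, Equiv.symm_apply_apply, dite_true, and_true, Fin.cast_eq_self, Polynomial.coeff_add,
      Polynomial.coeff_C_mul, Polynomial.coeff_X_pow, Sigma.mk.injEq, heq_eq_eq, true_and]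
    have e1 : (Polynomial.reflect (S.kk i) (S.q i j1)).coeff l = ka S i j1 l := by
      rw [Polynomial.coeff_reflect, ka]
      by_cases hl : l ≤ S.kk i
      · rw [Polynomial.revAt_le hl, if_pos hl]
      · rw [Polynomial.revAt_eq_self_of_lt (by omega), if_neg hl]
        exact Polynomial.coeff_eq_zero_of_natDegree_lt (lt_of_le_of_lt (S.hqdeg i j1) (by omega))
    congr 1
    · split_ifs with h1
      · rw [e1]; simp
      · simp
    · simp
  · have e : (if l = S.kk i - 1 then Rh S i else 0) (S.emb i ⟨j1, x⟩) (S.emb i ⟨j2, y⟩) = 0 := by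
      split_ifs
      · exact Rh_ne i j1 j2 x y h
      · rfl
    rw [e, Bent, dif_neg (by simpa using h), Polynomial.coeff_zero]
    rw [Finset.sum_eq_zero, add_zero]
    intro j _
    rw [if_neg (fun h' => h (congrArg Sigma.fst h'.1)), smul_zero]

/-- `Psi` attached to the `i`-th point. -/
abbrev Ps (S : Setup) (i : Fin (S.p+1)) (X : ℕ → Matrix (Fin S.n) (Fin S.n) ℂ) (l : ℕ) : Matrix (Fin S.n) (Fin S.n) ℂ :=
  PowerSeries.coeff l (Psi (EE S i) (ka S i) (S.kk i) (tr S i) X)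

theorem orbit_fwd (i) (A : PMat S) (h : inOrbit S i A) :
    ∃ (X : ℕ → Matrix (Fin S.n) (Fin S.n) ℂ) (γ : (Matrix (Fin S.n) (Fin S.n) ℂ)ˣ),
      (∀ l < S.kk i - 1, cf A l * γ.val = γ.val * Ps S i X l) ∧
      ∀ j, EE S i j * (γ⁻¹.val * cf A (S.kk i - 1) * γ.val) * EE S i j =
        EE S i j * Ps S i X (S.kk i - 1) * EE S i j + EE S i j * Rh S i * EE S i j := by
  obtain ⟨-, g, hg, hd⟩ := h
  obtain ⟨γ, hγ⟩ := hg
  rw [dvd_iff_Fil, toS_sub, toS_mul, toS_mul, toS_B] at hd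
  obtain ⟨X, h1, h2⟩ := orb_fwd (EE_OI i) (EE_sum i) (S.hkk i) (tr S i) (tr_good i) (tr_leaves i) (toS A) (toS g) (Rh S i) γ
    (by rw [coeff_toS, hγ]; rfl) hd
  simp only [coeff_toS] at h1 h2
  exact ⟨X, γ, h1, h2⟩

theorem orbit_bwd (i) (A : PMat S) (hA : degLT S (S.kk i) A) (T : Matrix (Fin S.n) (Fin S.n) ℂ)
    (γ η : (Matrix (Fin S.n) (Fin S.n) ℂ)ˣ) (X : ℕ → Matrix (Fin S.n) (Fin S.n) ℂ)
    (hη : ∀ j, η.val * EE S i j = EE S i j * η.val) (hT : T * η.val = η.val * Rh S i)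
    (h1 : ∀ l < S.kk i - 1, cf A l * γ.val = γ.val * Ps S i X l)
    (h2 : ∀ j, EE S i j * (γ⁻¹.val * cf A (S.kk i - 1) * γ.val) * EE S i j =
        EE S i j * Ps S i X (S.kk i - 1) * EE S i j + EE S i j * T * EE S i j) :
    inOrbit S i A := by
  refine ⟨hA, ?_⟩
  obtain ⟨g, hg, hd⟩ := orb_bwd (EE_OI i) (EE_sum i) (S.hkk i) (tr S i) (tr_good i) (tr_leaves i) (toS A) (Rh S i) T γ η X
    hη hT (by simpa only [coeff_toS] using h1) (by simpa only [coeff_toS] using h2)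
  let G : PMat S := Matrix.of fun a b => ∑ l ∈ Finset.range (S.kk i), Polynomial.C (PowerSeries.coeff l g a b) * Polynomial.X ^ l
  have hG : ∀ l < S.kk i, cf G l = PowerSeries.coeff l g := by
    intro l hl
    ext a b
    simp only [cf, G, Matrix.of_apply, Polynomial.finset_sum_coeff, Polynomial.coeff_C_mul, Polynomial.coeff_X_pow]
    simp [hl]
  have hGg : toS G - g ∈ Fil (S.kk i) := by
    intro l hl
    rw [map_sub, coeff_toS, hG l hl, sub_self]
  refine ⟨G, ?_, ?_⟩
  · have : (G.map fun r => r.coeff 0) = cf G 0 := rfl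
    rw [this, hG 0 (S.hkk i)]
    exact hg
  · rw [dvd_iff_Fil, toS_sub, toS_mul, toS_mul, toS_B]
    have e : toS G * (Bser (EE S i) (ka S i) Finset.univ + mon (S.kk i) (Rh S i)) - toS A * toS G =
      (g * (Bser (EE S i) (ka S i) Finset.univ + mon (S.kk i) (Rh S i)) - toS A * g) +
       ((toS G - g) * (Bser (EE S i) (ka S i) Finset.univ + mon (S.kk i) (Rh S i)) - toS A * (toS G - g)) := by
      noncomm_ring
    rw [e]
    exact add_mem hd (sub_mem (Fil_mul_right _ hGg) (Fil_mul_left _ hGg))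

end OrbSec
end

noncomputable section
section LegRk

/-- Partial products `∏_{l<k} (N - ξ_l)`. -/
def mp (S : Setup) (i : Fin (S.p+1)) (j : Fin (S.m i)) {d : ℕ} (N : Matrix (Fin d) (Fin d) ℂ) (k : ℕ) :
    Matrix (Fin d) (Fin d) ℂ :=
  (((List.finRange (S.e i j)).take k).map fun l => N - S.xi i j l • 1).prod

/-- The leg dimensions. -/
def rk (S : Setup) (i : Fin (S.p+1)) (j : Fin (S.m i)) (k : ℕ) : ℕ :=
  ((((List.finRange (S.e i j)).take (k + 1)).map fun l => S.R i j - S.xi i j l • 1).prod).rank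

/-- The eigenvalue list extended by zero. -/
def xiN (S : Setup) (i : Fin (S.p+1)) (j : Fin (S.m i)) (k : ℕ) : ℂ :=
  if h : k < S.e i j then S.xi i j ⟨k, h⟩ else 0

variable {S : Setup}

theorem mp_succ (i) (j) {d : ℕ} (N : Matrix (Fin d) (Fin d) ℂ) (k : ℕ) (hk : k < S.e i j) :
    mp S i j N (k+1) = mp S i j N k * (N - xiN S i j k • 1) := by
  rw [mp, List.take_add_one, List.map_append, List.prod_append, xiN, dif_pos hk]
  congr 1
  simp [List.getElem?_eq_getElem, hk]

theorem mp_pl (i) (j) {d : ℕ} (N : Matrix (Fin d) (Fin d) ℂ) (k : ℕ) (hk : k < S.e i j) :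
    mp S i j N (k+1) = pl N (xiN S i j) k := by
  induction k with
  | zero => rw [mp_succ _ _ _ _ hk, pl]; simp [mp]
  | succ k ih => rw [mp_succ _ _ _ _ hk, ih (by omega), pl]

theorem mp_big (i) (j) {d : ℕ} (N : Matrix (Fin d) (Fin d) ℂ) (k : ℕ) (hk : S.e i j ≤ k) :
    mp S i j N k = mp S i j N (S.e i j) := by
  rw [mp, mp, List.take_of_length_le, List.take_of_length_le] <;> simp [hk]

theorem mp_R (i) (j) : mp S i j (S.R i j) (S.e i j) = 0 := by
  rw [mp, List.take_of_length_le, S.hxi]; simp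

theorem rk_mp (i) (j) (k) : rk S i j k = (mp S i j (S.R i j) (k+1)).rank := rfl

theorem rk_big (i) (j) (k) (hk : S.e i j ≤ k + 1) : rk S i j k = 0 := by
  rw [rk_mp, mp_big _ _ _ _ hk, mp_R, Matrix.rank_zero]

theorem pl_big (i) (j) (k) (hk : S.e i j ≤ k + 1) : pl (S.R i j) (xiN S i j) k = 0 := by
  have he := S.he i j
  obtain ⟨c, rfl⟩ : ∃ c, k = S.e i j - 1 + c := ⟨k + 1 - S.e i j, by omega⟩
  clear hk
  induction c with
  | zero =>
    rw [add_zero, ← mp_pl _ _ _ _ (by omega), mp_big _ _ _ _ (by omega), mp_R]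
  | succ c ih => rw [← add_assoc, pl, ih, zero_mul]

theorem rk_pl (i) (j) (k) : (pl (S.R i j) (xiN S i j) k).rank = rk S i j k := by
  by_cases h : S.e i j ≤ k + 1
  · rw [pl_big _ _ _ h, rk_big _ _ _ h, Matrix.rank_zero]
  · rw [rk_mp, mp_pl _ _ _ _ (by omega)]

theorem lp_mp (i) (j) {d : ℕ} (N : Matrix (Fin d) (Fin d) ℂ) (k : ℕ) :
    lp (Matrix.toLinAlgEquiv' N) (((List.finRange (S.e i j)).map (S.xi i j)).take k) =
      Matrix.toLinAlgEquiv' (mp S i j N k) := by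
  rw [lp, mp, map_list_prod, ← List.map_take, List.map_map, List.map_map]
  congr 1
  refine List.map_congr_left fun l _ => ?_
  simp only [Function.comp, map_sub, map_smul, map_one]

theorem similar_R (i) (j) (N : Matrix (Fin (S.nn i j)) (Fin (S.nn i j)) ℂ)
    (h : ∀ k, (pl N (xiN S i j) k).rank = rk S i j k) :
    ∃ η : (Matrix (Fin (S.nn i j)) (Fin (S.nn i j)) ℂ)ˣ, N * η.val = η.val * S.R i j := by
  have he := S.he i j
  have h' : ∀ k ≤ S.e i j, (mp S i j (S.R i j) k).rank = (mp S i j N k).rank := by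
    intro k hk
    rcases k with _ | k
    · simp [mp]
    · rw [mp_pl _ _ N _ (by omega), h, rk_mp]
  have e : ∀ (A : Matrix (Fin (S.nn i j)) (Fin (S.nn i j)) ℂ),
      Module.finrank ℂ (LinearMap.range (Matrix.toLinAlgEquiv' A)) = A.rank := fun A => rfl
  obtain ⟨φ, hφ⟩ := similar_of_ranks ((List.finRange (S.e i j)).map (S.xi i j))
    (Matrix.toLinAlgEquiv' (S.R i j)) (Matrix.toLinAlgEquiv' N) (by
      intro k
      rw [lp_mp, lp_mp, e, e]
      by_cases hk : k ≤ S.e i j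
      · exact h' k hk
      · rw [mp_big _ _ _ _ (by omega), mp_big _ _ N _ (by omega)]; exact h' _ le_rfl) (by
      have := lp_mp i j (S.R i j) (S.e i j)
      rw [List.take_of_length_le (by simp)] at this
      rw [this, mp_R, map_zero])
  refine ⟨⟨LinearMap.toMatrix' φ.toLinearMap, LinearMap.toMatrix' φ.symm.toLinearMap, ?_, ?_⟩, ?_⟩
  · rw [← LinearMap.toMatrix'_comp, LinearEquiv.comp_coe, LinearEquiv.symm_trans_self]; exact LinearMap.toMatrix'_id
  · rw [← LinearMap.toMatrix'_comp, LinearEquiv.comp_coe, LinearEquiv.self_trans_symm]; exact LinearMap.toMatrix'_id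
  · apply Matrix.toLin'.injective
    show Matrix.toLin' (N * LinearMap.toMatrix' φ.toLinearMap) = Matrix.toLin' (LinearMap.toMatrix' φ.toLinearMap * S.R i j)
    rw [Matrix.toLin'_mul, Matrix.toLin'_mul, Matrix.toLin'_toMatrix']
    ext1 v
    ext1
    simpa using (hφ (Pi.single v 1)).symm

theorem pr_Rh (i) (j) : pr S i j * Rh S i = S.R i j * pr S i j := by
  rw [Rh, Matrix.mul_sum, Finset.sum_eq_single j]
  · rw [Matrix.mul_assoc, ← Matrix.mul_assoc, pr_inc_same, Matrix.one_mul]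
  · intro j' _ h
    rw [Matrix.mul_assoc, ← Matrix.mul_assoc, pr_inc_ne _ _ _ h.symm, Matrix.zero_mul]
  · simp

theorem Rh_inc (i) (j) : Rh S i * inc S i j = inc S i j * S.R i j := by
  rw [Rh, Matrix.sum_mul, Finset.sum_eq_single j]
  · rw [Matrix.mul_assoc, pr_inc_same, Matrix.mul_one]
  · intro j' _ h
    rw [Matrix.mul_assoc, pr_inc_ne _ _ _ h, Matrix.mul_zero]
  · simp

theorem Rh_EE (i) (j) : Rh S i * EE S i j = EE S i j * Rh S i := by
  rw [EE, ← Matrix.mul_assoc, Rh_inc, Matrix.mul_assoc _ _ (Rh S i), pr_Rh, Matrix.mul_assoc]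

theorem rank_Rh (i) (j) (k) : (pl (Rh S i) (xiN S i j) k * EE S i j).rank = rk S i j k := by
  have e : pl (Rh S i) (xiN S i j) k * EE S i j = inc S i j * pl (S.R i j) (xiN S i j) k * pr S i j := by
    rw [pl_comm _ _ _ (Rh_EE i j), EE, Matrix.mul_assoc, pl_conj _ _ _ _ (pr_Rh i j), Matrix.mul_assoc]
  rw [e, ← rk_pl]
  apply le_antisymm
  · exact (Matrix.rank_mul_le_left _ _).trans (Matrix.rank_mul_le_right _ _)
  · have : pl (S.R i j) (xiN S i j) k = pr S i j * (inc S i j * pl (S.R i j) (xiN S i j) k * pr S i j) * inc S i j := by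
      simp only [Matrix.mul_assoc, pr_inc_same, Matrix.mul_one]
      rw [← Matrix.mul_assoc, pr_inc_same, Matrix.one_mul]
    conv_lhs => rw [this]
    exact (Matrix.rank_mul_le_left _ _).trans (Matrix.rank_mul_le_right _ _)

end LegRk
end

noncomputable section
section GDSec

/-- Positions in legs. -/
abbrev Leg (S : Setup) := Σ i : Fin (S.p+1), Σ j : Fin (S.m i), ℕ

/-- Global data encoding a representation. -/
structure GD (S : Setup) where
  X : Fin (S.p+1) → ℕ → Matrix (Fin S.n) (Fin S.n) ℂ
  P : Fin (S.p+1) → (Matrix (Fin S.n) (Fin S.n) ℂ)ˣ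
  Q : Fin (S.p+1) → Matrix (Fin S.n) (Fin S.n) ℂ
  F : ∀ i j k, Matrix (Fin S.n) (Fin (rk S i j k)) ℂ
  G : ∀ i j k, Matrix (Fin (rk S i j k)) (Fin S.n) ℂ
  f : ∀ a b : Leg S, Matrix (Fin (rk S a.1 a.2.1 a.2.2)) (Fin (rk S b.1 b.2.1 b.2.2)) ℂ
  g : ∀ a b : Leg S, Matrix (Fin (rk S b.1 b.2.1 b.2.2)) (Fin (rk S a.1 a.2.1 a.2.2)) ℂ

variable {S : Setup}

/-- Leg maps. -/
def GD.lf (D : GD S) (i j) (k : ℕ) : Matrix (Fin (rk S i j k)) (Fin (rk S i j (k+1))) ℂ := D.f ⟨i, j, k⟩ ⟨i, j, k+1⟩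
/-- Leg maps. -/
def GD.lg (D : GD S) (i j) (k : ℕ) : Matrix (Fin (rk S i j (k+1))) (Fin (rk S i j k)) ℂ := D.g ⟨i, j, k⟩ ⟨i, j, k+1⟩

/-- The diagonal part. -/
def GD.Th (D : GD S) (i : Fin (S.p+1)) : Matrix (Fin S.n) (Fin S.n) ℂ := ∑ j, (xiN S i j 0 • EE S i j + D.F i j 0 * D.G i j 0)

/-- The residues. -/
def GD.res (D : GD S) (i : Fin (S.p+1)) : Matrix (Fin S.n) (Fin S.n) ℂ :=
  if ¬ Iirr S i then D.Th i
  else if i = 0 then ∑ i', (if ¬ Iirr S i' then - D.Th i' else if i' = 0 then 0 else D.Q i' * (D.P i').val)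
  else - (D.Q i * (D.P i).val)

/-- The non-residue coefficients. -/
def GD.co (D : GD S) (i : Fin (S.p+1)) (l : ℕ) : Matrix (Fin S.n) (Fin S.n) ℂ :=
  ((D.P i)⁻¹).val * Ps S i (D.X i) l * (D.P i).val

theorem irr0 : Iirr S 0 := Or.inr rfl

theorem GD.res_sum (D : GD S) : ∑ i, D.res i = 0 := by
  have : ∀ i, D.res i = (if i = 0 then
      ∑ i', (if ¬ Iirr S i' then - D.Th i' else if i' = 0 then 0 else D.Q i' * (D.P i').val) else 0)
      - (if ¬ Iirr S i then - D.Th i else if i = 0 then 0 else D.Q i * (D.P i).val) := by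
    intro i
    rw [GD.res]
    by_cases h : Iirr S i
    · by_cases h0 : i = 0
      · simp only [h, h0, not_true, if_false, if_true, irr0, sub_zero]
      · simp only [h, h0, not_true, if_false, if_true, zero_sub]
    · have h0 : i ≠ 0 := fun e => h (e ▸ irr0)
      simp only [h, h0, not_false_iff, if_true, if_false, zero_sub, neg_neg]
  rw [Finset.sum_congr rfl fun i _ => this i, Finset.sum_sub_distrib, Finset.sum_ite_eq' Finset.univ 0,
    if_pos (Finset.mem_univ _), sub_self]

/-- Admissible data. -/
structure GD.Ok (D : GD S) : Prop where
  P1 : ∀ i, (¬ Iirr S i ∨ i = 0) → D.P i = 1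
  EF : ∀ i j, EE S i j * D.F i j 0 = D.F i j 0
  GE : ∀ i j, D.G i j 0 * EE S i j = D.G i j 0
  leg : ∀ i j, legEq (xiN S i j) (D.F i j 0) (D.G i j 0) (D.lf i j) (D.lg i j)
  star : ∀ i j, EE S i j * ((D.P i).val * D.res i * ((D.P i)⁻¹).val) * EE S i j =
    EE S i j * Ps S i (D.X i) (S.kk i - 1) * EE S i j + EE S i j * D.Th i * EE S i j

theorem Th_block (D : GD S) (EF : ∀ i j, EE S i j * D.F i j 0 = D.F i j 0)
    (GE : ∀ i j, D.G i j 0 * EE S i j = D.G i j 0) (i j) :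
    EE S i j * D.Th i * EE S i j = xiN S i j 0 • EE S i j + D.F i j 0 * D.G i j 0 := by
  rw [GD.Th, Matrix.mul_sum, Matrix.sum_mul, Finset.sum_eq_single j]
  · rw [mul_add, add_mul, mul_smul_comm, smul_mul_assoc, EE_sq, EE_sq, ← Matrix.mul_assoc, EF, Matrix.mul_assoc, GE]
  · intro j' _ h
    rw [mul_add, add_mul, mul_smul_comm, smul_mul_assoc, EE_ne _ _ _ h.symm, zero_mul, smul_zero,
      ← EF i j', ← Matrix.mul_assoc, ← Matrix.mul_assoc, EE_ne _ _ _ h.symm]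
    simp
  · simp

theorem Ok.block {D : GD S} (h : D.Ok) (i j) :
    D.F i j 0 * D.G i j 0 = EE S i j * ((D.P i).val * D.res i * ((D.P i)⁻¹).val) * EE S i j -
      EE S i j * Ps S i (D.X i) (S.kk i - 1) * EE S i j - xiN S i j 0 • EE S i j := by
  rw [h.star, Th_block D h.EF h.GE]; abel

/-- Stabilizer algebra of a subspace. -/
def stab {n : ℕ} (W : Submodule ℂ (Fin n → ℂ)) : Subalgebra ℂ (Matrix (Fin n) (Fin n) ℂ) where
  carrier := {A | ∀ v ∈ W, A.mulVec v ∈ W}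
  mul_mem' := by
    intro a b ha hb v hv
    rw [← Matrix.mulVec_mulVec]
    exact ha _ (hb _ hv)
  add_mem' := by
    intro a b ha hb v hv
    rw [Matrix.add_mulVec]
    exact W.add_mem (ha _ hv) (hb _ hv)
  algebraMap_mem' := by
    intro r v hv
    rw [Algebra.algebraMap_eq_smul_one, Matrix.smul_mulVec, Matrix.one_mulVec]
    exact W.smul_mem _ hv

theorem mem_stab {n : ℕ} {W : Submodule ℂ (Fin n → ℂ)} {A} : A ∈ stab W ↔ ∀ v ∈ W, A.mulVec v ∈ W := Iff.rfl

/-- Transported subspace. -/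
def tw' {n : ℕ} (W : Submodule ℂ (Fin n → ℂ)) (P : (Matrix (Fin n) (Fin n) ℂ)ˣ) : Submodule ℂ (Fin n → ℂ) :=
  W.comap (P⁻¹.val).mulVecLin

theorem mem_tw {n : ℕ} {W : Submodule ℂ (Fin n → ℂ)} {P} {v} : v ∈ tw' W P ↔ (P⁻¹.val).mulVec v ∈ W := Iff.rfl

theorem mem_tw_P {n : ℕ} {W : Submodule ℂ (Fin n → ℂ)} {P : (Matrix (Fin n) (Fin n) ℂ)ˣ} {v} :
    P.val.mulVec v ∈ tw' W P ↔ v ∈ W := by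
  rw [mem_tw, Matrix.mulVec_mulVec, Units.inv_mul, Matrix.one_mulVec]

theorem stab_tw {n : ℕ} {W : Submodule ℂ (Fin n → ℂ)} {P : (Matrix (Fin n) (Fin n) ℂ)ˣ} {A} :
    A ∈ stab (tw' W P) ↔ P⁻¹.val * A * P.val ∈ stab W := by
  constructor
  · intro h v hv
    rw [← Matrix.mulVec_mulVec, ← Matrix.mulVec_mulVec]
    exact h _ (mem_tw_P.2 hv)
  · intro h v hv
    have := h _ (mem_tw.1 hv)
    rw [Matrix.mulVec_mulVec, mul_assoc, Units.mul_inv, mul_one, ← Matrix.mulVec_mulVec] at this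
    exact this

/-- Subobjects of the global data. -/
structure SubD (D : GD S) (W : Submodule ℂ (Fin S.n → ℂ)) (U : ∀ i j k, Submodule ℂ (Fin (rk S i j k) → ℂ)) : Prop where
  hE : ∀ i j, EE S i j ∈ stab (tw' W (D.P i))
  hX : ∀ i s s', s ≠ s' → ∀ l < dcnt S i s s', EE S i s * D.X i l * EE S i s' ∈ stab (tw' W (D.P i))
  hQ : ∀ i, Iirr S i → i ≠ 0 → D.Q i * (D.P i).val ∈ stab W
  hF : ∀ i j, ∀ u ∈ U i j 0, (D.F i j 0).mulVec u ∈ tw' W (D.P i)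
  hG : ∀ i j, ∀ v ∈ tw' W (D.P i), (D.G i j 0).mulVec v ∈ U i j 0
  hf : ∀ i j k, ∀ u ∈ U i j (k+1), (D.lf i j k).mulVec u ∈ U i j k
  hg : ∀ i j k, ∀ u ∈ U i j k, (D.lg i j k).mulVec u ∈ U i j (k+1)

/-- Quasi-irreducibility in terms of global data. -/
def QID (D : GD S) : Prop := ∀ W U, SubD D W U →
  (W = ⊥ ∧ ∀ i j k, U i j k = ⊥) ∨ (W = ⊤ ∧ ∀ i j k, U i j k = ⊤)

/-- Irreducibility in terms of global data. -/
def IrrD (D : GD S) : Prop := ∀ W : Submodule ℂ (Fin S.n → ℂ),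
  (∀ i, ∀ l < S.kk i - 1, D.co i l ∈ stab W) → (∀ i, D.res i ∈ stab W) → W = ⊥ ∨ W = ⊤

/-- Leg nondegeneracy. -/
def LegN (D : GD S) : Prop := ∀ i j k, LI (Fc (D.F i j 0) (D.lf i j) k) ∧ RI (Gc (D.G i j 0) (D.lg i j) k)

theorem co_stab (D : GD S) (W : Submodule ℂ (Fin S.n → ℂ)) (i) :
    (∀ l < S.kk i - 1, D.co i l ∈ stab W) ↔ ((∀ j, EE S i j ∈ stab (tw' W (D.P i))) ∧
      ∀ s s', s ≠ s' → ∀ l < dcnt S i s s', EE S i s * D.X i l * EE S i s' ∈ stab (tw' W (D.P i))) := by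
  rw [← Psi_gen (EE_OI i) (EE_sum i) (tr S i) (tr_good i) (tr_leaves i)]
  refine forall_congr' fun l => forall_congr' fun hl => ?_
  rw [stab_tw]; rfl

theorem Psres_mem (X : ℕ → Matrix (Fin S.n) (Fin S.n) ℂ) (i) (SA : Subalgebra ℂ (Matrix (Fin S.n) (Fin S.n) ℂ))
    (h : ∀ s s', s ≠ s' → ∀ l < dcnt S i s s', EE S i s * X l * EE S i s' ∈ SA) (j) :
    EE S i j * Ps S i X (S.kk i - 1) * EE S i j ∈ SA := by
  rw [Psi_moment (EE_OI i) (tr S i) (tr_good i) (tr_leaves i) X j (ka_top i j)]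
  refine Subalgebra.sum_mem _ fun s _ => Subalgebra.sum_mem _ fun l hl => ?_
  by_cases hs : s = j
  · subst hs; simp [SA.zero_mem]
  · apply SA.smul_mem
    have e : EE S i j * X l * EE S i s * X l * EE S i j = (EE S i j * X l * EE S i s) * (EE S i s * X l * EE S i j) := by
      conv_lhs => rw [← EE_sq i s]
      simp only [mul_assoc]
    rw [e]
    exact SA.mul_mem (h j s (Ne.symm hs) l (by rw [dcnt_symm]; exact Finset.mem_range.1 hl)) (h s j hs l (Finset.mem_range.1 hl))

theorem Th_tw {D : GD S} (h : D.Ok) {W U} (hS : SubD D W U) (i) : D.Th i ∈ stab (tw' W (D.P i)) := by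
  refine Subalgebra.sum_mem _ fun j _ => Subalgebra.add_mem _ (Subalgebra.smul_mem _ (hS.hE i j) _) ?_
  intro v hv
  rw [← Matrix.mulVec_mulVec]
  exact hS.hF i j _ (hS.hG i j _ hv)

theorem tw_one {n : ℕ} (W : Submodule ℂ (Fin n → ℂ)) : tw' W 1 = W := by
  ext v; rw [mem_tw]; simp

theorem qid_of {D : GD S} (h : D.Ok) (hI : IrrD D) (hL : LegN D) : QID D := by
  intro W U hS
  have hTh : ∀ i, ¬ Iirr S i → D.Th i ∈ stab W := by
    intro i hi
    have := Th_tw h hS i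
    rwa [h.P1 i (Or.inl hi), tw_one] at this
  have hW := hI W (fun i => (co_stab D W i).2 ⟨hS.hE i, hS.hX i⟩) (by
    intro i
    rw [GD.res]
    split_ifs with h1 h2
    · refine Subalgebra.sum_mem _ fun i' _ => ?_
      split_ifs with h3 h4
      · exact Subalgebra.zero_mem _
      · exact hS.hQ i' h3 h4
      · exact Subalgebra.neg_mem _ (hTh i' h3)
    · exact Subalgebra.neg_mem _ (hS.hQ i h1 h2)
    · exact hTh i h1)
  have hFc : ∀ i j k, ∀ u ∈ U i j k, (Fc (D.F i j 0) (D.lf i j) k).mulVec u ∈ tw' W (D.P i) := by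
    intro i j k
    induction k with
    | zero => exact hS.hF i j
    | succ k ih => intro u hu; rw [Fc, ← Matrix.mulVec_mulVec]; exact ih _ (hS.hf i j k u hu)
  have hGc : ∀ i j k, ∀ v ∈ tw' W (D.P i), (Gc (D.G i j 0) (D.lg i j) k).mulVec v ∈ U i j k := by
    intro i j k
    induction k with
    | zero => exact hS.hG i j
    | succ k ih => intro u hu; rw [Gc, ← Matrix.mulVec_mulVec]; exact hS.hg i j k _ (ih u hu)
  rcases hW with hW | hW
  · left
    refine ⟨hW, fun i j k => ?_⟩
    rw [Submodule.eq_bot_iff]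
    intro u hu
    have h1 := hFc i j k u hu
    rw [mem_tw, hW, Submodule.mem_bot] at h1
    obtain ⟨L, hL⟩ := (hL i j k).1
    have h2 : (Fc (D.F i j 0) (D.lf i j) k).mulVec u = 0 := by
      rw [← Matrix.one_mulVec ((Fc (D.F i j 0) (D.lf i j) k).mulVec u), ← Units.mul_inv (D.P i), ← Matrix.mulVec_mulVec, h1,
        Matrix.mulVec_zero]
    rw [← Matrix.one_mulVec u, ← hL, ← Matrix.mulVec_mulVec, h2, Matrix.mulVec_zero]
  · right
    refine ⟨hW, fun i j k => ?_⟩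
    rw [Submodule.eq_top_iff']
    intro u
    obtain ⟨K, hK⟩ := (hL i j k).2
    rw [← Matrix.one_mulVec u, ← hK, ← Matrix.mulVec_mulVec]
    apply hGc
    rw [mem_tw, hW]; trivial

theorem irrD_of {D : GD S} (h : D.Ok) (hQ : QID D) : IrrD D := by
  intro W h1 h2
  have hEX := fun i => (co_stab D W i).1 (h1 i)
  have hres : ∀ i, (D.P i).val * D.res i * ((D.P i)⁻¹).val ∈ stab (tw' W (D.P i)) := by
    intro i
    rw [stab_tw]
    have : (D.P i)⁻¹.val * ((D.P i).val * D.res i * ((D.P i)⁻¹).val) * (D.P i).val = D.res i := by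
      simp only [mul_assoc, Units.inv_mul, mul_one]; rw [← mul_assoc, Units.inv_mul, one_mul]
    rw [this]; exact h2 i
  have hFG : ∀ i j, D.F i j 0 * D.G i j 0 ∈ stab (tw' W (D.P i)) := by
    intro i j
    rw [Ok.block h]
    refine Subalgebra.sub_mem _ (Subalgebra.sub_mem _ ?_ (Psres_mem _ i _ (hEX i).2 j)) (Subalgebra.smul_mem _ ((hEX i).1 j) _)
    exact Subalgebra.mul_mem _ (Subalgebra.mul_mem _ ((hEX i).1 j) (hres i)) ((hEX i).1 j)
  have := hQ W (fun i j k => (tw' W (D.P i)).comap (Fc (D.F i j 0) (D.lf i j) k).mulVecLin) ?_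
  · rcases this with h | h
    · exact Or.inl h.1
    · exact Or.inr h.1
  · refine ⟨fun i => (hEX i).1, fun i => (hEX i).2, ?_, ?_, ?_, ?_, ?_⟩
    · intro i hi h0
      have := h2 i
      rw [GD.res, if_neg (not_not.2 hi), if_neg h0] at this
      have := Subalgebra.neg_mem _ this
      rwa [neg_neg] at this
    · intro i j u hu
      exact hu
    · intro i j v hv
      show (D.F i j 0).mulVec _ ∈ tw' W (D.P i)
      rw [Matrix.mulVec_mulVec]
      exact hFG i j v hv
    · intro i j k u hu
      show (Fc (D.F i j 0) (D.lf i j) k).mulVec _ ∈ tw' W (D.P i)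
      rw [Matrix.mulVec_mulVec]
      exact hu
    · intro i j k u hu
      show (Fc (D.F i j 0) (D.lf i j) k * D.lf i j k).mulVec _ ∈ tw' W (D.P i)
      rw [Matrix.mulVec_mulVec, Matrix.mul_assoc, leg_F (h.leg i j), ← Matrix.mulVec_mulVec]
      refine Subalgebra.sub_mem (stab (tw' W (D.P i))) (Subalgebra.add_mem _ (hFG i j) ?_) ?_ _ hu
      · exact Subalgebra.smul_mem _ (Subalgebra.one_mem _) _
      · exact Subalgebra.smul_mem _ (Subalgebra.one_mem _) _

theorem legN_of {D : GD S} (h : D.Ok) (hQ : QID D) : LegN D := by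
  have hn := S.hn
  have htw0 : ∀ P : (Matrix (Fin S.n) (Fin S.n) ℂ)ˣ, tw' ⊥ P = ⊥ := by
    intro P
    rw [Submodule.eq_bot_iff]
    intro v hv
    rw [mem_tw, Submodule.mem_bot] at hv
    rw [← Matrix.one_mulVec v, ← Units.mul_inv P, ← Matrix.mulVec_mulVec, hv, Matrix.mulVec_zero]
  have hne : (⊥ : Submodule ℂ (Fin S.n → ℂ)) ≠ ⊤ := by
    haveI : Nonempty (Fin S.n) := ⟨⟨0, hn⟩⟩
    exact bot_ne_top
  intro i j k
  constructor
  · apply left_inv_of_ker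
    intro v hv
    have := hQ ⊥ (fun i j k => LinearMap.ker (Fc (D.F i j 0) (D.lf i j) k).mulVecLin) ?_
    · rcases this with h | h
      · have h1 := h.2 i j k
        have : v ∈ LinearMap.ker (Fc (D.F i j 0) (D.lf i j) k).mulVecLin := hv
        rwa [h1, Submodule.mem_bot] at this
      · exact absurd h.1 hne
    · have hs : ∀ i A, A ∈ stab (tw' ⊥ (D.P i)) := by
        intro i A
        rw [htw0]
        intro v hv
        rw [Submodule.mem_bot] at hv ⊢
        rw [hv, Matrix.mulVec_zero]
      refine ⟨fun i j => hs _ _, fun i s s' _ l _ => hs _ _, ?_, ?_, ?_, ?_, ?_⟩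
      · intro i _ _ v hv
        rw [Submodule.mem_bot] at hv ⊢
        rw [hv, Matrix.mulVec_zero]
      · intro i j u hu
        rw [htw0]; exact hu
      · intro i j v hv
        rw [htw0, Submodule.mem_bot] at hv
        rw [hv, Matrix.mulVec_zero]; exact Submodule.zero_mem _
      · intro i j k u hu
        show (Fc (D.F i j 0) (D.lf i j) k).mulVec _ = 0
        rw [Matrix.mulVec_mulVec]
        exact hu
      · intro i j k u hu
        have hu' : (Fc (D.F i j 0) (D.lf i j) k).mulVec u = 0 := hu
        show (Fc (D.F i j 0) (D.lf i j) k * D.lf i j k).mulVec _ = 0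
        rw [Matrix.mulVec_mulVec, Matrix.mul_assoc, leg_F (h.leg i j), ← Matrix.mulVec_mulVec, hu', Matrix.mulVec_zero]
  · apply right_inv_of_surj
    have htop : ∀ i A, A ∈ stab (tw' ⊤ (D.P i)) := by
      intro i A v _
      rw [mem_tw]; trivial
    have := hQ ⊤ (fun i j k => LinearMap.range (Gc (D.G i j 0) (D.lg i j) k).mulVecLin) ?_
    · rcases this with h | h
      · exact absurd h.1.symm hne
      · intro v
        have h1 := h.2 i j k
        have : v ∈ LinearMap.range (Gc (D.G i j 0) (D.lg i j) k).mulVecLin := by rw [h1]; trivial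
        exact this
    · refine ⟨fun i j => htop _ _, fun i s s' _ l _ => htop _ _, ?_, ?_, ?_, ?_, ?_⟩
      · intro i _ _ v hv; trivial
      · intro i j u hu; rw [mem_tw]; trivial
      · intro i j v hv; exact ⟨v, rfl⟩
      · rintro i j k u ⟨v, rfl⟩
        refine ⟨((D.F i j 0 * D.G i j 0 + xiN S i j 0 • 1) - xiN S i j (k+1) • 1).mulVec v, ?_⟩
        have := leg_G (h.leg i j) k
        simp only [Matrix.mulVecLin_apply, Matrix.mulVec_mulVec]
        rw [← this, Gc]
        simp only [Matrix.mul_assoc]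
      · rintro i j k u ⟨v, rfl⟩
        refine ⟨v, ?_⟩
        simp only [Matrix.mulVecLin_apply, Matrix.mulVec_mulVec]
        rfl

end GDSec
end

noncomputable section
section AASec
variable {S : Setup}

/-- Block diagonal matrices. -/
def bd (S : Setup) (i : Fin (S.p+1)) (c : ∀ j, Matrix (Fin (S.nn i j)) (Fin (S.nn i j)) ℂ) : Matrix (Fin S.n) (Fin S.n) ℂ :=
  ∑ j, inc S i j * c j * pr S i j

theorem pr_bd (i) (c) (j) : pr S i j * bd S i c = c j * pr S i j := by
  rw [bd, Matrix.mul_sum, Finset.sum_eq_single j]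
  · rw [Matrix.mul_assoc, ← Matrix.mul_assoc, pr_inc_same, Matrix.one_mul]
  · intro j' _ h
    rw [Matrix.mul_assoc, ← Matrix.mul_assoc, pr_inc_ne _ _ _ h.symm, Matrix.zero_mul]
  · simp

theorem bd_inc (i) (c) (j) : bd S i c * inc S i j = inc S i j * c j := by
  rw [bd, Matrix.sum_mul, Finset.sum_eq_single j]
  · rw [Matrix.mul_assoc, pr_inc_same, Matrix.mul_one]
  · intro j' _ h
    rw [Matrix.mul_assoc, pr_inc_ne _ _ _ h, Matrix.mul_zero]
  · simp

theorem bd_mul (i) (c c') : bd S i c * bd S i c' = bd S i (fun j => c j * c' j) := by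
  have e0 : bd S i c = ∑ j, inc S i j * c j * pr S i j := rfl
  rw [e0, Matrix.sum_mul]
  conv_rhs => rw [bd]
  refine Finset.sum_congr rfl fun j _ => ?_
  rw [Matrix.mul_assoc, pr_bd]
  simp only [Matrix.mul_assoc]

theorem bd_one (i) : bd S i (fun j => 1) = 1 := by
  rw [← EE_sum i, bd]
  refine Finset.sum_congr rfl fun j _ => ?_
  rw [Matrix.mul_one, EE]

theorem bd_EE (i) (c) (j) : bd S i c * EE S i j = EE S i j * bd S i c := by
  rw [EE, ← Matrix.mul_assoc, bd_inc, Matrix.mul_assoc _ _ (bd S i c), pr_bd, Matrix.mul_assoc]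

/-- Block diagonal units. -/
def bdU (S : Setup) (i : Fin (S.p+1)) (c : ∀ j, (Matrix (Fin (S.nn i j)) (Fin (S.nn i j)) ℂ)ˣ) : (Matrix (Fin S.n) (Fin S.n) ℂ)ˣ where
  val := bd S i (fun j => (c j).val)
  inv := bd S i (fun j => (c j)⁻¹.val)
  val_inv := by rw [bd_mul]; simp only [Units.mul_inv]; exact bd_one i
  inv_val := by rw [bd_mul]; simp only [Units.inv_mul]; exact bd_one i

/-- Polynomial matrix with given coefficients. -/
def mkP (S : Setup) (c : ℕ → Matrix (Fin S.n) (Fin S.n) ℂ) (k : ℕ) : PMat S :=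
  Matrix.of fun a b => ∑ l ∈ Finset.range k, Polynomial.monomial l (c l a b)

theorem cf_mkP (c : ℕ → Matrix (Fin S.n) (Fin S.n) ℂ) (k l : ℕ) (hl : l < k) : cf (mkP S c k) l = c l := by
  ext a b
  rw [cf, Matrix.of_apply, mkP, Matrix.of_apply, Polynomial.finset_sum_coeff]
  simp [Polynomial.coeff_monomial, hl]

theorem deg_mkP (c : ℕ → Matrix (Fin S.n) (Fin S.n) ℂ) (k : ℕ) : degLT S k (mkP S c k) := by
  intro a b
  rw [Polynomial.degree_lt_iff_coeff_zero]
  intro l hl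
  rw [mkP, Matrix.of_apply, Polynomial.finset_sum_coeff]
  refine Finset.sum_eq_zero fun x hx => ?_
  rw [Polynomial.coeff_monomial, if_neg]
  have := Finset.mem_range.1 hx
  omega

theorem cf_big (A : PMat S) (k l : ℕ) (h : degLT S k A) (hl : k ≤ l) : cf A l = 0 := by
  ext a b
  exact (Polynomial.degree_lt_iff_coeff_zero _ _).1 (h a b) l hl

theorem cf_ext (A A' : PMat S) (h : ∀ l, cf A l = cf A' l) : A = A' := by
  ext a b l
  exact congrFun (congrFun (h l) a) b

theorem cf_conj (A : PMat S) (γ γ' : Matrix (Fin S.n) (Fin S.n) ℂ) (l : ℕ) :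
    cf (γ.map Polynomial.C * A * γ'.map Polynomial.C) l = γ * cf A l * γ' := by
  ext a b
  simp only [cf, Matrix.of_apply, Matrix.mul_apply, Matrix.map_apply, Polynomial.finset_sum_coeff,
    Polynomial.coeff_mul_C, Polynomial.coeff_C_mul]

/-- The tuple associated with global data. -/
def AA (D : GD S) (i : Fin (S.p+1)) : PMat S :=
  mkP S (fun l => if l < S.kk i - 1 then D.co i l else D.res i) (S.kk i)

theorem AA_co (D : GD S) (i) (l) (hl : l < S.kk i - 1) : cf (AA D i) l = D.co i l := by
  rw [AA, cf_mkP _ _ _ (by omega), if_pos hl]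

theorem AA_res (D : GD S) (i) : cf (AA D i) (S.kk i - 1) = D.res i := by
  have := S.hkk i
  rw [AA, cf_mkP _ _ _ (by omega), if_neg (lt_irrefl _)]

theorem AA_deg (D : GD S) (i) : degLT S (S.kk i) (AA D i) := deg_mkP _ _

theorem AA_irr (D : GD S) : irredTuple S (AA D) ↔ IrrD D := by
  have key : ∀ W : Submodule ℂ (Fin S.n → ℂ), (∀ (i : Fin (S.p+1)) (l : ℕ), ∀ v ∈ W,
        (Matrix.of fun a b => (AA D i a b).coeff l).mulVec v ∈ W) ↔
      ((∀ i, ∀ l < S.kk i - 1, D.co i l ∈ stab W) ∧ (∀ i, D.res i ∈ stab W)) := by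
    intro W
    constructor
    · intro h
      refine ⟨fun i l hl => ?_, fun i => ?_⟩
      · rw [← AA_co D i l hl]; exact h i l
      · rw [← AA_res D i]; exact h i _
    · rintro ⟨h1, h2⟩ i l
      show cf (AA D i) l ∈ stab W
      rcases lt_trichotomy l (S.kk i - 1) with h | h | h
      · rw [AA_co _ _ _ h]; exact h1 i l h
      · rw [h, AA_res]; exact h2 i
      · rw [cf_big _ _ _ (AA_deg D i) (by omega)]; exact Subalgebra.zero_mem _
  constructor
  · intro h W h1 h2
    exact h W ((key W).2 ⟨h1, h2⟩)
  · intro h W hW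
    exact h W ((key W).1 hW).1 ((key W).1 hW).2

theorem tupConj_iff (A A' : ∀ _ : Fin (S.p+1), PMat S) (hA : ∀ i, degLT S (S.kk i) (A i)) (hA' : ∀ i, degLT S (S.kk i) (A' i)) :
    tupConj S A A' ↔ ∃ γ : (Matrix (Fin S.n) (Fin S.n) ℂ)ˣ, ∀ i, ∀ l < S.kk i, γ.val * cf (A i) l = cf (A' i) l * γ.val := by
  refine exists_congr fun γ => forall_congr' fun i => ?_
  constructor
  · intro h l hl
    rw [h, cf_conj, mul_assoc, Units.inv_mul, mul_one]
  · intro h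
    apply cf_ext
    intro l
    rw [cf_conj]
    by_cases hl : l < S.kk i
    · rw [h l hl, mul_assoc, Units.mul_inv, mul_one]
    · rw [cf_big _ _ _ (hA i) (by omega), cf_big _ _ _ (hA' i) (by omega), mul_zero, zero_mul]

theorem AA_conj (D D' : GD S) : tupConj S (AA D) (AA D') ↔
    ∃ γ : (Matrix (Fin S.n) (Fin S.n) ℂ)ˣ, ∀ i, (∀ l < S.kk i - 1, γ.val * D.co i l = D'.co i l * γ.val) ∧
      γ.val * D.res i = D'.res i * γ.val := by
  rw [tupConj_iff (AA D) (AA D') (AA_deg D) (AA_deg D')]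
  refine exists_congr fun γ => forall_congr' fun i => ?_
  have hk := S.hkk i
  constructor
  · intro h
    refine ⟨fun l hl => ?_, ?_⟩
    · rw [← AA_co _ _ _ hl, ← AA_co _ _ _ hl]; exact h l (by omega)
    · rw [← AA_res, ← AA_res]; exact h _ (by omega)
  · rintro ⟨h1, h2⟩ l hl
    rcases lt_trichotomy l (S.kk i - 1) with h | h | h
    · rw [AA_co _ _ _ h, AA_co _ _ _ h]; exact h1 l h
    · rw [h, AA_res, AA_res]; exact h2
    · omega

theorem Fc_E {n : ℕ} {d : ℕ → ℕ} {m : ℕ} (A : Matrix (Fin m) (Fin n) ℂ) (F0 : Matrix (Fin n) (Fin (d 0)) ℂ)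
    (f : ∀ k, Matrix (Fin (d k)) (Fin (d (k+1))) ℂ) (k) : Fc (A * F0) f k = A * Fc F0 f k := by
  induction k with
  | zero => rfl
  | succ k ih => rw [Fc, ih, Matrix.mul_assoc]; rfl

theorem Gc_E {n : ℕ} {d : ℕ → ℕ} {m : ℕ} (A : Matrix (Fin n) (Fin m) ℂ) (G0 : Matrix (Fin (d 0)) (Fin n) ℂ)
    (g : ∀ k, Matrix (Fin (d (k+1))) (Fin (d k)) ℂ) (k) : Gc (G0 * A) g k = Gc G0 g k * A := by
  induction k with
  | zero => rfl
  | succ k ih => rw [Gc, ih, ← Matrix.mul_assoc]; rfl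

theorem Th_sim {D : GD S} (h : D.Ok) (hL : LegN D) (i) : ∃ η : (Matrix (Fin S.n) (Fin S.n) ℂ)ˣ,
    (∀ j, η.val * EE S i j = EE S i j * η.val) ∧ D.Th i * η.val = η.val * Rh S i := by
  have hN : ∀ j, ∃ η : (Matrix (Fin (S.nn i j)) (Fin (S.nn i j)) ℂ)ˣ,
      ((pr S i j * D.F i j 0) * (D.G i j 0 * inc S i j) + xiN S i j 0 • 1) * η.val = η.val * S.R i j := by
    intro j
    apply similar_R
    intro k
    have hl : legEq (xiN S i j) (pr S i j * D.F i j 0) (D.G i j 0 * inc S i j) (D.lf i j) (D.lg i j) := by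
      have := h.leg i j
      refine ⟨?_, this.2⟩
      rw [← this.1]
      congr 1
      rw [Matrix.mul_assoc, ← Matrix.mul_assoc (inc S i j)]
      show D.G i j 0 * (EE S i j * D.F i j 0) = _
      rw [h.EF]
    rw [← leg_FG hl]
    obtain ⟨L, hL1⟩ := (hL i j k).1
    obtain ⟨K, hK1⟩ := (hL i j k).2
    refine rank_of_inj_surj _ _ (L * inc S i j) (pr S i j * K) ?_ ?_
    · rw [Matrix.mul_assoc, Fc_E, ← Matrix.mul_assoc (inc S i j)]
      show L * (EE S i j * _) = 1
      rw [← Fc_E, h.EF, hL1]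
    · rw [Gc_E, Matrix.mul_assoc, ← Matrix.mul_assoc (inc S i j)]
      show Gc (D.G i j 0) (D.lg i j) k * (EE S i j * _) = 1
      rw [← Matrix.mul_assoc, ← Gc_E, h.GE, hK1]
  choose η hη using hN
  refine ⟨bdU S i η, fun j => bd_EE i _ j, ?_⟩
  have e : D.Th i = bd S i (fun j => (pr S i j * D.F i j 0) * (D.G i j 0 * inc S i j) + xiN S i j 0 • 1) := by
    rw [GD.Th, bd]
    refine Finset.sum_congr rfl fun j _ => ?_
    rw [Matrix.mul_add, Matrix.add_mul, add_comm]
    congr 1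
    · calc D.F i j 0 * D.G i j 0 = (EE S i j * D.F i j 0) * (D.G i j 0 * EE S i j) := by rw [h.EF, h.GE]
        _ = _ := by simp only [EE, Matrix.mul_assoc]
    · simp [EE]
  have e2 : Rh S i = bd S i (S.R i) := rfl
  rw [e, e2]
  show bd S i _ * bd S i _ = bd S i _ * bd S i _
  rw [bd_mul, bd_mul]
  congr 1
  funext j
  exact hη j

theorem AA_orbit {D : GD S} (h : D.Ok) (hL : LegN D) (i) : inOrbit S i (AA D i) := by
  obtain ⟨η, h1, h2⟩ := Th_sim h hL i
  refine orbit_bwd i (AA D i) (deg_mkP _ _) (D.Th i) (D.P i)⁻¹ η (D.X i) h1 h2 ?_ ?_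
  · intro l hl
    rw [AA_co _ _ _ hl, GD.co, mul_assoc, Units.mul_inv, mul_one]
  · intro j
    rw [AA_res, inv_inv]
    exact h.star i j

theorem AA_ds {D : GD S} (h : D.Ok) (hL : LegN D) : isDSElem S (AA D) := by
  refine ⟨AA_orbit h hL, ?_⟩
  rw [← D.res_sum]
  exact Finset.sum_congr rfl fun i _ => AA_res D i

end AASec
end

noncomputable section
section IsoSec
variable {S : Setup}

/-- The transition matrix at `i` induced by `γ`. -/
def hh (D D' : GD S) (γ : (Matrix (Fin S.n) (Fin S.n) ℂ)ˣ) (i : Fin (S.p+1)) : (Matrix (Fin S.n) (Fin S.n) ℂ)ˣ :=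
  D'.P i * γ * (D.P i)⁻¹

/-- Isomorphisms of global data. -/
structure IsoD (D D' : GD S) (γ : (Matrix (Fin S.n) (Fin S.n) ℂ)ˣ)
    (t : ∀ i j k, (Matrix (Fin (rk S i j k)) (Fin (rk S i j k)) ℂ)ˣ) : Prop where
  hE : ∀ i j, (hh D D' γ i).val * EE S i j = EE S i j * (hh D D' γ i).val
  hX : ∀ i s s', s ≠ s' → ∀ l < dcnt S i s s', (hh D D' γ i).val * (EE S i s * D.X i l * EE S i s') =
    (EE S i s * D'.X i l * EE S i s') * (hh D D' γ i).val
  hQ : ∀ i, Iirr S i → i ≠ 0 → γ.val * (D.Q i * (D.P i).val) = (D'.Q i * (D'.P i).val) * γ.val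
  hF : ∀ i j, (hh D D' γ i).val * D.F i j 0 = D'.F i j 0 * (t i j 0).val
  hG : ∀ i j, (t i j 0).val * D.G i j 0 = D'.G i j 0 * (hh D D' γ i).val
  hf : ∀ i j k, (t i j k).val * D.lf i j k = D'.lf i j k * (t i j (k+1)).val
  hg : ∀ i j k, (t i j (k+1)).val * D.lg i j k = D'.lg i j k * (t i j k).val

theorem hh_conj (D D' : GD S) (γ) (i) (A A' : Matrix (Fin S.n) (Fin S.n) ℂ) :
    γ.val * ((D.P i)⁻¹.val * A * (D.P i).val) = ((D'.P i)⁻¹.val * A' * (D'.P i).val) * γ.val ↔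
      (hh D D' γ i).val * A = A' * (hh D D' γ i).val := by
  rw [hh, Units.val_mul, Units.val_mul]
  constructor
  · intro h
    have := congrArg (fun z => (D'.P i).val * z * (D.P i)⁻¹.val) h
    simp only [mul_assoc, Units.mul_inv, mul_one] at this ⊢
    simp only [← mul_assoc, Units.mul_inv, one_mul] at this ⊢
    exact this
  · intro h
    have := congrArg (fun z => (D'.P i)⁻¹.val * z * (D.P i).val) h
    simp only [mul_assoc, Units.inv_mul, mul_one] at this ⊢
    simp only [← mul_assoc, Units.inv_mul, one_mul] at this ⊢
    exact this

theorem hh_conj' (D D' : GD S) (γ) (i) (A A' : Matrix (Fin S.n) (Fin S.n) ℂ) (h : γ.val * A = A' * γ.val) :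
      (hh D D' γ i).val * ((D.P i).val * A * (D.P i)⁻¹.val) = ((D'.P i).val * A' * (D'.P i)⁻¹.val) * (hh D D' γ i).val := by
  rw [← hh_conj]
  have e : ∀ (P : (Matrix (Fin S.n) (Fin S.n) ℂ)ˣ) A, P⁻¹.val * (P.val * A * P⁻¹.val) * P.val = A := by
    intro P A
    simp only [mul_assoc, Units.inv_mul, mul_one]
    simp only [← mul_assoc, Units.inv_mul, one_mul]
  rw [e, e, h]

theorem co_intertwine (D D' : GD S) (γ : (Matrix (Fin S.n) (Fin S.n) ℂ)ˣ) (i) :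
    (∀ l < S.kk i - 1, γ.val * D.co i l = D'.co i l * γ.val) ↔
    ((∀ j, (hh D D' γ i).val * EE S i j = EE S i j * (hh D D' γ i).val) ∧
      ∀ s s', s ≠ s' → ∀ l < dcnt S i s s', (hh D D' γ i).val * (EE S i s * D.X i l * EE S i s') =
    (EE S i s * D'.X i l * EE S i s') * (hh D D' γ i).val) := by
  rw [← Psi_intertwine (EE_OI i) (EE_sum i) (tr S i) (tr_good i) (tr_leaves i)]
  exact forall_congr' fun l => forall_congr' fun hl => hh_conj D D' γ i _ _

theorem Psres_intertwine (X X' : ℕ → Matrix (Fin S.n) (Fin S.n) ℂ) (i) (h : Matrix (Fin S.n) (Fin S.n) ℂ)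
    (hX : ∀ s s', s ≠ s' → ∀ l < dcnt S i s s', h * (EE S i s * X l * EE S i s') = (EE S i s * X' l * EE S i s') * h) (j) :
    h * (EE S i j * Ps S i X (S.kk i - 1) * EE S i j) = (EE S i j * Ps S i X' (S.kk i - 1) * EE S i j) * h := by
  rw [Psi_moment (EE_OI i) (tr S i) (tr_good i) (tr_leaves i) X j (ka_top i j),
    Psi_moment (EE_OI i) (tr S i) (tr_good i) (tr_leaves i) X' j (ka_top i j)]
  simp only [Finset.mul_sum, Finset.sum_mul]
  refine Finset.sum_congr rfl fun s _ => Finset.sum_congr rfl fun l hl => ?_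
  rw [mul_smul_comm, smul_mul_assoc]
  by_cases hs : s = j
  · subst hs; simp
  · congr 1
    have e : ∀ X : ℕ → Matrix (Fin S.n) (Fin S.n) ℂ, EE S i j * X l * EE S i s * X l * EE S i j = (EE S i j * X l * EE S i s) * (EE S i s * X l * EE S i j) := by
      intro X
      conv_lhs => rw [← EE_sq i s]
      simp only [mul_assoc]
    rw [e, e, ← mul_assoc, hX j s (Ne.symm hs) l (by rw [dcnt_symm]; exact Finset.mem_range.1 hl), mul_assoc,
      hX s j hs l (Finset.mem_range.1 hl)]
    simp only [mul_assoc]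

theorem hh_one (D D' : GD S) (h : D.Ok) (h' : D'.Ok) (γ) (i) (hi : ¬ Iirr S i ∨ i = 0) : hh D D' γ i = γ := by
  rw [hh, h.P1 i hi, h'.P1 i hi]; simp

theorem iso_of_conj {D D' : GD S} (h : D.Ok) (h' : D'.Ok) (hL : LegN D) (hL' : LegN D')
    (γ : (Matrix (Fin S.n) (Fin S.n) ℂ)ˣ)
    (hγ : ∀ i, (∀ l < S.kk i - 1, γ.val * D.co i l = D'.co i l * γ.val) ∧ γ.val * D.res i = D'.res i * γ.val) :
    ∃ t, IsoD D D' γ t := by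
  have hEX := fun i => (co_intertwine D D' γ i).1 (hγ i).1
  have hFG : ∀ i j, (hh D D' γ i).val * (D.F i j 0 * D.G i j 0) = (D'.F i j 0 * D'.G i j 0) * (hh D D' γ i).val := by
    intro i j
    rw [Ok.block h, Ok.block h', mul_sub, mul_sub, sub_mul, sub_mul, Psres_intertwine _ _ i _ (hEX i).2, mul_smul_comm,
      smul_mul_assoc, (hEX i).1 j]
    congr 2
    rw [← mul_assoc, ← mul_assoc, (hEX i).1 j, mul_assoc (EE S i j), hh_conj' D D' γ i _ _ (hγ i).2,
      mul_assoc, mul_assoc, (hEX i).1 j]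
    simp only [mul_assoc]
  have ht := fun i j => leg_iso (h.leg i j) (h'.leg i j) (hh D D' γ i) (hFG i j) (fun k => (hL i j k).1)
    (fun k => (hL i j k).2) (fun k => (hL' i j k).1) (fun k => (hL' i j k).2)
  choose t t1 t2 t3 t4 using ht
  refine ⟨t, fun i => (hEX i).1, fun i => (hEX i).2, ?_, t1, t2, t3, t4⟩
  intro i hi h0
  have := (hγ i).2
  rw [GD.res, GD.res, if_neg (not_not.2 hi), if_neg (not_not.2 hi), if_neg h0, if_neg h0, mul_neg, neg_mul, neg_inj] at this
  exact this

theorem conj_of_iso {D D' : GD S} (h : D.Ok) (h' : D'.Ok) (γ t) (hI : IsoD D D' γ t) (i) :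
    (∀ l < S.kk i - 1, γ.val * D.co i l = D'.co i l * γ.val) ∧ γ.val * D.res i = D'.res i * γ.val := by
  refine ⟨(co_intertwine D D' γ i).2 ⟨hI.hE i, hI.hX i⟩, ?_⟩
  have hTh : ∀ i, ¬ Iirr S i → γ.val * D.Th i = D'.Th i * γ.val := by
    intro i hi
    have e := hh_one D D' h h' γ i (Or.inl hi)
    rw [GD.Th, GD.Th, Finset.mul_sum, Finset.sum_mul]
    refine Finset.sum_congr rfl fun j _ => ?_
    have h1 := hI.hE i j
    have h2 := hI.hF i j
    have h3 := hI.hG i j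
    rw [e] at h1 h2 h3
    rw [mul_add, add_mul, mul_smul_comm, smul_mul_assoc, h1, ← Matrix.mul_assoc, h2, Matrix.mul_assoc, h3, Matrix.mul_assoc]
  rw [GD.res, GD.res]
  split_ifs with h1 h2
  · rw [Finset.mul_sum, Finset.sum_mul]
    refine Finset.sum_congr rfl fun i' _ => ?_
    split_ifs with h3 h4
    · simp
    · exact hI.hQ i' h3 h4
    · rw [mul_neg, neg_mul, hTh _ h3]
  · rw [mul_neg, neg_mul, hI.hQ i h1 h2]
  · exact hTh i h1

theorem conj_iff_iso {D D' : GD S} (h : D.Ok) (h' : D'.Ok) (hL : LegN D) (hL' : LegN D') :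
    tupConj S (AA D) (AA D') ↔ ∃ γ t, IsoD D D' γ t := by
  rw [AA_conj]
  constructor
  · rintro ⟨γ, hγ⟩
    exact ⟨γ, iso_of_conj h h' hL hL' γ hγ⟩
  · rintro ⟨γ, t, hI⟩
    exact ⟨γ, conj_of_iso h h' γ t hI⟩

end IsoSec
end

noncomputable section
section SurjSec
variable {S : Setup}

theorem irred_conj {A A' : ∀ _ : Fin (S.p+1), PMat S} (h : tupConj S A A') (hA : irredTuple S A) : irredTuple S A' := by
  obtain ⟨γ, hγ⟩ := h
  intro W hW
  have := hA (tw' W γ⁻¹) (by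
    intro i l
    show cf (A i) l ∈ stab (tw' W γ⁻¹)
    rw [stab_tw, inv_inv, ← cf_conj, ← hγ i]
    exact hW i l)
  have e : ∀ v, v ∈ W ↔ γ⁻¹.val.mulVec v ∈ tw' W γ⁻¹ := fun v => mem_tw_P.symm
  rcases this with h | h
  · left
    rw [Submodule.eq_bot_iff]
    intro v hv
    rw [e, h, Submodule.mem_bot] at hv
    rw [← Matrix.one_mulVec v, ← Units.mul_inv γ, ← Matrix.mulVec_mulVec, hv, Matrix.mulVec_zero]
  · right
    rw [Submodule.eq_top_iff']
    intro v
    rw [e, h]; trivial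

theorem reg_sub (i) (hi : ¬ Iirr S i) : Subsingleton (Fin (S.m i)) := by
  have h1 : ¬ 1 < S.m i := fun h => hi (Or.inl h)
  have h2 := S.hm i
  have : S.m i = 1 := by omega
  rw [this]; infer_instance

theorem reg_kk (i) (hi : ¬ Iirr S i) : S.kk i = 1 := S.hreg i hi

theorem reg_Psres (X : ℕ → Matrix (Fin S.n) (Fin S.n) ℂ) (i) (hi : ¬ Iirr S i) (j) :
    EE S i j * Ps S i X (S.kk i - 1) * EE S i j = 0 := by
  rw [Psi_moment (EE_OI i) (tr S i) (tr_good i) (tr_leaves i) X j (ka_top i j)]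
  haveI := reg_sub i hi
  refine Finset.sum_eq_zero fun s _ => Finset.sum_eq_zero fun l _ => ?_
  rw [Subsingleton.elim s j]
  simp

theorem exists_D (A : ∀ _ : Fin (S.p+1), PMat S) (hA : isDSElem S A) :
    ∃ D : GD S, D.Ok ∧ LegN D ∧ tupConj S A (AA D) := by
  obtain ⟨hO, hs⟩ := hA
  choose X γ hX hR using fun i => orbit_fwd i (A i) (hO i)
  obtain ⟨r, hr⟩ : ∃ r : ∀ i : Fin (S.p+1), Matrix (Fin S.n) (Fin S.n) ℂ,
      ∀ i, r i = (γ 0)⁻¹.val * cf (A i) (S.kk i - 1) * (γ 0).val := ⟨_, fun i => rfl⟩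
  have hrs : ∑ i, r i = 0 := by
    simp only [hr]
    rw [← Finset.sum_mul, ← Finset.mul_sum]
    have : ∑ i, cf (A i) (S.kk i - 1) = 0 := hs
    rw [this, mul_zero, zero_mul]
  obtain ⟨T, hT⟩ : ∃ T : ∀ i : Fin (S.p+1), Matrix (Fin S.n) (Fin S.n) ℂ,
      ∀ i, T i = if Iirr S i then Rh S i else r i := ⟨_, fun i => rfl⟩
  have hreg : ∀ i, ¬ Iirr S i → (γ i)⁻¹.val * cf (A i) (S.kk i - 1) * (γ i).val = Rh S i := by
    intro i hi
    have := hR i ⟨0, S.hm i⟩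
    rw [reg_Psres _ i hi, EE_reg i hi, zero_add] at this
    simpa using this
  have hleg : ∀ i j, ∃ (F0 : Matrix (Fin S.n) (Fin (rk S i j 0)) ℂ) (G0 : Matrix (Fin (rk S i j 0)) (Fin S.n) ℂ)
      (f : ∀ k, Matrix (Fin (rk S i j k)) (Fin (rk S i j (k+1))) ℂ) (g : ∀ k, Matrix (Fin (rk S i j (k+1))) (Fin (rk S i j k)) ℂ),
      legEq (xiN S i j) F0 G0 f g ∧ EE S i j * F0 = F0 ∧ G0 * EE S i j = G0 ∧ F0 * G0 = (T i - xiN S i j 0 • 1) * EE S i j ∧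
      (∀ k, LI (Fc F0 f k)) ∧ (∀ k, RI (Gc G0 g k)) := by
    intro i j
    apply exists_leg _ _ _ (EE_sq i j)
    · rw [hT]
      split_ifs with hi
      · exact Rh_EE i j
      · rw [EE_reg i hi]; simp
    · intro k
      rw [hT]
      split_ifs with hi
      · exact rank_Rh i j k
      · rw [← rank_Rh i j k, EE_reg i hi, mul_one, mul_one]
        have e : ((γ i)⁻¹ * γ 0).val * r i = Rh S i * ((γ i)⁻¹ * γ 0).val := by
          rw [← hreg i hi, hr, Units.val_mul]
          simp only [mul_assoc]
          rw [← mul_assoc (γ 0).val (γ 0)⁻¹.val, Units.mul_inv, one_mul, ← mul_assoc (γ i).val (γ i)⁻¹.val, Units.mul_inv, one_mul]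
        have e2 := pl_conj _ _ _ (xiN S i j) e k
        have hu : IsUnit ((γ i)⁻¹ * γ 0).val.det := (Matrix.isUnit_iff_isUnit_det _).1 (Units.isUnit _)
        rw [← Matrix.rank_mul_eq_right_of_isUnit_det _ _ hu, e2, Matrix.rank_mul_eq_left_of_isUnit_det _ _ hu]
  choose F0 G0 f0 g0 l1 l2 l3 l4 l5 l6 using hleg
  obtain ⟨P, hP⟩ : ∃ P : Fin (S.p+1) → (Matrix (Fin S.n) (Fin S.n) ℂ)ˣ, ∀ i, P i = if Iirr S i then (γ i)⁻¹ * γ 0 else 1 :=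
    ⟨_, fun i => rfl⟩
  obtain ⟨D, dX, dP, dQ, dF, dG, df, dg⟩ : ∃ D : GD S, D.X = X ∧ D.P = P ∧ (∀ i, D.Q i * (P i).val = - r i) ∧
      (∀ i j, D.F i j 0 = F0 i j) ∧ (∀ i j, D.G i j 0 = G0 i j) ∧ (∀ i j, D.lf i j = f0 i j) ∧ (∀ i j, D.lg i j = g0 i j) := by
    refine ⟨⟨X, P, fun i => - r i * (P i)⁻¹.val, fun i j k => match k with | 0 => F0 i j | _ => 0,
      fun i j k => match k with | 0 => G0 i j | _ => 0,
      fun a b => if h : (⟨a.1, a.2.1, a.2.2+1⟩ : Leg S) = b then by subst h; exact f0 a.1 a.2.1 a.2.2 else 0,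
      fun a b => if h : (⟨a.1, a.2.1, a.2.2+1⟩ : Leg S) = b then by subst h; exact g0 a.1 a.2.1 a.2.2 else 0⟩,
      rfl, rfl, ?_, fun i j => rfl, fun i j => rfl, ?_, ?_⟩
    · intro i
      simp only [mul_assoc, Units.inv_mul, mul_one]
    · intro i j; funext k
      exact dif_pos rfl
    · intro i j; funext k
      exact dif_pos rfl
  have hTh : ∀ i, D.Th i = T i := by
    intro i
    rw [GD.Th]
    calc _ = ∑ j, T i * EE S i j := by
          refine Finset.sum_congr rfl fun j _ => ?_
          rw [dF, dG, l4, sub_mul, smul_mul_assoc, one_mul]; abel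
      _ = _ := by rw [← Finset.mul_sum, EE_sum, mul_one]
  have hres : ∀ i, D.res i = r i := by
    have h1 : ∀ i, i ≠ 0 → D.res i = r i := by
      intro i h0
      rw [GD.res]
      split_ifs with hi
      · rw [dP, dQ, neg_neg]
      · rw [hTh, hT, if_neg hi]
    intro i
    by_cases h0 : i = 0
    · subst h0
      have a := D.res_sum
      rw [← Finset.add_sum_erase _ _ (Finset.mem_univ 0)] at a hrs
      rw [Finset.sum_congr rfl fun i hi => h1 i (Finset.ne_of_mem_erase hi)] at a
      exact add_right_cancel (a.trans hrs.symm)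
    · exact h1 i h0
  have hconj : ∀ i, Iirr S i → (P i).val * r i * (P i)⁻¹.val = (γ i)⁻¹.val * cf (A i) (S.kk i - 1) * (γ i).val := by
    intro i hi
    rw [hP, if_pos hi, hr, _root_.mul_inv_rev, inv_inv, Units.val_mul, Units.val_mul]
    simp only [mul_assoc]
    rw [← mul_assoc (γ 0).val (γ 0)⁻¹.val, Units.mul_inv, one_mul, ← mul_assoc (γ 0).val (γ 0)⁻¹.val, Units.mul_inv, one_mul]
  have hok : D.Ok := by
    refine ⟨?_, fun i j => by rw [dF, l2], fun i j => by rw [dG, l3], fun i j => by rw [dF, dG, df, dg]; exact l1 i j, ?_⟩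
    · intro i hi
      rw [dP, hP]
      split_ifs with h
      · rcases hi with hi | hi
        · exact absurd h hi
        · rw [hi, inv_mul_cancel]
      · rfl
    · intro i j
      rw [hTh, hT, hres, dP, dX]
      by_cases hi : Iirr S i
      · rw [hconj i hi, if_pos hi, hR]
      · rw [reg_Psres _ i hi, if_neg hi, zero_add, hP, if_neg hi]
        simp
  refine ⟨D, hok, fun i j k => ?_, ?_⟩
  · rw [dF, dG, df, dg]; exact ⟨l5 i j k, l6 i j k⟩
  · rw [tupConj_iff _ _ (fun i => (hO i).1) (AA_deg D)]
    refine ⟨(γ 0)⁻¹, fun i l hl => ?_⟩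
    by_cases h : l < S.kk i - 1
    · have hi : Iirr S i := by
        by_contra hi
        have := reg_kk i hi
        omega
      rw [AA_co _ _ _ h, GD.co, dP, dX, hP, if_pos hi, _root_.mul_inv_rev, inv_inv, Units.val_mul, Units.val_mul]
      have := hX i l h
      rw [mul_assoc (γ 0)⁻¹.val, ← this]
      simp only [mul_assoc, Units.mul_inv, mul_one]
    · have : l = S.kk i - 1 := by omega
      subst this
      rw [AA_res, hres, hr, mul_assoc _ (γ 0).val, Units.mul_inv, mul_one]

end SurjSec
end

noncomputable section
section ArrSec
variable {S : Setup}

theorem arr_bb_same (i : {i : Fin (S.p+1) // Iirr S i}) (j j' : Fin (S.m i.1)) :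
    arr S (Sum.inl ⟨i, j⟩) (Sum.inl ⟨i, j'⟩) = if j < j' then dcnt S i.1 j j' else 0 := by
  show (if i.1 = 0 ∧ i.1 ≠ 0 then 1 else 0) + _ = _
  rw [if_neg (fun h => h.2 h.1), dif_pos rfl, zero_add]
  rfl

theorem arr_bb_0 (i : {i : Fin (S.p+1) // Iirr S i}) (h : i.1 ≠ 0) (j : Fin (S.m (i0 S).1)) (j' : Fin (S.m i.1)) :
    arr S (Sum.inl ⟨i0 S, j⟩) (Sum.inl ⟨i, j'⟩) = 1 := by
  show (if (i0 S).1 = 0 ∧ i.1 ≠ 0 then 1 else 0) + _ = _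
  rw [if_pos ⟨rfl, h⟩, dif_neg]
  intro e; exact h (congrArg Subtype.val e.symm)

theorem arr_bb_ne (i i' : {i : Fin (S.p+1) // Iirr S i}) (h : i ≠ i') (h0 : i ≠ i0 S) (j : Fin (S.m i.1)) (j' : Fin (S.m i'.1)) :
    arr S (Sum.inl ⟨i, j⟩) (Sum.inl ⟨i', j'⟩) = 0 := by
  show (if i.1 = 0 ∧ i'.1 ≠ 0 then 1 else 0) + _ = _
  rw [if_neg (fun e => h0 (Subtype.ext e.1)), dif_neg h]

theorem arr_rb_irr (i : {i : Fin (S.p+1) // Iirr S i}) (j κ j') :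
    arr S (Sum.inr ⟨i.1, j, κ⟩) (Sum.inl ⟨i, j'⟩) = if j = j' ∧ κ.val = 0 then 1 else 0 := by
  show (if i.1 = i.1 ∧ j.val = j'.val ∧ κ.val = 0 then 1 else 0) + (if _ then 1 else 0) = _
  have h2 : ¬ (¬ Iirr S i.1 ∧ i.1 = 0 ∧ j.val = 0 ∧ κ.val = 0) := fun h => h.1 i.2
  rw [if_neg h2]
  simp [Fin.ext_iff]

theorem arr_rb_reg (i) (hi : ¬ Iirr S i) (j : Fin (S.m i)) (κ) (j' : Fin (S.m (i0 S).1)) :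
    arr S (Sum.inr ⟨i, j, κ⟩) (Sum.inl ⟨i0 S, j'⟩) = if κ.val = 0 then 1 else 0 := by
  show (if i = 0 ∧ j.val = j'.val ∧ κ.val = 0 then 1 else 0) + (if ¬ Iirr S i ∧ (0 : Fin (S.p+1)) = 0 ∧ j.val = 0 ∧ κ.val = 0 then 1 else 0) = _
  have h0 : i ≠ 0 := fun h => hi (h ▸ irr0)
  have hj : j.val = 0 := by
    haveI := reg_sub i hi
    rw [Subsingleton.elim j ⟨0, S.hm i⟩]
  simp [h0, hi, hj]

theorem arr_rb_ne (i) (j : Fin (S.m i)) (κ) (i' : {i : Fin (S.p+1) // Iirr S i}) (j') (h : i ≠ i'.1) (h' : Iirr S i ∨ i' ≠ i0 S) :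
    arr S (Sum.inr ⟨i, j, κ⟩) (Sum.inl ⟨i', j'⟩) = 0 := by
  show (if i = i'.1 ∧ j.val = j'.val ∧ κ.val = 0 then 1 else 0) + (if ¬ Iirr S i ∧ i'.1 = 0 ∧ j.val = 0 ∧ κ.val = 0 then 1 else 0) = _
  rw [if_neg (fun e => h e.1), if_neg]
  rintro ⟨a, b, -⟩
  rcases h' with h' | h'
  · exact a h'
  · exact h' (Subtype.ext b)

theorem arr_rr_same (i) (j j' : Fin (S.m i)) (κ κ') :
    arr S (Sum.inr ⟨i, j, κ⟩) (Sum.inr ⟨i, j', κ'⟩) = if j = j' ∧ κ.val = κ'.val + 1 then 1 else 0 := by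
  show (if i = i ∧ j.val = j'.val ∧ κ.val = κ'.val + 1 then 1 else 0) = _
  simp [Fin.ext_iff]

theorem arr_rr_ne (i i') (j : Fin (S.m i)) (j' : Fin (S.m i')) (κ κ') (h : i ≠ i') :
    arr S (Sum.inr ⟨i, j, κ⟩) (Sum.inr ⟨i', j', κ'⟩) = 0 := by
  show (if i = i' ∧ j.val = j'.val ∧ κ.val = κ'.val + 1 then 1 else 0) = _
  rw [if_neg (fun e => h e.1)]

theorem arr_br (x y) : arr S (Sum.inl x) (Sum.inr y) = 0 := rfl

theorem forall_arr (C : V S → V S → ℕ → Prop) :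
    (∀ a b l, l < arr S a b → C a b l) ↔
    (∀ (i : {i : Fin (S.p+1) // Iirr S i}) (s s' : Fin (S.m i.1)), s < s' → ∀ l < dcnt S i.1 s s', C (Sum.inl ⟨i, s⟩) (Sum.inl ⟨i, s'⟩) l) ∧
    (∀ (i : {i : Fin (S.p+1) // Iirr S i}), i.1 ≠ 0 → ∀ (j : Fin (S.m (i0 S).1)) (j' : Fin (S.m i.1)), C (Sum.inl ⟨i0 S, j⟩) (Sum.inl ⟨i, j'⟩) 0) ∧
    (∀ (i : {i : Fin (S.p+1) // Iirr S i}) (j : Fin (S.m i.1)) (h : 0 < S.e i.1 j - 1), C (Sum.inr ⟨i.1, j, ⟨0, h⟩⟩) (Sum.inl ⟨i, j⟩) 0) ∧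
    (∀ (i : Fin (S.p+1)), ¬ Iirr S i → ∀ (j : Fin (S.m i)) (h : 0 < S.e i j - 1) (j' : Fin (S.m (i0 S).1)),
      C (Sum.inr ⟨i, j, ⟨0, h⟩⟩) (Sum.inl ⟨i0 S, j'⟩) 0) ∧
    (∀ (i : Fin (S.p+1)) (j : Fin (S.m i)) (k : ℕ) (h : k + 1 < S.e i j - 1),
      C (Sum.inr ⟨i, j, ⟨k+1, h⟩⟩) (Sum.inr ⟨i, j, ⟨k, Nat.lt_of_succ_lt h⟩⟩) 0) := by
  constructor
  · intro H
    refine ⟨?_, ?_, ?_, ?_, ?_⟩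
    · intro i s s' h l hl
      apply H; rw [arr_bb_same, if_pos h]; exact hl
    · intro i h j j'
      apply H; rw [arr_bb_0 i h]; exact zero_lt_one
    · intro i j h
      apply H; rw [arr_rb_irr, if_pos ⟨rfl, rfl⟩]; exact zero_lt_one
    · intro i hi j h j'
      apply H; rw [arr_rb_reg i hi, if_pos rfl]; exact zero_lt_one
    · intro i j k h
      apply H; rw [arr_rr_same, if_pos ⟨rfl, rfl⟩]; exact zero_lt_one
  · rintro ⟨h1, h2, h3, h4, h5⟩ a b l hl
    rcases a with ⟨i, j⟩ | ⟨i, j, κ⟩ <;> rcases b with ⟨i', j'⟩ | ⟨i', j', κ'⟩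
    · by_cases e : i = i'
      · subst e
        rw [arr_bb_same] at hl
        split_ifs at hl with h
        · exact h1 i j j' h l hl
        · exact absurd hl (Nat.not_lt_zero _)
      · by_cases e0 : i = i0 S
        · subst e0
          have h' : i'.1 ≠ 0 := fun h => e (Subtype.ext h.symm)
          rw [arr_bb_0 i' h'] at hl
          obtain rfl : l = 0 := by omega
          exact h2 i' h' j j'
        · rw [arr_bb_ne i i' e e0] at hl
          exact absurd hl (Nat.not_lt_zero _)
    · exact absurd hl (Nat.not_lt_zero _)
    · by_cases e : i = i'.1
      · subst e
        rw [arr_rb_irr] at hl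
        split_ifs at hl with h
        · obtain ⟨rfl, hk⟩ := h
          obtain rfl : l = 0 := by omega
          obtain ⟨κ, hκ⟩ := κ
          simp only at hk
          subst hk
          exact h3 i' j hκ
        · exact absurd hl (Nat.not_lt_zero _)
      · by_cases e0 : Iirr S i ∨ i' ≠ i0 S
        · rw [arr_rb_ne _ _ _ _ _ e e0] at hl
          exact absurd hl (Nat.not_lt_zero _)
        · push Not at e0
          obtain ⟨hi, rfl⟩ := e0
          rw [arr_rb_reg i hi] at hl
          split_ifs at hl with hk
          · obtain rfl : l = 0 := by omega
            obtain ⟨κ, hκ⟩ := κ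
            simp only at hk
            subst hk
            exact h4 i hi j hκ j'
          · exact absurd hl (Nat.not_lt_zero _)
    · by_cases e : i = i'
      · subst e
        rw [arr_rr_same] at hl
        split_ifs at hl with h
        · obtain ⟨rfl, hk⟩ := h
          obtain rfl : l = 0 := by omega
          obtain ⟨κ, hκ⟩ := κ
          obtain ⟨κ', hκ'⟩ := κ'
          simp only at hk
          subst hk
          exact h5 i j κ' hκ
        · exact absurd hl (Nat.not_lt_zero _)
      · rw [arr_rr_ne _ _ _ _ _ _ e] at hl
        exact absurd hl (Nat.not_lt_zero _)

section sums
variable {A : Type*} [AddCommMonoid A] (φ : V S → ℕ → A)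

theorem sum_fin0 {n : ℕ} (ψ : Fin n → A) (h : ∀ k : Fin n, k.val ≠ 0 → ψ k = 0) :
    ∑ k, ψ k = if h : 0 < n then ψ ⟨0, h⟩ else 0 := by
  split_ifs with h0
  · rw [Finset.sum_eq_single ⟨0, h0⟩]
    · intro b _ hb
      apply h
      intro e; exact hb (Fin.ext e)
    · simp
  · obtain rfl : n = 0 := by omega
    simp

theorem sum_bb_in (i : {i : Fin (S.p+1) // Iirr S i}) (j : Fin (S.m i.1)) :
    ∑ a : Vb S, ∑ l ∈ Finset.range (arr S (Sum.inl a) (Sum.inl ⟨i, j⟩)), φ (Sum.inl a) l =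
      (if i.1 ≠ 0 then ∑ j', φ (Sum.inl ⟨i0 S, j'⟩) 0 else 0) +
      ∑ s, (if s < j then ∑ l ∈ Finset.range (dcnt S i.1 s j), φ (Sum.inl ⟨i, s⟩) l else 0) := by
  rw [Fintype.sum_sigma, ← Finset.add_sum_erase _ _ (Finset.mem_univ i), add_comm]
  congr 1
  · split_ifs with h
    · have hm : i0 S ∈ Finset.univ.erase i := by
        rw [Finset.mem_erase]; exact ⟨fun e => h (congrArg Subtype.val e.symm), Finset.mem_univ _⟩
      rw [Finset.sum_eq_single_of_mem _ hm]
      · refine Finset.sum_congr rfl fun j' _ => ?_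
        rw [arr_bb_0 i h, Finset.sum_range_one]
      · intro i' hi' h0
        refine Finset.sum_eq_zero fun j' _ => ?_
        rw [arr_bb_ne i' i (Finset.ne_of_mem_erase hi') h0, Finset.sum_range_zero]
    · refine Finset.sum_eq_zero fun i' hi' => Finset.sum_eq_zero fun j' _ => ?_
      have hi := Finset.ne_of_mem_erase hi'
      rw [arr_bb_ne i' i hi, Finset.sum_range_zero]
      rintro rfl
      push Not at h
      exact hi (Subtype.ext h.symm)
  · refine Finset.sum_congr rfl fun s _ => ?_
    rw [arr_bb_same]
    split_ifs <;> simp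

theorem sum_bb_out (i : {i : Fin (S.p+1) // Iirr S i}) (j : Fin (S.m i.1)) :
    ∑ a : Vb S, ∑ l ∈ Finset.range (arr S (Sum.inl ⟨i, j⟩) (Sum.inl a)), φ (Sum.inl a) l =
      (if i.1 ≠ 0 then 0 else ∑ i' ∈ Finset.univ.erase (i0 S), ∑ j', φ (Sum.inl ⟨i', j'⟩) 0) +
      ∑ s, (if j < s then ∑ l ∈ Finset.range (dcnt S i.1 j s), φ (Sum.inl ⟨i, s⟩) l else 0) := by
  rw [Fintype.sum_sigma, ← Finset.add_sum_erase _ _ (Finset.mem_univ i), add_comm]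
  congr 1
  · split_ifs with h
    · refine Finset.sum_eq_zero fun i' hi' => Finset.sum_eq_zero fun j' _ => ?_
      rw [arr_bb_ne i i' (Finset.ne_of_mem_erase hi').symm, Finset.sum_range_zero]
      rintro rfl
      exact h rfl
    · push Not at h
      obtain rfl : i = i0 S := Subtype.ext h
      refine Finset.sum_congr rfl fun i' hi' => Finset.sum_congr rfl fun j' _ => ?_
      rw [arr_bb_0 i' (fun e => Finset.ne_of_mem_erase hi' (Subtype.ext e)), Finset.sum_range_one]
  · refine Finset.sum_congr rfl fun s _ => ?_
    rw [arr_bb_same]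
    split_ifs <;> simp

theorem sum_rb_in (i : {i : Fin (S.p+1) // Iirr S i}) (j : Fin (S.m i.1)) :
    ∑ a : Vr S, ∑ l ∈ Finset.range (arr S (Sum.inr a) (Sum.inl ⟨i, j⟩)), φ (Sum.inr a) l =
      (if h : 0 < S.e i.1 j - 1 then φ (Sum.inr ⟨i.1, j, ⟨0, h⟩⟩) 0 else 0) +
      (if i.1 ≠ 0 then 0 else ∑ i' : Fin (S.p+1), if ¬ Iirr S i' then
        ∑ j', (if h : 0 < S.e i' j' - 1 then φ (Sum.inr ⟨i', j', ⟨0, h⟩⟩) 0 else 0) else 0) := by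
  rw [Fintype.sum_sigma, ← Finset.add_sum_erase _ _ (Finset.mem_univ i.1)]
  congr 1
  · rw [Fintype.sum_sigma, Finset.sum_eq_single j]
    · rw [sum_fin0]
      · refine dite_congr rfl (fun h => ?_) (fun h => rfl)
        rw [arr_rb_irr, if_pos ⟨rfl, rfl⟩, Finset.sum_range_one]
      · intro κ hκ
        rw [arr_rb_irr, if_neg (fun h => hκ h.2), Finset.sum_range_zero]
    · intro j' _ hj
      refine Finset.sum_eq_zero fun κ _ => ?_
      rw [arr_rb_irr, if_neg (fun h => hj h.1), Finset.sum_range_zero]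
    · simp
  · split_ifs with h
    · refine Finset.sum_eq_zero fun i' hi' => Finset.sum_eq_zero fun x _ => ?_
      rw [arr_rb_ne _ _ _ _ _ (Finset.ne_of_mem_erase hi'), Finset.sum_range_zero]
      right; rintro rfl; exact h rfl
    · push Not at h
      obtain rfl : i = i0 S := Subtype.ext h
      rw [← Finset.add_sum_erase _ _ (Finset.mem_univ (i0 S).1), if_neg (not_not.2 (i0 S).2), zero_add]
      refine Finset.sum_congr rfl fun i' hi' => ?_
      by_cases hi : ¬ Iirr S i'
      · rw [Fintype.sum_sigma, if_pos hi]
        refine Finset.sum_congr rfl fun j' _ => ?_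
        rw [sum_fin0]
        · refine dite_congr rfl (fun h => ?_) (fun h => rfl)
          rw [arr_rb_reg i' hi, if_pos rfl, Finset.sum_range_one]
        · intro κ hκ
          rw [arr_rb_reg i' hi, if_neg hκ, Finset.sum_range_zero]
      · rw [if_neg hi]
        refine Finset.sum_eq_zero fun x _ => ?_
        rw [arr_rb_ne _ _ _ _ _ (Finset.ne_of_mem_erase hi') (Or.inl (not_not.1 hi)), Finset.sum_range_zero]

theorem sum_rr_in (i) (j : Fin (S.m i)) (κ : Fin (S.e i j - 1)) :
    ∑ a : Vr S, ∑ l ∈ Finset.range (arr S (Sum.inr a) (Sum.inr ⟨i, j, κ⟩)), φ (Sum.inr a) l =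
      (if h : κ.val + 1 < S.e i j - 1 then φ (Sum.inr ⟨i, j, ⟨κ.val+1, h⟩⟩) 0 else 0) := by
  rw [Fintype.sum_sigma, Finset.sum_eq_single i, Fintype.sum_sigma, Finset.sum_eq_single j]
  · split_ifs with h
    · rw [Finset.sum_eq_single ⟨κ.val+1, h⟩]
      · rw [arr_rr_same, if_pos ⟨rfl, rfl⟩, Finset.sum_range_one]
      · intro b _ hb
        rw [arr_rr_same, if_neg (fun h => hb (Fin.ext h.2)), Finset.sum_range_zero]
      · simp
    · refine Finset.sum_eq_zero fun b _ => ?_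
      rw [arr_rr_same, if_neg, Finset.sum_range_zero]
      rintro ⟨-, e⟩
      exact h (e ▸ b.2)
  · intro j' _ hj
    refine Finset.sum_eq_zero fun κ _ => ?_
    rw [arr_rr_same, if_neg (fun h => hj h.1), Finset.sum_range_zero]
  · simp
  · intro i' _ hi
    refine Finset.sum_eq_zero fun κ _ => ?_
    rw [arr_rr_ne _ _ _ _ _ _ hi, Finset.sum_range_zero]
  · simp

theorem sum_rr_out (i) (j : Fin (S.m i)) (κ : Fin (S.e i j - 1)) :
    ∑ a : Vr S, ∑ l ∈ Finset.range (arr S (Sum.inr ⟨i, j, κ⟩) (Sum.inr a)), φ (Sum.inr a) l =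
      (if h : 0 < κ.val then φ (Sum.inr ⟨i, j, ⟨κ.val-1, lt_of_le_of_lt (Nat.sub_le _ _) κ.2⟩⟩) 0 else 0) := by
  rw [Fintype.sum_sigma, Finset.sum_eq_single i, Fintype.sum_sigma, Finset.sum_eq_single j]
  · split_ifs with h
    · rw [Finset.sum_eq_single ⟨κ.val-1, lt_of_le_of_lt (Nat.sub_le _ _) κ.2⟩]
      · rw [arr_rr_same, if_pos ⟨rfl, (Nat.sub_add_cancel h).symm⟩, Finset.sum_range_one]
      · intro b _ hb
        rw [arr_rr_same, if_neg, Finset.sum_range_zero]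
        rintro ⟨-, h2⟩
        exact hb (Fin.ext (by simp only; omega))
      · simp
    · refine Finset.sum_eq_zero fun b _ => ?_
      rw [arr_rr_same, if_neg (fun e => h (by rw [e.2]; omega)), Finset.sum_range_zero]
  · intro j' _ hj
    refine Finset.sum_eq_zero fun κ _ => ?_
    rw [arr_rr_same, if_neg (fun h => hj h.1.symm), Finset.sum_range_zero]
  · simp
  · intro i' _ hi
    refine Finset.sum_eq_zero fun κ _ => ?_
    rw [arr_rr_ne _ _ _ _ _ _ hi.symm, Finset.sum_range_zero]
  · simp

theorem sum_rb_out (i) (j : Fin (S.m i)) (κ : Fin (S.e i j - 1)) :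
    ∑ a : Vb S, ∑ l ∈ Finset.range (arr S (Sum.inr ⟨i, j, κ⟩) (Sum.inl a)), φ (Sum.inl a) l =
      if κ.val = 0 then (if h : Iirr S i then φ (Sum.inl ⟨⟨i, h⟩, j⟩) 0 else ∑ j', φ (Sum.inl ⟨i0 S, j'⟩) 0) else 0 := by
  rw [Fintype.sum_sigma]
  by_cases hi : Iirr S i
  · rw [Finset.sum_eq_single ⟨i, hi⟩, Finset.sum_eq_single j, dif_pos hi]
    · have := arr_rb_irr ⟨i, hi⟩ j κ j
      simp only [true_and] at this
      rw [this]
      by_cases hκ : κ.val = 0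
      · rw [if_pos hκ, if_pos hκ, Finset.sum_range_one]
      · rw [if_neg hκ, if_neg hκ, Finset.sum_range_zero]
    · intro j' _ hj
      have := arr_rb_irr ⟨i, hi⟩ j κ j'
      simp only [true_and] at this
      rw [this, if_neg (fun h => hj h.1.symm), Finset.sum_range_zero]
    · simp
    · intro i' _ hi'
      refine Finset.sum_eq_zero fun x _ => ?_
      rw [arr_rb_ne _ _ _ _ _ (fun e => hi' (Subtype.ext e.symm)) (Or.inl hi), Finset.sum_range_zero]
    · simp
  · rw [Finset.sum_eq_single (i0 S), dif_neg hi]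
    · split_ifs with hκ
      · refine Finset.sum_congr rfl fun x _ => ?_
        rw [arr_rb_reg _ hi, if_pos hκ, Finset.sum_range_one]
      · refine Finset.sum_eq_zero fun x _ => ?_
        rw [arr_rb_reg _ hi, if_neg hκ, Finset.sum_range_zero]
    · intro i' _ hi'
      refine Finset.sum_eq_zero fun x _ => ?_
      rw [arr_rb_ne _ _ _ _ _ (fun e : i = i'.1 => hi (e.symm ▸ i'.2)) (Or.inr hi'), Finset.sum_range_zero]
    · simp

end sums
end ArrSec
end

noncomputable section
section OfSec
variable {S : Setup}

/-- Arrow matrices attached to global data. -/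
def fT (D : GD S) : ∀ a b : V S, ℕ → Matrix (Fin (alN S b)) (Fin (alN S a)) ℂ
  | .inl ⟨i, j⟩, .inl ⟨i', j'⟩, l => pr S i'.1 j' * (if i.1 = 0 ∧ i'.1 ≠ 0 then (D.P i'.1).val else D.X i'.1 l) * inc S i.1 j
  | .inl _, .inr _, _ => 0
  | .inr ⟨i, j, κ⟩, .inl ⟨i', j'⟩, _ => pr S i'.1 j' * D.F i j κ.val
  | .inr ⟨i, j, κ⟩, .inr ⟨i', j', κ'⟩, _ => D.f ⟨i', j', κ'.val⟩ ⟨i, j, κ.val⟩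

/-- Reverse arrow matrices attached to global data. -/
def gT (D : GD S) : ∀ a b : V S, ℕ → Matrix (Fin (alN S a)) (Fin (alN S b)) ℂ
  | .inl ⟨i, j⟩, .inl ⟨i', j'⟩, l => pr S i.1 j * (if i.1 = 0 ∧ i'.1 ≠ 0 then D.Q i'.1 else D.X i.1 l) * inc S i'.1 j'
  | .inl _, .inr _, _ => 0
  | .inr ⟨i, j, κ⟩, .inl ⟨i', j'⟩, _ => D.G i j κ.val * inc S i'.1 j'
  | .inr ⟨i, j, κ⟩, .inr ⟨i', j', κ'⟩, _ => D.g ⟨i', j', κ'.val⟩ ⟨i, j, κ.val⟩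

/-- The representation attached to global data. -/
def ofGD (D : GD S) : Rep S (alN S) := ⟨fun a b ρ => fT D a b ρ.val, fun a b ρ => gT D a b ρ.val⟩

theorem mom_T (D : GD S) (c : V S) : moment S (ofGD D) c =
    (∑ a : V S, ∑ l ∈ Finset.range (arr S a c), fT D a c l * gT D a c l)
    - ∑ b : V S, ∑ l ∈ Finset.range (arr S c b), gT D c b l * fT D c b l := by
  rw [moment]
  congr 1
  · refine Finset.sum_congr rfl fun a _ => ?_
    rw [Finset.sum_range]; rfl
  · refine Finset.sum_congr rfl fun a _ => ?_
    rw [Finset.sum_range]; rfl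

theorem fT_bb (D : GD S) (i s s' l) : fT D (.inl ⟨i, s⟩) (.inl ⟨i, s'⟩) l = pr S i.1 s' * D.X i.1 l * inc S i.1 s := by
  show _ * (if i.1 = 0 ∧ i.1 ≠ 0 then _ else _) * _ = _
  rw [if_neg (fun h => h.2 h.1)]; rfl
theorem gT_bb (D : GD S) (i s s' l) : gT D (.inl ⟨i, s⟩) (.inl ⟨i, s'⟩) l = pr S i.1 s * D.X i.1 l * inc S i.1 s' := by
  show _ * (if i.1 = 0 ∧ i.1 ≠ 0 then _ else _) * _ = _
  rw [if_neg (fun h => h.2 h.1)]; rfl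
theorem fT_b0 (D : GD S) (i : {i : Fin (S.p+1) // Iirr S i}) (h : i.1 ≠ 0) (s s' l) :
    fT D (.inl ⟨i0 S, s⟩) (.inl ⟨i, s'⟩) l = pr S i.1 s' * (D.P i.1).val * inc S (i0 S).1 s := by
  show _ * (if (i0 S).1 = 0 ∧ i.1 ≠ 0 then _ else _) * _ = _
  rw [if_pos ⟨rfl, h⟩]; rfl
theorem gT_b0 (D : GD S) (i : {i : Fin (S.p+1) // Iirr S i}) (h : i.1 ≠ 0) (s s' l) :
    gT D (.inl ⟨i0 S, s⟩) (.inl ⟨i, s'⟩) l = pr S (i0 S).1 s * D.Q i.1 * inc S i.1 s' := by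
  show _ * (if (i0 S).1 = 0 ∧ i.1 ≠ 0 then _ else _) * _ = _
  rw [if_pos ⟨rfl, h⟩]; rfl

theorem mul_empty {a b c : ℕ} (h : b = 0) (A : Matrix (Fin a) (Fin b) ℂ) (B : Matrix (Fin b) (Fin c) ℂ) : A * B = 0 := by
  subst h
  ext; simp [Matrix.mul_apply]

theorem sand {a b : ℕ} (i) (A : Matrix (Fin a) (Fin S.n) ℂ) (B : Matrix (Fin S.n) (Fin b) ℂ) :
    ∑ j, (A * inc S i j) * (pr S i j * B) = A * B := by
  calc _ = ∑ j, A * EE S i j * B := by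
        refine Finset.sum_congr rfl fun j _ => ?_
        simp only [EE, Matrix.mul_assoc]
    _ = _ := by rw [← Matrix.sum_mul, ← Matrix.mul_sum, EE_sum, Matrix.mul_one]

/-- The quadratic part of the moment map. -/
def KK (D : GD S) (i : Fin (S.p+1)) (j : Fin (S.m i)) : Matrix (Fin S.n) (Fin S.n) ℂ :=
  ∑ s, ∑ l ∈ Finset.range (dcnt S i s j), (if s < j then (1 : ℂ) else if j < s then -1 else 0) • (D.X i l * EE S i s * D.X i l)

theorem KK_Ps (D : GD S) (i) (j) : EE S i j * Ps S i (D.X i) (S.kk i - 1) * EE S i j = EE S i j * KK D i j * EE S i j := by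
  rw [Psi_moment (EE_OI i) (tr S i) (tr_good i) (tr_leaves i) (D.X i) j (ka_top i j), KK]
  simp only [Matrix.mul_sum, Matrix.sum_mul, Matrix.mul_smul, Matrix.smul_mul, Matrix.mul_assoc]

theorem KK_split (D : GD S) (i : {i : Fin (S.p+1) // Iirr S i}) (j : Fin (S.m i.1)) :
   (∑ s, (if s < j then ∑ l ∈ Finset.range (dcnt S i.1 s j), fT D (.inl ⟨i, s⟩) (.inl ⟨i, j⟩) l * gT D (.inl ⟨i, s⟩) (.inl ⟨i, j⟩) l else 0))
   - (∑ s, (if j < s then ∑ l ∈ Finset.range (dcnt S i.1 j s), gT D (.inl ⟨i, j⟩) (.inl ⟨i, s⟩) l * fT D (.inl ⟨i, j⟩) (.inl ⟨i, s⟩) l else 0))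
   = pr S i.1 j * KK D i.1 j * inc S i.1 j := by
  rw [KK, Matrix.mul_sum, Matrix.sum_mul, ← Finset.sum_sub_distrib]
  refine Finset.sum_congr rfl fun s _ => ?_
  rw [Matrix.mul_sum, Matrix.sum_mul]
  have e : ∀ l, (pr S i.1 j * D.X i.1 l * inc S i.1 s) * (pr S i.1 s * D.X i.1 l * inc S i.1 j) =
    pr S i.1 j * (D.X i.1 l * EE S i.1 s * D.X i.1 l) * inc S i.1 j := by
    intro l; simp only [EE, Matrix.mul_assoc]
  by_cases h1 : s < j
  · rw [if_pos h1, if_neg (lt_asymm h1), sub_zero]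
    refine Finset.sum_congr rfl fun l _ => ?_
    rw [fT_bb, gT_bb, if_pos h1, one_smul, ← e]; rfl
  · rw [if_neg h1, zero_sub]
    by_cases h2 : j < s
    · rw [if_pos h2, ← Finset.sum_neg_distrib, dcnt_symm]
      refine Finset.sum_congr rfl fun l _ => ?_
      rw [fT_bb, gT_bb, if_neg h1, if_pos h2, neg_one_smul, Matrix.mul_neg, Matrix.neg_mul, ← e]; rfl
    · rw [if_neg h2, neg_zero]
      symm
      refine Finset.sum_eq_zero fun l _ => ?_
      rw [if_neg h1, if_neg h2, zero_smul, Matrix.mul_zero, Matrix.zero_mul]; rfl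

theorem leg_in (D : GD S) (i) (j) (i' : {i : Fin (S.p+1) // Iirr S i}) (j' : Fin (S.m i'.1)) :
    (if h : 0 < S.e i j - 1 then fT D (.inr ⟨i, j, ⟨0, h⟩⟩) (.inl ⟨i', j'⟩) 0 * gT D (.inr ⟨i, j, ⟨0, h⟩⟩) (.inl ⟨i', j'⟩) 0 else 0)
    = pr S i'.1 j' * (D.F i j 0 * D.G i j 0) * inc S i'.1 j' := by
  split_ifs with h
  · show (pr S i'.1 j' * D.F i j 0) * (D.G i j 0 * inc S i'.1 j') = _
    simp only [Matrix.mul_assoc]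
  · rw [mul_empty (rk_big i j 0 (by omega)), Matrix.mul_zero, Matrix.zero_mul]; rfl

theorem mom_b (D : GD S) (i : {i : Fin (S.p+1) // Iirr S i}) (h : i.1 ≠ 0) (j : Fin (S.m i.1)) :
    moment S (ofGD D) (.inl ⟨i, j⟩) = pr S i.1 j * ((D.P i.1).val * D.Q i.1 + KK D i.1 j + D.F i.1 j 0 * D.G i.1 j 0) * inc S i.1 j := by
  rw [mom_T, Fintype.sum_sum_type, Fintype.sum_sum_type]
  have e1 := sum_bb_in (fun a l => fT D a (.inl ⟨i, j⟩) l * gT D a (.inl ⟨i, j⟩) l) i j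
  have e2 := sum_rb_in (fun a l => fT D a (.inl ⟨i, j⟩) l * gT D a (.inl ⟨i, j⟩) l) i j
  have e3 := sum_bb_out (fun a l => gT D (.inl ⟨i, j⟩) a l * fT D (.inl ⟨i, j⟩) a l) i j
  rw [if_pos h] at e1 e2 e3
  rw [leg_in] at e2
  have e4 : ∑ a : Vr S, ∑ l ∈ Finset.range (arr S (.inl ⟨i, j⟩) (.inr a)), gT D (.inl ⟨i, j⟩) (.inr a) l * fT D (.inl ⟨i, j⟩) (.inr a) l = 0 := by
    refine Finset.sum_eq_zero fun a _ => ?_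
    rw [arr_br, Finset.sum_range_zero]
  have e5 : ∑ j', fT D (.inl ⟨i0 S, j'⟩) (.inl ⟨i, j⟩) 0 * gT D (.inl ⟨i0 S, j'⟩) (.inl ⟨i, j⟩) 0 =
      pr S i.1 j * ((D.P i.1).val * D.Q i.1) * inc S i.1 j := by
    have := sand (S := S) (i0 S).1 (pr S i.1 j * (D.P i.1).val) (D.Q i.1 * inc S i.1 j)
    rw [Matrix.mul_assoc, ← Matrix.mul_assoc (D.P i.1).val, ← Matrix.mul_assoc (pr S i.1 j)] at this
    refine (Finset.sum_congr rfl fun j' _ => ?_).trans this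
    exact congrArg₂ (fun (A : Matrix (Fin (S.nn i.1 j)) (Fin (S.nn (i0 S).1 j')) ℂ)
      (B : Matrix (Fin (S.nn (i0 S).1 j')) (Fin (S.nn i.1 j)) ℂ) => A * B) (fT_b0 D i h j' j 0)
      ((gT_b0 D i h j' j 0).trans (Matrix.mul_assoc _ _ _))
  rw [e5] at e1
  have e6 := KK_split D i j
  rw [Matrix.mul_add, Matrix.mul_add, Matrix.add_mul, Matrix.add_mul, ← e6]
  exact (congrArg₂ (· - ·) (congrArg₂ (· + ·) e1 e2) (congrArg₂ (· + ·) e3 e4)).trans (by abel)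

theorem abel_aux {A : Type*} [AddCommGroup A] (a b c d e : A) : (0 + a) + (b + c) - ((d + e) + 0) = ((a - e) + b + c) - d := by abel

theorem mom_0 (D : GD S) (j : Fin (S.m (i0 S).1)) :
    moment S (ofGD D) (.inl ⟨i0 S, j⟩) = pr S (i0 S).1 j * (KK D (i0 S).1 j + D.F (i0 S).1 j 0 * D.G (i0 S).1 j 0
      + (∑ i' : Fin (S.p+1), if ¬ Iirr S i' then ∑ j', D.F i' j' 0 * D.G i' j' 0 else 0)
      - ∑ i' ∈ Finset.univ.erase (i0 S), D.Q i'.1 * (D.P i'.1).val) * inc S (i0 S).1 j := by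
  rw [mom_T, Fintype.sum_sum_type, Fintype.sum_sum_type]
  have e1 := sum_bb_in (fun a l => fT D a (.inl ⟨i0 S, j⟩) l * gT D a (.inl ⟨i0 S, j⟩) l) (i0 S) j
  have e2 := sum_rb_in (fun a l => fT D a (.inl ⟨i0 S, j⟩) l * gT D a (.inl ⟨i0 S, j⟩) l) (i0 S) j
  have e3 := sum_bb_out (fun a l => gT D (.inl ⟨i0 S, j⟩) a l * fT D (.inl ⟨i0 S, j⟩) a l) (i0 S) j
  have h : ¬ ((i0 S).1 ≠ 0) := fun h => h rfl
  rw [if_neg h] at e1 e2 e3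
  rw [leg_in] at e2
  simp only [leg_in] at e2
  have e4 : ∑ a : Vr S, ∑ l ∈ Finset.range (arr S (.inl ⟨i0 S, j⟩) (.inr a)), gT D (.inl ⟨i0 S, j⟩) (.inr a) l * fT D (.inl ⟨i0 S, j⟩) (.inr a) l = 0 := by
    refine Finset.sum_eq_zero fun a _ => ?_
    rw [arr_br, Finset.sum_range_zero]
  have e5 : ∑ i' ∈ Finset.univ.erase (i0 S), ∑ j', gT D (.inl ⟨i0 S, j⟩) (.inl ⟨i', j'⟩) 0 * fT D (.inl ⟨i0 S, j⟩) (.inl ⟨i', j'⟩) 0 =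
      pr S (i0 S).1 j * (∑ i' ∈ Finset.univ.erase (i0 S), D.Q i'.1 * (D.P i'.1).val) * inc S (i0 S).1 j := by
    rw [Matrix.mul_sum, Matrix.sum_mul]
    refine Finset.sum_congr rfl fun i' hi' => ?_
    have hi : i'.1 ≠ 0 := fun e => Finset.ne_of_mem_erase hi' (Subtype.ext e)
    have := sand (S := S) i'.1 (pr S (i0 S).1 j * D.Q i'.1) ((D.P i'.1).val * inc S (i0 S).1 j)
    rw [Matrix.mul_assoc, ← Matrix.mul_assoc (D.Q i'.1), ← Matrix.mul_assoc (pr S (i0 S).1 j)] at this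
    refine (Finset.sum_congr rfl fun j' _ => ?_).trans this
    exact congrArg₂ (fun (A : Matrix (Fin (S.nn (i0 S).1 j)) (Fin (S.nn i'.1 j')) ℂ)
      (B : Matrix (Fin (S.nn i'.1 j')) (Fin (S.nn (i0 S).1 j)) ℂ) => A * B) (gT_b0 D i' hi j j' 0)
      ((fT_b0 D i' hi j j' 0).trans (Matrix.mul_assoc _ _ _))
  rw [e5] at e3
  have e7 : (∑ i' : Fin (S.p+1), if ¬ Iirr S i' then ∑ j', pr S (i0 S).1 j * (D.F i' j' 0 * D.G i' j' 0) * inc S (i0 S).1 j else 0) =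
    pr S (i0 S).1 j * (∑ i' : Fin (S.p+1), if ¬ Iirr S i' then ∑ j', D.F i' j' 0 * D.G i' j' 0 else 0) * inc S (i0 S).1 j := by
    rw [Matrix.mul_sum, Matrix.sum_mul]
    refine Finset.sum_congr rfl fun i' _ => ?_
    split_ifs
    · rw [Matrix.mul_zero, Matrix.zero_mul]
    · rw [Matrix.mul_sum, Matrix.sum_mul]
  have e6 := KK_split D (i0 S) j
  rw [Matrix.mul_sub, Matrix.sub_mul, Matrix.mul_add, Matrix.mul_add, Matrix.add_mul, Matrix.add_mul, ← e6, ← e7]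
  exact (congrArg₂ (· - ·) (congrArg₂ (· + ·) e1 e2) (congrArg₂ (· + ·) e3 e4)).trans (abel_aux _ _ _ _ _)

theorem leg_up (D : GD S) (i) (j : Fin (S.m i)) (κ : Fin (S.e i j - 1)) :
    (∑ a : V S, ∑ l ∈ Finset.range (arr S a (.inr ⟨i, j, κ⟩)), fT D a (.inr ⟨i, j, κ⟩) l * gT D a (.inr ⟨i, j, κ⟩) l) =
    D.lf i j κ.val * D.lg i j κ.val := by
  have e1 := sum_rr_in (fun a l => fT D a (.inr ⟨i, j, κ⟩) l * gT D a (.inr ⟨i, j, κ⟩) l) i j κ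
  rw [Fintype.sum_sum_type]
  have e4 : ∑ a : Vb S, ∑ l ∈ Finset.range (arr S (.inl a) (.inr ⟨i, j, κ⟩)), fT D (.inl a) (.inr ⟨i, j, κ⟩) l * gT D (.inl a) (.inr ⟨i, j, κ⟩) l = 0 := by
    refine Finset.sum_eq_zero fun a _ => ?_
    rw [arr_br, Finset.sum_range_zero]
  refine (congrArg₂ (· + ·) e4 e1).trans ?_
  simp only [zero_add]
  split_ifs with h
  · rfl
  · rw [mul_empty (rk_big i j (κ.val+1) (by omega)) (D.lf i j κ.val) (D.lg i j κ.val)]; rfl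

theorem mom_r0 (D : GD S) (EF : ∀ i j, EE S i j * D.F i j 0 = D.F i j 0) (i) (j : Fin (S.m i)) (h : 0 < S.e i j - 1) :
    moment S (ofGD D) (.inr ⟨i, j, ⟨0, h⟩⟩) = D.lf i j 0 * D.lg i j 0 - D.G i j 0 * D.F i j 0 := by
  rw [mom_T, leg_up]
  have e1 := sum_rr_out (fun a l => gT D (.inr ⟨i, j, ⟨0, h⟩⟩) a l * fT D (.inr ⟨i, j, ⟨0, h⟩⟩) a l) i j ⟨0, h⟩
  have e2 := sum_rb_out (fun a l => gT D (.inr ⟨i, j, ⟨0, h⟩⟩) a l * fT D (.inr ⟨i, j, ⟨0, h⟩⟩) a l) i j ⟨0, h⟩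
  rw [dif_neg (lt_irrefl 0)] at e1
  rw [if_pos rfl] at e2
  rw [Fintype.sum_sum_type]
  refine congrArg₂ (· - ·) rfl ((congrArg₂ (· + ·) e2 e1).trans ?_)
  simp only [add_zero]
  split_ifs with hi
  · show (D.G i j 0 * inc S i j) * (pr S i j * D.F i j 0) = _
    have := EF i j
    rw [EE, Matrix.mul_assoc] at this
    rw [Matrix.mul_assoc, this]
  · exact sand (S := S) (i0 S).1 (D.G i j 0) (D.F i j 0)

theorem mom_rs (D : GD S) (i) (j : Fin (S.m i)) (k : ℕ) (h : k + 1 < S.e i j - 1) :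
    moment S (ofGD D) (.inr ⟨i, j, ⟨k+1, h⟩⟩) = D.lf i j (k+1) * D.lg i j (k+1) - D.lg i j k * D.lf i j k := by
  rw [mom_T, leg_up]
  have e1 := sum_rr_out (fun a l => gT D (.inr ⟨i, j, ⟨k+1, h⟩⟩) a l * fT D (.inr ⟨i, j, ⟨k+1, h⟩⟩) a l) i j ⟨k+1, h⟩
  have e2 := sum_rb_out (fun a l => gT D (.inr ⟨i, j, ⟨k+1, h⟩⟩) a l * fT D (.inr ⟨i, j, ⟨k+1, h⟩⟩) a l) i j ⟨k+1, h⟩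
  rw [dif_pos (Nat.succ_pos k)] at e1
  rw [if_neg (Nat.succ_ne_zero k)] at e2
  rw [Fintype.sum_sum_type]
  refine congrArg₂ (· - ·) rfl ((congrArg₂ (· + ·) e2 e1).trans ?_)
  simp only [zero_add]
  rfl

end OfSec
end

noncomputable section
section MuSec
variable {S : Setup}

/-- Normalized data. -/
structure Nrm (D : GD S) : Prop where
  P1 : ∀ i, (¬ Iirr S i ∨ i = 0) → D.P i = 1
  EF : ∀ i j, EE S i j * D.F i j 0 = D.F i j 0
  GE : ∀ i j, D.G i j 0 * EE S i j = D.G i j 0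

theorem blk_iff (i) (j) (A B : Matrix (Fin S.n) (Fin S.n) ℂ) :
    EE S i j * A * EE S i j = EE S i j * B * EE S i j ↔ pr S i j * A * inc S i j = pr S i j * B * inc S i j := by
  have e1 : ∀ A, EE S i j * A * EE S i j = inc S i j * (pr S i j * A * inc S i j) * pr S i j := by
    intro A; simp only [EE, Matrix.mul_assoc]
  have e2 : ∀ A, pr S i j * A * inc S i j = pr S i j * (EE S i j * A * EE S i j) * inc S i j := by
    intro A
    calc _ = (pr S i j * EE S i j) * A * (EE S i j * inc S i j) := by rw [EE_pr, EE_inc]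
      _ = _ := by simp only [Matrix.mul_assoc]
  constructor
  · intro h; rw [e2, h, ← e2]
  · intro h; rw [e1, h, ← e1]

theorem star_iff (D : GD S) (N : Nrm D) (i) (j) :
    (EE S i j * ((D.P i).val * D.res i * ((D.P i)⁻¹).val) * EE S i j =
    EE S i j * Ps S i (D.X i) (S.kk i - 1) * EE S i j + EE S i j * D.Th i * EE S i j) ↔
    pr S i j * ((D.P i).val * D.res i * ((D.P i)⁻¹).val) * inc S i j =
      pr S i j * KK D i j * inc S i j + xiN S i j 0 • 1 + pr S i j * (D.F i j 0 * D.G i j 0) * inc S i j := by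
  have : EE S i j * Ps S i (D.X i) (S.kk i - 1) * EE S i j + EE S i j * D.Th i * EE S i j =
    EE S i j * (KK D i j + xiN S i j 0 • 1 + D.F i j 0 * D.G i j 0) * EE S i j := by
    rw [KK_Ps, Th_block D N.EF N.GE, mul_add, mul_add, add_mul, add_mul, mul_smul_comm, smul_mul_assoc, mul_one, EE_sq,
      ← Matrix.mul_assoc (EE S i j) (D.F i j 0), N.EF, Matrix.mul_assoc (D.F i j 0), N.GE, add_assoc]
  rw [this, blk_iff, Matrix.mul_add, Matrix.mul_add, Matrix.add_mul, Matrix.add_mul, Matrix.mul_smul, Matrix.smul_mul, Matrix.mul_one, pr_inc_same]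

theorem ab1 {A : Type*} [AddCommGroup A] (a k x f : A) : -a = k + x + f ↔ a + k + f = -x := by
  constructor
  · intro h
    have : a = -(k + x + f) := by rw [← h, neg_neg]
    rw [this]; abel
  · intro h
    have : x = -(a + k + f) := by rw [h, neg_neg]
    rw [this]; abel

theorem ab2 {A : Type*} [AddCommGroup A] (c z y k x f : A) : -c - z + y = k + x + f ↔ k + f + z - y = -x - c := by
  constructor
  · intro h
    have : x = -c - z + y - k - f := by rw [h]; abel
    rw [this]; abel
  · intro h
    have : x = - (k + f + z - y) - c := by rw [h]; abel
    rw [this]; abel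

theorem mu_b (D : GD S) (N : Nrm D) (i : {i : Fin (S.p+1) // Iirr S i}) (h : i.1 ≠ 0) (j : Fin (S.m i.1)) :
    moment S (ofGD D) (.inl ⟨i, j⟩) = lam S (.inl ⟨i, j⟩) • 1 ↔
    pr S i.1 j * ((D.P i.1).val * D.res i.1 * ((D.P i.1)⁻¹).val) * inc S i.1 j =
      pr S i.1 j * KK D i.1 j * inc S i.1 j + xiN S i.1 j 0 • 1 + pr S i.1 j * (D.F i.1 j 0 * D.G i.1 j 0) * inc S i.1 j := by
  have e1 : lam S (.inl ⟨i, j⟩) = - xiN S i.1 j 0 := by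
    rw [xiN, dif_pos (S.he i.1 j)]
    exact dif_neg h
  have e2 : (D.P i.1).val * D.res i.1 * ((D.P i.1)⁻¹).val = - ((D.P i.1).val * D.Q i.1) := by
    rw [GD.res, if_neg (not_not.2 i.2), if_neg h, mul_neg, neg_mul, mul_assoc, mul_assoc, Units.mul_inv, mul_one]
  rw [mom_b D i h, e1, e2, Matrix.mul_add, Matrix.mul_add, Matrix.add_mul, Matrix.add_mul, Matrix.mul_neg, Matrix.neg_mul, neg_smul]
  exact (ab1 _ _ _ _).symm

theorem res0 (D : GD S) : D.res (i0 S).1 =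
    -((∑ i' ∈ Finset.univ.filter (fun i' : Fin (S.p+1) => ¬ Iirr S i'), xiN S i' ⟨0, S.hm i'⟩ 0) • (1 : Matrix (Fin S.n) (Fin S.n) ℂ))
    - (∑ i' : Fin (S.p+1), if ¬ Iirr S i' then ∑ j', D.F i' j' 0 * D.G i' j' 0 else 0)
    + ∑ i' ∈ Finset.univ.erase (i0 S), D.Q i'.1 * (D.P i'.1).val := by
  have hY : ∑ i' ∈ Finset.univ.erase (i0 S), D.Q i'.1 * (D.P i'.1).val =
      ∑ i' : Fin (S.p+1), if ¬ Iirr S i' then 0 else if i' = 0 then 0 else D.Q i' * (D.P i').val := by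
    have a : ∑ i' : {i : Fin (S.p+1) // Iirr S i}, (if i'.1 = 0 then 0 else D.Q i'.1 * (D.P i'.1).val) =
        ∑ i' ∈ Finset.univ.erase (i0 S), D.Q i'.1 * (D.P i'.1).val := by
      rw [← Finset.add_sum_erase _ _ (Finset.mem_univ (i0 S)), if_pos (show (i0 S).1 = 0 from rfl), zero_add]
      refine Finset.sum_congr rfl fun i' hi' => ?_
      rw [if_neg (fun e : i'.1 = 0 => Finset.ne_of_mem_erase hi' (Subtype.ext e))]
    rw [← a, ← Finset.sum_subtype (Finset.univ.filter (Iirr S)) (by simp) (fun i' => if i' = 0 then 0 else D.Q i' * (D.P i').val),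
      Finset.sum_filter]
    refine Finset.sum_congr rfl fun i' _ => ?_
    by_cases hi : Iirr S i'
    · rw [if_pos hi, if_neg (not_not.2 hi)]
    · rw [if_neg hi, if_pos hi]
  rw [hY, Finset.sum_filter, Finset.sum_smul, ← Finset.sum_neg_distrib, ← Finset.sum_sub_distrib, ← Finset.sum_add_distrib, GD.res,
    if_neg (not_not.2 (i0 S).2), if_pos (show (i0 S).1 = 0 from rfl)]
  refine Finset.sum_congr rfl fun i' _ => ?_
  by_cases hi : Iirr S i'
  · rw [if_neg (not_not.2 hi), if_neg (not_not.2 hi), if_neg (not_not.2 hi), if_neg (not_not.2 hi)]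
    simp
  · rw [if_pos hi, if_pos hi, if_pos hi, if_pos hi, GD.Th, Finset.sum_add_distrib, add_zero, neg_add', Finset.sum_eq_single ⟨0, S.hm i'⟩,
      EE_reg _ hi]
    · intro b _ hb
      haveI := reg_sub i' hi
      exact absurd (Subsingleton.elim _ _) hb
    · simp

theorem mu_0 (D : GD S) (N : Nrm D) (j : Fin (S.m (i0 S).1)) :
    moment S (ofGD D) (.inl ⟨i0 S, j⟩) = lam S (.inl ⟨i0 S, j⟩) • 1 ↔
    pr S (i0 S).1 j * ((D.P (i0 S).1).val * D.res (i0 S).1 * ((D.P (i0 S).1)⁻¹).val) * inc S (i0 S).1 j =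
      pr S (i0 S).1 j * KK D (i0 S).1 j * inc S (i0 S).1 j + xiN S (i0 S).1 j 0 • 1 + pr S (i0 S).1 j * (D.F (i0 S).1 j 0 * D.G (i0 S).1 j 0) * inc S (i0 S).1 j := by
  have e1 : lam S (.inl ⟨i0 S, j⟩) = - xiN S (i0 S).1 j 0 - ∑ i' ∈ Finset.univ.filter (fun i' : Fin (S.p+1) => ¬ Iirr S i'), xiN S i' ⟨0, S.hm i'⟩ 0 := by
    rw [xiN, dif_pos (S.he (i0 S).1 j)]
    have : ∀ i', xiN S i' ⟨0, S.hm i'⟩ 0 = S.xi i' ⟨0, S.hm i'⟩ ⟨0, S.he i' ⟨0, S.hm i'⟩⟩ := fun i' => dif_pos _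
    rw [Finset.sum_congr rfl fun i' _ => this i']
    rw [lam, dif_pos (show (i0 S).1 = 0 from rfl)]; rfl
  rw [mom_0 D, e1, N.P1 (i0 S).1 (Or.inr rfl), inv_one, Units.val_one, mul_one, one_mul, res0]
  simp only [Matrix.mul_add, Matrix.mul_sub, Matrix.add_mul, Matrix.sub_mul, Matrix.mul_neg, Matrix.neg_mul, Matrix.mul_smul,
    Matrix.smul_mul, Matrix.mul_one, pr_inc_same]
  rw [sub_smul, neg_smul]
  exact (ab2 _ _ _ _ _ _).symm

theorem empty_eq {a : ℕ} (h : a = 0) (A B : Matrix (Fin a) (Fin a) ℂ) : A = B := by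
  subst h
  ext i; exact i.elim0

theorem lam_r (i) (j : Fin (S.m i)) (κ) : lam S (.inr ⟨i, j, κ⟩) = xiN S i j κ.val - xiN S i j (κ.val+1) := by
  have h := κ.2
  rw [xiN, dif_pos (by omega), xiN, dif_pos (by omega)]; rfl

theorem onMu_iff (D : GD S) (N : Nrm D) : onMu S (lam S) (ofGD D) ↔ D.Ok := by
  constructor
  · intro H
    refine ⟨N.P1, N.EF, N.GE, ?_, ?_⟩
    · intro i j
      constructor
      · by_cases h : 0 < S.e i j - 1
        · have := H (.inr ⟨i, j, ⟨0, h⟩⟩)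
          rw [mom_r0 D N.EF, lam_r] at this
          exact this
        · exact empty_eq (rk_big i j 0 (by omega)) _ _
      · intro k
        by_cases h : k + 1 < S.e i j - 1
        · have := H (.inr ⟨i, j, ⟨k+1, h⟩⟩)
          rw [mom_rs D, lam_r] at this
          exact this
        · exact empty_eq (rk_big i j (k+1) (by omega)) _ _
    · intro i j
      by_cases hi : Iirr S i
      · rw [star_iff D N]
        by_cases h0 : i = 0
        · subst h0
          exact (mu_0 D N j).1 (H _)
        · exact (mu_b D N ⟨i, hi⟩ h0 j).1 (H _)
      · rw [reg_Psres _ i hi, zero_add, N.P1 i (Or.inl hi), GD.res, if_pos hi]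
        simp
  · intro H c
    rcases c with ⟨i, j⟩ | ⟨i, j, κ, hκ⟩
    · have := (star_iff D N i.1 j).1 (H.star i.1 j)
      by_cases h0 : i.1 = 0
      · obtain rfl : i = i0 S := Subtype.ext h0
        exact (mu_0 D N j).2 this
      · exact (mu_b D N i h0 j).2 this
    · rw [lam_r]
      cases κ with
      | zero => rw [mom_r0 D N.EF]; exact (H.leg i j).1
      | succ k => rw [mom_rs D]; exact (H.leg i j).2 k

end MuSec
end

noncomputable section
section SurjSec
variable {S : Setup}

theorem unit_sub {n : ℕ} {α β : Type*} [Fintype α] [Fintype β] [DecidableEq α] [DecidableEq β] (A : Matrix (Fin n) (Fin n) ℂ)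
    (e : α ≃ Fin n) (f : β ≃ Fin n) : Function.Bijective ((A.submatrix e f).mulVec) ↔ IsUnit A := by
  have h : (A.submatrix e f).mulVec = (fun w : Fin n → ℂ => w ∘ e) ∘ A.mulVec ∘ (fun v : β → ℂ => v ∘ f.symm) := by
    funext v
    rw [Function.comp_apply, Function.comp_apply, ← Matrix.submatrix_mulVec_equiv]
  have h1 : Function.Bijective (fun w : Fin n → ℂ => w ∘ e) := (Equiv.arrowCongr e.symm (Equiv.refl ℂ)).bijective
  have h2 : Function.Bijective (fun v : β → ℂ => v ∘ f.symm) := (Equiv.arrowCongr f (Equiv.refl ℂ)).bijective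
  rw [h, Function.Bijective.of_comp_iff' h1, Function.Bijective.of_comp_iff _ h2]
  constructor
  · intro h
    exact Matrix.mulVec_injective_iff_isUnit.1 h.1
  · intro h
    exact ⟨Matrix.mulVec_injective_iff_isUnit.2 h, Matrix.mulVec_surjective_iff_isUnit.2 h⟩

theorem cross_of (D : GD S) (i : {i : Fin (S.p+1) // Iirr S i}) (h : i.1 ≠ 0) :
    crossMat S (ofGD D) i = (D.P i.1).val.submatrix (S.emb i.1) (S.emb 0) := by
  ext ⟨j', x⟩ ⟨j, y⟩
  have a := arr_bb_0 i h j j'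
  rw [crossMat, Matrix.of_apply, dif_pos (by show 0 < arr S (Sum.inl ⟨i0 S, j⟩) (Sum.inl ⟨i, j'⟩); rw [a]; exact one_pos)]
  refine (congrFun (congrFun (fT_b0 D i h j j' 0) x) y).trans ?_
  exact (mul_inc_apply _ _ _ _ _).trans (pr_mul_apply _ _ _ _ _)

theorem crossBij_of (D : GD S) : crossBij S (ofGD D) := by
  intro i h
  rw [cross_of D i h]
  exact (unit_sub _ _ _).2 (D.P i.1).isUnit

/-- Assembling a matrix from blocks. -/
def asm (i i2 : Fin (S.p+1)) (B : ∀ (s : Fin (S.m i)) (s2 : Fin (S.m i2)), Matrix (Fin (S.nn i s)) (Fin (S.nn i2 s2)) ℂ) :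
    Matrix (Fin S.n) (Fin S.n) ℂ :=
  Matrix.of fun a b => B ((S.emb i).symm a).1 ((S.emb i2).symm b).1 ((S.emb i).symm a).2 ((S.emb i2).symm b).2

theorem asm_apply (i i2 : Fin (S.p+1)) (B) (s s2 x y) : asm i i2 B (S.emb i ⟨s, x⟩) (S.emb i2 ⟨s2, y⟩) = B s s2 x y := by
  have h : ∀ (x' : Σ j, Fin (S.nn i j)) (y' : Σ j, Fin (S.nn i2 j)), x' = ⟨s, x⟩ → y' = ⟨s2, y⟩ → B x'.1 y'.1 x'.2 y'.2 = B s s2 x y := by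
    rintro _ _ rfl rfl; rfl
  exact h _ _ ((S.emb i).symm_apply_apply _) ((S.emb i2).symm_apply_apply _)

theorem asm_blk (i i2 : Fin (S.p+1)) (B) (s s2) : pr S i s * asm i i2 B * inc S i2 s2 = B s s2 := by
  ext x y
  rw [mul_inc_apply, pr_mul_apply, asm_apply]

/-- Total arrows. -/
def TF (M : Rep S (alN S)) (a b : V S) (l : ℕ) : Matrix (Fin (alN S b)) (Fin (alN S a)) ℂ :=
  if h : l < arr S a b then M.f a b ⟨l, h⟩ else 0
/-- Total reverse arrows. -/
def TG (M : Rep S (alN S)) (a b : V S) (l : ℕ) : Matrix (Fin (alN S a)) (Fin (alN S b)) ℂ :=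
  if h : l < arr S a b then M.g a b ⟨l, h⟩ else 0

theorem ofGD_eq (D : GD S) (M : Rep S (alN S)) (h : ∀ a b l, l < arr S a b → fT D a b l = TF M a b l ∧ gT D a b l = TG M a b l) :
    ofGD D = M := by
  obtain ⟨f, g⟩ := M
  rw [ofGD]
  congr 1
  · funext a b ρ
    rw [(h a b ρ.1 ρ.2).1, TF, dif_pos ρ.2]
  · funext a b ρ
    rw [(h a b ρ.1 ρ.2).2, TG, dif_pos ρ.2]

theorem cross_asm (M : Rep S (alN S)) (i : {i : Fin (S.p+1) // Iirr S i}) :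
    crossMat S M i = (asm i.1 0 (fun s' s => TF M (.inl ⟨i0 S, s⟩) (.inl ⟨i, s'⟩) 0)).submatrix (S.emb i.1) (S.emb 0) := by
  ext ⟨j', x⟩ ⟨j, y⟩
  refine Eq.trans ?_ (asm_apply i.1 0 (fun s' s => TF M (.inl ⟨i0 S, s⟩) (.inl ⟨i, s'⟩) 0) j' j x y).symm
  rw [crossMat, Matrix.of_apply, TF]
  by_cases h : 0 < arr S (.inl ⟨i0 S, j⟩) (.inl ⟨i, j'⟩)
  · rw [dif_pos h]
    exact dif_pos h
  · rw [dif_neg h]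
    exact dif_neg h

/-- The `P` part of the global data of a representation. -/
def PM (M : Rep S (alN S)) (hM : crossBij S M) (i : Fin (S.p+1)) : (Matrix (Fin S.n) (Fin S.n) ℂ)ˣ :=
  if h : Iirr S i ∧ i ≠ 0 then
    ((unit_sub _ _ _).1 ((cross_asm M ⟨i, h.1⟩) ▸ hM ⟨i, h.1⟩ h.2)).unit
  else 1

/-- Leg arrows with explicit sizes. -/
def tf3 (M : Rep S (alN S)) (i : Fin (S.p+1)) (j : Fin (S.m i)) (h : 0 < S.e i j - 1) (i' : {i : Fin (S.p+1) // Iirr S i}) (j' : Fin (S.m i'.1)) :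
    Matrix (Fin (S.nn i'.1 j')) (Fin (rk S i j 0)) ℂ := TF M (.inr ⟨i, j, ⟨0, h⟩⟩) (.inl ⟨i', j'⟩) 0
def tg3 (M : Rep S (alN S)) (i : Fin (S.p+1)) (j : Fin (S.m i)) (h : 0 < S.e i j - 1) (i' : {i : Fin (S.p+1) // Iirr S i}) (j' : Fin (S.m i'.1)) :
    Matrix (Fin (rk S i j 0)) (Fin (S.nn i'.1 j')) ℂ := TG M (.inr ⟨i, j, ⟨0, h⟩⟩) (.inl ⟨i', j'⟩) 0

def FM (M : Rep S (alN S)) (i : Fin (S.p+1)) (j : Fin (S.m i)) (h : 0 < S.e i j - 1) : Matrix (Fin S.n) (Fin (rk S i j 0)) ℂ :=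
  if hi : Iirr S i then inc S i j * tf3 M i j h ⟨i, hi⟩ j
  else ∑ j', inc S (i0 S).1 j' * tf3 M i j h (i0 S) j'
def GM (M : Rep S (alN S)) (i : Fin (S.p+1)) (j : Fin (S.m i)) (h : 0 < S.e i j - 1) : Matrix (Fin (rk S i j 0)) (Fin S.n) ℂ :=
  if hi : Iirr S i then tg3 M i j h ⟨i, hi⟩ j * pr S i j
  else ∑ j', tg3 M i j h (i0 S) j' * pr S (i0 S).1 j'

def toGD (M : Rep S (alN S)) (hM : crossBij S M) : GD S where
  X i l := if hi : Iirr S i then asm i i (fun s' s => if s < s' then TF M (.inl ⟨⟨i, hi⟩, s⟩) (.inl ⟨⟨i, hi⟩, s'⟩) l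
      else TG M (.inl ⟨⟨i, hi⟩, s'⟩) (.inl ⟨⟨i, hi⟩, s⟩) l) else 0
  P := PM M hM
  Q i := if hi : Iirr S i then asm 0 i (fun s s' => TG M (.inl ⟨i0 S, s⟩) (.inl ⟨⟨i, hi⟩, s'⟩) 0) else 0
  F i j k := match k with
    | 0 => if h : 0 < S.e i j - 1 then FM M i j h else 0
    | _+1 => 0
  G i j k := match k with
    | 0 => if h : 0 < S.e i j - 1 then GM M i j h else 0
    | _+1 => 0
  f a b := if h : a.2.2 < S.e a.1 a.2.1 - 1 ∧ b.2.2 < S.e b.1 b.2.1 - 1 then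
      TF M (.inr ⟨b.1, b.2.1, ⟨b.2.2, h.2⟩⟩) (.inr ⟨a.1, a.2.1, ⟨a.2.2, h.1⟩⟩) 0 else 0
  g a b := if h : a.2.2 < S.e a.1 a.2.1 - 1 ∧ b.2.2 < S.e b.1 b.2.1 - 1 then
      TG M (.inr ⟨b.1, b.2.1, ⟨b.2.2, h.2⟩⟩) (.inr ⟨a.1, a.2.1, ⟨a.2.2, h.1⟩⟩) 0 else 0

theorem toGD_nrm (M : Rep S (alN S)) (hM : crossBij S M) : Nrm (toGD M hM) := by
  refine ⟨?_, ?_, ?_⟩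
  · intro i hi
    show PM M hM i = 1
    rw [PM, dif_neg]
    rintro ⟨a, b⟩
    rcases hi with hi | hi
    · exact hi a
    · exact b hi
  · intro i j
    show EE S i j * (if h : 0 < S.e i j - 1 then FM M i j h else 0 : Matrix (Fin S.n) (Fin (rk S i j 0)) ℂ) = (if h : 0 < S.e i j - 1 then FM M i j h else 0 : Matrix (Fin S.n) (Fin (rk S i j 0)) ℂ)
    by_cases h : 0 < S.e i j - 1
    · rw [dif_pos h]
      by_cases hi : Iirr S i
      · rw [FM, dif_pos hi, ← Matrix.mul_assoc, EE_inc]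
      · rw [EE_reg i hi, Matrix.one_mul]
    · rw [dif_neg h, Matrix.mul_zero]
  · intro i j
    show (if h : 0 < S.e i j - 1 then GM M i j h else 0 : Matrix (Fin (rk S i j 0)) (Fin S.n) ℂ) * EE S i j = (if h : 0 < S.e i j - 1 then GM M i j h else 0 : Matrix (Fin (rk S i j 0)) (Fin S.n) ℂ)
    by_cases h : 0 < S.e i j - 1
    · rw [dif_pos h]
      by_cases hi : Iirr S i
      · rw [GM, dif_pos hi, Matrix.mul_assoc, EE_pr]
      · rw [EE_reg i hi, Matrix.mul_one]
    · rw [dif_neg h, Matrix.zero_mul]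

theorem toGD_of (M : Rep S (alN S)) (hM : crossBij S M) : ofGD (toGD M hM) = M := by
  apply ofGD_eq
  rw [forall_arr]
  refine ⟨?_, ?_, ?_, ?_, ?_⟩
  · intro i s s' hs l hl
    rw [fT_bb, gT_bb]
    have e : (toGD M hM).X i.1 l = asm i.1 i.1 (fun s' s => if s < s' then TF M (.inl ⟨i, s⟩) (.inl ⟨i, s'⟩) l
      else TG M (.inl ⟨i, s'⟩) (.inl ⟨i, s⟩) l) := dif_pos i.2
    rw [e]
    constructor
    · exact (asm_blk i.1 i.1 _ s' s).trans (if_pos hs)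
    · exact (asm_blk i.1 i.1 _ s s').trans (if_neg (lt_asymm hs))
  · intro i h j j'
    rw [fT_b0 _ i h, gT_b0 _ i h]
    have e : ((toGD M hM).P i.1).val = asm i.1 0 (fun s' s => TF M (.inl ⟨i0 S, s⟩) (.inl ⟨i, s'⟩) 0) := by
      show (PM M hM i.1).val = _
      rw [PM, dif_pos ⟨i.2, h⟩]; rfl
    have e' : (toGD M hM).Q i.1 = asm 0 i.1 (fun s s' => TG M (.inl ⟨i0 S, s⟩) (.inl ⟨i, s'⟩) 0) := dif_pos i.2
    rw [e, e']
    exact ⟨asm_blk i.1 0 _ j' j, asm_blk 0 i.1 _ j j'⟩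
  · intro i j h
    have e : (toGD M hM).F i.1 j 0 = inc S i.1 j * tf3 M i.1 j h i j :=
      (dif_pos h).trans (dif_pos i.2)
    have e' : (toGD M hM).G i.1 j 0 = tg3 M i.1 j h i j * pr S i.1 j :=
      (dif_pos h).trans (dif_pos i.2)
    constructor
    · show pr S i.1 j * (toGD M hM).F i.1 j 0 = _
      rw [e, ← Matrix.mul_assoc, pr_inc_same, Matrix.one_mul]; rfl
    · show (toGD M hM).G i.1 j 0 * inc S i.1 j = _
      rw [e', Matrix.mul_assoc, pr_inc_same, Matrix.mul_one]; rfl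
  · intro i hi j h j'
    have e : (toGD M hM).F i j 0 = ∑ j', inc S (i0 S).1 j' * tf3 M i j h (i0 S) j' :=
      (dif_pos h).trans (dif_neg hi)
    have e' : (toGD M hM).G i j 0 = ∑ j', tg3 M i j h (i0 S) j' * pr S (i0 S).1 j' :=
      (dif_pos h).trans (dif_neg hi)
    constructor
    · show pr S (i0 S).1 j' * (toGD M hM).F i j 0 = _
      rw [e, Matrix.mul_sum, Finset.sum_eq_single j']
      · rw [← Matrix.mul_assoc, pr_inc_same, Matrix.one_mul]; rfl
      · intro s _ hs
        rw [← Matrix.mul_assoc, pr_inc_ne _ _ _ hs.symm, Matrix.zero_mul]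
      · simp
    · show (toGD M hM).G i j 0 * inc S (i0 S).1 j' = _
      rw [e', Matrix.sum_mul, Finset.sum_eq_single j']
      · rw [Matrix.mul_assoc, pr_inc_same, Matrix.mul_one]; rfl
      · intro s _ hs
        rw [Matrix.mul_assoc, pr_inc_ne _ _ _ hs, Matrix.mul_zero]
      · simp
  · intro i j k h
    exact ⟨dif_pos ⟨Nat.lt_of_succ_lt h, h⟩, dif_pos ⟨Nat.lt_of_succ_lt h, h⟩⟩

end SurjSec
end

noncomputable section
section VEqSec
variable {S : Setup}

/-- Vertexwise isomorphisms of global data. -/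
structure VEq (D D' : GD S) (c : ∀ (i : {i : Fin (S.p+1) // Iirr S i}) (j : Fin (S.m i.1)), (Matrix (Fin (S.nn i.1 j)) (Fin (S.nn i.1 j)) ℂ)ˣ)
    (t : ∀ i j k, (Matrix (Fin (rk S i j k)) (Fin (rk S i j k)) ℂ)ˣ) : Prop where
  v1 : ∀ i s s', s ≠ s' → ∀ l < dcnt S i.1 s s', (c i s).val * (pr S i.1 s * D.X i.1 l * inc S i.1 s') = (pr S i.1 s * D'.X i.1 l * inc S i.1 s') * (c i s').val
  v2 : ∀ i, i.1 ≠ 0 → ∀ j j', (c i j').val * (pr S i.1 j' * (D.P i.1).val * inc S (i0 S).1 j) = (pr S i.1 j' * (D'.P i.1).val * inc S (i0 S).1 j) * (c (i0 S) j).val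
  v2' : ∀ i, i.1 ≠ 0 → ∀ j j', (c (i0 S) j).val * (pr S (i0 S).1 j * D.Q i.1 * inc S i.1 j') = (pr S (i0 S).1 j * D'.Q i.1 * inc S i.1 j') * (c i j').val
  v3 : ∀ i j, (c i j).val * (pr S i.1 j * D.F i.1 j 0) = (pr S i.1 j * D'.F i.1 j 0) * (t i.1 j 0).val
  v3' : ∀ i j, (t i.1 j 0).val * (D.G i.1 j 0 * inc S i.1 j) = (D'.G i.1 j 0 * inc S i.1 j) * (c i j).val
  v4 : ∀ i, ¬ Iirr S i → ∀ j j', (c (i0 S) j').val * (pr S (i0 S).1 j' * D.F i j 0) = (pr S (i0 S).1 j' * D'.F i j 0) * (t i j 0).val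
  v4' : ∀ i, ¬ Iirr S i → ∀ j j', (t i j 0).val * (D.G i j 0 * inc S (i0 S).1 j') = (D'.G i j 0 * inc S (i0 S).1 j') * (c (i0 S) j').val
  v5 : ∀ i j k, (t i j k).val * D.lf i j k = D'.lf i j k * (t i j (k+1)).val
  v5' : ∀ i j k, (t i j (k+1)).val * D.lg i j k = D'.lg i j k * (t i j k).val

theorem emp_r {a b : ℕ} (h : a = 0) (A B : Matrix (Fin a) (Fin b) ℂ) : A = B := by
  subst h; ext i; exact i.elim0
theorem emp_c {a b : ℕ} (h : b = 0) (A B : Matrix (Fin a) (Fin b) ℂ) : A = B := by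
  subst h; ext i j; exact j.elim0

theorem conj_move {a b : ℕ} (u : (Matrix (Fin a) (Fin a) ℂ)ˣ) (v : (Matrix (Fin b) (Fin b) ℂ)ˣ) (A A' : Matrix (Fin a) (Fin b) ℂ) :
    A' = (u.val * A) * v⁻¹.val ↔ u.val * A = A' * v.val := by
  constructor
  · rintro rfl
    rw [Matrix.mul_assoc, Units.inv_mul, Matrix.mul_one]
  · intro h
    rw [h, Matrix.mul_assoc, Units.mul_inv, Matrix.mul_one]

theorem repConj_arr (D D' : GD S) : repConj S (ofGD D) (ofGD D') ↔ ∃ g : ∀ a : V S, (Matrix (Fin (alN S a)) (Fin (alN S a)) ℂ)ˣ,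
    ∀ a b l, l < arr S a b → (g b).val * fT D a b l = fT D' a b l * (g a).val ∧ (g a).val * gT D a b l = gT D' a b l * (g b).val := by
  constructor
  · rintro ⟨g, h1, h2⟩
    refine ⟨g, fun a b l hl => ⟨?_, ?_⟩⟩
    · exact (conj_move _ _ _ _).1 (h1 a b ⟨l, hl⟩)
    · exact (conj_move _ _ _ _).1 (h2 a b ⟨l, hl⟩)
  · rintro ⟨g, h⟩
    refine ⟨g, fun a b ρ => ?_, fun a b ρ => ?_⟩
    · exact (conj_move _ _ _ _).2 (h a b ρ.1 ρ.2).1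
    · exact (conj_move _ _ _ _).2 (h a b ρ.1 ρ.2).2

theorem repConj_iff (D D' : GD S) : repConj S (ofGD D) (ofGD D') ↔ ∃ c t, VEq D D' c t := by
  rw [repConj_arr]
  constructor
  · rintro ⟨g, h⟩
    rw [forall_arr] at h
    obtain ⟨h1, h2, h3, h4, h5⟩ := h
    obtain ⟨c, hc⟩ : ∃ c : ∀ (i : {i : Fin (S.p+1) // Iirr S i}) (j : Fin (S.m i.1)), (Matrix (Fin (S.nn i.1 j)) (Fin (S.nn i.1 j)) ℂ)ˣ,
      ∀ i j, c i j = g (.inl ⟨i, j⟩) := ⟨fun i j => g (.inl ⟨i, j⟩), fun _ _ => rfl⟩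
    obtain ⟨t, ht⟩ : ∃ t : ∀ i j k, (Matrix (Fin (rk S i j k)) (Fin (rk S i j k)) ℂ)ˣ,
      ∀ i j k (h : k < S.e i j - 1), t i j k = g (.inr ⟨i, j, ⟨k, h⟩⟩) :=
      ⟨fun i j k => if h : k < S.e i j - 1 then g (.inr ⟨i, j, ⟨k, h⟩⟩) else 1, fun i j k h => dif_pos h⟩
    refine ⟨c, t, ?_, ?_, ?_, ?_, ?_, ?_, ?_, ?_, ?_⟩
    · intro i s s' hs l hl
      rw [hc, hc]
      rcases lt_or_gt_of_ne hs with hs | hs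
      · have := (h1 i s s' hs l hl).2
        rw [gT_bb, gT_bb] at this
        exact this
      · have := (h1 i s' s hs l (by rw [dcnt_symm]; exact hl)).1
        rw [fT_bb, fT_bb] at this
        exact this
    · intro i hi j j'
      rw [hc, hc]
      have := (h2 i hi j j').1
      rw [fT_b0 _ i hi, fT_b0 _ i hi] at this
      exact this
    · intro i hi j j'
      rw [hc, hc]
      have := (h2 i hi j j').2
      rw [gT_b0 _ i hi, gT_b0 _ i hi] at this
      exact this
    · intro i j
      by_cases h : 0 < S.e i.1 j - 1
      · rw [hc, ht _ _ _ h]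
        exact (h3 i j h).1
      · exact emp_c (rk_big _ _ _ (by omega)) _ _
    · intro i j
      by_cases h : 0 < S.e i.1 j - 1
      · rw [hc, ht _ _ _ h]
        exact (h3 i j h).2
      · exact emp_r (rk_big _ _ _ (by omega)) _ _
    · intro i hi j j'
      by_cases h : 0 < S.e i j - 1
      · rw [hc, ht _ _ _ h]
        exact (h4 i hi j h j').1
      · exact emp_c (rk_big _ _ _ (by omega)) _ _
    · intro i hi j j'
      by_cases h : 0 < S.e i j - 1
      · rw [hc, ht _ _ _ h]
        exact (h4 i hi j h j').2
      · exact emp_r (rk_big _ _ _ (by omega)) _ _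
    · intro i j k
      by_cases h : k + 1 < S.e i j - 1
      · rw [ht _ _ _ h, ht _ _ _ (Nat.lt_of_succ_lt h)]
        exact (h5 i j k h).1
      · exact emp_c (rk_big _ _ _ (by omega)) _ _
    · intro i j k
      by_cases h : k + 1 < S.e i j - 1
      · rw [ht _ _ _ h, ht _ _ _ (Nat.lt_of_succ_lt h)]
        exact (h5 i j k h).2
      · exact emp_r (rk_big _ _ _ (by omega)) _ _
  · rintro ⟨c, t, H⟩
    refine ⟨fun a => match a with
      | .inl ⟨i, j⟩ => c i j
      | .inr ⟨i, j, κ⟩ => t i j κ.val, ?_⟩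
    rw [forall_arr]
    refine ⟨?_, ?_, ?_, ?_, ?_⟩
    · intro i s s' hs l hl
      rw [fT_bb, gT_bb, fT_bb, gT_bb]
      exact ⟨H.v1 i s' s hs.ne' l (by rw [dcnt_symm]; exact hl), H.v1 i s s' hs.ne l hl⟩
    · intro i h j j'
      rw [fT_b0 _ i h, gT_b0 _ i h, fT_b0 _ i h, gT_b0 _ i h]
      exact ⟨H.v2 i h j j', H.v2' i h j j'⟩
    · intro i j h
      exact ⟨H.v3 i j, H.v3' i j⟩
    · intro i hi j h j'
      exact ⟨H.v4 i hi j j', H.v4' i hi j j'⟩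
    · intro i j k h
      exact ⟨H.v5 i j k, H.v5' i j k⟩

theorem blk_ext {a : ℕ} (i) (A B : Matrix (Fin S.n) (Fin a) ℂ) (h : ∀ j, pr S i j * A = pr S i j * B) : A = B := by
  rw [← Matrix.one_mul A, ← Matrix.one_mul B, ← EE_sum i, Matrix.sum_mul, Matrix.sum_mul]
  refine Finset.sum_congr rfl fun j _ => ?_
  rw [EE, Matrix.mul_assoc, h, Matrix.mul_assoc]

theorem blk_ext' {a : ℕ} (i) (A B : Matrix (Fin a) (Fin S.n) ℂ) (h : ∀ j, A * inc S i j = B * inc S i j) : A = B := by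
  rw [← Matrix.mul_one A, ← Matrix.mul_one B, ← EE_sum i, Matrix.mul_sum, Matrix.mul_sum]
  refine Finset.sum_congr rfl fun j _ => ?_
  rw [EE, ← Matrix.mul_assoc, h, ← Matrix.mul_assoc]

/-- Compatibility of a global matrix with its diagonal blocks. -/
def Cmp (i : Fin (S.p+1)) (h : Matrix (Fin S.n) (Fin S.n) ℂ) (c : ∀ j, Matrix (Fin (S.nn i j)) (Fin (S.nn i j)) ℂ) : Prop :=
  ∀ j, pr S i j * h = c j * pr S i j ∧ h * inc S i j = inc S i j * c j

theorem Cmp.EE {i : Fin (S.p+1)} {h c} (H : Cmp i h c) (j) : h * EE S i j = EE S i j * h := by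
  rw [DS.EE, ← Matrix.mul_assoc, (H j).2, Matrix.mul_assoc, Matrix.mul_assoc, (H j).1]

theorem Cmp.of_EE {i : Fin (S.p+1)} {h : Matrix (Fin S.n) (Fin S.n) ℂ} (H : ∀ j, h * DS.EE S i j = DS.EE S i j * h) :
    Cmp i h (fun j => pr S i j * h * inc S i j) := by
  intro j
  constructor
  · show _ = (pr S i j * h * inc S i j) * pr S i j
    rw [Matrix.mul_assoc, ← DS.EE, Matrix.mul_assoc, H, ← Matrix.mul_assoc, EE_pr]
  · show _ = inc S i j * (pr S i j * h * inc S i j)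
    rw [Matrix.mul_assoc, ← Matrix.mul_assoc, ← DS.EE, ← Matrix.mul_assoc, ← H, Matrix.mul_assoc, EE_inc]

theorem Cmp.blk {i i2 : Fin (S.p+1)} {h c h2 c2} (H : Cmp i h c) (H2 : Cmp i2 h2 c2) (A A' : Matrix (Fin S.n) (Fin S.n) ℂ) (j j2) :
    c j * (pr S i j * A * inc S i2 j2) = (pr S i j * A' * inc S i2 j2) * c2 j2 ↔
      pr S i j * (h * A) * inc S i2 j2 = pr S i j * (A' * h2) * inc S i2 j2 := by
  have e1 : pr S i j * (h * A) * inc S i2 j2 = c j * (pr S i j * A * inc S i2 j2) := by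
    rw [← Matrix.mul_assoc, (H j).1]; simp only [Matrix.mul_assoc]
  have e2 : pr S i j * (A' * h2) * inc S i2 j2 = (pr S i j * A' * inc S i2 j2) * c2 j2 := by
    rw [Matrix.mul_assoc, Matrix.mul_assoc, (H2 j2).2]; simp only [Matrix.mul_assoc]
  rw [e1, e2]

theorem Cmp.blks {i i2 : Fin (S.p+1)} {h c h2 c2} (H : Cmp i h c) (H2 : Cmp i2 h2 c2) (A A' : Matrix (Fin S.n) (Fin S.n) ℂ) :
    (∀ j j2, c j * (pr S i j * A * inc S i2 j2) = (pr S i j * A' * inc S i2 j2) * c2 j2) ↔ h * A = A' * h2 := by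
  constructor
  · intro H'
    refine blk_ext i _ _ fun j => blk_ext' i2 _ _ fun j2 => ?_
    exact (H.blk H2 A A' j j2).1 (H' j j2)
  · intro H' j j2
    rw [H.blk H2, H']

theorem Cmp.XX {i : Fin (S.p+1)} {h c} (H : Cmp i h c) (A A' : Matrix (Fin S.n) (Fin S.n) ℂ) (s s') :
    c s * (pr S i s * A * inc S i s') = (pr S i s * A' * inc S i s') * c s' ↔
    h * (DS.EE S i s * A * DS.EE S i s') = (DS.EE S i s * A' * DS.EE S i s') * h := by
  have e1 : h * (DS.EE S i s * A * DS.EE S i s') = inc S i s * (c s * (pr S i s * A * inc S i s')) * pr S i s' := by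
    have : h * (DS.EE S i s * A * DS.EE S i s') = (h * inc S i s) * (pr S i s * A * inc S i s') * pr S i s' := by
      simp only [DS.EE, Matrix.mul_assoc]
    rw [this, (H s).2]; simp only [Matrix.mul_assoc]
  have e2 : (DS.EE S i s * A' * DS.EE S i s') * h = inc S i s * ((pr S i s * A' * inc S i s') * c s') * pr S i s' := by
    have : (DS.EE S i s * A' * DS.EE S i s') * h = inc S i s * (pr S i s * A' * inc S i s') * (pr S i s' * h) := by
      simp only [DS.EE, Matrix.mul_assoc]
    rw [this, (H s').1]; simp only [Matrix.mul_assoc]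
  rw [e1, e2]
  constructor
  · intro h; rw [h]
  · intro h
    have h' := congrArg (fun B => pr S i s * B * inc S i s') h
    have e3 : ∀ B : Matrix (Fin (S.nn i s)) (Fin (S.nn i s')) ℂ, pr S i s * (inc S i s * B * pr S i s') * inc S i s' = B := by
      intro B
      rw [← Matrix.mul_assoc, ← Matrix.mul_assoc, pr_inc_same, Matrix.one_mul, Matrix.mul_assoc, pr_inc_same, Matrix.mul_one]
    rw [e3, e3] at h'
    exact h'

theorem Cmp.FF {i : Fin (S.p+1)} {h c} (H : Cmp i h c) {a : ℕ} (F F' : Matrix (Fin S.n) (Fin a) ℂ) (t : Matrix (Fin a) (Fin a) ℂ) (j) :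
    c j * (pr S i j * F) = (pr S i j * F') * t ↔ pr S i j * (h * F) = pr S i j * (F' * t) := by
  rw [← Matrix.mul_assoc, ← (H j).1]; simp only [Matrix.mul_assoc]

theorem Cmp.GG {i : Fin (S.p+1)} {h c} (H : Cmp i h c) {a : ℕ} (G G' : Matrix (Fin a) (Fin S.n) ℂ) (t : Matrix (Fin a) (Fin a) ℂ) (j) :
    t * (G * inc S i j) = (G' * inc S i j) * c j ↔ (t * G) * inc S i j = (G' * h) * inc S i j := by
  rw [Matrix.mul_assoc _ _ (c j), ← (H j).2]; simp only [Matrix.mul_assoc]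

theorem VEq_iff {D D' : GD S} (N : D.Ok) (N' : D'.Ok) : (∃ c t, VEq D D' c t) ↔ ∃ γ t, IsoD D D' γ t := by
  constructor
  · rintro ⟨c, t, H⟩
    have hc : ∀ i : {i : Fin (S.p+1) // Iirr S i}, Cmp i.1 (bdU S i.1 (c i)).val (fun j => (c i j).val) :=
      fun i j => ⟨pr_bd i.1 _ j, bd_inc i.1 _ j⟩
    have h2 : ∀ i : {i : Fin (S.p+1) // Iirr S i}, i.1 ≠ 0 → (bdU S i.1 (c i)).val * (D.P i.1).val = (D'.P i.1).val * (bdU S (i0 S).1 (c (i0 S))).val := by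
      intro i hi
      rw [← (hc i).blks (hc (i0 S))]
      exact fun j' j => H.v2 i hi j j'
    obtain ⟨γ, hγ⟩ : ∃ γ, γ = bdU S (i0 S).1 (c (i0 S)) := ⟨_, rfl⟩
    rw [← hγ] at h2
    have hh1 : ∀ i : {i : Fin (S.p+1) // Iirr S i}, hh D D' γ i.1 = bdU S i.1 (c i) := by
      intro i
      by_cases hi : i.1 = 0
      · rw [hh_one D D' N N' γ i.1 (Or.inr hi), hγ]
        have : i = i0 S := Subtype.ext hi
        rw [this]
      · rw [hh]
        apply Units.ext
        rw [Units.val_mul, Units.val_mul, ← h2 i hi, mul_assoc, Units.mul_inv, mul_one]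
    have hr : ∀ i, ¬ Iirr S i → hh D D' γ i = bdU S (i0 S).1 (c (i0 S)) := fun i hi => by
      rw [hh_one D D' N N' γ i (Or.inl hi), hγ]
    refine ⟨γ, t, ?_, ?_, ?_, ?_, ?_, H.v5, H.v5'⟩
    · intro i j
      by_cases hi : Iirr S i
      · rw [hh1 ⟨i, hi⟩]
        exact (hc ⟨i, hi⟩).EE j
      · rw [EE_reg i hi, mul_one, one_mul]
    · intro i s s' hs l hl
      by_cases hi : Iirr S i
      · rw [hh1 ⟨i, hi⟩]
        exact ((hc ⟨i, hi⟩).XX _ _ _ _).1 (H.v1 ⟨i, hi⟩ s s' hs l hl)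
      · exact absurd ((reg_sub i hi).elim s s') hs
    · intro i hi hi0
      have h3 : (bdU S (i0 S).1 (c (i0 S))).val * D.Q i = D'.Q i * (bdU S i (c ⟨i, hi⟩)).val := by
        rw [← (hc (i0 S)).blks (hc ⟨i, hi⟩)]
        exact fun j j' => H.v2' ⟨i, hi⟩ hi0 j j'
      rw [← hγ] at h3
      rw [← mul_assoc, h3, mul_assoc, h2 ⟨i, hi⟩ hi0, mul_assoc]
    · intro i j
      by_cases hi : Iirr S i
      · rw [hh1 ⟨i, hi⟩]
        have := ((hc ⟨i, hi⟩).FF _ _ _ j).1 (H.v3 ⟨i, hi⟩ j)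
        rw [← N.EF, ← Matrix.mul_assoc, (hc ⟨i, hi⟩).EE j, Matrix.mul_assoc, DS.EE, Matrix.mul_assoc, this, ← Matrix.mul_assoc, ← DS.EE,
          ← Matrix.mul_assoc, N'.EF]
      · rw [hr i hi]
        refine blk_ext (i0 S).1 _ _ fun j' => ?_
        exact ((hc (i0 S)).FF _ _ _ j').1 (H.v4 i hi j j')
    · intro i j
      by_cases hi : Iirr S i
      · rw [hh1 ⟨i, hi⟩]
        have := ((hc ⟨i, hi⟩).GG _ _ _ j).1 (H.v3' ⟨i, hi⟩ j)
        rw [← N'.GE, Matrix.mul_assoc, ← (hc ⟨i, hi⟩).EE j, ← Matrix.mul_assoc, DS.EE, ← Matrix.mul_assoc, ← this, Matrix.mul_assoc, ← DS.EE,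
          Matrix.mul_assoc, N.GE]
      · rw [hr i hi]
        refine blk_ext' (i0 S).1 _ _ fun j' => ?_
        exact ((hc (i0 S)).GG _ _ _ j').1 (H.v4' i hi j j')
  · rintro ⟨γ, t, H⟩
    have hE' : ∀ i j, (hh D D' γ i)⁻¹.val * EE S i j = EE S i j * (hh D D' γ i)⁻¹.val := by
      intro i j
      have h := H.hE i j
      calc _ = (hh D D' γ i)⁻¹.val * (EE S i j * (hh D D' γ i).val) * (hh D D' γ i)⁻¹.val := by
            rw [mul_assoc, mul_assoc, Units.mul_inv, mul_one]
        _ = _ := by rw [← h, ← mul_assoc, Units.inv_mul, one_mul]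
    have c1 := fun i => Cmp.of_EE (H.hE i)
    have c2 := fun i => Cmp.of_EE (hE' i)
    obtain ⟨c, hc⟩ : ∃ c : ∀ (i : {i : Fin (S.p+1) // Iirr S i}) (j : Fin (S.m i.1)), (Matrix (Fin (S.nn i.1 j)) (Fin (S.nn i.1 j)) ℂ)ˣ,
       ∀ i j, (c i j).val = pr S i.1 j * (hh D D' γ i.1).val * inc S i.1 j := by
      refine ⟨fun i j => ⟨pr S i.1 j * (hh D D' γ i.1).val * inc S i.1 j, pr S i.1 j * (hh D D' γ i.1)⁻¹.val * inc S i.1 j, ?_, ?_⟩, fun _ _ => rfl⟩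
      · show (pr S i.1 j * (hh D D' γ i.1).val * inc S i.1 j) * (pr S i.1 j * (hh D D' γ i.1)⁻¹.val * inc S i.1 j) = 1
        rw [Matrix.mul_assoc, ← (c2 i.1 j).2, Matrix.mul_assoc, ← Matrix.mul_assoc _ _ (inc S i.1 j), Units.mul_inv, Matrix.one_mul, pr_inc_same]
      · show (pr S i.1 j * (hh D D' γ i.1)⁻¹.val * inc S i.1 j) * (pr S i.1 j * (hh D D' γ i.1).val * inc S i.1 j) = 1
        rw [Matrix.mul_assoc, ← (c1 i.1 j).2, Matrix.mul_assoc, ← Matrix.mul_assoc _ _ (inc S i.1 j), Units.inv_mul, Matrix.one_mul, pr_inc_same]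
    have hC : ∀ i : {i : Fin (S.p+1) // Iirr S i}, Cmp i.1 (hh D D' γ i.1).val (fun j => (c i j).val) := by
      intro i
      have := c1 i.1
      have e : (fun j => (c i j).val) = fun j => pr S i.1 j * (hh D D' γ i.1).val * inc S i.1 j := funext (hc i)
      rw [e]; exact this
    have h0 : hh D D' γ (i0 S).1 = γ := hh_one D D' N N' γ _ (Or.inr rfl)
    have hC0 : Cmp (i0 S).1 γ.val (fun j => (c (i0 S) j).val) := by
      have := hC (i0 S); rw [h0] at this; exact this
    have hhP : ∀ i, (hh D D' γ i).val * (D.P i).val = (D'.P i).val * γ.val := by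
      intro i
      rw [hh, Units.val_mul, Units.val_mul, mul_assoc, Units.inv_mul, mul_one]
    have hr : ∀ i, ¬ Iirr S i → hh D D' γ i = γ := fun i hi => hh_one D D' N N' γ i (Or.inl hi)
    refine ⟨c, t, ?_, ?_, ?_, ?_, ?_, ?_, ?_, H.hf, H.hg⟩
    · intro i s s' hs l hl
      exact ((hC i).XX _ _ _ _).2 (H.hX i.1 s s' hs l hl)
    · intro i hi j j'
      exact ((hC i).blks hC0 _ _).2 (hhP i.1) j' j
    · intro i hi j j'
      refine (hC0.blks (hC i) (D.Q i.1) (D'.Q i.1)).2 ?_ j j'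
      have h1 := H.hQ i.1 i.2 hi
      rw [mul_assoc, ← hhP, ← mul_assoc, ← mul_assoc] at h1
      have h2 := congrArg (fun A => A * (D.P i.1)⁻¹.val) h1
      simp only [mul_assoc, Units.mul_inv, mul_one] at h2
      exact h2
    · intro i j
      rw [(hC i).FF, H.hF]
    · intro i j
      rw [(hC i).GG, H.hG]
    · intro i hi j j'
      rw [hC0.FF, ← hr i hi, H.hF]
    · intro i hi j j'
      rw [hC0.GG, ← hr i hi, H.hG]

end VEqSec
end

noncomputable section
section QISec
variable {S : Setup}

/-- Vertexwise subrepresentations. -/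
structure VSub (D : GD S) (w : ∀ (i : {i : Fin (S.p+1) // Iirr S i}) (j : Fin (S.m i.1)), Submodule ℂ (Fin (S.nn i.1 j) → ℂ))
    (U : ∀ i j k, Submodule ℂ (Fin (rk S i j k) → ℂ)) : Prop where
  v1 : ∀ (i : {i : Fin (S.p+1) // Iirr S i}) (s s' : Fin (S.m i.1)), s ≠ s' → ∀ l < dcnt S i.1 s s', ∀ v ∈ w i s', (pr S i.1 s * D.X i.1 l * inc S i.1 s').mulVec v ∈ w i s
  v2 : ∀ i : {i : Fin (S.p+1) // Iirr S i}, i.1 ≠ 0 → ∀ j j', ∀ v ∈ w (i0 S) j, (pr S i.1 j' * (D.P i.1).val * inc S (i0 S).1 j).mulVec v ∈ w i j'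
  v2' : ∀ i : {i : Fin (S.p+1) // Iirr S i}, i.1 ≠ 0 → ∀ j j', ∀ v ∈ w i j', (pr S (i0 S).1 j * D.Q i.1 * inc S i.1 j').mulVec v ∈ w (i0 S) j
  v3 : ∀ (i : {i : Fin (S.p+1) // Iirr S i}) (j : Fin (S.m i.1)), ∀ u ∈ U i.1 j 0, (pr S i.1 j * D.F i.1 j 0).mulVec u ∈ w i j
  v3' : ∀ (i : {i : Fin (S.p+1) // Iirr S i}) (j : Fin (S.m i.1)), ∀ v ∈ w i j, (D.G i.1 j 0 * inc S i.1 j).mulVec v ∈ U i.1 j 0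
  v4 : ∀ i, ¬ Iirr S i → ∀ j j', ∀ u ∈ U i j 0, (pr S (i0 S).1 j' * D.F i j 0).mulVec u ∈ w (i0 S) j'
  v4' : ∀ i, ¬ Iirr S i → ∀ j j', ∀ v ∈ w (i0 S) j', (D.G i j 0 * inc S (i0 S).1 j').mulVec v ∈ U i j 0
  v5 : ∀ i j k, ∀ u ∈ U i j (k+1), (D.lf i j k).mulVec u ∈ U i j k
  v5' : ∀ i j k, ∀ u ∈ U i j k, (D.lg i j k).mulVec u ∈ U i j (k+1)

theorem mem_emp {a b : ℕ} (h : b = 0) (A : Matrix (Fin a) (Fin b) ℂ) (v) (W : Submodule ℂ (Fin a → ℂ)) : A.mulVec v ∈ W := by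
  have : v = 0 := by subst h; exact Subsingleton.elim _ _
  rw [this, Matrix.mulVec_zero]; exact W.zero_mem
theorem mem_emp' {a : ℕ} (h : a = 0) (v) (W : Submodule ℂ (Fin a → ℂ)) : v ∈ W := by
  have : v = 0 := by subst h; exact Subsingleton.elim _ _
  rw [this]; exact W.zero_mem
theorem sub_emp {a : ℕ} (h : a = 0) (W W' : Submodule ℂ (Fin a → ℂ)) : W = W' := by
  subst h; exact Subsingleton.elim _ _

theorem isSubrep_arr (D : GD S) (Wv : ∀ a : V S, Submodule ℂ (Fin (alN S a) → ℂ)) : isSubrep S (ofGD D) Wv ↔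
    ∀ a b l, l < arr S a b → (∀ v ∈ Wv a, (fT D a b l).mulVec v ∈ Wv b) ∧ (∀ v ∈ Wv b, (gT D a b l).mulVec v ∈ Wv a) :=
  ⟨fun h a b l hl => h a b ⟨l, hl⟩, fun h a b ρ => h a b ρ.1 ρ.2⟩

theorem vsub_of (D : GD S) (Wv : ∀ a : V S, Submodule ℂ (Fin (alN S a) → ℂ)) (h : isSubrep S (ofGD D) Wv)
    (w : ∀ (i : {i : Fin (S.p+1) // Iirr S i}) (j : Fin (S.m i.1)), Submodule ℂ (Fin (S.nn i.1 j) → ℂ))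
    (U : ∀ i j k, Submodule ℂ (Fin (rk S i j k) → ℂ)) (hw : ∀ i j, w i j = Wv (.inl ⟨i, j⟩))
    (hU : ∀ i j k (h : k < S.e i j - 1), U i j k = Wv (.inr ⟨i, j, ⟨k, h⟩⟩)) : VSub D w U := by
  rw [isSubrep_arr, forall_arr] at h
  obtain ⟨h1, h2, h3, h4, h5⟩ := h
  constructor
  · intro i s s' hs l hl
    rw [hw, hw]
    rcases lt_or_gt_of_ne hs with hs | hs
    · have := (h1 i s s' hs l hl).2
      rw [gT_bb] at this
      exact this
    · have := (h1 i s' s hs l (by rw [dcnt_symm]; exact hl)).1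
      rw [fT_bb] at this
      exact this
  · intro i hi j j'
    rw [hw, hw]
    have := (h2 i hi j j').1
    rw [fT_b0 _ i hi] at this
    exact this
  · intro i hi j j'
    rw [hw, hw]
    have := (h2 i hi j j').2
    rw [gT_b0 _ i hi] at this
    exact this
  · intro i j
    by_cases h : 0 < S.e i.1 j - 1
    · rw [hw, hU _ _ _ h]
      exact (h3 i j h).1
    · exact fun u _ => mem_emp (rk_big _ _ _ (by omega)) _ _ _
  · intro i j
    by_cases h : 0 < S.e i.1 j - 1
    · rw [hw, hU _ _ _ h]
      exact (h3 i j h).2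
    · exact fun u _ => mem_emp' (rk_big _ _ _ (by omega)) _ _
  · intro i hi j j'
    by_cases h : 0 < S.e i j - 1
    · rw [hw, hU _ _ _ h]
      exact (h4 i hi j h j').1
    · exact fun u _ => mem_emp (rk_big _ _ _ (by omega)) _ _ _
  · intro i hi j j'
    by_cases h : 0 < S.e i j - 1
    · rw [hw, hU _ _ _ h]
      exact (h4 i hi j h j').2
    · exact fun u _ => mem_emp' (rk_big _ _ _ (by omega)) _ _
  · intro i j k
    by_cases h : k + 1 < S.e i j - 1
    · rw [hU _ _ _ h, hU _ _ _ (Nat.lt_of_succ_lt h)]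
      exact (h5 i j k h).1
    · exact fun u _ => mem_emp (rk_big _ _ _ (by omega)) _ _ _
  · intro i j k
    by_cases h : k + 1 < S.e i j - 1
    · rw [hU _ _ _ h, hU _ _ _ (Nat.lt_of_succ_lt h)]
      exact (h5 i j k h).2
    · exact fun u _ => mem_emp' (rk_big _ _ _ (by omega)) _ _

/-- The vertex spaces of a vertexwise subrepresentation. -/
def WvOf (w : ∀ (i : {i : Fin (S.p+1) // Iirr S i}) (j : Fin (S.m i.1)), Submodule ℂ (Fin (S.nn i.1 j) → ℂ))
    (U : ∀ i j k, Submodule ℂ (Fin (rk S i j k) → ℂ)) : ∀ a : V S, Submodule ℂ (Fin (alN S a) → ℂ)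
  | .inl ⟨i, j⟩ => w i j
  | .inr ⟨i, j, κ⟩ => U i j κ.val

theorem of_vsub (D : GD S) (w U) (H : VSub D w U) : isSubrep S (ofGD D) (WvOf w U) := by
  rw [isSubrep_arr, forall_arr]
  refine ⟨?_, ?_, ?_, ?_, ?_⟩
  · intro i s s' hs l hl
    rw [fT_bb, gT_bb]
    exact ⟨H.v1 i s' s hs.ne' l (by rw [dcnt_symm]; exact hl), H.v1 i s s' hs.ne l hl⟩
  · intro i h j j'
    rw [fT_b0 _ i h, gT_b0 _ i h]
    exact ⟨H.v2 i h j j', H.v2' i h j j'⟩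
  · intro i j h
    exact ⟨H.v3 i j, H.v3' i j⟩
  · intro i hi j h j'
    exact ⟨H.v4 i hi j j', H.v4' i hi j j'⟩
  · intro i j k h
    exact ⟨H.v5 i j k, H.v5' i j k⟩

/-- Glue subspaces of blocks. -/
def glue (i : Fin (S.p+1)) (w : ∀ j, Submodule ℂ (Fin (S.nn i j) → ℂ)) : Submodule ℂ (Fin S.n → ℂ) :=
  ⨅ j, (w j).comap (pr S i j).mulVecLin

/-- Block components of a subspace. -/
def cut (i : Fin (S.p+1)) (W : Submodule ℂ (Fin S.n → ℂ)) (j) : Submodule ℂ (Fin (S.nn i j) → ℂ) :=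
  W.comap (inc S i j).mulVecLin

theorem mem_glue {i : Fin (S.p+1)} {w v} : v ∈ glue i w ↔ ∀ j, (pr S i j).mulVec v ∈ w j := by
  rw [glue, Submodule.mem_iInf]; rfl

theorem mem_cut {i : Fin (S.p+1)} {W : Submodule ℂ (Fin S.n → ℂ)} {j v} : v ∈ cut i W j ↔ (inc S i j).mulVec v ∈ W := Iff.rfl

theorem dec {a : ℕ} (i : Fin (S.p+1)) (A : Matrix (Fin a) (Fin S.n) ℂ) (v) :
    A.mulVec v = ∑ j, (A * inc S i j).mulVec ((pr S i j).mulVec v) := by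
  have : A = ∑ j, A * inc S i j * pr S i j := by
    conv_lhs => rw [← Matrix.mul_one A, ← EE_sum i, Matrix.mul_sum]
    refine Finset.sum_congr rfl fun j _ => ?_
    rw [EE, Matrix.mul_assoc]
  conv_lhs => rw [this, Matrix.sum_mulVec]
  refine Finset.sum_congr rfl fun j _ => ?_
  rw [Matrix.mulVec_mulVec]

theorem inc_mem {i : Fin (S.p+1)} {w : ∀ j, Submodule ℂ (Fin (S.nn i j) → ℂ)} {j v} :
    (inc S i j).mulVec v ∈ glue i w ↔ v ∈ w j := by
  rw [mem_glue]
  constructor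
  · intro h
    have := h j
    rw [Matrix.mulVec_mulVec, pr_inc_same, Matrix.one_mulVec] at this
    exact this
  · intro h j'
    rw [Matrix.mulVec_mulVec]
    by_cases e : j' = j
    · subst e
      rw [pr_inc_same, Matrix.one_mulVec]; exact h
    · rw [pr_inc_ne _ _ _ e, Matrix.zero_mulVec]; exact (w j').zero_mem

theorem cut_glue (i : Fin (S.p+1)) (w : ∀ j, Submodule ℂ (Fin (S.nn i j) → ℂ)) (j) : cut i (glue i w) j = w j := by
  ext v; exact inc_mem

theorem glue_stab (i : Fin (S.p+1)) (w : ∀ j, Submodule ℂ (Fin (S.nn i j) → ℂ)) (j) : EE S i j ∈ stab (glue i w) := by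
  intro v hv
  rw [EE, ← Matrix.mulVec_mulVec, inc_mem]
  exact mem_glue.1 hv j

theorem glue_cut (i : Fin (S.p+1)) (W : Submodule ℂ (Fin S.n → ℂ)) (h : ∀ j, EE S i j ∈ stab W) : glue i (cut i W) = W := by
  ext v
  rw [mem_glue]
  constructor
  · intro hv
    have := dec i (1 : Matrix (Fin S.n) (Fin S.n) ℂ) v
    rw [Matrix.one_mulVec] at this
    rw [this]
    refine W.sum_mem fun j _ => ?_
    rw [Matrix.one_mul]
    exact hv j
  · intro hv j
    rw [mem_cut, Matrix.mulVec_mulVec]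
    exact h j v hv

theorem glue_finrank (i : Fin (S.p+1)) (w : ∀ j, Submodule ℂ (Fin (S.nn i j) → ℂ)) :
    Module.finrank ℂ (glue i w) = ∑ j, Module.finrank ℂ (w j) := by
  have e : (glue i w) ≃ₗ[ℂ] (∀ j, w j) :=
    LinearEquiv.ofBijective
      (LinearMap.pi fun j => ((pr S i j).mulVecLin).restrict (p := glue i w) (q := w j) (fun v hv => mem_glue.1 hv j)) (by
      constructor
      · intro a b hab
        apply Subtype.ext
        have ha := dec i (1 : Matrix (Fin S.n) (Fin S.n) ℂ) a.1
        have hb := dec i (1 : Matrix (Fin S.n) (Fin S.n) ℂ) b.1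
        rw [Matrix.one_mulVec] at ha hb
        rw [ha, hb]
        refine Finset.sum_congr rfl fun j _ => ?_
        have := congrArg Subtype.val (congrFun hab j)
        have h' : (pr S i j).mulVec a.1 = (pr S i j).mulVec b.1 := this
        rw [h']
      · intro u
        refine ⟨⟨∑ j, (inc S i j).mulVec (u j).1, (glue i w).sum_mem fun j _ => inc_mem.2 (u j).2⟩, ?_⟩
        funext j
        apply Subtype.ext
        show (pr S i j).mulVec (∑ j, (inc S i j).mulVec (u j).1) = _
        rw [Matrix.mulVec_sum, Finset.sum_eq_single j]
        · rw [Matrix.mulVec_mulVec, pr_inc_same, Matrix.one_mulVec]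
        · intro j' _ h
          rw [Matrix.mulVec_mulVec, pr_inc_ne _ _ _ h.symm, Matrix.zero_mulVec]
        · simp)
  rw [e.finrank_eq, Module.finrank_pi_fintype]

theorem tw_finrank {n : ℕ} (W : Submodule ℂ (Fin n → ℂ)) (P : (Matrix (Fin n) (Fin n) ℂ)ˣ) :
    Module.finrank ℂ (tw' W P) = Module.finrank ℂ W := by
  apply le_antisymm
  · refine LinearMap.finrank_le_finrank_of_injective (f := ((P⁻¹.val).mulVecLin).restrict (p := tw' W P) (q := W) (fun v hv => hv)) ?_
    intro a b h
    apply Subtype.ext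
    have : (P⁻¹.val).mulVec a.1 = (P⁻¹.val).mulVec b.1 := congrArg Subtype.val h
    have h2 := congrArg (fun v => P.val.mulVec v) this
    simpa [Matrix.mulVec_mulVec] using h2
  · refine LinearMap.finrank_le_finrank_of_injective (f := ((P.val).mulVecLin).restrict (p := W) (q := tw' W P) (fun v hv => mem_tw_P.2 hv)) ?_
    intro a b h
    apply Subtype.ext
    have : (P.val).mulVec a.1 = (P.val).mulVec b.1 := congrArg Subtype.val h
    have h2 := congrArg (fun v => P⁻¹.val.mulVec v) this
    simpa [Matrix.mulVec_mulVec] using h2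

theorem tw_bot {n : ℕ} (P : (Matrix (Fin n) (Fin n) ℂ)ˣ) : tw' ⊥ P = ⊥ := by
  apply Submodule.finrank_eq_zero.1
  rw [tw_finrank, finrank_bot]
theorem tw_top {n : ℕ} (P : (Matrix (Fin n) (Fin n) ℂ)ˣ) : tw' ⊤ P = ⊤ := rfl

theorem cut_bot (i : Fin (S.p+1)) (j) : cut i (⊥ : Submodule ℂ (Fin S.n → ℂ)) j = ⊥ := by
  rw [eq_bot_iff]
  intro v hv
  rw [mem_cut, Submodule.mem_bot] at hv
  have := congrArg (fun v => (pr S i j).mulVec v) hv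
  simp only [Matrix.mulVec_mulVec, pr_inc_same, Matrix.one_mulVec, Matrix.mulVec_zero] at this
  exact this

theorem QID_of_qi (D : GD S) (N : D.Ok) (h : quasiIrred S (ofGD D)) : QID D := by
  intro W U H
  have t0 : tw' W (D.P (i0 S).1) = W := by rw [N.P1 (i0 S).1 (Or.inr rfl), tw_one]
  have tr : ∀ i, ¬ Iirr S i → tw' W (D.P i) = W := fun i hi => by rw [N.P1 _ (Or.inl hi), tw_one]
  have gl : ∀ i, glue i (cut i (tw' W (D.P i))) = tw' W (D.P i) := fun i => glue_cut i _ (H.hE i)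
  have hE0 : ∀ j, EE S (i0 S).1 j ∈ stab W := by
    intro j; have := H.hE (i0 S).1 j; rw [t0] at this; exact this
  have hV : VSub D (fun i => cut i.1 (tw' W (D.P i.1))) U := by
    constructor
    · intro i s s' hs l hl v hv
      have := H.hX i.1 s s' hs l hl _ hv
      rw [mem_cut]
      show _ ∈ _
      rw [Matrix.mulVec_mulVec]
      have e : inc S i.1 s * (pr S i.1 s * D.X i.1 l * inc S i.1 s') = EE S i.1 s * D.X i.1 l * EE S i.1 s' * inc S i.1 s' := by
        rw [Matrix.mul_assoc _ (EE S i.1 s'), EE_inc]; simp only [EE, Matrix.mul_assoc]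
      rw [e, ← Matrix.mulVec_mulVec]
      exact this
    · intro i hi j j' v hv
      rw [mem_cut, t0] at hv
      have := H.hE i.1 j' _ (mem_tw_P.2 hv)
      rw [mem_cut, Matrix.mulVec_mulVec]
      rw [Matrix.mulVec_mulVec, Matrix.mulVec_mulVec] at this
      have e : inc S i.1 j' * (pr S i.1 j' * (D.P i.1).val * inc S (i0 S).1 j) = EE S i.1 j' * ((D.P i.1).val * inc S (i0 S).1 j) := by
        simp only [EE, Matrix.mul_assoc]
      rw [e, ← Matrix.mul_assoc]
      simpa only [Matrix.mul_assoc] using this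
    · intro i hi j j' v hv
      rw [mem_cut, mem_tw] at hv
      have := hE0 j _ (H.hQ i.1 i.2 hi _ hv)
      rw [mem_cut, t0]
      rw [Matrix.mulVec_mulVec, Matrix.mulVec_mulVec, Matrix.mulVec_mulVec] at this
      rw [Matrix.mulVec_mulVec]
      have e : inc S (i0 S).1 j * (pr S (i0 S).1 j * D.Q i.1 * inc S i.1 j') = EE S (i0 S).1 j * (D.Q i.1 * (D.P i.1).val) * (D.P i.1)⁻¹.val * inc S i.1 j' := by
        rw [← mul_assoc (EE S (i0 S).1 j), mul_assoc _ (D.P i.1).val, Units.mul_inv, mul_one]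
        simp only [EE, Matrix.mul_assoc]
      rw [e]
      simpa only [Matrix.mul_assoc] using this
    · intro i j u hu
      have := H.hE i.1 j _ (H.hF i.1 j u hu)
      rw [mem_cut, Matrix.mulVec_mulVec, ← Matrix.mul_assoc]
      rw [Matrix.mulVec_mulVec] at this
      exact this
    · intro i j v hv
      have := H.hG i.1 j _ hv
      rw [← Matrix.mulVec_mulVec]
      exact this
    · intro i hi j j' u hu
      have h1 := H.hF i j u hu
      rw [tr i hi] at h1
      have := hE0 j' _ h1
      rw [mem_cut, t0, Matrix.mulVec_mulVec, ← Matrix.mul_assoc]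
      rw [Matrix.mulVec_mulVec] at this
      exact this
    · intro i hi j j' v hv
      rw [mem_cut, t0, ← tr i hi] at hv
      have := H.hG i j _ hv
      rw [← Matrix.mulVec_mulVec]
      exact this
    · exact H.hf
    · exact H.hg
  have hb : balanced S (fun a => Module.finrank ℂ (WvOf (fun i => cut i.1 (tw' W (D.P i.1))) U a)) := by
    intro i hi
    refine Eq.trans (b := Module.finrank ℂ W) ?_ ?_
    · refine (glue_finrank (i0 S).1 (cut (i0 S).1 (tw' W (D.P (i0 S).1)))).symm.trans ?_
      rw [gl, tw_finrank]
    · refine Eq.symm ((glue_finrank i.1 (cut i.1 (tw' W (D.P i.1)))).symm.trans ?_)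
      rw [gl, tw_finrank]
  rcases h _ (of_vsub D _ U hV) hb with h | h
  · left
    constructor
    · rw [← t0, ← gl, eq_bot_iff]
      intro v hv
      have e : ∀ j, cut (i0 S).1 (tw' W (D.P (i0 S).1)) j = ⊥ := fun j => h (.inl ⟨i0 S, j⟩)
      rw [mem_glue] at hv
      have := dec (i0 S).1 (1 : Matrix (Fin S.n) (Fin S.n) ℂ) v
      rw [Matrix.one_mulVec] at this
      rw [this]
      refine Submodule.sum_mem _ fun j _ => ?_
      have h1 := hv j
      rw [e, Submodule.mem_bot] at h1
      rw [h1, Matrix.mulVec_zero]; exact Submodule.zero_mem _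
    · intro i j k
      by_cases hk : k < S.e i j - 1
      · exact h (.inr ⟨i, j, ⟨k, hk⟩⟩)
      · exact sub_emp (rk_big _ _ _ (by omega)) _ _
  · right
    constructor
    · rw [← t0, ← gl, eq_top_iff]
      intro v _
      have e : ∀ j, cut (i0 S).1 (tw' W (D.P (i0 S).1)) j = ⊤ := fun j => h (.inl ⟨i0 S, j⟩)
      rw [mem_glue]
      intro j
      rw [e]; trivial
    · intro i j k
      by_cases hk : k < S.e i j - 1
      · exact h (.inr ⟨i, j, ⟨k, hk⟩⟩)
      · exact sub_emp (rk_big _ _ _ (by omega)) _ _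

theorem qi_of_QID (D : GD S) (N : D.Ok) (h : QID D) : quasiIrred S (ofGD D) := by
  intro Wv hW hb
  obtain ⟨w, hw⟩ : ∃ w : ∀ (i : {i : Fin (S.p+1) // Iirr S i}) (j : Fin (S.m i.1)), Submodule ℂ (Fin (S.nn i.1 j) → ℂ),
    ∀ i j, w i j = Wv (.inl ⟨i, j⟩) := ⟨fun i j => Wv (.inl ⟨i, j⟩), fun _ _ => rfl⟩
  obtain ⟨U, hU⟩ : ∃ U : ∀ i j k, Submodule ℂ (Fin (rk S i j k) → ℂ),
    ∀ i j k (h : k < S.e i j - 1), U i j k = Wv (.inr ⟨i, j, ⟨k, h⟩⟩) :=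
    ⟨fun i j k => if h : k < S.e i j - 1 then Wv (.inr ⟨i, j, ⟨k, h⟩⟩) else ⊤, fun i j k h => dif_pos h⟩
  have V := vsub_of D Wv hW w U hw hU
  obtain ⟨W, hW0⟩ : ∃ W, W = glue (i0 S).1 (w (i0 S)) := ⟨_, rfl⟩
  have hfr : ∀ i : {i : Fin (S.p+1) // Iirr S i}, i.1 ≠ 0 → Module.finrank ℂ W = Module.finrank ℂ (glue i.1 (w i)) := by
    intro i hi
    rw [hW0, glue_finrank, glue_finrank]
    have e : ∀ i, w i = fun j => Wv (.inl ⟨i, j⟩) := fun i => funext (hw i)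
    rw [e, e]
    exact hb i hi
  have tr : ∀ i, ¬ Iirr S i → tw' W (D.P i) = W := fun i hi => by rw [N.P1 _ (Or.inl hi), tw_one]
  have T : ∀ i : {i : Fin (S.p+1) // Iirr S i}, tw' W (D.P i.1) = glue i.1 (w i) := by
    intro i
    by_cases hi : i.1 = 0
    · have : i = i0 S := Subtype.ext hi
      subst this
      rw [N.P1 (i0 S).1 (Or.inr rfl), tw_one, hW0]
    · apply Submodule.eq_of_le_of_finrank_eq
      · intro v hv
        rw [mem_tw, hW0] at hv
        have e : v = (D.P i.1).val.mulVec ((D.P i.1)⁻¹.val.mulVec v) := by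
          rw [Matrix.mulVec_mulVec, Units.mul_inv, Matrix.one_mulVec]
        rw [e, mem_glue]
        intro j'
        rw [Matrix.mulVec_mulVec, dec (i0 S).1]
        exact Submodule.sum_mem _ fun j _ => V.v2 i hi j j' _ (mem_glue.1 hv j)
      · rw [tw_finrank, hfr i hi]
  have T' : ∀ i (hi : Iirr S i), tw' W (D.P i) = glue i (w ⟨i, hi⟩) := fun i hi => T ⟨i, hi⟩
  have hS : SubD D W U := by
    constructor
    · intro i j
      by_cases hi : Iirr S i
      · rw [T' i hi]; exact glue_stab i _ j
      · rw [EE_reg i hi]; exact Subalgebra.one_mem _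
    · intro i s s' hs l hl
      by_cases hi : Iirr S i
      · rw [T' i hi]
        intro v hv
        have := V.v1 ⟨i, hi⟩ s s' hs l hl _ (mem_glue.1 hv s')
        have e : EE S i s * D.X i l * EE S i s' = inc S i s * ((pr S i s * D.X i l * inc S i s') * pr S i s') := by
          simp only [EE, Matrix.mul_assoc]
        rw [e, ← Matrix.mulVec_mulVec, inc_mem, ← Matrix.mulVec_mulVec]
        exact this
      · exact absurd ((reg_sub i hi).elim s s') hs
    · intro i hi hi0 v hv
      rw [← Matrix.mulVec_mulVec, hW0, mem_glue]
      have h1 : (D.P i).val.mulVec v ∈ glue i (w ⟨i, hi⟩) := by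
        rw [← T' i hi]; exact mem_tw_P.2 hv
      intro j
      rw [Matrix.mulVec_mulVec, dec i]
      exact Submodule.sum_mem _ fun j' _ => V.v2' ⟨i, hi⟩ hi0 j j' _ (mem_glue.1 h1 j')
    · intro i j u hu
      by_cases hi : Iirr S i
      · rw [T' i hi, ← N.EF, EE, Matrix.mul_assoc, ← Matrix.mulVec_mulVec, inc_mem]
        exact V.v3 ⟨i, hi⟩ j u hu
      · rw [tr i hi, hW0, mem_glue]
        intro j'
        rw [Matrix.mulVec_mulVec]
        exact V.v4 i hi j j' u hu
    · intro i j v hv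
      by_cases hi : Iirr S i
      · rw [T' i hi] at hv
        rw [← N.GE, EE, ← Matrix.mul_assoc, ← Matrix.mulVec_mulVec]
        exact V.v3' ⟨i, hi⟩ j _ (mem_glue.1 hv j)
      · rw [tr i hi, hW0] at hv
        rw [dec (i0 S).1]
        exact Submodule.sum_mem _ fun j' _ => V.v4' i hi j j' _ (mem_glue.1 hv j')
    · exact V.v5
    · exact V.v5'
  have hww : ∀ i j, w i j = cut i.1 (tw' W (D.P i.1)) j := fun i j => by rw [T, cut_glue]
  rcases h W U hS with ⟨h1, h2⟩ | ⟨h1, h2⟩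
  · left
    rintro (⟨i, j⟩ | ⟨i, j, κ⟩)
    · rw [← hw, hww, h1, tw_bot, cut_bot]; rfl
    · exact (hU i j κ.1 κ.2).symm.trans (h2 i j κ.1)
  · right
    rintro (⟨i, j⟩ | ⟨i, j, κ⟩)
    · rw [← hw, hww, h1, tw_top]; rfl
    · exact (hU i j κ.1 κ.2).symm.trans (h2 i j κ.1)

end QISec
end

noncomputable section
section FinSec
variable {S : Setup}

theorem tupConj_equiv : Equivalence (tupConj S) where
  refl A := ⟨1, fun i => by simp⟩
  symm := by
    rintro A A' ⟨g, h⟩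
    refine ⟨g⁻¹, fun i => ?_⟩
    have e1 : (g⁻¹.val.map (Polynomial.C : ℂ → ℂ[X])) * (g.val.map Polynomial.C) = 1 := by
      rw [← Matrix.map_mul, Units.inv_mul]; simp
    rw [h i, inv_inv]
    calc A i = ((g⁻¹.val.map (Polynomial.C : ℂ → ℂ[X])) * (g.val.map Polynomial.C)) * A i *
          ((g⁻¹.val.map (Polynomial.C : ℂ → ℂ[X])) * (g.val.map Polynomial.C)) := by rw [e1, one_mul, mul_one]
      _ = _ := by simp only [mul_assoc]
  trans := by
    rintro A A' A'' ⟨g, h⟩ ⟨g', h'⟩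
    refine ⟨g' * g, fun i => ?_⟩
    rw [h' i, h i, _root_.mul_inv_rev, Units.val_mul, Units.val_mul, Matrix.map_mul, Matrix.map_mul]
    simp only [mul_assoc]

theorem repConj_refl (M : Rep S (alN S)) : repConj S M M :=
  ⟨fun _ => 1, fun a b ρ => by simp, fun a b ρ => by simp⟩

theorem ok_of (M : QIC S (lam S)) : (toGD M.1 M.2.2.2).Ok :=
  (onMu_iff _ (toGD_nrm M.1 M.2.2.2)).1 (by rw [toGD_of]; exact M.2.1)

theorem qid_M (M : QIC S (lam S)) : QID (toGD M.1 M.2.2.2) :=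
  QID_of_qi _ (ok_of M) (by rw [toGD_of]; exact M.2.2.1)

/-- The tuple attached to a representation. -/
def AM (M : QIC S (lam S)) : MstC S :=
  ⟨AA (toGD M.1 M.2.2.2), AA_ds (ok_of M) (legN_of (ok_of M) (qid_M M)),
    (AA_irr _).2 (irrD_of (ok_of M) (qid_M M))⟩

theorem AA_iff {D D' : GD S} (h : D.Ok) (h' : D'.Ok) (hL : LegN D) (hL' : LegN D') :
    tupConj S (AA D) (AA D') ↔ repConj S (ofGD D) (ofGD D') := by
  rw [conj_iff_iso h h' hL hL', repConj_iff, VEq_iff h h']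

theorem AM_iff (M N : QIC S (lam S)) : tupConj S (AM M).1 (AM N).1 ↔ repConj S M.1 N.1 := by
  have := AA_iff (ok_of M) (ok_of N) (legN_of (ok_of M) (qid_M M)) (legN_of (ok_of N) (qid_M N))
  rw [toGD_of, toGD_of] at this
  exact this

theorem AM_surj (A : MstC S) : ∃ M : QIC S (lam S), tupConj S (AM M).1 A.1 := by
  obtain ⟨D, h, hL, hc⟩ := exists_D A.1 A.2.1
  have hI := (AA_irr D).1 (irred_conj hc A.2.2)
  have hQ := qid_of h hI hL
  refine ⟨⟨ofGD D, (onMu_iff D ⟨h.P1, h.EF, h.GE⟩).2 h, qi_of_QID D h hQ, crossBij_of D⟩, ?_⟩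
  refine tupConj_equiv.trans ?_ (tupConj_equiv.symm hc)
  refine (AA_iff (ok_of _) h (legN_of (ok_of _) (qid_M _)) hL).2 ?_
  rw [toGD_of]
  exact repConj_refl _

theorem final (S : Setup) : Nonempty (Mst S ≃ QIQ S (lam S)) := by
  let f : QIQ S (lam S) → Mst S := Quot.map AM fun M N h => (AM_iff M N).2 h
  have hf : Function.Bijective f := by
    constructor
    · intro a b
      induction a using Quot.ind with | _ M =>
      induction b using Quot.ind with | _ N =>
      intro h
      apply Quot.sound
      rw [← AM_iff]
      let s : Setoid (MstC S) := ⟨fun A A' => tupConj S A.1 A'.1,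
        ⟨fun A => tupConj_equiv.refl _, fun h => tupConj_equiv.symm h, fun h h' => tupConj_equiv.trans h h'⟩⟩
      exact Quotient.exact (s := s) h
    · intro a
      induction a using Quot.ind with | _ A =>
      obtain ⟨M, hM⟩ := AM_surj A
      exact ⟨Quot.mk _ M, Quot.sound hM⟩
  exact ⟨(Equiv.ofBijective f hf).symm⟩

end FinSec
end

/-- There is a bijection between `GL(n,ℂ)`-conjugacy classes of irreducible
elements of `∏ 𝒪_{B⁽ⁱ⁾}` with vanishing residue sum and orbits of
quasi-irreducible representations in `Rep(Q̄,α)_λ` with invertible block matrices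
`(ψ_{ρ^{[0,j]}_{[i,j']}})` for `i ∈ I_irr∖{0}`. -/
theorem statement4 (S : Setup) : Nonempty (Mst S ≃ QIQ S (lam S)) :=
  final S

end

end DS
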